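/- Let 𝒱 = {φ_Λ}_{Λ∈𝒞} be a positive, continuous, T-invariant specification on X = S^ℤ, let s ∈ S, and set f(x) = φ_{{0}}(x)/φ_{{0}}(s_0 x) for x ∈ X. If there exists 0 < α ≤ 1 such that ∏_{i=0}^n r_{(-∞,i]}(f) = O(n^{1-α}) as n → ∞, and ∑_{i=2^n}^{2^{n+1}} (log r_{[-i,∞)}(f))^{2α} → 0 as n → ∞, then 𝒱 has a unique Gibbs state μ; moreover μ is T-invariant and the system (X,ℬ,μ,T) is Bernoulli. -/

import Mathlib

open MeasureTheory Filter Set Asymptotics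

noncomputable section

namespace GibbsFormal

/-- The configuration space `X = S^ℤ`. -/
abbrev Conf (S : Type) := ℤ → S

variable {S : Type} [Fintype S] [Nonempty S] [DecidableEq S]
  [TopologicalSpace S] [DiscreteTopology S]
  [MeasurableSpace S] [MeasurableSingletonClass S]

/-- The configuration obtained from `x` by replacing its coordinates on `Λ` by `ζ`. -/
def ov (x : Conf S) (Λ : Finset ℤ) (ζ : Λ → S) : Conf S :=
  fun i => if h : i ∈ Λ then ζ ⟨i, h⟩ else x i

/-- The configuration `x'_Λ x_{Λᶜ}`, agreeing with `x'` on `Λ` and with `x` off `Λ`. -/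
def merge (Λ : Finset ℤ) (x' x : Conf S) : Conf S :=
  fun i => if i ∈ Λ then x' i else x i

/-- The configuration `s_n x`. -/
def upd (s : S) (n : ℤ) (x : Conf S) : Conf S :=
  fun i => if i = n then s else x i

/-- The shift `Tⁿ`:  `(Tⁿ x) i = x (i + n)`. -/
def shift (n : ℤ) (x : Conf S) : Conf S := fun i => x (i + n)

/-- The sub-σ-algebra `ℬ_Λ` of the Borel (= product) σ-algebra, generated by
coordinates in `Λ`. -/
def cylSA (Λ : Set ℤ) : MeasurableSpace (Conf S) :=
  MeasurableSpace.comap (fun x => Λ.restrict x) inferInstance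

/-- The cylinder set `[ζ]_Λ`. -/
def cylEvent (Λ : Finset ℤ) (ζ : Λ → S) : Set (Conf S) :=
  {y | ∀ i : Λ, y i = ζ i}

/-- `r_Λ(f) = sup {f x / f y : x_Λ = y_Λ}`. -/
def rSup (Λ : Set ℤ) (f : Conf S → ℝ) : ℝ :=
  sSup {r : ℝ | ∃ x y : Conf S, (∀ i ∈ Λ, x i = y i) ∧ f x / f y = r}

/-- `r̄_Λ(f) = inf {f x / f y : x_Λ = y_Λ}`. -/
def rInf (Λ : Set ℤ) (f : Conf S → ℝ) : ℝ :=
  sInf {r : ℝ | ∃ x y : Conf S, (∀ i ∈ Λ, x i = y i) ∧ f x / f y = r}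

/-- A specification `𝒱 = {φ_Λ}` on `S^ℤ`:  a family of nonnegative Borel functions
satisfying the normalisation and consistency conditions.  (The value on the empty set
is normalised to `1`, which is forced by the unguarded normalisation condition.) -/
structure Specification (A : Type) [Fintype A] [MeasurableSpace A] where
  φ : Finset ℤ → Conf A → ℝ
  nonneg : ∀ Λ x, 0 ≤ φ Λ x
  measurable : ∀ Λ, Measurable (φ Λ)
  sum_one : ∀ (Λ : Finset ℤ) (x : Conf A), ∑ ζ : Λ → A, φ Λ (ov x Λ ζ) = 1
  consistent : ∀ (K Λ : Finset ℤ), K ⊆ Λ → ∀ x : Conf A,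
    φ Λ x = φ K x * ∑ ζ : K → A, φ Λ (ov x K ζ)

/-- A positive specification. -/
def Specification.Positive (V : Specification S) : Prop := ∀ Λ x, 0 < V.φ Λ x

/-- A continuous specification. -/
def Specification.IsCont (V : Specification S) : Prop := ∀ Λ, Continuous (V.φ Λ)

/-- A `T`-invariant specification: `φ_{n+Λ}(x) = φ_Λ(Tⁿ x)`. -/
def Specification.TInvariant (V : Specification S) : Prop :=
  ∀ (n : ℤ) (Λ : Finset ℤ) (x : Conf S),
    V.φ (Λ.image fun i => n + i) x = V.φ Λ (shift n x)

/-- The DLR (Gibbs) condition for a family `φfam` of conditional probabilities: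
for each finite nonempty `Λ` and each pattern `ζ` on `Λ`, the conditional probability
of the cylinder `[ζ]_Λ` given `ℬ_{Λᶜ}` is `x ↦ φfam Λ (ζ x_{Λᶜ})`, `μ`-a.e. -/
def GibbsCond (φfam : Finset ℤ → Conf S → ℝ) (μ : Measure (Conf S)) : Prop :=
  ∀ (Λ : Finset ℤ), Λ.Nonempty → ∀ ζ : Λ → S,
    (fun x => φfam Λ (ov x Λ ζ)) =ᵐ[μ]
      μ[(cylEvent Λ ζ).indicator (fun _ => (1 : ℝ)) | cylSA ((↑Λ : Set ℤ)ᶜ)]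

/-- `μ` is a Gibbs state for the specification `V`. -/
def IsGibbs (V : Specification S) (μ : Measure (Conf S)) : Prop :=
  IsProbabilityMeasure μ ∧ GibbsCond V.φ μ

/-- `g ∈ 𝒢_X`: a nonnegative bounded `ℬ_{ℤ⁻}`-measurable function with
`∑_{s ∈ S} g (s_0 x) = 1`. -/
def MemG (g : Conf S → ℝ) : Prop :=
  (∃ C, ∀ x, |g x| ≤ C) ∧ (∀ x, 0 ≤ g x) ∧
    Measurable[cylSA (Set.Iic (0 : ℤ))] g ∧
    ∀ x : Conf S, ∑ s : S, g (upd s 0 x) = 1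

/-- `μ` is a `g`-chain: for every `n` the conditional probability of the symbol at
site `n` given `ℬ_{(-∞,n-1]}` is `x ↦ g (Tⁿ (s_n x))`, `μ`-a.e. -/
def IsGChain (g : Conf S → ℝ) (μ : Measure (Conf S)) : Prop :=
  IsProbabilityMeasure μ ∧ ∀ (n : ℤ) (s : S),
    (fun x => g (shift n (upd s n x))) =ᵐ[μ]
      μ[({y : Conf S | y n = s}).indicator (fun _ => (1 : ℝ)) | cylSA (Set.Iic (n - 1))]

/-- The probability `π^𝒱_{[0,n]}([x]_{{0}} | x)`. -/
def piG (V : Specification S) (n : ℕ) (x : Conf S) : ℝ :=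
  ∑ ζ : (Finset.Icc (0 : ℤ) (n : ℤ)) → S,
    V.φ (Finset.Icc (0 : ℤ) (n : ℤ)) (ov x (Finset.Icc (0 : ℤ) (n : ℤ)) ζ) *
      (if ov x (Finset.Icc (0 : ℤ) (n : ℤ)) ζ 0 = x 0 then 1 else 0)

/-- A specification sequence of the form `{([0,n], f_n)}`: each `f_n` is bounded,
strictly positive and `ℬ_{[0,n-1]ᶜ}`-measurable. -/
def IsSpecSeq (f : ℕ → Conf S → ℝ) : Prop :=
  ∀ n : ℕ, (∃ C, ∀ x, f n x ≤ C) ∧ (∀ x, 0 < f n x) ∧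
    Measurable[cylSA ((Set.Ico (0 : ℤ) (n : ℤ))ᶜ)] (f n)

/-- `{([0,n], f_n)}` is a specification sequence for the family `φfam`. -/
def IsSpecSeqForFam (φfam : Finset ℤ → Conf S → ℝ) (f : ℕ → Conf S → ℝ) : Prop :=
  IsSpecSeq f ∧ ∀ (n : ℕ) (x : Conf S),
    φfam (Finset.Icc (0 : ℤ) (n : ℤ)) x =
      (∏ j ∈ Finset.range (n + 1), f j x) /
        ∑ ζ : (Finset.Icc (0 : ℤ) (n : ℤ)) → S,
          ∏ j ∈ Finset.range (n + 1), f j (ov x (Finset.Icc (0 : ℤ) (n : ℤ)) ζ)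

/-- `{([0,n], f_n)}` is a specification sequence for the specification `V`. -/
def IsSpecSeqFor (V : Specification S) (f : ℕ → Conf S → ℝ) : Prop :=
  IsSpecSeqForFam V.φ f

/-- The operator `L_{m,n} h (x) = ∑_{y ∈ [x]_{[m,n]ᶜ}} (∏_{i=m}^n f_i y) · h y`. -/
def Lop (f : ℕ → Conf S → ℝ) (m n : ℕ) (h : Conf S → ℝ) (x : Conf S) : ℝ :=
  ∑ ζ : (Finset.Icc (m : ℤ) (n : ℤ)) → S,
    (∏ i ∈ Finset.Icc m n, f i (ov x (Finset.Icc (m : ℤ) (n : ℤ)) ζ)) *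
      h (ov x (Finset.Icc (m : ℤ) (n : ℤ)) ζ)

/-- The ratio bounds `ρ_k^{(n)}(x,y)` (with `ρ_{-1}^{(n)}` for negative `k`). -/
def rho (f : ℕ → Conf S → ℝ) (k : ℤ) (n : ℕ) (x y : Conf S) : ℝ :=
  if k < 0 then
    sInf {r : ℝ | ∃ m : ℕ,
      Lop f m (m + n) (fun _ => 1) x / Lop f m (m + n) (fun _ => 1) y = r}
  else
    sInf {r : ℝ | ∃ (m : ℕ) (ζ : (Finset.Icc (m : ℤ) ((m : ℤ) + k)) → S),
      Lop f m (m + n) ((cylEvent (Finset.Icc (m : ℤ) ((m : ℤ) + k)) ζ).indicator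
          fun _ => 1) x /
        Lop f m (m + n) ((cylEvent (Finset.Icc (m : ℤ) ((m : ℤ) + k)) ζ).indicator
          fun _ => 1) y = r}

/-- A `T`-invariant interaction potential `Φ = {Φ_Λ}`. -/
structure Potential (A : Type) [Fintype A] [MeasurableSpace A] where
  Φ : Finset ℤ → Conf A → ℝ
  measurable : ∀ Λ : Finset ℤ, Λ.Nonempty → Measurable[cylSA (↑Λ : Set ℤ)] (Φ Λ)
  bounded : ∀ Λ : Finset ℤ, ∃ C, ∀ x, |Φ Λ x| ≤ C
  invariant : ∀ (n : ℤ) (Λ : Finset ℤ), Λ.Nonempty → ∀ x : Conf A,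
    Φ (Λ.image fun i => n + i) x = Φ Λ (shift n x)

/-- `var(h) = sup h − inf h`. -/
def pvar (h : Conf S → ℝ) : ℝ := (⨆ x, h x) - ⨅ x, h x

/-- `‖h‖ = sup |h|`. -/
def pnorm (h : Conf S → ℝ) : ℝ := ⨆ x, |h x|

/-- `∑_{Λ ∋ 0} ‖Φ_Λ‖ < ∞`. -/
def NormSummable (P : Potential S) : Prop :=
  Summable fun Λ : {Λ : Finset ℤ // (0 : ℤ) ∈ Λ} => pnorm (P.Φ ↑Λ)

/-- `∑_{Λ ∋ 0, Λ ∩ [n,∞) ≠ ∅} var(Φ_Λ)`. -/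
def varTail (P : Potential S) (n : ℕ) : ℝ :=
  ∑' Λ : {Λ : Finset ℤ // (0 : ℤ) ∈ Λ ∧ ∃ i ∈ Λ, (n : ℤ) ≤ i}, pvar (P.Φ ↑Λ)

/-- The Hamiltonian `H_Λ(x) = ∑_{K ∩ Λ ≠ ∅} Φ_K(x)`. -/
def HPot (P : Potential S) (Λ : Finset ℤ) (x : Conf S) : ℝ :=
  ∑' K : {K : Finset ℤ // (K ∩ Λ).Nonempty}, P.Φ ↑K x

/-- The specification `𝒱_Φ` associated with an interaction potential. -/
def potPhi (P : Potential S) (Λ : Finset ℤ) (x : Conf S) : ℝ :=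
  Real.exp (-HPot P Λ x) / ∑ ζ : Λ → S, Real.exp (-HPot P Λ (ov x Λ ζ))

/-- `μ` is a Gibbs state for the potential `P`. -/
def IsGibbsPot (P : Potential S) (μ : Measure (Conf S)) : Prop :=
  IsProbabilityMeasure μ ∧ GibbsCond (potPhi P) μ

/-- `(T,μ)` is Bernoulli: the shift on `(S^ℤ, μ)` is measure-theoretically isomorphic
(mod 0) to the shift on `A^ℤ` carrying an i.i.d. product probability measure for some
finite alphabet `A` (wlog `A = Fin m`). -/
def IsBernoulliSystem (μ : Measure (Conf S)) : Prop :=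
  ∃ (m : ℕ) (p : Fin m → ENNReal) (ν : Measure (ℤ → Fin m)),
    IsProbabilityMeasure ν ∧ (∑ a, p a = 1) ∧
    (∀ (Λ : Finset ℤ) (ζ : Λ → Fin m),
      ν {y : ℤ → Fin m | ∀ i : Λ, y ↑i = ζ i} = ∏ i : Λ, p (ζ i)) ∧
    ∃ (θ : Conf S → ℤ → Fin m) (θinv : (ℤ → Fin m) → Conf S),
      Measurable θ ∧ Measurable θinv ∧ μ.map θ = ν ∧
      (∀ᵐ x ∂μ, θ (shift 1 x) = fun i => θ x (i + 1)) ∧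
      (∀ᵐ x ∂μ, θinv (θ x) = x) ∧ (∀ᵐ y ∂ν, θ (θinv y) = y)

/-- The recursively defined quantities `p_k^{(n)}` of Lemma 3.3 (`k = -1` is encoded
by any negative argument). -/
def pSeq (v : ℕ → ℝ) : ℕ → ℤ → ℝ
  | 0, k => if k < 0 then 1 else v 0
  | n + 1, k =>
    if k < 0 then 1
    else v k.toNat * pSeq v n (k - 1) +
      ∑ j ∈ Finset.Ico k.toNat (n + 1), (v (j + 1) - v j) * pSeq v n (j : ℤ)

set_option linter.unusedSectionVars false

/-! ### Finite couplings -/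

section Coupling

variable {α β γ α' β' : Type*} [Fintype α] [Fintype β] [Fintype γ] [Fintype α'] [Fintype β']

/-- The finite nonnegative vectors `p` and `q` have a coupling of total cost at most `t`. -/
def Cpl (p : α → ℝ) (q : β → ℝ) (c : α → β → ℝ) (t : ℝ) : Prop :=
  ∃ w : α → β → ℝ, (∀ a b, 0 ≤ w a b) ∧ (∀ a, ∑ b, w a b = p a) ∧ (∀ b, ∑ a, w a b = q b) ∧
    ∑ a, ∑ b, w a b * c a b ≤ t

lemma Cpl.mono {p : α → ℝ} {q : β → ℝ} {c : α → β → ℝ} {t t' : ℝ} (h : Cpl p q c t)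
    (ht : t ≤ t') : Cpl p q c t' := by
  obtain ⟨w, h0, h1, h2, h3⟩ := h
  exact ⟨w, h0, h1, h2, h3.trans ht⟩

lemma Cpl.cost_mono {p : α → ℝ} {q : β → ℝ} {c c' : α → β → ℝ} {t : ℝ} (h : Cpl p q c t)
    (hc : ∀ a b, c' a b ≤ c a b) : Cpl p q c' t := by
  obtain ⟨w, h0, h1, h2, h3⟩ := h
  refine ⟨w, h0, h1, h2, le_trans ?_ h3⟩
  exact Finset.sum_le_sum fun a _ => Finset.sum_le_sum fun b _ =>
    mul_le_mul_of_nonneg_left (hc a b) (h0 a b)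

lemma Cpl.symm {p : α → ℝ} {q : β → ℝ} {c : α → β → ℝ} {t : ℝ} (h : Cpl p q c t) :
    Cpl q p (fun b a => c a b) t := by
  obtain ⟨w, h0, h1, h2, h3⟩ := h
  refine ⟨fun b a => w a b, fun b a => h0 a b, h2, h1, ?_⟩
  rw [Finset.sum_comm]; exact h3

lemma Cpl.of_prod {p : α → ℝ} {q : β → ℝ} (hp : ∀ a, 0 ≤ p a) (hq : ∀ b, 0 ≤ q b)
    (hp1 : ∑ a, p a = 1) (hq1 : ∑ b, q b = 1) {c : α → β → ℝ} {t : ℝ} (hc : ∀ a b, c a b ≤ t) :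
    Cpl p q c t := by
  refine ⟨fun a b => p a * q b, fun a b => mul_nonneg (hp a) (hq b), fun a => ?_, fun b => ?_, ?_⟩
  · rw [← Finset.mul_sum, hq1, mul_one]
  · rw [← Finset.sum_mul, hp1, one_mul]
  · calc ∑ a, ∑ b, p a * q b * c a b ≤ ∑ a, ∑ b, p a * q b * t :=
          Finset.sum_le_sum fun a _ => Finset.sum_le_sum fun b _ =>
            mul_le_mul_of_nonneg_left (hc a b) (mul_nonneg (hp a) (hq b))
      _ = t := by simp_rw [← Finset.sum_mul, ← Finset.mul_sum, hq1, mul_one, hp1, one_mul]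

/-- Sequential composition of couplings. -/
lemma Cpl.seq {p : α → ℝ} {q : β → ℝ} {c s : α → β → ℝ} {t : ℝ}
    {P : α → α' → ℝ} {Q : β → β' → ℝ} {d : α' → β' → ℝ}
    (h : Cpl p q (fun a b => c a b + s a b) t)
    (hP : ∀ a, ∑ x, P a x = 1)
    (hd : ∀ a b, Cpl (P a) (Q b) d (s a b)) :
    Cpl (fun x : α × α' => p x.1 * P x.1 x.2) (fun y : β × β' => q y.1 * Q y.1 y.2)
      (fun x y => c x.1 y.1 + d x.2 y.2) t := by
  obtain ⟨w, h0, h1, h2, h3⟩ := h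
  choose v v0 v1 v2 v3 using hd
  refine ⟨fun x y => w x.1 y.1 * v x.1 y.1 x.2 y.2, fun x y => mul_nonneg (h0 _ _) (v0 _ _ _ _),
    ?_, ?_, ?_⟩
  · rintro ⟨a, x⟩
    simp only [Fintype.sum_prod_type, ← Finset.mul_sum, v1, ← Finset.sum_mul, h1]
  · rintro ⟨b, y⟩
    simp only [Fintype.sum_prod_type, ← Finset.mul_sum, v2, ← Finset.sum_mul, h2]
  · refine le_trans ?_ h3
    have tot : ∀ a b, ∑ x, ∑ y, v a b x y = 1 := fun a b => by simp_rw [v1, hP]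
    calc ∑ x : α × α', ∑ y : β × β', w x.1 y.1 * v x.1 y.1 x.2 y.2 * (c x.1 y.1 + d x.2 y.2)
        = ∑ a, ∑ b, ∑ x, ∑ y, w a b * v a b x y * (c a b + d x y) := by
          simp only [Fintype.sum_prod_type]
          exact Finset.sum_congr rfl fun a _ => Finset.sum_comm
      _ = ∑ a, ∑ b, w a b * (c a b + ∑ x, ∑ y, v a b x y * d x y) := by
          refine Finset.sum_congr rfl fun a _ => Finset.sum_congr rfl fun b _ => ?_
          have : ∀ x y, w a b * v a b x y * (c a b + d x y) =
              w a b * c a b * v a b x y + w a b * (v a b x y * d x y) := fun x y => by ring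
          simp_rw [this, Finset.sum_add_distrib, ← Finset.mul_sum, tot]
          ring
      _ ≤ ∑ a, ∑ b, w a b * (c a b + s a b) :=
          Finset.sum_le_sum fun a _ => Finset.sum_le_sum fun b _ =>
            mul_le_mul_of_nonneg_left (by linarith [v3 a b]) (h0 a b)

/-- Gluing of couplings along a common marginal. -/
lemma Cpl.trans {p : α → ℝ} {q : β → ℝ} {r : γ → ℝ} {c : α → β → ℝ} {d : β → γ → ℝ}
    {e : α → γ → ℝ} {t s : ℝ} (h : Cpl p q c t) (h' : Cpl q r d s)
    (he : ∀ a b g, e a g ≤ c a b + d b g) : Cpl p r e (t + s) := by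
  obtain ⟨w, h0, h1, h2, h3⟩ := h
  obtain ⟨v, k0, k1, k2, k3⟩ := h'
  have hq : ∀ b, 0 ≤ q b := fun b => (h2 b) ▸ Finset.sum_nonneg fun a _ => h0 a b
  have hw0 : ∀ a b, q b = 0 → w a b = 0 := fun a b hb => by
    rw [← h2 b] at hb
    exact (Finset.sum_eq_zero_iff_of_nonneg fun a _ => h0 a b).1 hb a (Finset.mem_univ a)
  have hv0 : ∀ b g, q b = 0 → v b g = 0 := fun b g hb => by
    rw [← k1 b] at hb
    exact (Finset.sum_eq_zero_iff_of_nonneg fun a _ => k0 b a).1 hb g (Finset.mem_univ g)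
  have e1 : ∀ a b, ∑ g, w a b * v b g / q b = w a b := fun a b => by
    rw [← Finset.sum_div, ← Finset.mul_sum, k1]
    by_cases hb : q b = 0
    · simp [hw0 a b hb]
    · field_simp
  have e2 : ∀ b g, ∑ a, w a b * v b g / q b = v b g := fun b g => by
    rw [← Finset.sum_div, ← Finset.sum_mul, h2]
    by_cases hb : q b = 0
    · simp [hv0 b g hb]
    · field_simp
  have nn : ∀ a b g, 0 ≤ w a b * v b g / q b := fun a b g =>
    div_nonneg (mul_nonneg (h0 _ _) (k0 _ _)) (hq b)
  refine ⟨fun a g => ∑ b, w a b * v b g / q b, fun a g => Finset.sum_nonneg fun b _ => nn a b g,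
    fun a => ?_, fun g => ?_, ?_⟩
  · rw [Finset.sum_comm]; simp_rw [e1, h1]
  · rw [Finset.sum_comm]; simp_rw [e2, k2]
  · calc ∑ a, ∑ g, (∑ b, w a b * v b g / q b) * e a g
        ≤ ∑ a, ∑ g, ∑ b, w a b * v b g / q b * (c a b + d b g) := by
          refine Finset.sum_le_sum fun a _ => Finset.sum_le_sum fun g _ => ?_
          rw [Finset.sum_mul]
          exact Finset.sum_le_sum fun b _ => mul_le_mul_of_nonneg_left (he a b g) (nn a b g)
      _ = (∑ a, ∑ b, w a b * c a b) + ∑ b, ∑ g, v b g * d b g := by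
          simp_rw [mul_add, Finset.sum_add_distrib]
          congr 1
          · refine Finset.sum_congr rfl fun a _ => ?_
            rw [Finset.sum_comm]
            refine Finset.sum_congr rfl fun b _ => ?_
            rw [← Finset.sum_mul, e1]
          · rw [Finset.sum_comm]
            rw [Finset.sum_comm (s := Finset.univ (α := β))]
            refine Finset.sum_congr rfl fun g _ => ?_
            rw [Finset.sum_comm]
            refine Finset.sum_congr rfl fun b _ => ?_
            rw [← Finset.sum_mul, e2]
      _ ≤ t + s := add_le_add h3 k3

lemma Cpl.reindex {p : α → ℝ} {q : β → ℝ} {c : α → β → ℝ} {t : ℝ} (h : Cpl p q c t)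
    (e : α' ≃ α) (e' : β' ≃ β) :
    Cpl (fun x => p (e x)) (fun y => q (e' y)) (fun x y => c (e x) (e' y)) t := by
  obtain ⟨w, h0, h1, h2, h3⟩ := h
  refine ⟨fun x y => w (e x) (e' y), fun x y => h0 _ _, fun x => ?_, fun y => ?_, ?_⟩
  · exact (Equiv.sum_comp e' (fun b => w (e x) b)).trans (h1 _)
  · exact (Equiv.sum_comp e (fun a => w a (e' y))).trans (h2 _)
  · refine le_of_eq_of_le ?_ h3
    rw [← Equiv.sum_comp e]
    exact Finset.sum_congr rfl fun x _ => Equiv.sum_comp e' (fun b => w (e x) b * c (e x) b)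

/-- The maximal coupling. -/
lemma Cpl.maximal [DecidableEq α] {p q : α → ℝ} (hp : ∀ a, 0 ≤ p a) (hq : ∀ b, 0 ≤ q b)
    (hp1 : ∑ a, p a = 1) (hq1 : ∑ b, q b = 1) {c : α → α → ℝ} {δ C₀ C₁ : ℝ}
    (hov : 1 - δ ≤ ∑ a, min (p a) (q a)) (h01 : C₀ ≤ C₁)
    (hc0 : ∀ a, c a a ≤ C₀) (hc1 : ∀ a b, c a b ≤ C₁) :
    Cpl p q c ((1 - δ) * C₀ + δ * C₁) := by
  set m : α → ℝ := fun a => min (p a) (q a) with hm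
  set M := ∑ a, m a with hM
  have hmp : ∀ a, m a ≤ p a := fun a => min_le_left _ _
  have hmq : ∀ a, m a ≤ q a := fun a => min_le_right _ _
  have hm0 : ∀ a, 0 ≤ m a := fun a => le_min (hp a) (hq a)
  have hM1 : M ≤ 1 := hp1 ▸ Finset.sum_le_sum fun a _ => hmp a
  have sp : ∑ a, (p a - m a) = 1 - M := by rw [Finset.sum_sub_distrib, hp1]
  have sq : ∑ a, (q a - m a) = 1 - M := by rw [Finset.sum_sub_distrib, hq1]
  have zp : 1 - M = 0 → ∀ a, p a - m a = 0 := fun h a => by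
    rw [← sp] at h
    exact (Finset.sum_eq_zero_iff_of_nonneg fun a _ => sub_nonneg.2 (hmp a)).1 h a (Finset.mem_univ a)
  have zq : 1 - M = 0 → ∀ a, q a - m a = 0 := fun h a => by
    rw [← sq] at h
    exact (Finset.sum_eq_zero_iff_of_nonneg fun a _ => sub_nonneg.2 (hmq a)).1 h a (Finset.mem_univ a)
  have r1 : ∀ a, ∑ b, (p a - m a) * (q b - m b) / (1 - M) = p a - m a := fun a => by
    rw [← Finset.sum_div, ← Finset.mul_sum, sq]
    by_cases h : 1 - M = 0
    · simp [zp h a]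
    · field_simp
  have r2 : ∀ b, ∑ a, (p a - m a) * (q b - m b) / (1 - M) = q b - m b := fun b => by
    rw [← Finset.sum_div, ← Finset.sum_mul, sp]
    by_cases h : 1 - M = 0
    · simp [zq h b]
    · field_simp
  have nn : ∀ a b, 0 ≤ (p a - m a) * (q b - m b) / (1 - M) := fun a b =>
    div_nonneg (mul_nonneg (sub_nonneg.2 (hmp a)) (sub_nonneg.2 (hmq b))) (by linarith)
  refine ⟨fun a b => (if a = b then m a else 0) + (p a - m a) * (q b - m b) / (1 - M),
    fun a b => ?_, fun a => ?_, fun b => ?_, ?_⟩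
  · refine add_nonneg ?_ (nn a b)
    split_ifs
    exacts [hm0 a, le_rfl]
  · rw [Finset.sum_add_distrib, r1]; simp
  · rw [Finset.sum_add_distrib, r2]; simp
  · simp only [add_mul, Finset.sum_add_distrib, ite_mul, zero_mul, Finset.sum_ite_eq,
      Finset.mem_univ, if_true]
    have b1 : ∑ a, m a * c a a ≤ M * C₀ := by
      rw [hM, Finset.sum_mul]
      exact Finset.sum_le_sum fun a _ => mul_le_mul_of_nonneg_left (hc0 a) (hm0 a)
    have b2 : ∑ a, ∑ b, (p a - m a) * (q b - m b) / (1 - M) * c a b ≤ (1 - M) * C₁ := by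
      calc _ ≤ ∑ a, ∑ b, (p a - m a) * (q b - m b) / (1 - M) * C₁ :=
            Finset.sum_le_sum fun a _ => Finset.sum_le_sum fun b _ =>
              mul_le_mul_of_nonneg_left (hc1 a b) (nn a b)
        _ = (1 - M) * C₁ := by simp_rw [← Finset.sum_mul, r1, sp]
    nlinarith [b1, b2, mul_nonneg (sub_nonneg.2 h01) (sub_nonneg.2 hov)]

/-- The overlap of two probability vectors in terms of their Hellinger affinity. -/
lemma overlap_ge_of_affinity {p q : α → ℝ} (hp : ∀ a, 0 ≤ p a) (hq : ∀ b, 0 ≤ q b)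
    (hp1 : ∑ a, p a = 1) (hq1 : ∑ b, q b = 1) {x : ℝ}
    (hx : 1 - x / 2 ≤ ∑ a, √(p a * q a)) : 1 - √x ≤ ∑ a, min (p a) (q a) := by
  set M := ∑ a, min (p a) (q a) with hM
  have hsum : ∑ a, max (p a) (q a) = 2 - M := by
    have : ∀ a, max (p a) (q a) = p a + q a - min (p a) (q a) := fun a => by
      linarith [min_add_max (p a) (q a)]
    simp_rw [this, Finset.sum_sub_distrib, Finset.sum_add_distrib, hp1, hq1]; ring
  have hcs : (∑ a, √(p a * q a)) ^ 2 ≤ M * (2 - M) := by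
    have h := Finset.sum_mul_sq_le_sq_mul_sq Finset.univ
      (fun a => √(min (p a) (q a))) (fun a => √(max (p a) (q a)))
    have e1 : ∀ a, √(min (p a) (q a)) * √(max (p a) (q a)) = √(p a * q a) := fun a => by
      rw [← Real.sqrt_mul (le_min (hp a) (hq a)), min_mul_max]
    have e2 : ∀ a, √(min (p a) (q a)) ^ 2 = min (p a) (q a) := fun a =>
      Real.sq_sqrt (le_min (hp a) (hq a))
    have e3 : ∀ a, √(max (p a) (q a)) ^ 2 = max (p a) (q a) := fun a =>
      Real.sq_sqrt (le_max_of_le_left (hp a))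
    simp_rw [e1, e2, e3, hsum] at h
    exact h
  have hρ0 : 0 ≤ ∑ a, √(p a * q a) := Finset.sum_nonneg fun a _ => Real.sqrt_nonneg _
  have hM0 : 0 ≤ M := Finset.sum_nonneg fun a _ => le_min (hp a) (hq a)
  by_cases hx2 : 2 ≤ x
  · have : 1 ≤ √x := by
      rw [Real.one_le_sqrt]; linarith
    linarith
  · have h1 : (1 - M) ^ 2 ≤ x := by nlinarith
    have := Real.le_sqrt_of_sq_le h1
    linarith

end Coupling

/-- A multiscale recursion: if costs started from agreement length `2 ^ j` satisfy the natural
one-step inequalities with failure probabilities `d j → 0`, then costs grow sublinearly. -/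
lemma sublinear_of_dyadic_recursion (P : ℕ → ℕ → ℝ → Prop)
    (mono : ∀ n k t t', P n k t → t ≤ t' → P n k t')
    (triv : ∀ n k, P n k n) (d : ℕ → ℝ) (hd0 : ∀ j, 0 ≤ d j) (hd : Tendsto d atTop (nhds 0))
    (j₁ : ℕ) (short : ∀ j n, j₁ ≤ j → n ≤ 2 ^ j → P n (2 ^ j) (d j * n))
    (step : ∀ j n t₀ t₁, j₁ ≤ j → t₁ ≤ 2 ^ j + t₀ → P n 0 t₀ → P n (2 ^ (j + 1)) t₁ →
      P (2 ^ j + n) (2 ^ j) ((1 - d j) * t₁ + d j * (2 ^ j + t₀)))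
    (start : ∀ j, j₁ ≤ j → ∃ c : ℝ, 0 < c ∧ c ≤ 1 ∧ ∀ n t₀ t₁, t₁ ≤ 2 ^ j + t₀ → P n 0 t₀ →
      P n (2 ^ j) t₁ → P (2 ^ j + n) 0 (c * t₁ + (1 - c) * (2 ^ j + t₀))) :
    ∀ ε : ℝ, 0 < ε → ∃ K : ℝ, 0 ≤ K ∧ ∀ n : ℕ, P n 0 (ε * n + K) := by
  intro ε hε
  obtain ⟨j₀, hj₀⟩ : ∃ j₀, ∀ j ≥ j₀, j₁ ≤ j ∧ d j ≤ min (ε / 2) (1 / 4) := by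
    have h := (hd.eventually (ge_mem_nhds (show (0 : ℝ) < min (ε / 2) (1 / 4) by positivity)))
    obtain ⟨a, ha⟩ := eventually_atTop.1 h
    exact ⟨max a j₁, fun j hj => ⟨(le_max_right _ _).trans hj, ha j ((le_max_left _ _).trans hj)⟩⟩
  obtain ⟨c, hc0, hc1, hst⟩ := start j₀ (hj₀ j₀ le_rfl).1
  set E : ℝ := 2 ^ j₀ / c with hE
  have hE1 : (2 : ℝ) ^ j₀ ≤ E := by
    rw [hE, le_div_iff₀ hc0]
    nlinarith [show (0 : ℝ) < 2 ^ j₀ by positivity]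
  have hE0 : 0 < E := lt_of_lt_of_le (by positivity) hE1
  set e : ℕ → ℝ := fun j => E * (4 / 3) ^ (j - j₀) with he
  obtain ⟨M, hM0, hM⟩ : ∃ M ≥ j₀, e M ≤ 2 ^ M := by
    have h : Tendsto (fun r : ℕ => E * (2 / 3 : ℝ) ^ r) atTop (nhds (E * 0)) :=
      (tendsto_pow_atTop_nhds_zero_of_lt_one (by norm_num) (by norm_num)).const_mul E
    rw [mul_zero] at h
    obtain ⟨r, hr⟩ := (h.eventually (ge_mem_nhds one_pos)).exists
    refine ⟨j₀ + r, by omega, ?_⟩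
    simp only [he, Nat.add_sub_cancel_left]
    have e1 : (4 / 3 : ℝ) ^ r = (2 / 3) ^ r * 2 ^ r := by rw [← mul_pow]; norm_num
    rw [e1, pow_add]
    have : (1 : ℝ) ≤ 2 ^ j₀ := one_le_pow₀ (by norm_num)
    have h2 : (0 : ℝ) < 2 ^ r := by positivity
    nlinarith [mul_le_mul_of_nonneg_right hr h2.le]
  set K := e M with hK
  have emono : ∀ i j, i ≤ j → e i ≤ e j := fun i j hij =>
    mul_le_mul_of_nonneg_left (pow_le_pow_right₀ (by norm_num) (Nat.sub_le_sub_right hij _)) hE0.le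
  have hej0 : e j₀ = E := by simp [he]
  have hK0 : E ≤ K := hej0 ▸ emono _ _ hM0
  set Kj : ℕ → ℝ := fun j => if j ≤ M then K - e j else 0 with hKj
  have hKjM : ∀ j ≥ M, Kj j = 0 := fun j hj => by
    simp only [hKj]
    split_ifs with h
    · rw [le_antisymm h hj, hK, sub_self]
    · rfl
  have hKj0 : ∀ j, 0 ≤ Kj j := fun j => by
    simp only [hKj]
    split_ifs with h
    · exact sub_nonneg.2 (emono _ _ h)
    · exact le_rfl
  have hKjK : ∀ j, Kj j ≤ K := fun j => by
    simp only [hKj]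
    split_ifs with h
    · have : 0 ≤ e j := by positivity
      linarith
    · linarith
  have main : ∀ n : ℕ, P n 0 (ε * n + K) ∧ ∀ j ≥ j₀, P n (2 ^ j) (ε * n + Kj j) := by
    intro n
    induction n using Nat.strong_induction_on with
    | _ n ih =>
      constructor
      · by_cases hn : n ≤ 2 ^ j₀
        · refine mono _ _ _ _ (triv n 0) ?_
          have : (n : ℝ) ≤ 2 ^ j₀ := by exact_mod_cast hn
          have h2 : 0 ≤ ε * n := by positivity
          linarith
        · obtain ⟨n', rfl⟩ := Nat.exists_eq_add_of_le (not_le.1 hn).le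
          have hlt : n' < 2 ^ j₀ + n' := Nat.lt_add_of_pos_left (by positivity)
          obtain ⟨i1, i2⟩ := ih n' hlt
          refine mono _ _ _ _ (hst n' _ _ ?_ i1 (i2 j₀ le_rfl)) ?_
          · have := hKjK j₀
            have h2 : (0 : ℝ) < 2 ^ j₀ := by positivity
            linarith
          · have h3 : Kj j₀ = K - E := by simp only [hKj, if_pos hM0, hej0]
            have h4 : c * E = 2 ^ j₀ := by rw [hE]; field_simp
            rw [h3]; push_cast
            have h5 : 0 ≤ ε * 2 ^ j₀ := by positivity
            have h6 : 0 ≤ c * 2 ^ j₀ := by positivity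
            linear_combination h5 + h6 - h4
      · intro j hj
        obtain ⟨hj1, hdj⟩ := hj₀ j hj
        have hd1 := hdj.trans (min_le_left _ _)
        have hd2 := hdj.trans (min_le_right _ _)
        by_cases hn : n ≤ 2 ^ j
        · refine mono _ _ _ _ (short j n hj1 hn) ?_
          have h1 : d j * n ≤ ε * n :=
            mul_le_mul_of_nonneg_right (by linarith) (Nat.cast_nonneg n)
          linarith [hKj0 j]
        · obtain ⟨n', rfl⟩ := Nat.exists_eq_add_of_le (not_le.1 hn).le
          have hlt : n' < 2 ^ j + n' := Nat.lt_add_of_pos_left (by positivity)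
          obtain ⟨i1, i2⟩ := ih n' hlt
          have h2j : (0 : ℝ) < 2 ^ j := by positivity
          refine mono _ _ _ _ (step j n' _ _ hj1 ?_ i1 (i2 (j + 1) (by omega))) ?_
          · linarith [hKjK (j + 1)]
          · push_cast
            have hdd : d j * 2 ^ j ≤ ε / 2 * 2 ^ j := mul_le_mul_of_nonneg_right hd1 h2j.le
            by_cases hjM : M ≤ j
            · rw [hKjM j hjM, hKjM (j + 1) (by omega)]
              have hK2 : K ≤ 2 ^ j := hM.trans (pow_le_pow_right₀ (by norm_num) hjM)
              have : d j * K ≤ ε / 2 * 2 ^ j :=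
                (mul_le_mul_of_nonneg_left hK2 (hd0 j)).trans hdd
              linarith
            · push Not at hjM
              have k1 : Kj j = K - e j := by simp only [hKj, if_pos hjM.le]
              have k2 : Kj (j + 1) = K - e (j + 1) := by
                simp only [hKj, if_pos (show j + 1 ≤ M by omega)]
              have k3 : e (j + 1) = 4 / 3 * e j := by
                simp only [he, show j + 1 - j₀ = (j - j₀) + 1 by omega, pow_succ]; ring
              rw [k1, k2, k3]
              have : 0 ≤ e j := by positivity
              have h5 : 0 ≤ ε * 2 ^ j := by positivity
              nlinarith [mul_le_mul_of_nonneg_right hd2 this]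
  exact ⟨K, hE0.le.trans hK0, fun n => (main n).1⟩

/-! ### Words -/

section Words

variable {A : Type*}

/-- Extend a finite word to a sequence by an arbitrary letter. -/
def wext [Nonempty A] {n : ℕ} (u : Fin n → A) : ℕ → A :=
  fun i => if h : i < n then u ⟨i, h⟩ else Classical.arbitrary A

lemma wext_lt [Nonempty A] {n : ℕ} (u : Fin n → A) {i : ℕ} (h : i < n) :
    wext u i = u ⟨i, h⟩ := dif_pos h

@[simp] lemma wext_fin [Nonempty A] {n : ℕ} (u : Fin n → A) (i : Fin n) : wext u i = u i :=
  wext_lt u i.2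

lemma wext_append_left [Nonempty A] {m n : ℕ} (u : Fin m → A) (v : Fin n → A) {i : ℕ}
    (h : i < m) : wext (Fin.append u v) i = wext u i := by
  rw [wext_lt u h, wext_lt _ (by omega : i < m + n)]
  exact Fin.append_left u v ⟨i, h⟩

lemma wext_append_right [Nonempty A] {m n : ℕ} (u : Fin m → A) (v : Fin n → A) (i : ℕ) :
    wext (Fin.append u v) (m + i) = wext v i := by
  by_cases h : i < n
  · rw [wext_lt v h, wext_lt _ (by omega : m + i < m + n)]
    exact Fin.append_right u v ⟨i, h⟩
  · rw [wext, wext, dif_neg h, dif_neg (by omega)]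

lemma sum_append {m n : ℕ} [Fintype A] {M : Type*} [AddCommMonoid M] (F : (Fin (m + n) → A) → M) :
    ∑ z, F z = ∑ u : Fin m → A, ∑ v : Fin n → A, F (Fin.append u v) := by
  rw [← Equiv.sum_comp (Fin.appendEquiv m n), Fintype.sum_prod_type]
  rfl

/-- The (real valued) Hamming distance. -/
def ham [DecidableEq A] {n : ℕ} (u v : Fin n → A) : ℝ := ∑ i, if u i = v i then 0 else 1

variable [DecidableEq A]

lemma ham_self {n : ℕ} (u : Fin n → A) : ham u u = 0 := by simp [ham]

lemma ham_nonneg {n : ℕ} (u v : Fin n → A) : 0 ≤ ham u v :=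
  Finset.sum_nonneg fun i _ => by split_ifs <;> norm_num

lemma ham_le {n : ℕ} (u v : Fin n → A) : ham u v ≤ n := by
  calc ham u v ≤ ∑ _i : Fin n, (1 : ℝ) :=
        Finset.sum_le_sum fun i _ => by split_ifs <;> norm_num
    _ = n := by simp

lemma ham_comm {n : ℕ} (u v : Fin n → A) : ham u v = ham v u := by
  simp only [ham, eq_comm]

lemma ham_triangle {n : ℕ} (u v w : Fin n → A) : ham u w ≤ ham u v + ham v w := by
  rw [ham, ham, ham, ← Finset.sum_add_distrib]
  refine Finset.sum_le_sum fun i _ => ?_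
  by_cases h1 : u i = v i
  · rw [h1]; simp
  · rw [if_neg h1]; split_ifs <;> norm_num

lemma ham_append {m n : ℕ} (u u' : Fin m → A) (v v' : Fin n → A) :
    ham (Fin.append u v) (Fin.append u' v') = ham u u' + ham v v' := by
  simp [ham, Fin.sum_univ_add]

end Words

/-! ### State kernels -/

/-- A positive transition kernel on letters, driven by a state, whose dependence on the state
decays with the length of agreement, in a dyadic square-summable sense. -/
structure StateKernel (σ A : Type*) [Fintype A] where
  step : σ → A → σ
  κ : σ → A → ℝ
  c : ℝ
  c_pos : 0 < c
  c_le : ∀ s a, c ≤ κ s a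
  sum_one : ∀ s, ∑ a, κ s a = 1
  Ag : ℕ → σ → σ → Prop
  ag_zero : ∀ s s', Ag 0 s s'
  ag_symm : ∀ k s s', Ag k s s' → Ag k s' s
  ag_step : ∀ k s s' a, Ag k s s' → Ag (k + 1) (step s a) (step s' a)
  ω : ℕ → ℝ
  ω_nonneg : ∀ k, 0 ≤ ω k
  ratio : ∀ k s s' a, Ag k s s' → κ s a ≤ Real.exp (ω k) * κ s' a
  dyadic : Tendsto (fun n : ℕ => ∑ i ∈ Finset.Icc (2 ^ n) (2 ^ (n + 1)), ω i ^ 2) atTop (nhds 0)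

namespace StateKernel

variable {σ A : Type*} [Fintype A] (k : StateKernel σ A)

/-- The state after reading the first `n` letters of `x`. -/
def st (s : σ) (x : ℕ → A) : ℕ → σ
  | 0 => s
  | n + 1 => k.step (st s x n) (x n)

/-- The probability of the first `n` letters of `x`. -/
def lw (s : σ) (x : ℕ → A) (n : ℕ) : ℝ := ∏ i ∈ Finset.range n, k.κ (k.st s x i) (x i)

lemma st_congr (s : σ) {x y : ℕ → A} {n : ℕ} (h : ∀ i < n, x i = y i) :
    k.st s x n = k.st s y n := by
  induction n with
  | zero => rfl
  | succ n ih => rw [st, st, ih fun i hi => h i (by omega), h n (by omega)]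

lemma lw_congr (s : σ) {x y : ℕ → A} {n : ℕ} (h : ∀ i < n, x i = y i) :
    k.lw s x n = k.lw s y n := by
  refine Finset.prod_congr rfl fun i hi => ?_
  have hi := Finset.mem_range.1 hi
  rw [k.st_congr s fun j hj => h j (hj.trans hi), h i hi]

lemma st_add (s : σ) (x : ℕ → A) (m n : ℕ) :
    k.st s x (m + n) = k.st (k.st s x m) (fun i => x (m + i)) n := by
  induction n with
  | zero => rfl
  | succ n ih => rw [← add_assoc, st, st, ih]

lemma lw_add (s : σ) (x : ℕ → A) (m n : ℕ) :
    k.lw s x (m + n) = k.lw s x m * k.lw (k.st s x m) (fun i => x (m + i)) n := by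
  rw [lw, lw, lw, Finset.prod_range_add]
  simp_rw [k.st_add]

lemma κ_pos (s : σ) (a : A) : 0 < k.κ s a := k.c_pos.trans_le (k.c_le s a)

lemma κ_le_one (s : σ) (a : A) : k.κ s a ≤ 1 := by
  rw [← k.sum_one s]
  exact Finset.single_le_sum (fun b _ => (k.κ_pos s b).le) (Finset.mem_univ a)

lemma lw_pos (s : σ) (x : ℕ → A) (n : ℕ) : 0 < k.lw s x n :=
  Finset.prod_pos fun _ _ => k.κ_pos _ _

lemma lw_ge (s : σ) (x : ℕ → A) (n : ℕ) : k.c ^ n ≤ k.lw s x n := by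
  have := Finset.prod_le_prod (s := Finset.range n) (f := fun _ => k.c)
    (g := fun i => k.κ (k.st s x i) (x i)) (fun _ _ => k.c_pos.le) fun _ _ => k.c_le _ _
  simpa [lw] using this

variable [Nonempty A]

/-- The law of the first `n` letters. -/
def law (n : ℕ) (s : σ) (u : Fin n → A) : ℝ := k.lw s (wext u) n

/-- The state after reading a word. -/
def run (n : ℕ) (s : σ) (u : Fin n → A) : σ := k.st s (wext u) n

lemma law_pos (n : ℕ) (s : σ) (u : Fin n → A) : 0 < k.law n s u := k.lw_pos _ _ _

lemma law_append {m n : ℕ} (s : σ) (u : Fin m → A) (v : Fin n → A) :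
    k.law (m + n) s (Fin.append u v) = k.law m s u * k.law n (k.run m s u) v := by
  rw [law, lw_add]
  congr 1
  · exact k.lw_congr s fun i hi => wext_append_left u v hi
  · rw [k.st_congr s fun i hi => wext_append_left u v hi]
    exact k.lw_congr _ fun i _ => wext_append_right u v i

lemma run_append {m n : ℕ} (s : σ) (u : Fin m → A) (v : Fin n → A) :
    k.run (m + n) s (Fin.append u v) = k.run n (k.run m s u) v := by
  rw [run, st_add, k.st_congr s fun i hi => wext_append_left u v hi]
  exact k.st_congr _ fun i _ => wext_append_right u v i

lemma law_zero (s : σ) (u : Fin 0 → A) : k.law 0 s u = 1 := rfl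

lemma law_one (s : σ) (u : Fin 1 → A) : k.law 1 s u = k.κ s (u 0) := by
  simp only [law, lw, Finset.prod_range_one, st]
  rw [wext_lt u zero_lt_one]; rfl

lemma sum_law (n : ℕ) (s : σ) : ∑ u, k.law n s u = 1 := by
  induction n generalizing s with
  | zero => simp [law_zero]
  | succ n ih =>
    rw [show n + 1 = n + 1 from rfl, sum_append]
    simp_rw [law_append, ← Finset.mul_sum, law_one]
    have h : ∀ s, ∑ v : Fin 1 → A, k.κ s (v 0) = 1 := fun s => by
      rw [← Equiv.sum_comp (Equiv.funUnique (Fin 1) A).symm]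
      exact k.sum_one s
    simp_rw [h, mul_one, ih]

lemma ag_run {n : ℕ} {j : ℕ} {s s' : σ} (h : k.Ag j s s') (u : Fin n → A) :
    k.Ag (j + n) (k.run n s u) (k.run n s' u) := by
  have : ∀ m, k.Ag (j + m) (k.st s (wext u) m) (k.st s' (wext u) m) := fun m => by
    induction m with
    | zero => exact h
    | succ m ih => exact k.ag_step _ _ _ _ ih
  exact this n

lemma affinity_one {j : ℕ} {s s' : σ} (h : k.Ag j s s') (hω : k.ω j ≤ 1) :
    1 - k.ω j ^ 2 / 2 ≤ ∑ a, √(k.κ s a * k.κ s' a) := by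
  set w := k.ω j with hw
  have w0 : 0 ≤ w := k.ω_nonneg j
  have key : ∀ a, (√(k.κ s a) - √(k.κ s' a)) ^ 2 ≤ w ^ 2 * k.κ s' a := fun a => by
    set p := √(k.κ s a) with hp
    set q := √(k.κ s' a) with hq
    have hp0 : 0 ≤ p := Real.sqrt_nonneg _
    have hq0 : 0 ≤ q := Real.sqrt_nonneg _
    have hexp : Real.exp w ≤ (1 + w) ^ 2 := by
      have := Real.abs_exp_sub_one_sub_id_le (x := w) (by rw [abs_of_nonneg w0]; exact hω)
      have := (abs_le.1 this).2
      nlinarith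
    have comp : ∀ t t', k.Ag j t t' → √(k.κ t a) ≤ (1 + w) * √(k.κ t' a) := fun t t' ht => by
      have h1 := k.ratio j t t' a ht
      have h2 : k.κ t a ≤ (1 + w) ^ 2 * k.κ t' a :=
        h1.trans (mul_le_mul_of_nonneg_right hexp (k.κ_pos _ _).le)
      calc √(k.κ t a) ≤ √((1 + w) ^ 2 * k.κ t' a) := Real.sqrt_le_sqrt h2
        _ = (1 + w) * √(k.κ t' a) := by
          rw [Real.sqrt_mul (sq_nonneg _), Real.sqrt_sq (by linarith)]
    have h1 : p ≤ (1 + w) * q := comp _ _ h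
    have h2 : q ≤ (1 + w) * p := comp _ _ (k.ag_symm _ _ _ h)
    have hqq : q ^ 2 = k.κ s' a := Real.sq_sqrt (k.κ_pos _ _).le
    rw [← hqq, ← mul_pow]
    refine sq_le_sq' ?_ (by linarith)
    by_cases hpq : p ≤ q
    · nlinarith
    · nlinarith [mul_nonneg w0 hq0]
  have h2 : ∑ a, (√(k.κ s a) - √(k.κ s' a)) ^ 2 ≤ w ^ 2 := by
    refine (Finset.sum_le_sum fun a _ => key a).trans ?_
    rw [← Finset.mul_sum, k.sum_one, mul_one]
  have h3 : ∀ a, (√(k.κ s a) - √(k.κ s' a)) ^ 2 =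
      k.κ s a + k.κ s' a - 2 * √(k.κ s a * k.κ s' a) := fun a => by
    rw [Real.sqrt_mul (k.κ_pos _ _).le, sub_sq, Real.sq_sqrt (k.κ_pos _ _).le,
      Real.sq_sqrt (k.κ_pos _ _).le]
    ring
  simp_rw [h3, Finset.sum_sub_distrib, Finset.sum_add_distrib, k.sum_one, ← Finset.mul_sum] at h2
  linarith

lemma affinity {n j : ℕ} {s s' : σ} (h : k.Ag j s s') (hω : ∀ i, j ≤ i → k.ω i ≤ 1) :
    1 - (∑ i ∈ Finset.range n, k.ω (j + i) ^ 2) / 2 ≤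
      ∑ u : Fin n → A, √(k.law n s u * k.law n s' u) := by
  induction n with
  | zero => simp [law_zero]
  | succ n ih =>
    rw [sum_append]
    have e1 : ∀ (u : Fin n → A) (v : Fin 1 → A),
        √(k.law (n + 1) s (Fin.append u v) * k.law (n + 1) s' (Fin.append u v)) =
        √(k.law n s u * k.law n s' u) *
          √(k.κ (k.run n s u) (v 0) * k.κ (k.run n s' u) (v 0)) := fun u v => by
      rw [law_append, law_append, law_one, law_one, ← Real.sqrt_mul
        (mul_nonneg (k.law_pos _ _ _).le (k.law_pos _ _ _).le)]
      congr 1; ring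
    simp_rw [e1, ← Finset.mul_sum]
    have e2 : ∀ t t', ∑ v : Fin 1 → A, √(k.κ t (v 0) * k.κ t' (v 0)) =
        ∑ a, √(k.κ t a * k.κ t' a) := fun t t' => by
      rw [← Equiv.sum_comp (Equiv.funUnique (Fin 1) A).symm]
      rfl
    simp_rw [e2]
    have hx : ∀ u : Fin n → A, 1 - k.ω (j + n) ^ 2 / 2 ≤
        ∑ a, √(k.κ (k.run n s u) a * k.κ (k.run n s' u) a) := fun u =>
      k.affinity_one (k.ag_run h u) (hω _ (by omega))
    have hT : ∑ u : Fin n → A, √(k.law n s u * k.law n s' u) ≤ 1 := by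
      calc _ ≤ ∑ u : Fin n → A, (k.law n s u + k.law n s' u) / 2 := by
            refine Finset.sum_le_sum fun u _ => ?_
            have ha := (k.law_pos n s u).le
            have hb := (k.law_pos n s' u).le
            refine Real.sqrt_le_iff.2 ⟨by positivity, ?_⟩
            nlinarith [sq_nonneg (k.law n s u - k.law n s' u)]
        _ = 1 := by
            rw [← Finset.sum_div, Finset.sum_add_distrib, sum_law, sum_law]; norm_num
    have step : (∑ u : Fin n → A, √(k.law n s u * k.law n s' u)) * (1 - k.ω (j + n) ^ 2 / 2) ≤
        ∑ u : Fin n → A, √(k.law n s u * k.law n s' u) *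
          ∑ a, √(k.κ (k.run n s u) a * k.κ (k.run n s' u) a) := by
      rw [Finset.sum_mul]
      exact Finset.sum_le_sum fun u _ => mul_le_mul_of_nonneg_left (hx u) (Real.sqrt_nonneg _)
    rw [Finset.sum_range_succ]
    nlinarith [sq_nonneg (k.ω (j + n))]

end StateKernel

lemma Cpl.diff_le {α β : Type*} [Fintype α] [Fintype β] {p : α → ℝ} {q : β → ℝ} {G : α → ℝ}
    {G' : β → ℝ} {t : ℝ} (h : Cpl p q (fun a b => G a - G' b) t) :
    ∑ a, p a * G a - ∑ b, q b * G' b ≤ t := by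
  obtain ⟨w, h0, h1, h2, h3⟩ := h
  refine le_of_eq_of_le ?_ h3
  simp_rw [mul_sub, Finset.sum_sub_distrib]
  congr 1
  · simp_rw [← Finset.sum_mul, h1]
  · rw [Finset.sum_comm]; simp_rw [← Finset.sum_mul, h2]

namespace StateKernel

variable {σ A : Type*} [Fintype A] [Nonempty A] (k : StateKernel σ A)

/-- The overlap of the laws of the next `n` letters. -/
def ovl (n : ℕ) (s s' : σ) : ℝ := ∑ u : Fin n → A, min (k.law n s u) (k.law n s' u)

/-- The dyadic sums of the squared variations. -/
def dsum (j : ℕ) : ℝ := ∑ i ∈ Finset.Icc (2 ^ j) (2 ^ (j + 1)), k.ω i ^ 2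

lemma ovl_dyadic : ∃ d : ℕ → ℝ, (∀ j, 0 ≤ d j) ∧ Tendsto d atTop (nhds 0) ∧ ∃ j₁, ∀ j ≥ j₁,
    d j ≤ 1 ∧ ∀ n s s', n ≤ 2 * 2 ^ j → k.Ag (2 ^ j) s s' → 1 - d j ≤ k.ovl n s s' := by
  have hD : Tendsto k.dsum atTop (nhds 0) := k.dyadic
  have hd : Tendsto (fun j => √(k.dsum j + k.dsum (j + 1))) atTop (nhds 0) := by
    have := (hD.add ((tendsto_add_atTop_iff_nat 1).2 hD)).sqrt
    simpa using this
  refine ⟨_, fun j => Real.sqrt_nonneg _, hd, ?_⟩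
  have hw : ∃ a, ∀ i, 2 ^ a ≤ i → k.ω i ≤ 1 := by
    obtain ⟨a, ha⟩ := eventually_atTop.1 (hD.eventually (ge_mem_nhds one_pos))
    refine ⟨a, fun i hi => ?_⟩
    have hi0 : i ≠ 0 := by rintro rfl; simp at hi
    have h1 : a ≤ Nat.log 2 i := Nat.le_log_of_pow_le one_lt_two hi
    have h2 := ha _ h1
    have h3 : k.ω i ^ 2 ≤ k.dsum (Nat.log 2 i) := by
      refine Finset.single_le_sum (f := fun i => k.ω i ^ 2) (fun _ _ => sq_nonneg _) ?_
      exact Finset.mem_Icc.2 ⟨Nat.pow_log_le_self 2 hi0, (Nat.lt_pow_succ_log_self one_lt_two i).le⟩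
    nlinarith [k.ω_nonneg i]
  obtain ⟨a, ha⟩ := hw
  obtain ⟨b, hb⟩ := eventually_atTop.1 (hd.eventually (ge_mem_nhds one_pos))
  refine ⟨max a b, fun j hj => ⟨hb j ((le_max_right _ _).trans hj), fun n s s' hn hag => ?_⟩⟩
  have haj : a ≤ j := (le_max_left _ _).trans hj
  have := k.affinity (n := n) hag fun i hi => ha i
    ((Nat.pow_le_pow_right two_pos haj).trans hi)
  refine overlap_ge_of_affinity (fun u => (k.law_pos _ _ u).le) (fun u => (k.law_pos _ _ u).le)
    (k.sum_law _ _) (k.sum_law _ _) (le_trans ?_ this)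
  have hle : ∑ i ∈ Finset.range n, k.ω (2 ^ j + i) ^ 2 ≤ k.dsum j + k.dsum (j + 1) := by
    calc ∑ i ∈ Finset.range n, k.ω (2 ^ j + i) ^ 2
        ≤ ∑ i ∈ Finset.range (2 ^ j + 2 ^ j), k.ω (2 ^ j + i) ^ 2 :=
          Finset.sum_le_sum_of_subset_of_nonneg
            (Finset.range_subset_range.2 (by omega)) fun _ _ _ => sq_nonneg _
      _ = ∑ i ∈ Finset.range (2 ^ j), k.ω (2 ^ j + i) ^ 2 +
          ∑ i ∈ Finset.range (2 ^ j), k.ω (2 ^ (j + 1) + i) ^ 2 := by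
          rw [Finset.sum_range_add]
          congr 1
          refine Finset.sum_congr rfl fun i _ => ?_
          rw [← add_assoc, ← mul_two, ← pow_succ]
      _ ≤ k.dsum j + k.dsum (j + 1) := by
          have gen : ∀ (a N b : ℕ), a + N ≤ b + 1 →
              ∑ i ∈ Finset.range N, k.ω (a + i) ^ 2 ≤ ∑ i ∈ Finset.Icc a b, k.ω i ^ 2 := by
            intro a N b hb
            have : ∑ i ∈ Finset.range N, k.ω (a + i) ^ 2 =
                ∑ i ∈ Finset.Ico a (a + N), k.ω i ^ 2 := by
              rw [Finset.sum_Ico_eq_sum_range]; simp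
            rw [this]
            refine Finset.sum_le_sum_of_subset_of_nonneg (fun i hi => ?_) fun _ _ _ => sq_nonneg _
            rw [Finset.mem_Ico] at hi
            rw [Finset.mem_Icc]; omega
          refine add_le_add (gen _ _ _ ?_) (gen _ _ _ ?_)
          · rw [pow_succ]; omega
          · have : 0 < 2 ^ j := by positivity
            rw [pow_succ, pow_succ]; omega
  linarith

lemma ovl_start (n : ℕ) (s s' : σ) : k.c ^ n ≤ k.ovl n s s' := by
  obtain ⟨u⟩ : Nonempty (Fin n → A) := inferInstance
  refine le_trans (le_min (k.lw_ge s (wext u) n) (k.lw_ge s' (wext u) n)) ?_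
  exact Finset.single_le_sum (f := fun u => min (k.law n s u) (k.law n s' u))
    (fun u _ => le_min (k.law_pos _ _ _).le (k.law_pos _ _ _).le) (Finset.mem_univ u)

lemma Cpl_law [DecidableEq A] {n : ℕ} {s s' : σ} {δ C₀ C₁ : ℝ} (h : 1 - δ ≤ k.ovl n s s')
    {c : (Fin n → A) → (Fin n → A) → ℝ} (h01 : C₀ ≤ C₁)
    (hc0 : ∀ a, c a a ≤ C₀) (hc1 : ∀ a b, c a b ≤ C₁) :
    Cpl (k.law n s) (k.law n s') c ((1 - δ) * C₀ + δ * C₁) :=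
  Cpl.maximal (fun u => (k.law_pos _ _ u).le) (fun u => (k.law_pos _ _ u).le)
    (k.sum_law _ _) (k.sum_law _ _) h h01 hc0 hc1

lemma ham_step [DecidableEq A] {m n j : ℕ} {δ t₀ t₁ : ℝ} (ht : t₁ ≤ m + t₀)
    (h : ∀ s s', k.Ag j s s' → 1 - δ ≤ k.ovl m s s')
    (h0 : ∀ s s', k.Ag 0 s s' → Cpl (k.law n s) (k.law n s') ham t₀)
    (h1 : ∀ s s', k.Ag (j + m) s s' → Cpl (k.law n s) (k.law n s') ham t₁) (s s' : σ)
    (hag : k.Ag j s s') :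
    Cpl (k.law (m + n) s) (k.law (m + n) s') ham ((1 - δ) * t₁ + δ * (m + t₀)) := by
  have c1 : Cpl (k.law m s) (k.law m s')
      (fun u v => ham u v + if u = v then t₁ else t₀) ((1 - δ) * min t₁ (m + t₀) + δ * (m + t₀)) := by
    refine k.Cpl_law (h s s' hag) (min_le_right _ _) (fun u => ?_) (fun u v => ?_)
    · rw [ham_self, if_pos rfl, zero_add]; exact le_min le_rfl ht
    · split_ifs with huv
      · rw [huv, ham_self, zero_add]; exact ht
      · linarith [ham_le u v]
  rw [min_eq_left ht] at c1
  have c2 := c1.seq (P := fun u => k.law n (k.run m s u)) (Q := fun u => k.law n (k.run m s' u))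
    (d := ham) (fun u => k.sum_law _ _) (fun u v => by
      split_ifs with huv
      · subst huv
        exact h1 _ _ (k.ag_run hag u)
      · exact h0 _ _ (k.ag_zero _ _))
  have c3 := c2.reindex (Fin.appendEquiv m n).symm (Fin.appendEquiv m n).symm
  obtain ⟨e, he⟩ : ∃ e, e = Fin.appendEquiv (α := A) m n := ⟨_, rfl⟩
  rw [← he] at c3
  have hz : ∀ z, Fin.append (e.symm z).1 (e.symm z).2 = z := fun z => by
    subst he; exact Equiv.apply_symm_apply (Fin.appendEquiv m n) z
  convert c3 using 1
  · funext z
    rw [← k.law_append, hz]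
  · funext z
    rw [← k.law_append, hz]
  · funext z z'
    rw [← ham_append, hz, hz]

/-- Very weak Bernoullicity of a state kernel, uniformly in the initial states. -/
theorem veryWeakBernoulli [DecidableEq A] {ε : ℝ} (hε : 0 < ε) :
    ∃ K : ℝ, 0 ≤ K ∧ ∀ n s s', Cpl (k.law n s) (k.law n s') ham (ε * n + K) := by
  obtain ⟨d, d0, dlim, j₁, hj⟩ := k.ovl_dyadic
  obtain ⟨K, K0, hK⟩ := sublinear_of_dyadic_recursion
    (fun n j t => ∀ s s', k.Ag j s s' → Cpl (k.law n s) (k.law n s') ham t)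
    (fun n j t t' h ht s s' hs => (h s s' hs).mono ht)
    (fun n j s s' _ => Cpl.of_prod (fun u => (k.law_pos _ _ u).le) (fun u => (k.law_pos _ _ u).le)
      (k.sum_law _ _) (k.sum_law _ _) ham_le) d d0 dlim j₁
    (fun j n hj1 hn s s' hs => by
      have := k.Cpl_law (C₀ := 0) (C₁ := n) ((hj j hj1).2 n s s' (by omega) hs) (Nat.cast_nonneg n)
        (fun u => (ham_self u).le) ham_le
      simpa using this)
    (fun j n t₀ t₁ hj1 ht h0 h1 => by
      have := k.ham_step (m := 2 ^ j) (n := n) (j := 2 ^ j) (δ := d j) (t₀ := t₀) (t₁ := t₁)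
        (by push_cast; exact ht) (fun s s' hs => (hj j hj1).2 _ s s' (by omega) hs) h0
        (by rw [← mul_two, ← pow_succ]; exact h1)
      push_cast at this
      exact this)
    (fun j _ => ⟨min (k.c ^ 2 ^ j) 1, lt_min (pow_pos k.c_pos _) one_pos, min_le_right _ _,
      fun n t₀ t₁ ht h0 h1 => by
      have := k.ham_step (m := 2 ^ j) (n := n) (j := 0) (δ := 1 - min (k.c ^ 2 ^ j) 1) (t₀ := t₀)
        (t₁ := t₁) (by push_cast; exact ht)
        (fun s s' _ => by
          have h2 := k.ovl_start (2 ^ j) s s'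
          have h3 := min_le_left (k.c ^ 2 ^ j) 1
          linarith) h0 (by rw [zero_add]; exact h1)
      push_cast at this
      rwa [sub_sub_cancel] at this⟩)
    ε hε
  exact ⟨K, K0, fun n s s' => hK n s s' (k.ag_zero _ _)⟩

/-- The expectation of `g` at the state reached after `n` letters. -/
def avg (g : σ → ℝ) (n : ℕ) (s : σ) : ℝ := ∑ u : Fin n → A, k.law n s u * g (k.run n s u)

lemma avg_add (g : σ → ℝ) (m n : ℕ) (s : σ) :
    k.avg g (m + n) s = ∑ u : Fin m → A, k.law m s u * k.avg g n (k.run m s u) := by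
  rw [avg, sum_append]
  refine Finset.sum_congr rfl fun u _ => ?_
  rw [avg, Finset.mul_sum]
  refine Finset.sum_congr rfl fun v _ => ?_
  rw [law_append, run_append]; ring

/-- The conditional expectation of a function of the next `k₀` letters. -/
def look {k₀ : ℕ} (h : (Fin k₀ → A) → ℝ) (s : σ) : ℝ := ∑ v, k.law k₀ s v * h v

lemma avg_look_diff {k₀ : ℕ} {h : (Fin k₀ → A) → ℝ} (h0 : ∀ v, 0 ≤ h v) (h1 : ∀ v, h v ≤ 1)
    {n : ℕ} {s s' : σ} {δ : ℝ} (hov : 1 - δ ≤ k.ovl (n + k₀) s s') :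
    k.avg (k.look h) n s - k.avg (k.look h) n s' ≤ δ := by
  classical
  have e : ∀ s, k.avg (k.look h) n s = ∑ z : Fin (n + k₀) → A, k.law (n + k₀) s z *
      h (fun i => z (Fin.natAdd n i)) := fun s => by
    rw [sum_append, avg]
    refine Finset.sum_congr rfl fun u _ => ?_
    rw [look, Finset.mul_sum]
    refine Finset.sum_congr rfl fun v _ => ?_
    rw [law_append, mul_assoc]
    simp
  rw [e, e]
  have := k.Cpl_law (C₀ := 0) (C₁ := 1)
    (c := fun z z' => h (fun i => z (Fin.natAdd n i)) - h (fun i => z' (Fin.natAdd n i)))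
    hov zero_le_one (fun u => (sub_self _).le) (fun u v => by
      linarith [h1 (fun i => u (Fin.natAdd n i)), h0 (fun i => v (Fin.natAdd n i))])
  have := this.diff_le
  linarith

lemma avg_step (g : σ → ℝ) {m n j : ℕ} {δ o₀ o₁ : ℝ} (hδ : δ ≤ 1)
    (h : ∀ s s', k.Ag j s s' → 1 - δ ≤ k.ovl m s s')
    (h0 : ∀ s s', k.Ag 0 s s' → k.avg g n s - k.avg g n s' ≤ o₀)
    (h1 : ∀ s s', k.Ag (j + m) s s' → k.avg g n s - k.avg g n s' ≤ o₁)
    (s s' : σ) (hag : k.Ag j s s') :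
    k.avg g (m + n) s - k.avg g (m + n) s' ≤ (1 - δ) * o₁ + δ * o₀ := by
  classical
  rw [avg_add, avg_add]
  have := k.Cpl_law (C₀ := min o₁ o₀) (C₁ := o₀)
    (c := fun u v => k.avg g n (k.run m s u) - k.avg g n (k.run m s' v))
    (h s s' hag) (min_le_right _ _)
    (fun u => le_min (h1 _ _ (k.ag_run hag u)) (h0 _ _ (k.ag_zero _ _)))
    (fun u v => h0 _ _ (k.ag_zero _ _))
  have := this.diff_le
  nlinarith [mul_le_mul_of_nonneg_left (min_le_left o₁ o₀) (sub_nonneg.2 hδ)]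

/-- Uniform loss of memory. -/
theorem loss_of_memory {k₀ : ℕ} {h : (Fin k₀ → A) → ℝ} (h0 : ∀ v, 0 ≤ h v) (h1 : ∀ v, h v ≤ 1)
    {ε : ℝ} (hε : 0 < ε) :
    ∃ n₀, ∀ n ≥ n₀, ∀ s s', k.avg (k.look h) n s - k.avg (k.look h) n s' ≤ ε := by
  obtain ⟨d, d0, dlim, j₁, hj⟩ := k.ovl_dyadic
  obtain ⟨j₂, hj₂⟩ : ∃ j₂, k₀ ≤ 2 ^ j₂ := ⟨k₀, Nat.lt_two_pow_self.le⟩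
  have hk0 : ∀ j ≥ max j₁ j₂, k₀ ≤ 2 ^ j := fun j hj =>
    hj₂.trans (Nat.pow_le_pow_right two_pos ((le_max_right _ _).trans hj))
  set P : ℕ → ℕ → ℝ → Prop := fun N j t => ∃ o : ℕ → ℝ, (∀ n < N, ∀ s s', k.Ag j s s' →
    k.avg (k.look h) n s - k.avg (k.look h) n s' ≤ o n) ∧ ∑ n ∈ Finset.range N, o n ≤ t with hP
  have hstep : ∀ (m N j : ℕ) (δ t₀ t₁ : ℝ), k₀ ≤ m → δ ≤ 1 → 0 ≤ δ →
      (∀ n s s', n ≤ 2 * m → k.Ag j s s' → 1 - δ ≤ k.ovl n s s') → P N 0 t₀ → P N (j + m) t₁ →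
      P (m + N) j ((1 - δ) * t₁ + δ * (m + t₀)) := by
    rintro m N j δ t₀ t₁ hkm hδ hδ0 hov ⟨o₀, a0, b0⟩ ⟨o₁, a1, b1⟩
    refine ⟨fun n => if n < m then δ else (1 - δ) * o₁ (n - m) + δ * o₀ (n - m), ?_, ?_⟩
    · intro n hn s s' hs
      dsimp only
      split_ifs with hnm
      · exact k.avg_look_diff h0 h1 (hov _ s s' (by omega) hs)
      · obtain ⟨n', rfl⟩ := Nat.exists_eq_add_of_le (not_lt.1 hnm)
        rw [Nat.add_sub_cancel_left]
        exact k.avg_step _ hδ (fun s s' hs => hov _ s s' (by omega) hs)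
          (a0 n' (by omega)) (a1 n' (by omega)) s s' hs
    · rw [Finset.sum_range_add]
      have e1 : ∑ x ∈ Finset.range m,
          (if x < m then δ else (1 - δ) * o₁ (x - m) + δ * o₀ (x - m)) = m * δ := by
        rw [Finset.sum_congr rfl fun x hx => if_pos (Finset.mem_range.1 hx)]
        simp
      simp only [e1, Nat.add_sub_cancel_left, show ∀ x, ¬ (m + x < m) from fun x => by omega,
        if_false, Finset.sum_add_distrib, ← Finset.mul_sum]
      nlinarith [mul_le_mul_of_nonneg_left b1 (sub_nonneg.2 hδ), mul_le_mul_of_nonneg_left b0 hδ0]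
  obtain ⟨K, K0, hK⟩ := sublinear_of_dyadic_recursion P
    (fun n j t t' ⟨o, ho, ho'⟩ ht => ⟨o, ho, ho'.trans ht⟩)
    (fun n j => ⟨fun _ => 1, fun n _ s s' _ =>
      k.avg_look_diff h0 h1 (by
        rw [sub_self]
        exact Finset.sum_nonneg fun u _ => le_min (k.law_pos _ _ _).le (k.law_pos _ _ _).le),
      by simp⟩) d d0 dlim (max j₁ j₂)
    (fun j n hj1 hn => ⟨fun _ => d j, fun m hm s s' hs =>
      k.avg_look_diff h0 h1 ((hj j ((le_max_left _ _).trans hj1)).2 _ s s'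
        (by have := hk0 j hj1; omega) hs), by simp [mul_comm]⟩)
    (fun j n t₀ t₁ hj1 _ p0 p1 => by
      have hjj := hj j ((le_max_left _ _).trans hj1)
      have := hstep (2 ^ j) n (2 ^ j) (d j) t₀ t₁ (hk0 j hj1) hjj.1 (d0 j) hjj.2 p0
        (by rw [← mul_two, ← pow_succ]; exact p1)
      push_cast at this
      exact this)
    (fun j hj1 => by
      refine ⟨min 1 k.c ^ (2 * 2 ^ j), pow_pos (lt_min one_pos k.c_pos) _,
        pow_le_one₀ (lt_min one_pos k.c_pos).le (min_le_left _ _), fun n t₀ t₁ _ p0 p1 => ?_⟩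
      have hm0 : 0 < min 1 k.c := lt_min one_pos k.c_pos
      have hp1 : min 1 k.c ^ (2 * 2 ^ j) ≤ 1 := pow_le_one₀ hm0.le (min_le_left _ _)
      have := hstep (2 ^ j) n 0 (1 - min 1 k.c ^ (2 * 2 ^ j)) t₀ t₁ (hk0 j hj1)
        (by linarith [pow_pos hm0 (2 * 2 ^ j)]) (by linarith) (fun n s s' hn _ => by
          have h2 := k.ovl_start n s s'
          have h3 : min 1 k.c ^ (2 * 2 ^ j) ≤ k.c ^ n :=
            (pow_le_pow_of_le_one hm0.le (min_le_left _ _) hn).trans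
              (pow_le_pow_left₀ hm0.le (min_le_right _ _) n)
          linarith) p0 (by rw [zero_add]; exact p1)
      push_cast at this
      rwa [sub_sub_cancel] at this)
    (ε / 2) (by positivity)
  obtain ⟨N, hN⟩ : ∃ N : ℕ, K < ε / 2 * N := by
    obtain ⟨N, hN⟩ := exists_nat_gt (K / (ε / 2))
    exact ⟨N, by rwa [div_lt_iff₀' (by positivity)] at hN⟩
  obtain ⟨o, ho, hs⟩ := hK N
  have : ∃ n < N, o n ≤ ε := by
    by_contra! hcon
    have h2 : ∑ n ∈ Finset.range N, ε ≤ ∑ n ∈ Finset.range N, o n :=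
      Finset.sum_le_sum fun n hn => (hcon n (Finset.mem_range.1 hn)).le
    rw [Finset.sum_const, Finset.card_range, nsmul_eq_mul] at h2
    linarith
  obtain ⟨n₀, hn₀, hon⟩ := this
  refine ⟨n₀, fun n hn s s' => ?_⟩
  obtain ⟨m, rfl⟩ := Nat.exists_eq_add_of_le' hn
  have := k.avg_step (k.look h) (m := m) (n := n₀) (j := 0) (δ := 1) (o₀ := ε) (o₁ := ε) le_rfl
    (fun s s' _ => by
      rw [sub_self]
      exact Finset.sum_nonneg fun u _ => le_min (k.law_pos _ _ _).le (k.law_pos _ _ _).le)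
    (fun s s' hs => (ho n₀ hn₀ s s' hs).trans hon)
    (fun s s' _ => (ho n₀ hn₀ s s' (k.ag_zero _ _)).trans hon) s s' (k.ag_zero _ _)
  linarith

end StateKernel

/-! ### Shannon entropy of finite probability vectors -/

section Entropy

variable {α β γ : Type*} [Fintype α] [Fintype β] [Fintype γ]

/-- Shannon entropy. -/
def ent (p : α → ℝ) : ℝ := ∑ a, Real.negMulLog (p a)

lemma ent_equiv (e : β ≃ α) (p : α → ℝ) : ent (fun b => p (e b)) = ent p :=
  Equiv.sum_comp e fun a => Real.negMulLog (p a)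

lemma ent_nonneg {p : α → ℝ} (hp : ∀ a, 0 ≤ p a) (hp1 : ∑ a, p a = 1) : 0 ≤ ent p :=
  Finset.sum_nonneg fun a _ => Real.negMulLog_nonneg (hp a)
    (hp1 ▸ Finset.single_le_sum (fun b _ => hp b) (Finset.mem_univ a))

/-- Strong subadditivity, with a quantitative (Pinsker type) form. -/
lemma ssa {P : α → β → γ → ℝ} (hP : ∀ a b c, 0 ≤ P a b c) (hP1 : ∑ a, ∑ b, ∑ c, P a b c = 1)
    {I : ℝ} (hI : I = (∑ a, ∑ b, Real.negMulLog (∑ c, P a b c)) +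
      (∑ b, ∑ c, Real.negMulLog (∑ a, P a b c)) -
      (∑ b, Real.negMulLog (∑ a, ∑ c, P a b c)) - ∑ a, ∑ b, ∑ c, Real.negMulLog (P a b c)) :
    0 ≤ I ∧ 1 - √I ≤ ∑ a, ∑ b, ∑ c,
      min (P a b c) ((∑ c, P a b c) * (∑ a, P a b c) / ∑ a, ∑ c, P a b c) := by
  set AB : α → β → ℝ := fun a b => ∑ c, P a b c with hAB
  set BC : β → γ → ℝ := fun b c => ∑ a, P a b c with hBC
  set B : β → ℝ := fun b => ∑ a, ∑ c, P a b c with hB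
  have hABB : ∀ b, ∑ a, AB a b = B b := fun b => rfl
  have hBCB : ∀ b, ∑ c, BC b c = B b := fun b => Finset.sum_comm
  have AB0 : ∀ a b, 0 ≤ AB a b := fun a b => Finset.sum_nonneg fun c _ => hP a b c
  have BC0 : ∀ b c, 0 ≤ BC b c := fun b c => Finset.sum_nonneg fun a _ => hP a b c
  have B0 : ∀ b, 0 ≤ B b := fun b => Finset.sum_nonneg fun a _ => AB0 a b
  have hPAB : ∀ a b c, P a b c ≤ AB a b := fun a b c =>
    Finset.single_le_sum (fun c _ => hP a b c) (Finset.mem_univ c)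
  have hPBC : ∀ a b c, P a b c ≤ BC b c := fun a b c =>
    Finset.single_le_sum (f := fun a => P a b c) (fun a _ => hP a b c) (Finset.mem_univ a)
  have hABle : ∀ a b, AB a b ≤ B b := fun a b =>
    Finset.single_le_sum (f := fun a => AB a b) (fun a _ => AB0 a b) (Finset.mem_univ a)
  set Q : α → β → γ → ℝ := fun a b c => AB a b * BC b c / B b with hQ
  have Q0 : ∀ a b c, 0 ≤ Q a b c := fun a b c =>
    div_nonneg (mul_nonneg (AB0 _ _) (BC0 _ _)) (B0 _)
  have hAB1 : ∑ a, ∑ b, AB a b = 1 := hP1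
  have hQ1 : ∑ a, ∑ b, ∑ c, Q a b c = 1 := by
    rw [← hAB1]
    refine Finset.sum_congr rfl fun a _ => Finset.sum_congr rfl fun b _ => ?_
    simp only [hQ]
    rw [← Finset.sum_div, ← Finset.mul_sum, hBCB]
    by_cases hb : B b = 0
    · have := le_antisymm (hb ▸ hABle a b) (AB0 a b)
      simp [this]
    · field_simp
  have eI : I = ∑ a, ∑ b, ∑ c,
      P a b c * (Real.log (P a b c) + Real.log (B b) - Real.log (AB a b) - Real.log (BC b c)) := by
    have t1 : ∑ a, ∑ b, Real.negMulLog (AB a b) =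
        - ∑ a, ∑ b, ∑ c, P a b c * Real.log (AB a b) := by
      simp_rw [← Finset.sum_neg_distrib]
      refine Finset.sum_congr rfl fun a _ => Finset.sum_congr rfl fun b _ => ?_
      rw [Finset.sum_neg_distrib, ← Finset.sum_mul, Real.negMulLog]; ring
    have t2 : ∑ b, ∑ c, Real.negMulLog (BC b c) =
        - ∑ a, ∑ b, ∑ c, P a b c * Real.log (BC b c) := by
      rw [Finset.sum_comm (s := Finset.univ (α := α)), ← Finset.sum_neg_distrib]
      refine Finset.sum_congr rfl fun b _ => ?_
      rw [Finset.sum_comm, ← Finset.sum_neg_distrib]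
      refine Finset.sum_congr rfl fun c _ => ?_
      rw [← Finset.sum_mul, Real.negMulLog]; ring
    have t3 : ∑ b, Real.negMulLog (B b) =
        - ∑ a, ∑ b, ∑ c, P a b c * Real.log (B b) := by
      rw [Finset.sum_comm (s := Finset.univ (α := α)), ← Finset.sum_neg_distrib]
      refine Finset.sum_congr rfl fun b _ => ?_
      simp_rw [← Finset.sum_mul]
      rw [Real.negMulLog]; simp only [hB]; ring
    rw [hI, t1, t2, t3]
    simp only [mul_add, mul_sub, Finset.sum_sub_distrib, Finset.sum_add_distrib, Real.negMulLog,
      neg_mul, Finset.sum_neg_distrib]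
    ring
  have aff : 1 - I / 2 ≤ ∑ a, ∑ b, ∑ c, √(P a b c * Q a b c) := by
    have key : ∀ a b c, 2 * P a b c - 2 * √(P a b c * Q a b c) ≤
        P a b c * (Real.log (P a b c) + Real.log (B b) - Real.log (AB a b) - Real.log (BC b c)) := by
      intro a b c
      rcases (hP a b c).eq_or_lt with h | h
      · rw [← h]; simp
      · have h1 : 0 < AB a b := h.trans_le (hPAB a b c)
        have h2 : 0 < BC b c := h.trans_le (hPBC a b c)
        have h3 : 0 < B b := h1.trans_le (hABle a b)
        have h4 : 0 < Q a b c := by positivity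
        have h5 : Real.log (√(Q a b c / P a b c)) =
            (Real.log (AB a b) + Real.log (BC b c) - Real.log (B b) - Real.log (P a b c)) / 2 := by
          rw [Real.log_sqrt (by positivity), Real.log_div h4.ne' h.ne']
          simp only [hQ]
          rw [Real.log_div (by positivity) h3.ne', Real.log_mul h1.ne' h2.ne']
        have h6 := Real.log_le_sub_one_of_pos (Real.sqrt_pos.2 (div_pos h4 h))
        have h7 : P a b c * √(Q a b c / P a b c) = √(P a b c * Q a b c) := by
          rw [show P a b c * Q a b c = P a b c ^ 2 * (Q a b c / P a b c) by field_simp,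
            Real.sqrt_mul (sq_nonneg _), Real.sqrt_sq h.le]
        rw [h5] at h6
        nlinarith
    have := Finset.sum_le_sum fun a (_ : a ∈ Finset.univ) => Finset.sum_le_sum
      fun b (_ : b ∈ Finset.univ) => Finset.sum_le_sum fun c (_ : c ∈ Finset.univ) => key a b c
    rw [← eI] at this
    simp only [Finset.sum_sub_distrib, ← Finset.mul_sum, hP1] at this
    linarith
  have ov := overlap_ge_of_affinity (α := α × β × γ) (p := fun x => P x.1 x.2.1 x.2.2)
    (q := fun x => Q x.1 x.2.1 x.2.2) (x := I) (fun x => hP _ _ _) (fun x => Q0 _ _ _)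
    (by simpa only [Fintype.sum_prod_type] using hP1)
    (by simpa only [Fintype.sum_prod_type] using hQ1)
    (by simpa only [Fintype.sum_prod_type] using aff)
  simp only [Fintype.sum_prod_type] at ov
  refine ⟨?_, ov⟩
  have : ∑ a, ∑ b, ∑ c, √(P a b c * Q a b c) ≤ ∑ a, ∑ b, ∑ c, (P a b c + Q a b c) / 2 := by
    refine Finset.sum_le_sum fun a _ => Finset.sum_le_sum fun b _ => Finset.sum_le_sum fun c _ => ?_
    refine Real.sqrt_le_iff.2 ⟨by linarith [hP a b c, Q0 a b c], ?_⟩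
    nlinarith [sq_nonneg (P a b c - Q a b c)]
  simp_rw [← Finset.sum_div, Finset.sum_add_distrib, hP1, hQ1] at this
  linarith

/-- The image of a finite measure. -/
def push [DecidableEq β] (f : α → β) (p : α → ℝ) (b : β) : ℝ :=
  ∑ a, if f a = b then p a else 0

lemma push_nonneg [DecidableEq β] (f : α → β) {p : α → ℝ} (hp : ∀ a, 0 ≤ p a) (b : β) :
    0 ≤ push f p b := Finset.sum_nonneg fun a _ => by split_ifs; exacts [hp a, le_rfl]

lemma sum_push_mul [DecidableEq β] (f : α → β) (p : α → ℝ) (g : β → ℝ) :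
    ∑ b, push f p b * g b = ∑ a, p a * g (f a) := by
  simp_rw [push, Finset.sum_mul]
  rw [Finset.sum_comm]
  simp

lemma sum_push [DecidableEq β] (f : α → β) (p : α → ℝ) : ∑ b, push f p b = ∑ a, p a := by
  simpa using sum_push_mul f p fun _ => 1

lemma le_push [DecidableEq β] (f : α → β) {p : α → ℝ} (hp : ∀ a, 0 ≤ p a) (a : α) :
    p a ≤ push f p (f a) := by
  have := Finset.single_le_sum (f := fun a' => if f a' = f a then p a' else 0)
    (fun a' _ => by split_ifs; exacts [hp a', le_rfl]) (Finset.mem_univ a)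
  simpa [push] using this

lemma ent_push [DecidableEq β] (f : α → β) (p : α → ℝ) :
    ent (push f p) = - ∑ a, p a * Real.log (push f p (f a)) := by
  rw [← sum_push_mul f p fun b => Real.log (push f p b), ent, ← Finset.sum_neg_distrib]
  exact Finset.sum_congr rfl fun b _ => by rw [Real.negMulLog]; ring

/-- Entropy lost by a map, in terms of fibre cardinalities. -/
lemma ent_le_ent_push_add [DecidableEq β] (f : α → β) {p : α → ℝ} (hp : ∀ a, 0 ≤ p a)
    (hp1 : ∑ a, p a = 1) (s : Finset α) (hs : ∀ a ∉ s, p a = 0) (N : β → ℝ)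
    (hN : ∀ a ∈ s, ((s.filter fun a' => f a' = f a).card : ℝ) ≤ N (f a)) :
    ent p ≤ ent (push f p) + ∑ a, p a * Real.log (N (f a)) := by
  classical
  rw [ent_push, ent]
  have hN0 : ∀ a ∈ s, 0 < N (f a) := fun a ha => by
    have : 0 < (s.filter fun a' => f a' = f a).card :=
      Finset.card_pos.2 ⟨a, Finset.mem_filter.2 ⟨ha, rfl⟩⟩
    exact lt_of_lt_of_le (by exact_mod_cast this) (hN a ha)
  have key : ∀ a, Real.negMulLog (p a) + p a * Real.log (push f p (f a)) -
      p a * Real.log (N (f a)) ≤ (if a ∈ s then push f p (f a) / N (f a) else 0) - p a := by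
    intro a
    by_cases has : a ∈ s
    · rw [if_pos has]
      rcases (hp a).eq_or_lt with h | h
      · rw [← h]
        have := div_nonneg (push_nonneg f hp (f a)) (hN0 a has).le
        simpa using this
      · have h1 : 0 < push f p (f a) := h.trans_le (le_push f hp a)
        have h2 := hN0 a has
        have h3 := Real.log_le_sub_one_of_pos (div_pos h1 (mul_pos h h2))
        rw [Real.log_div h1.ne' (mul_pos h h2).ne', Real.log_mul h.ne' h2.ne'] at h3
        have h4 : p a * (push f p (f a) / (p a * N (f a))) = push f p (f a) / N (f a) := by
          field_simp
        rw [Real.negMulLog]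
        nlinarith [mul_le_mul_of_nonneg_left h3 h.le]
    · rw [if_neg has, hs a has]; simp
  have h2 : ∑ a, (if a ∈ s then push f p (f a) / N (f a) else 0) ≤ 1 := by
    rw [← hp1, ← sum_push f p]
    have e : ∀ a, (if a ∈ s then push f p (f a) / N (f a) else 0) =
        ∑ b, if f a = b then (if a ∈ s then push f p b / N b else 0) else 0 := fun a => by simp
    simp_rw [e]
    rw [Finset.sum_comm]
    refine Finset.sum_le_sum fun b _ => ?_
    have e2 : ∀ a, (if f a = b then (if a ∈ s then push f p b / N b else 0) else 0) =
        if a ∈ s.filter (fun a' => f a' = b) then push f p b / N b else 0 := fun a => by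
      simp only [Finset.mem_filter]
      by_cases h1 : f a = b <;> by_cases h2 : a ∈ s <;> simp [h1, h2]
    simp_rw [e2]
    rw [Finset.sum_ite_mem, Finset.univ_inter, Finset.sum_const, nsmul_eq_mul]
    by_cases hne : (s.filter fun a' => f a' = b).Nonempty
    · obtain ⟨a, ha⟩ := hne
      obtain ⟨has, rfl⟩ := Finset.mem_filter.1 ha
      have := hN a has
      have h0 := hN0 a has
      rw [mul_div_assoc', div_le_iff₀ h0, mul_comm]
      exact mul_le_mul_of_nonneg_left this (push_nonneg f hp _)
    · rw [Finset.not_nonempty_iff_eq_empty.1 hne]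
      simpa using push_nonneg f hp b
  have h3 := Finset.sum_le_sum fun a (_ : a ∈ Finset.univ) => key a
  simp only [Finset.sum_sub_distrib, Finset.sum_add_distrib, hp1] at h3
  linarith

lemma ent_le_log_card {p : α → ℝ} (hp : ∀ a, 0 ≤ p a) (hp1 : ∑ a, p a = 1) :
    ent p ≤ Real.log (Fintype.card α) := by
  have := ent_le_ent_push_add (fun _ : α => ()) hp hp1 Finset.univ (by simp)
    (fun _ => (Fintype.card α : ℝ)) (by simp)
  rw [← Finset.sum_mul, hp1, one_mul] at this
  have h2 : ent (push (fun _ : α => ()) p) = 0 := by simp [ent, push, hp1]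
  linarith

/-- Subadditivity of entropy. -/
lemma ent_pair_le {P : α → β → ℝ} (hP : ∀ a b, 0 ≤ P a b) (hP1 : ∑ a, ∑ b, P a b = 1) :
    ent (fun x : α × β => P x.1 x.2) ≤ ent (fun a => ∑ b, P a b) + ent fun b => ∑ a, P a b := by
  have := (ssa (P := fun (a : α) (_ : Unit) (b : β) => P a b) (fun a _ b => hP a b)
    (by simpa using hP1) rfl).1
  simp only [Finset.univ_unique, Finset.sum_singleton, hP1] at this
  simp only [ent, Fintype.sum_prod_type]
  simp at this
  linarith

lemma ent_continuous (γ : ℝ) (hγ : 0 < γ) : ∃ η > 0, ∀ p q : α → ℝ, (∀ a, 0 ≤ p a) →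
    (∀ a, 0 ≤ q a) → ∑ a, p a = 1 → ∑ a, q a = 1 → ∑ a, |p a - q a| ≤ η →
    |ent p - ent q| ≤ γ := by
  have huc := (isCompact_Icc (a := (0 : ℝ)) (b := 1)).uniformContinuousOn_of_continuous
    Real.continuous_negMulLog.continuousOn
  rw [Metric.uniformContinuousOn_iff] at huc
  obtain ⟨η, hη, h⟩ := huc (γ / (Fintype.card α + 1)) (by positivity)
  refine ⟨η / 2, by positivity, fun p q hp hq hp1 hq1 hpq => ?_⟩
  have le1 : ∀ p : α → ℝ, (∀ a, 0 ≤ p a) → ∑ a, p a = 1 → ∀ a, p a ∈ Set.Icc (0 : ℝ) 1 :=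
    fun p hp hp1 a => ⟨hp a, hp1 ▸ Finset.single_le_sum (fun b _ => hp b) (Finset.mem_univ a)⟩
  rw [ent, ent, ← Finset.sum_sub_distrib]
  refine (Finset.abs_sum_le_sum_abs _ _).trans ?_
  calc ∑ a, |Real.negMulLog (p a) - Real.negMulLog (q a)|
      ≤ ∑ _a : α, γ / (Fintype.card α + 1) := by
        refine Finset.sum_le_sum fun a _ => ?_
        have hd : |p a - q a| ≤ η / 2 :=
          (Finset.single_le_sum (f := fun a => |p a - q a|) (fun b _ => abs_nonneg _)
            (Finset.mem_univ a)).trans hpq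
        have := h (p a) (le1 p hp hp1 a) (q a) (le1 q hq hq1 a)
          (by rw [Real.dist_eq]; linarith)
        rw [Real.dist_eq] at this
        exact this.le
    _ ≤ γ := by
        rw [Finset.sum_const, Finset.card_univ, nsmul_eq_mul, mul_div_assoc', div_le_iff₀ (by positivity)]
        nlinarith

end Entropy

/-! ### Laws of finite valued random variables -/

section DLaw

variable {Ω β γ : Type*} [MeasurableSpace Ω] [Fintype β] [MeasurableSpace β]
  [MeasurableSingletonClass β] [Fintype γ] [MeasurableSpace γ] [MeasurableSingletonClass γ]

/-- The law of a finite valued random variable. -/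
def dlaw (μ : Measure Ω) (Z : Ω → β) (b : β) : ℝ := μ.real (Z ⁻¹' {b})

lemma dlaw_nonneg (μ : Measure Ω) (Z : Ω → β) (b : β) : 0 ≤ dlaw μ Z b := measureReal_nonneg

variable {μ : Measure Ω} [IsProbabilityMeasure μ] {Z : Ω → β} {Z' : Ω → γ}

lemma integrable_dcomp (hZ : Measurable Z) (g : β → ℝ) : Integrable (fun x => g (Z x)) μ := by
  have : IsProbabilityMeasure (μ.map Z) := Measure.isProbabilityMeasure_map hZ.aemeasurable
  exact (Integrable.of_finite (μ := μ.map Z) (f := g)).comp_measurable hZ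

lemma integral_dcomp (hZ : Measurable Z) (g : β → ℝ) :
    ∫ x, g (Z x) ∂μ = ∑ b, dlaw μ Z b * g b := by
  have : IsProbabilityMeasure (μ.map Z) := Measure.isProbabilityMeasure_map hZ.aemeasurable
  rw [← integral_map hZ.aemeasurable Integrable.of_finite.aestronglyMeasurable,
    integral_fintype Integrable.of_finite]
  refine Finset.sum_congr rfl fun b _ => ?_
  rw [map_measureReal_apply hZ (measurableSet_singleton b), smul_eq_mul, dlaw]

lemma sum_dlaw (hZ : Measurable Z) : ∑ b, dlaw μ Z b = 1 := by
  simpa using (integral_dcomp (μ := μ) hZ fun _ => 1).symm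

lemma dlaw_comp [DecidableEq γ] (hZ : Measurable Z) (f : β → γ) :
    dlaw μ (fun x => f (Z x)) = push f (dlaw μ Z) := by
  ext c
  have h := integral_dcomp (μ := μ) hZ fun b => if f b = c then (1 : ℝ) else 0
  have e : (fun x => if f (Z x) = c then (1 : ℝ) else 0) =
      ((fun x => f (Z x)) ⁻¹' {c}).indicator fun _ => 1 := by
    ext x; simp [Set.indicator]
  have e2 : ∫ x, (if f (Z x) = c then (1 : ℝ) else 0) ∂μ = dlaw μ (fun x => f (Z x)) c := by
    have hm : MeasurableSet ((fun x => f (Z x)) ⁻¹' {c}) :=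
      (measurable_of_finite f).comp hZ (measurableSet_singleton c)
    rw [e, integral_indicator_const _ hm]
    simp [dlaw]
  rw [← e2, h, push]
  exact Finset.sum_congr rfl fun b _ => by split_ifs <;> simp

lemma prob_dcomp (hZ : Measurable Z) (p : β → Prop) [DecidablePred p] :
    μ.real {x | p (Z x)} = ∑ b, dlaw μ Z b * if p b then 1 else 0 := by
  rw [← integral_dcomp hZ]
  have e : (fun x => if p (Z x) then (1 : ℝ) else 0) =
      {x | p (Z x)}.indicator fun _ => 1 := by
    ext x; simp [Set.indicator]
  have hm : MeasurableSet {x | p (Z x)} := hZ (Set.toFinite {b | p b}).measurableSet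
  rw [e, integral_indicator_const _ hm]
  simp

lemma dlaw_fst (hZ : Measurable Z) (hZ' : Measurable Z') (b : β) :
    ∑ c, dlaw μ (fun x => (Z x, Z' x)) (b, c) = dlaw μ Z b := by
  classical
  have := congrFun (dlaw_comp (μ := μ) (hZ.prodMk hZ') Prod.fst) b
  rw [show dlaw μ Z b = _ from this, push, Fintype.sum_prod_type, Finset.sum_comm]
  simp

lemma dlaw_snd (hZ : Measurable Z) (hZ' : Measurable Z') (c : γ) :
    ∑ b, dlaw μ (fun x => (Z x, Z' x)) (b, c) = dlaw μ Z' c := by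
  classical
  have := congrFun (dlaw_comp (μ := μ) (hZ.prodMk hZ') Prod.snd) c
  rw [show dlaw μ Z' c = _ from this, push, Fintype.sum_prod_type]
  simp

lemma Cpl.of_joint (hZ : Measurable Z) (hZ' : Measurable Z') {c : β → γ → ℝ} {t : ℝ}
    (h : ∫ x, c (Z x) (Z' x) ∂μ ≤ t) : Cpl (dlaw μ Z) (dlaw μ Z') c t := by
  refine ⟨fun b c => dlaw μ (fun x => (Z x, Z' x)) (b, c), fun _ _ => dlaw_nonneg _ _ _,
    dlaw_fst hZ hZ', dlaw_snd hZ hZ', ?_⟩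
  rw [integral_dcomp (hZ.prodMk hZ') fun p : β × γ => c p.1 p.2, Fintype.sum_prod_type] at h
  exact h

lemma ent_dlaw_comp_le (hZ : Measurable Z) (f : β → γ) :
    ent (dlaw μ fun x => f (Z x)) ≤ ent (dlaw μ Z) := by
  classical
  rw [dlaw_comp hZ, ent_push, ent, ← Finset.sum_neg_distrib]
  refine Finset.sum_le_sum fun b _ => ?_
  rw [Real.negMulLog, neg_mul]
  rcases (dlaw_nonneg μ Z b).eq_or_lt with h | h
  · rw [← h]; simp
  · exact neg_le_neg (mul_le_mul_of_nonneg_left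
      (Real.log_le_log h (le_push f (dlaw_nonneg μ Z) b)) h.le)

lemma ent_dlaw_pair_le (hZ : Measurable Z) (hZ' : Measurable Z') :
    ent (dlaw μ fun x => (Z x, Z' x)) ≤ ent (dlaw μ Z) + ent (dlaw μ Z') := by
  have := ent_pair_le (P := fun b c => dlaw μ (fun x => (Z x, Z' x)) (b, c))
    (fun _ _ => dlaw_nonneg _ _ _) (by
      rw [← Fintype.sum_prod_type' fun b c => dlaw μ (fun x => (Z x, Z' x)) (b, c)]
      exact sum_dlaw (hZ.prodMk hZ'))
  simp only [dlaw_fst hZ hZ', dlaw_snd hZ hZ'] at this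
  exact this

end DLaw

/-! ### Words of configurations and stationary processes -/

section Stationary

variable {A : Type} [Fintype A] [Nonempty A] [MeasurableSpace A] [MeasurableSingletonClass A]

/-- The word of length `n` read from position `t`. -/
def word {A : Type} (t : ℤ) (n : ℕ) (x : ℤ → A) : Fin n → A := fun i => x (t + i)

lemma measurable_word (t : ℤ) (n : ℕ) : Measurable (word (A := A) t n) :=
  measurable_pi_lambda _ fun _ => measurable_pi_apply _

lemma measurable_shift (n : ℤ) : Measurable (shift (S := A) n) :=
  measurable_pi_lambda _ fun _ => measurable_pi_apply _

lemma word_shift {A : Type} (t m : ℤ) (n : ℕ) (x : ℤ → A) :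
    word t n (shift m x) = word (t + m) n x := by
  ext i; simp only [word, shift]; congr 1; ring

lemma shift_shift {A : Type} (m n : ℤ) (x : ℤ → A) : shift m (shift n x) = shift (m + n) x := by
  ext i; simp only [shift]; congr 1; ring

lemma shift_zero {A : Type} (x : ℤ → A) : shift 0 x = x := by
  ext i; simp [shift]

lemma word_append {A : Type} (t : ℤ) (m n : ℕ) (x : ℤ → A) :
    word t (m + n) x = Fin.append (word t m x) (word (t + m) n x) := by
  ext i
  refine Fin.addCases (fun i => ?_) (fun i => ?_) i
  · rw [Fin.append_left]; simp [word]
  · rw [Fin.append_right]; simp [word, add_assoc]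

/-- A shift invariant probability measure. -/
structure Stat {A : Type} [MeasurableSpace A] (μ : Measure (ℤ → A)) : Prop where
  prob : IsProbabilityMeasure μ
  inv : ∀ n : ℤ, MeasurePreserving (shift n) μ μ

variable {μ : Measure (ℤ → A)}

lemma Stat.of_one [IsProbabilityMeasure μ] (h : μ.map (shift 1) = μ) : Stat μ := by
  refine ⟨inferInstance, fun n => ⟨measurable_shift n, ?_⟩⟩
  have hneg : μ.map (shift (-1)) = μ := by
    conv_lhs => rw [← h]
    rw [Measure.map_map (measurable_shift _) (measurable_shift _)]
    have : shift (S := A) (-1) ∘ shift 1 = id := by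
      ext1 x; simp [shift_shift, shift_zero]
    rw [this, Measure.map_id]
  induction n using Int.induction_on with
  | zero =>
    have : shift (S := A) 0 = id := funext shift_zero
    rw [this, Measure.map_id]
  | succ n ih =>
    have : shift (S := A) (n + 1) = shift n ∘ shift 1 := by
      ext1 x; simp [shift_shift]
    rw [this, ← Measure.map_map (measurable_shift _) (measurable_shift _), h, ih]
  | pred n ih =>
    have : shift (S := A) (-n - 1) = shift (-n) ∘ shift (-1) := by
      ext1 x; simp [shift_shift, sub_eq_add_neg]
    rw [this, ← Measure.map_map (measurable_shift _) (measurable_shift _), hneg, ih]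

lemma Stat.integral_shift (hμ : Stat μ) (n : ℤ) {g : (ℤ → A) → ℝ} (hg : Measurable g) :
    ∫ x, g (shift n x) ∂μ = ∫ x, g x ∂μ := by
  have := integral_map (μ := μ) (measurable_shift n).aemeasurable hg.aestronglyMeasurable
  rw [(hμ.inv n).map_eq] at this
  exact this.symm

lemma Stat.prob_shift (hμ : Stat μ) (n : ℤ) {p : (ℤ → A) → Prop} (hp : MeasurableSet {x | p x}) :
    μ.real {x | p (shift n x)} = μ.real {x | p x} := by
  have := map_measureReal_apply (μ := μ) (measurable_shift n) hp
  rw [(hμ.inv n).map_eq] at this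
  exact this.symm

lemma Stat.dlaw_shift {β : Type*} [MeasurableSpace β] [MeasurableSingletonClass β] (hμ : Stat μ)
    (n : ℤ) {Z : (ℤ → A) → β} (hZ : Measurable Z) :
    dlaw μ (fun x => Z (shift n x)) = dlaw μ Z := by
  ext b
  exact hμ.prob_shift n (p := fun x => Z x = b) (hZ (measurableSet_singleton b))

/-- The law of words of length `n`. -/
def wl (μ : Measure (ℤ → A)) (n : ℕ) : (Fin n → A) → ℝ := dlaw μ (word 0 n)

lemma wl_nonneg (μ : Measure (ℤ → A)) (n : ℕ) (u : Fin n → A) : 0 ≤ wl μ n u :=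
  dlaw_nonneg _ _ _

lemma Stat.dlaw_word (hμ : Stat μ) (t : ℤ) (n : ℕ) : dlaw μ (word t n) = wl μ n := by
  have := hμ.dlaw_shift t (measurable_word (A := A) 0 n)
  simp only [word_shift, zero_add] at this
  exact this

lemma Stat.sum_wl (hμ : Stat μ) (n : ℕ) : ∑ u, wl μ n u = 1 :=
  have := hμ.prob
  sum_dlaw (measurable_word 0 n)

lemma wl_append (m n : ℕ) (u : Fin m → A) (v : Fin n → A) :
    wl μ (m + n) (Fin.append u v) = dlaw μ (fun x => (word 0 m x, word m n x)) (u, v) := by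
  have : word (A := A) 0 (m + n) ⁻¹' {Fin.append u v} =
      (fun x => (word 0 m x, word m n x)) ⁻¹' {(u, v)} := by
    ext x
    simp only [Set.mem_preimage, Set.mem_singleton_iff, word_append, zero_add]
    exact (Fin.appendEquiv m n).injective.eq_iff (a := (word 0 m x, word m n x)) (b := (u, v))
  rw [wl, dlaw, dlaw, this]

lemma Stat.sum_wl_right (hμ : Stat μ) (m n : ℕ) (u : Fin m → A) :
    ∑ v, wl μ (m + n) (Fin.append u v) = wl μ m u := by
  have := hμ.prob
  simp only [wl_append]
  exact dlaw_fst (measurable_word 0 m) (measurable_word m n) u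

lemma Stat.sum_wl_left (hμ : Stat μ) (m n : ℕ) (v : Fin n → A) :
    ∑ u, wl μ (m + n) (Fin.append u v) = wl μ n v := by
  have := hμ.prob
  simp only [wl_append]
  rw [dlaw_snd (measurable_word 0 m) (measurable_word m n) v, hμ.dlaw_word]

/-- Entropy of words of length `n`. -/
def went (μ : Measure (ℤ → A)) (n : ℕ) : ℝ := ent (wl μ n)

end Stationary

/-! ### The entropy rate of a stationary process -/

section Rate

variable {A : Type} [Fintype A] [Nonempty A] [MeasurableSpace A] [MeasurableSingletonClass A]
  {μ : Measure (ℤ → A)}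

lemma wl_append₃ (j m n : ℕ) (a : Fin j → A) (b : Fin m → A) (c : Fin n → A) :
    wl μ (j + m + n) (Fin.append (Fin.append a b) c) =
      dlaw μ (fun x => (word 0 j x, (word j m x, word ((j : ℤ) + m) n x))) (a, (b, c)) := by
  have : word (A := A) 0 (j + m + n) ⁻¹' {Fin.append (Fin.append a b) c} =
      (fun x => (word 0 j x, (word j m x, word ((j : ℤ) + m) n x))) ⁻¹' {(a, (b, c))} := by
    ext x
    have h1 := (Fin.appendEquiv (α := A) (j + m) n).injective.eq_iff
      (a := (word 0 (j + m) x, word ((j : ℤ) + m) n x)) (b := (Fin.append a b, c))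
    have h2 := (Fin.appendEquiv (α := A) j m).injective.eq_iff
      (a := (word 0 j x, word j m x)) (b := (a, b))
    simp only [Fin.appendEquiv, Equiv.coe_fn_mk, Prod.mk.injEq] at h1 h2
    have h3 := word_append 0 (j + m) n x
    push_cast [zero_add] at h3
    have h4 := word_append 0 j m x
    rw [zero_add] at h4
    simp only [Set.mem_preimage, Set.mem_singleton_iff, Prod.mk.injEq]
    rw [h3, h1, h4, h2, and_assoc]
  rw [wl, dlaw, dlaw, this]

lemma Stat.sum_wl_left₃ (hμ : Stat μ) (j m n : ℕ) (b : Fin m → A) (c : Fin n → A) :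
    ∑ a, wl μ (j + m + n) (Fin.append (Fin.append a b) c) = wl μ (m + n) (Fin.append b c) := by
  have := hμ.prob
  simp only [wl_append₃]
  have hm : Measurable fun x : ℤ → A => (word j m x, word ((j : ℤ) + m) n x) :=
    (measurable_word _ _).prodMk (measurable_word _ _)
  rw [dlaw_snd (measurable_word 0 j) hm, wl_append, ← hμ.dlaw_shift j
    ((measurable_word 0 m).prodMk (measurable_word m n))]
  simp only [word_shift, zero_add, add_comm (m : ℤ)]

lemma went_eq_sum (m n : ℕ) : went μ (m + n) =
    ∑ u : Fin m → A, ∑ v : Fin n → A, Real.negMulLog (wl μ (m + n) (Fin.append u v)) := by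
  rw [went, ent, sum_append]

/-- Conditional mutual information of the words at three consecutive places. -/
lemma Stat.cond_mutual (hμ : Stat μ) (j m n : ℕ) {I : ℝ}
    (hI : I = went μ (j + m) + went μ (m + n) - went μ m - went μ (j + m + n)) :
    0 ≤ I ∧ 1 - √I ≤ ∑ a : Fin j → A, ∑ b : Fin m → A, ∑ c : Fin n → A,
      min (wl μ (j + m + n) (Fin.append (Fin.append a b) c))
        (wl μ (j + m) (Fin.append a b) * wl μ (m + n) (Fin.append b c) / wl μ m b) := by
  have := ssa (P := fun (a : Fin j → A) (b : Fin m → A) (c : Fin n → A) =>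
    wl μ (j + m + n) (Fin.append (Fin.append a b) c)) (I := I) (fun _ _ _ => wl_nonneg _ _ _)
    (by
      have := hμ.sum_wl (j + m + n)
      rwa [sum_append, sum_append] at this)
    (by
      rw [hI]
      simp only [hμ.sum_wl_right, hμ.sum_wl_left₃, hμ.sum_wl_left]
      rw [went_eq_sum j m, went_eq_sum m n, went_eq_sum (j + m) n, sum_append]
      rfl)
  simpa only [hμ.sum_wl_right, hμ.sum_wl_left₃, hμ.sum_wl_left] using this

lemma Stat.went_nonneg (hμ : Stat μ) (n : ℕ) : 0 ≤ went μ n :=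
  ent_nonneg (wl_nonneg μ n) (hμ.sum_wl n)

lemma Stat.went_zero (hμ : Stat μ) : went μ 0 = 0 := by
  have := hμ.sum_wl 0
  simp only [Finset.univ_unique, Finset.sum_singleton] at this
  simp [went, ent, this]

lemma Stat.went_mono (hμ : Stat μ) (m n : ℕ) : went μ m ≤ went μ (m + n) := by
  have := hμ.prob
  have := ent_dlaw_comp_le (μ := μ) (measurable_word (A := A) 0 (m + n))
    fun u => fun i : Fin m => u (Fin.castAdd n i)
  exact this

/-- The entropy rate. -/
def hrate (μ : Measure (ℤ → A)) : ℝ := ⨅ n, (went μ (n + 1) - went μ n)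

lemma Stat.went_sub_antitone (hμ : Stat μ) (j m n : ℕ) :
    went μ (j + m + n) - went μ (j + m) ≤ went μ (m + n) - went μ m := by
  have := (hμ.cond_mutual j m n rfl).1
  linarith

lemma Stat.antitone_incr (hμ : Stat μ) : Antitone fun n => went μ (n + 1) - went μ n := by
  refine antitone_nat_of_succ_le fun n => ?_
  have := hμ.went_sub_antitone 1 n 1
  rwa [add_comm 1 n] at this

lemma Stat.bddBelow (hμ : Stat μ) : BddBelow (Set.range fun n => went μ (n + 1) - went μ n) :=
  ⟨0, by rintro _ ⟨n, rfl⟩; exact sub_nonneg.2 (hμ.went_mono n 1)⟩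

lemma Stat.tendsto_incr (hμ : Stat μ) :
    Tendsto (fun n => went μ (n + 1) - went μ n) atTop (nhds (hrate μ)) :=
  tendsto_atTop_ciInf hμ.antitone_incr hμ.bddBelow

lemma Stat.hrate_le (hμ : Stat μ) (n : ℕ) : hrate μ ≤ went μ (n + 1) - went μ n :=
  ciInf_le hμ.bddBelow n

lemma Stat.hrate_nonneg (hμ : Stat μ) : 0 ≤ hrate μ :=
  le_ciInf fun n => sub_nonneg.2 (hμ.went_mono n 1)

lemma Stat.mul_hrate_le (hμ : Stat μ) (m n : ℕ) : n * hrate μ ≤ went μ (m + n) - went μ m := by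
  induction n with
  | zero => simp
  | succ n ih =>
    have := hμ.hrate_le (m + n)
    rw [← add_assoc]
    push_cast
    linarith

lemma Stat.tendsto_incr_block (hμ : Stat μ) (n : ℕ) :
    Tendsto (fun m => went μ (m + n) - went μ m) atTop (nhds (n * hrate μ)) := by
  induction n with
  | zero => simp
  | succ n ih =>
    have h := (hμ.tendsto_incr.comp (tendsto_add_atTop_nat n)).add ih
    refine (h.congr fun m => ?_).trans_eq (by push_cast; congr 1; ring)
    simp only [Function.comp]
    rw [← add_assoc]; ring

lemma Stat.tendsto_went_div (hμ : Stat μ) :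
    Tendsto (fun n : ℕ => went μ n / n) atTop (nhds (hrate μ)) := by
  refine hμ.tendsto_incr.cesaro.congr fun n => ?_
  rw [Finset.sum_range_sub, hμ.went_zero, sub_zero, div_eq_inv_mul]

lemma Stat.le_hrate (hμ : Stat μ) {r C : ℝ} (h : ∀ n : ℕ, n * r ≤ went μ n + C) :
    r ≤ hrate μ := by
  have h0 : Tendsto (fun n : ℕ => went μ n / n + C / n) atTop (nhds (hrate μ + 0)) :=
    hμ.tendsto_went_div.add (tendsto_const_div_atTop_nhds_zero_nat C)
  rw [add_zero] at h0
  refine ge_of_tendsto h0 ((eventually_gt_atTop 0).mono fun n hn => ?_)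
  have : (0 : ℝ) < n := by exact_mod_cast hn
  rw [← add_div, le_div_iff₀ this]
  linarith [h n]

end Rate

/-! ### Processes with a state kernel: law of large numbers and equipartition -/

section KRep

variable {A : Type} [Fintype A] [Nonempty A] [MeasurableSpace A] [MeasurableSingletonClass A]

/-- A representation of a process by a state kernel. -/
structure KRep (μ : Measure (ℤ → A)) where
  σ : Type
  k : StateKernel σ A
  s₀ : σ
  law_eq : ∀ n u, k.law n s₀ u = wl μ n u

variable {μ : Measure (ℤ → A)}

lemma KRep.wl_pos (R : KRep μ) (n : ℕ) (u : Fin n → A) : 0 < wl μ n u := R.law_eq n u ▸ R.k.law_pos _ _ _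

lemma integrable_word [IsProbabilityMeasure μ] (t : ℤ) (n : ℕ) (g : (Fin n → A) → ℝ) :
    Integrable (fun x => g (word t n x)) μ :=
  integrable_dcomp (measurable_word t n) g

lemma Stat.integral_word (hμ : Stat μ) (t : ℤ) (n : ℕ) (g : (Fin n → A) → ℝ) :
    ∫ x, g (word t n x) ∂μ = ∑ u, wl μ n u * g u := by
  have := hμ.prob
  rw [integral_dcomp (measurable_word t n) g, hμ.dlaw_word]

lemma KRep.integral_pair (R : KRep μ) (hμ : Stat μ) (m j k₀ : ℕ) (g : (Fin m → A) → ℝ)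
    (h : (Fin k₀ → A) → ℝ) :
    ∫ x, g (word 0 m x) * h (word ((m : ℤ) + j) k₀ x) ∂μ =
      ∑ u, R.k.law m R.s₀ u * (g u * R.k.avg (R.k.look h) j (R.k.run m R.s₀ u)) := by
  have := hμ.integral_word 0 (m + j + k₀) fun z =>
    g (fun i => z (Fin.castAdd k₀ (Fin.castAdd j i))) * h (fun i => z (Fin.natAdd (m + j) i))
  have e : ∀ x : ℤ → A, (fun i => word 0 (m + j + k₀) x (Fin.natAdd (m + j) i)) =
      word ((m : ℤ) + j) k₀ x := fun x => by
    ext i; simp [word]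
  have e2 : ∀ x : ℤ → A, (fun i => word 0 (m + j + k₀) x (Fin.castAdd k₀ (Fin.castAdd j i))) =
      word 0 m x := fun x => by
    ext i; simp [word]
  simp only [e, e2] at this
  rw [this, sum_append, sum_append]
  refine Finset.sum_congr rfl fun u _ => ?_
  rw [StateKernel.avg, Finset.mul_sum, Finset.mul_sum]
  refine Finset.sum_congr rfl fun w _ => ?_
  rw [StateKernel.look, Finset.mul_sum, Finset.mul_sum, Finset.mul_sum]
  refine Finset.sum_congr rfl fun v _ => ?_
  rw [← R.law_eq, R.k.law_append, R.k.law_append, R.k.run_append]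
  simp only [Fin.append_left, Fin.append_right]
  ring

/-- Uniform decay of correlations. -/
lemma KRep.mixing (R : KRep μ) (hμ : Stat μ) {k₀ : ℕ} {h : (Fin k₀ → A) → ℝ} (h0 : ∀ v, 0 ≤ h v)
    (h1 : ∀ v, h v ≤ 1) {ε : ℝ} (hε : 0 < ε) : ∃ n₀ : ℕ, ∀ j : ℕ, n₀ ≤ j → ∀ (m : ℕ) (g : (Fin m → A) → ℝ),
      (∀ u, |g u| ≤ 1) →
      |∫ x, g (word 0 m x) * (h (word ((m : ℤ) + j) k₀ x) - ∑ v, wl μ k₀ v * h v) ∂μ| ≤ ε := by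
  have := hμ.prob
  obtain ⟨n₀, hn₀⟩ := R.k.loss_of_memory h0 h1 hε
  refine ⟨n₀, fun j hj m g hg => ?_⟩
  set M := ∑ v, wl μ k₀ v * h v with hM
  set a : (Fin m → A) → ℝ := fun u => R.k.avg (R.k.look h) j (R.k.run m R.s₀ u)
  have hlaw : ∀ u, 0 ≤ R.k.law m R.s₀ u := fun u => (R.k.law_pos _ _ _).le
  have eM : M = ∑ u, R.k.law m R.s₀ u * a u := by
    have := R.integral_pair hμ m j k₀ (fun _ => 1) h
    simp only [one_mul] at this
    rw [← this, hμ.integral_word]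
  have e : ∫ x, g (word 0 m x) * (h (word ((m : ℤ) + j) k₀ x) - M) ∂μ =
      ∑ u, R.k.law m R.s₀ u * (g u * (a u - M)) := by
    have h2 : ∀ v, h v - M = (fun v => h v - M) v := fun _ => rfl
    simp only [mul_sub]
    have i1 : Integrable (fun x => g (word 0 m x) * h (word ((m : ℤ) + j) k₀ x)) μ :=
      integrable_dcomp (Z := fun x => (word 0 m x, word ((m : ℤ) + j) k₀ x))
        ((measurable_word _ _).prodMk (measurable_word _ _)) fun p => g p.1 * h p.2
    rw [integral_sub i1 ((integrable_word 0 m g).mul_const M), R.integral_pair hμ,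
      integral_mul_const, hμ.integral_word, Finset.sum_sub_distrib]
    simp only [← R.law_eq, Finset.sum_mul]
    congr 1
    exact Finset.sum_congr rfl fun u _ => by ring
  have hsum : ∑ u, R.k.law m R.s₀ u = 1 := R.k.sum_law m R.s₀
  have ha : ∀ u, |a u - M| ≤ ε := by
    intro u
    have : a u - M = ∑ u', R.k.law m R.s₀ u' * (a u - a u') := by
      simp only [mul_sub, Finset.sum_sub_distrib, ← Finset.sum_mul, hsum, one_mul, eM]
    rw [this]
    refine (Finset.abs_sum_le_sum_abs _ _).trans ?_
    calc ∑ u', |R.k.law m R.s₀ u' * (a u - a u')| ≤ ∑ u', R.k.law m R.s₀ u' * ε := by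
          refine Finset.sum_le_sum fun u' _ => ?_
          rw [abs_mul, abs_of_nonneg (hlaw u')]
          refine mul_le_mul_of_nonneg_left (abs_le.2 ⟨?_, hn₀ j hj _ _⟩) (hlaw u')
          linarith [hn₀ j hj (R.k.run m R.s₀ u') (R.k.run m R.s₀ u)]
      _ = ε := by rw [← Finset.sum_mul, hsum, one_mul]
  rw [e]
  refine (Finset.abs_sum_le_sum_abs _ _).trans ?_
  calc ∑ u, |R.k.law m R.s₀ u * (g u * (a u - M))| ≤ ∑ u, R.k.law m R.s₀ u * ε := by
        refine Finset.sum_le_sum fun u _ => ?_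
        rw [abs_mul, abs_of_nonneg (hlaw u), abs_mul]
        refine mul_le_mul_of_nonneg_left ?_ (hlaw u)
        nlinarith [hg u, ha u, abs_nonneg (g u), abs_nonneg (a u - M)]
    _ = ε := by rw [← Finset.sum_mul, hsum, one_mul]

lemma KRep.second_moment (R : KRep μ) (hμ : Stat μ) {k₀ : ℕ} {h : (Fin k₀ → A) → ℝ} (h0 : ∀ v, 0 ≤ h v)
    (h1 : ∀ v, h v ≤ 1) {ε : ℝ} (hε : 0 < ε) : ∃ C : ℝ, ∀ N : ℕ,
      ∫ x, (∑ i ∈ Finset.range N, (h (word i k₀ x) - ∑ v, wl μ k₀ v * h v)) ^ 2 ∂μ ≤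
        ε * N ^ 2 + C * N := by
  have := hμ.prob
  obtain ⟨n₀, hn₀⟩ := R.mixing hμ h0 h1 hε
  set M := ∑ v, wl μ k₀ v * h v with hM
  have hM0 : 0 ≤ M := Finset.sum_nonneg fun v _ => mul_nonneg (wl_nonneg _ _ _) (h0 v)
  have hM1 : M ≤ 1 := by
    rw [← hμ.sum_wl k₀]
    exact Finset.sum_le_sum fun v _ => mul_le_of_le_one_right (wl_nonneg _ _ _) (h1 v)
  have hb : ∀ v, |h v - M| ≤ 1 := fun v => abs_le.2 ⟨by linarith [h0 v], by linarith [h1 v]⟩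
  set c : ℕ → ℕ → ℝ := fun i j => ∫ x, (h (word i k₀ x) - M) * (h (word j k₀ x) - M) ∂μ with hc
  have int2 : ∀ i j : ℕ, Integrable
      (fun x => (h (word i k₀ x) - M) * (h (word j k₀ x) - M)) μ := fun i j =>
    integrable_dcomp (Z := fun x => (word (i : ℤ) k₀ x, word (j : ℤ) k₀ x))
      ((measurable_word _ _).prodMk (measurable_word _ _)) fun p => (h p.1 - M) * (h p.2 - M)
  have c1 : ∀ i j, |c i j| ≤ 1 := fun i j => by
    have := norm_integral_le_of_norm_le_const (μ := μ) (C := 1)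
      (f := fun x => (h (word i k₀ x) - M) * (h (word j k₀ x) - M))
      (ae_of_all _ fun x => by
        rw [Real.norm_eq_abs, abs_mul]
        nlinarith [hb (word i k₀ x), hb (word j k₀ x), abs_nonneg (h (word i k₀ x) - M),
          abs_nonneg (h (word j k₀ x) - M)])
    simpa using this
  have csymm : ∀ i j, c i j = c j i := fun i j => by simp only [hc, mul_comm]
  have cfar : ∀ i j : ℕ, i + k₀ + n₀ ≤ j → |c i j| ≤ ε := by
    intro i j hij
    obtain ⟨d, rfl⟩ := Nat.exists_eq_add_of_le hij
    have := hn₀ (n₀ + d) (by omega) k₀ (fun u => h u - M) hb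
    have e : c i (i + k₀ + n₀ + d) = ∫ x, (h (word 0 k₀ x) - M) *
        (h (word ((k₀ : ℤ) + ((n₀ + d : ℕ) : ℤ)) k₀ x) - M) ∂μ := by
      have hm : Measurable fun x : ℤ → A => (h (word 0 k₀ x) - M) *
        (h (word ((k₀ : ℤ) + ((n₀ + d : ℕ) : ℤ)) k₀ x) - M) :=
        (((measurable_of_finite h).comp (measurable_word _ _)).sub_const M).mul
          (((measurable_of_finite h).comp (measurable_word _ _)).sub_const M)
      rw [← hμ.integral_shift (i : ℤ) hm]
      simp only [hc, word_shift]
      push_cast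
      congr 2; ext x; congr 4 <;> ring_nf
    rw [e]; exact this
  have cle : ∀ i j : ℕ, c i j ≤ ε + if j ∈ Finset.Ico (i + 1 - (k₀ + n₀)) (i + (k₀ + n₀)) then 1
      else 0 := by
    intro i j
    split_ifs with hij
    · linarith [le_abs_self (c i j), c1 i j]
    · rw [add_zero]
      rw [Finset.mem_Ico, not_and_or, not_le, not_lt] at hij
      rcases hij with hij | hij
      · rw [csymm]; exact (le_abs_self _).trans (cfar j i (by omega))
      · exact (le_abs_self _).trans (cfar i j (by omega))
  refine ⟨2 * (k₀ + n₀), fun N => ?_⟩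
  simp only [sq, Finset.sum_mul_sum]
  rw [integral_finsetSum _ fun i _ => integrable_finsetSum _ fun j _ => int2 i j]
  simp_rw [integral_finsetSum (Finset.range N) fun j _ => int2 _ j]
  calc ∑ i ∈ Finset.range N, ∑ j ∈ Finset.range N, c i j
      ≤ ∑ i ∈ Finset.range N, (ε * N + 2 * (k₀ + n₀)) := by
        refine Finset.sum_le_sum fun i _ => ?_
        refine (Finset.sum_le_sum fun j _ => cle i j).trans ?_
        rw [Finset.sum_add_distrib, Finset.sum_const, Finset.card_range, nsmul_eq_mul,
          mul_comm ε, Finset.sum_ite_mem, Finset.sum_const, nsmul_eq_mul, mul_one]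
        gcongr
        calc ((Finset.range N ∩ Finset.Ico (i + 1 - (k₀ + n₀)) (i + (k₀ + n₀))).card : ℝ)
            ≤ ((Finset.Ico (i + 1 - (k₀ + n₀)) (i + (k₀ + n₀))).card : ℝ) := by
              exact_mod_cast Finset.card_le_card Finset.inter_subset_right
          _ ≤ ((2 * (k₀ + n₀) : ℕ) : ℝ) := by
              rw [Nat.card_Ico]; exact_mod_cast (by omega)
          _ = _ := by push_cast; ring
    _ = _ := by
        rw [Finset.sum_const, Finset.card_range, nsmul_eq_mul]; ring

/-- The weak law of large numbers. -/
theorem KRep.lln (R : KRep μ) (hμ : Stat μ) {k₀ : ℕ} (h : (Fin k₀ → A) → ℝ) {δ ε : ℝ} (hδ : 0 < δ)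
    (hε : 0 < ε) : ∃ N₀ : ℕ, ∀ N ≥ N₀, μ.real {x | δ * N ≤
      |∑ i ∈ Finset.range N, (h (word i k₀ x) - ∑ v, wl μ k₀ v * h v)|} ≤ ε := by
  have := hμ.prob
  obtain ⟨B, hB⟩ : ∃ B : ℝ, ∀ v, |h v| ≤ B :=
    ⟨∑ v, |h v|, fun v => Finset.single_le_sum (f := fun v => |h v|) (fun _ _ => abs_nonneg _)
      (Finset.mem_univ v)⟩
  set D : ℝ := 2 * B + 1 with hD
  have hB0 : 0 ≤ B := (abs_nonneg _).trans (hB fun _ => Classical.arbitrary A)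
  have hD0 : 0 < D := by positivity
  set h' : (Fin k₀ → A) → ℝ := fun v => (h v + B) / D with hh'
  have h'0 : ∀ v, 0 ≤ h' v := fun v => div_nonneg (by linarith [(abs_le.1 (hB v)).1]) hD0.le
  have h'1 : ∀ v, h' v ≤ 1 := fun v =>
    (div_le_one hD0).2 (by linarith [(abs_le.1 (hB v)).2])
  have hrel : ∀ v, h' v - ∑ v, wl μ k₀ v * h' v = (h v - ∑ v, wl μ k₀ v * h v) / D := by
    intro v
    have : ∑ v, wl μ k₀ v * h' v = (∑ v, wl μ k₀ v * h v + B) / D := by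
      simp only [hh', mul_div_assoc', ← Finset.sum_div, mul_add, Finset.sum_add_distrib,
        ← Finset.sum_mul, hμ.sum_wl, one_mul]
    rw [this]; simp only [hh']; ring
  obtain ⟨C, hC⟩ := R.second_moment hμ h'0 h'1 (ε := ε * (δ / D) ^ 2 / 2) (by positivity)
  obtain ⟨N₀, hN₀⟩ := exists_nat_gt (C * 2 / (ε * (δ / D) ^ 2))
  refine ⟨N₀ + 1, fun N hN => ?_⟩
  have hNpos : (0 : ℝ) < N := by exact_mod_cast (by omega : 0 < N)
  have hNN : C * 2 / (ε * (δ / D) ^ 2) ≤ N := hN₀.le.trans (by exact_mod_cast (by omega))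
  have h_int : Integrable (fun x => (∑ i ∈ Finset.range N,
      (h' (word i k₀ x) - ∑ v, wl μ k₀ v * h' v)) ^ 2) μ := by
    have hm : Measurable fun x : ℤ → A => fun i : Fin N => word (i : ℤ) k₀ x :=
      measurable_pi_lambda _ fun i => measurable_word _ _
    have := integrable_dcomp (μ := μ) hm fun p => (∑ i : Fin N,
      (h' (p i) - ∑ v, wl μ k₀ v * h' v)) ^ 2
    simpa only [Finset.sum_range] using this
  have cheb := mul_meas_ge_le_integral_of_nonneg (μ := μ)
    (ae_of_all _ fun x => sq_nonneg _) h_int ((δ / D * N) ^ 2)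
  have hset : {x | δ * N ≤ |∑ i ∈ Finset.range N, (h (word i k₀ x) - ∑ v, wl μ k₀ v * h v)|} ⊆
      {x | (δ / D * N) ^ 2 ≤ (∑ i ∈ Finset.range N,
        (h' (word i k₀ x) - ∑ v, wl μ k₀ v * h' v)) ^ 2} := by
    intro x hx
    change δ * N ≤ _ at hx
    change (δ / D * N) ^ 2 ≤ _
    simp only [hrel, ← Finset.sum_div]
    rw [← sq_abs (_ / D), abs_div, abs_of_pos hD0]
    refine pow_le_pow_left₀ (by positivity) ?_ 2
    rw [div_mul_eq_mul_div]
    exact div_le_div_of_nonneg_right hx hD0.le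
  refine (measureReal_mono hset).trans ?_
  have h2 := cheb.trans (hC N)
  rw [div_le_iff₀ (by positivity)] at hNN
  have hp : 0 < (δ / D * N) ^ 2 := by positivity
  refine le_of_mul_le_mul_left (h2.trans ?_) hp
  nlinarith

end KRep

section AEP

variable {A : Type} [Fintype A] [Nonempty A] [MeasurableSpace A] [MeasurableSingletonClass A]

lemma StateKernel.exists_ω_le {σ : Type} (k : StateKernel σ A) {ε : ℝ} (hε : 0 < ε) :
    ∃ L, k.ω L ≤ ε := by
  obtain ⟨n, hn⟩ := (k.dyadic.eventually_lt_const (pow_pos hε 2)).exists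
  refine ⟨2 ^ n, ?_⟩
  have : k.ω (2 ^ n) ^ 2 ≤ _ := Finset.single_le_sum (f := fun i => k.ω i ^ 2)
    (fun i _ => sq_nonneg _) (Finset.mem_Icc.2 ⟨le_rfl, Nat.pow_le_pow_right (by norm_num)
      (Nat.le_succ n)⟩)
  exact (sq_le_sq₀ (k.ω_nonneg _) hε.le).1 (this.trans hn.le)

variable {μ : Measure (ℤ → A)}

/-- The finite window approximation of the information function. -/
def KRep.info (R : KRep μ) (L : ℕ) (v : Fin (L + 1) → A) : ℝ :=
  -Real.log (R.k.κ (R.k.run L R.s₀ fun i => v i.castSucc) (v (Fin.last L)))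

lemma KRep.wl_word (R : KRep μ) (N : ℕ) (x : ℤ → A) :
    wl μ N (word 0 N x) = R.k.lw R.s₀ (fun i : ℕ => x i) N := by
  rw [← R.law_eq]
  refine R.k.lw_congr _ fun i hi => ?_
  rw [wext_lt _ hi, word]; simp

lemma KRep.info_word (R : KRep μ) (L t : ℕ) (x : ℤ → A) : R.info L (word t (L + 1) x) =
    -Real.log (R.k.κ (R.k.st R.s₀ (fun i : ℕ => x (t + i : ℕ)) L) (x (t + L : ℕ))) := by
  have : R.k.run L R.s₀ (fun i => word t (L + 1) x i.castSucc) =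
      R.k.st R.s₀ (fun i : ℕ => x (t + i : ℕ)) L := by
    refine R.k.st_congr _ fun i hi => ?_
    rw [wext_lt _ hi, word]; simp
  rw [info, this]
  simp [word]

lemma KRep.abs_info_sub_le (R : KRep μ) (L N : ℕ) (x : ℤ → A) :
    |-Real.log (wl μ (N + L) (word 0 (N + L) x)) -
      ∑ t ∈ Finset.range N, R.info L (word t (L + 1) x)| ≤
      N * R.k.ω L + L * -Real.log R.k.c := by
  set y : ℕ → A := fun i => x i
  have hlog : ∀ s a, 0 ≤ -Real.log (R.k.κ s a) ∧ -Real.log (R.k.κ s a) ≤ -Real.log R.k.c :=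
    fun s a => ⟨neg_nonneg.2 (Real.log_nonpos (R.k.κ_pos _ _).le (R.k.κ_le_one _ _)),
      neg_le_neg (Real.log_le_log R.k.c_pos (R.k.c_le _ _))⟩
  have e : -Real.log (wl μ (N + L) (word 0 (N + L) x)) =
      ∑ i ∈ Finset.range L, -Real.log (R.k.κ (R.k.st R.s₀ y i) (y i)) +
      ∑ t ∈ Finset.range N, -Real.log (R.k.κ (R.k.st R.s₀ y (t + L)) (y (t + L))) := by
    rw [R.wl_word, StateKernel.lw, Real.log_prod fun i _ => (R.k.κ_pos _ _).ne', add_comm N L,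
      Finset.sum_range_add, neg_add, Finset.sum_neg_distrib, Finset.sum_neg_distrib]
    congr 2
    exact Finset.sum_congr rfl fun i _ => by rw [add_comm L i]
  have hstep : ∀ t : ℕ, |-Real.log (R.k.κ (R.k.st R.s₀ y (t + L)) (y (t + L))) -
      R.info L (word t (L + 1) x)| ≤ R.k.ω L := by
    intro t
    rw [R.info_word]
    have hag : ∀ (n : ℕ) s s' (z : ℕ → A), R.k.Ag n (R.k.st s z n) (R.k.st s' z n) := by
      intro n s s' z
      induction n with
      | zero => exact R.k.ag_zero _ _
      | succ n ih => exact R.k.ag_step _ _ _ _ ih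
    have h := hag L (R.k.st R.s₀ y t) R.s₀ (fun i => y (t + i))
    rw [← R.k.st_add] at h
    have key : ∀ s s' a, R.k.Ag L s s' →
        Real.log (R.k.κ s a) - Real.log (R.k.κ s' a) ≤ R.k.ω L := by
      intro s s' a hs
      have := Real.log_le_log (R.k.κ_pos s a) (R.k.ratio L s s' a hs)
      rw [Real.log_mul (Real.exp_pos _).ne' (R.k.κ_pos _ _).ne', Real.log_exp] at this
      linarith
    rw [abs_le]
    have h1 := key _ _ (y (t + L)) h
    have h2 := key _ _ (y (t + L)) (R.k.ag_symm _ _ _ h)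
    constructor
    · linarith
    · linarith
  rw [e, add_sub_assoc, ← Finset.sum_sub_distrib, add_comm]
  refine (abs_add_le _ _).trans (add_le_add ?_ ?_)
  · refine (Finset.abs_sum_le_sum_abs _ _).trans ((Finset.sum_le_sum fun t _ => hstep t).trans ?_)
    simp
  · refine (Finset.abs_sum_le_sum_abs _ _).trans ((Finset.sum_le_sum (g := fun _ => -Real.log R.k.c)
      fun i _ => ?_).trans ?_)
    · rw [abs_of_nonneg (hlog _ _).1]; exact (hlog _ _).2
    · simp

lemma KRep.abs_hrate_sub_le (R : KRep μ) (hμ : Stat μ) (L : ℕ) :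
    |hrate μ - ∑ v, wl μ (L + 1) v * R.info L v| ≤ R.k.ω L := by
  have := hμ.prob
  set m := ∑ v, wl μ (L + 1) v * R.info L v
  set C := L * -Real.log R.k.c
  have h_int : ∀ N : ℕ, |went μ (N + L) - N * m| ≤ N * R.k.ω L + C := by
    intro N
    have e : went μ (N + L) - N * m = ∫ x, (-Real.log (wl μ (N + L) (word 0 (N + L) x)) -
      ∑ t ∈ Finset.range N, R.info L (word t (L + 1) x)) ∂μ := by
      rw [integral_sub (integrable_word 0 (N + L) fun u => -Real.log (wl μ (N + L) u))
        (integrable_finsetSum _ fun t _ => integrable_word _ _ _),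
        integral_finsetSum _ fun t _ => integrable_word _ _ _,
        hμ.integral_word 0 (N + L) fun u => -Real.log (wl μ (N + L) u)]
      simp only [hμ.integral_word, Finset.sum_const, Finset.card_range, nsmul_eq_mul]
      congr 1
      rw [went, ent]
      exact Finset.sum_congr rfl fun u _ => by rw [Real.negMulLog]; ring
    rw [e]
    have := norm_integral_le_of_norm_le_const (μ := μ)
      (f := fun x => -Real.log (wl μ (N + L) (word 0 (N + L) x)) -
        ∑ t ∈ Finset.range N, R.info L (word t (L + 1) x))
      (ae_of_all _ fun x => R.abs_info_sub_le L N x)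
    rwa [probReal_univ, mul_one, Real.norm_eq_abs] at this
  have hlim := hμ.tendsto_went_div
  have h2 : Tendsto (fun N : ℕ => went μ (N + L) / N) atTop (nhds (hrate μ)) := by
    have h3 := (tendsto_add_atTop_iff_nat L).2 hlim
    have h4 : Tendsto (fun N : ℕ => ((N + L : ℕ) : ℝ) / N) atTop (nhds 1) := by
      have : Tendsto (fun N : ℕ => 1 + (L : ℝ) / N) atTop (nhds (1 + 0)) :=
        tendsto_const_nhds.add (tendsto_const_div_atTop_nhds_zero_nat _)
      rw [add_zero] at this
      refine this.congr' ?_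
      filter_upwards [eventually_gt_atTop 0] with N hN
      have : (N : ℝ) ≠ 0 := by positivity
      push_cast; field_simp
    have := h3.mul h4
    rw [mul_one] at this
    refine this.congr' ?_
    filter_upwards [eventually_gt_atTop 0] with N hN
    have : (N : ℝ) ≠ 0 := by positivity
    have : ((N + L : ℕ) : ℝ) ≠ 0 := by positivity
    field_simp
  have h5 : Tendsto (fun N : ℕ => |went μ (N + L) / N - m|) atTop (nhds |hrate μ - m|) :=
    (h2.sub_const m).abs
  have h6 : Tendsto (fun N : ℕ => R.k.ω L + C / N) atTop (nhds (R.k.ω L + 0)) :=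
    tendsto_const_nhds.add (tendsto_const_div_atTop_nhds_zero_nat _)
  rw [add_zero] at h6
  refine le_of_tendsto_of_tendsto h5 h6 ?_
  filter_upwards [eventually_gt_atTop 0] with N hN
  have hN' : (0 : ℝ) < N := by exact_mod_cast hN
  have e : went μ (N + L) / N - m = (went μ (N + L) - N * m) / N := by field_simp
  rw [e, abs_div, abs_of_pos hN', div_le_iff₀ hN']
  refine (h_int N).trans_eq ?_
  field_simp

/-- Asymptotic equipartition. -/
theorem KRep.aep (R : KRep μ) (hμ : Stat μ) {γ ε : ℝ} (hγ : 0 < γ) (hε : 0 < ε) :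
    ∃ N₀ : ℕ, ∀ N ≥ N₀, μ.real {x | γ * N ≤
      |-Real.log (wl μ N (word 0 N x)) - N * hrate μ|} ≤ ε := by
  have := hμ.prob
  obtain ⟨L, hL⟩ := R.k.exists_ω_le (ε := γ / 8) (by positivity)
  obtain ⟨N₀, hN₀⟩ := R.lln hμ (R.info L) (δ := γ / 8) (by positivity) hε
  set C := L * -Real.log R.k.c + L * |hrate μ|
  obtain ⟨N₁, hN₁⟩ := exists_nat_gt (C / (γ / 8))
  refine ⟨N₀ + N₁ + L + 1, fun M hM => ?_⟩
  obtain ⟨N, rfl⟩ : ∃ N, M = N + L := ⟨M - L, by omega⟩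
  refine le_trans (measureReal_mono fun x hx => ?_) (hN₀ N (by omega))
  change γ * ((N + L : ℕ) : ℝ) ≤ _ at hx
  change γ / 8 * N ≤ _
  have h1 := R.abs_info_sub_le L N x
  have h2 := R.abs_hrate_sub_le hμ L
  rw [Finset.sum_sub_distrib, Finset.sum_const, Finset.card_range, nsmul_eq_mul]
  have h3 : C ≤ γ / 8 * N := by
    rw [div_lt_iff₀ (by positivity)] at hN₁
    have : (N₁ : ℝ) ≤ N := by exact_mod_cast (by omega)
    nlinarith
  set I := -Real.log (wl μ (N + L) (word 0 (N + L) x))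
  set T := ∑ t ∈ Finset.range N, R.info L (word t (L + 1) x)
  set m := ∑ v, wl μ (L + 1) v * R.info L v
  have tri : |I - ((N + L : ℕ) : ℝ) * hrate μ| ≤ |I - T| + |T - N * m| + N * |hrate μ - m| +
      L * |hrate μ| := by
    have e : I - ((N + L : ℕ) : ℝ) * hrate μ =
      ((I - T) + (T - N * m)) + N * (m - hrate μ) + L * (-hrate μ) := by push_cast; ring
    rw [e]
    refine (abs_add_le _ _).trans (add_le_add ((abs_add_le _ _).trans (add_le_add (abs_add_le _ _)
      ?_)) ?_)
    · rw [abs_mul, abs_sub_comm, Nat.abs_cast]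
    · rw [abs_mul, abs_neg, Nat.abs_cast]
  have h4 : (N : ℝ) * |hrate μ - m| ≤ N * (γ / 8) := by gcongr; exact h2.trans hL
  have h5 : (N : ℝ) * R.k.ω L ≤ N * (γ / 8) := by gcongr
  have h6 : (0 : ℝ) ≤ γ * L := by positivity
  have h7 : (0 : ℝ) ≤ γ * N := by positivity
  push_cast at hx tri
  have h8 : C = L * -Real.log R.k.c + L * |hrate μ| := rfl
  linarith

end AEP

/-! ### Finitely determined processes -/

section FD

lemma Cpl.add_left {α β : Type*} [Fintype α] [Fintype β] {p : α → ℝ} {q : β → ℝ}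
    {c : α → β → ℝ} {t : ℝ} (h : Cpl p q c t) (s : α → ℝ) :
    Cpl p q (fun a b => c a b + s a) (t + ∑ a, p a * s a) := by
  obtain ⟨w, h0, h1, h2, h3⟩ := h
  refine ⟨w, h0, h1, h2, ?_⟩
  simp only [mul_add, Finset.sum_add_distrib, ← Finset.sum_mul, h1]
  linarith

variable {A : Type} [Fintype A] [Nonempty A] [MeasurableSpace A] [MeasurableSingletonClass A]

variable {μ ν : Measure (ℤ → A)}

/-- The conditional law of the next `n` letters given the first `N` ones. -/
def cnd (μ : Measure (ℤ → A)) (N n : ℕ) (u : Fin N → A) (v : Fin n → A) : ℝ :=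
  if wl μ N u = 0 then wl μ n v else wl μ (N + n) (Fin.append u v) / wl μ N u

lemma cnd_nonneg (N n : ℕ) (u : Fin N → A) (v : Fin n → A) : 0 ≤ cnd μ N n u v := by
  unfold cnd
  split_ifs
  · exact wl_nonneg _ _ _
  · exact div_nonneg (wl_nonneg _ _ _) (wl_nonneg _ _ _)

lemma Stat.sum_cnd (hμ : Stat μ) (N n : ℕ) (u : Fin N → A) : ∑ v, cnd μ N n u v = 1 := by
  unfold cnd
  split_ifs with h
  · exact hμ.sum_wl n
  · rw [← Finset.sum_div, hμ.sum_wl_right, div_self h]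

lemma Stat.wl_append_le (hμ : Stat μ) (N n : ℕ) (u : Fin N → A) (v : Fin n → A) :
    wl μ (N + n) (Fin.append u v) ≤ wl μ N u := by
  rw [← hμ.sum_wl_right N n u]
  exact Finset.single_le_sum (f := fun v => wl μ (N + n) (Fin.append u v))
    (fun _ _ => wl_nonneg _ _ _) (Finset.mem_univ v)

lemma Stat.wl_mul_cnd (hμ : Stat μ) (N n : ℕ) (u : Fin N → A) (v : Fin n → A) :
    wl μ N u * cnd μ N n u v = wl μ (N + n) (Fin.append u v) := by
  unfold cnd
  split_ifs with h
  · rw [h, zero_mul]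
    exact le_antisymm (wl_nonneg _ _ _) (h ▸ hμ.wl_append_le N n u v)
  · field_simp

variable [DecidableEq A]

lemma Cpl.extend (hμ : Stat μ) (hν : Stat ν) {N n : ℕ} {t : ℝ}
    (h : Cpl (wl ν N) (wl μ N) ham t) {s : (Fin N → A) → ℝ}
    (hs : ∀ u u', Cpl (cnd ν N n u) (cnd μ N n u') ham (s u)) :
    Cpl (wl ν (N + n)) (wl μ (N + n)) ham (t + ∑ u, wl ν N u * s u) := by
  have h1 := Cpl.seq (h.add_left s) (hν.sum_cnd N n) hs
  have h2 := h1.reindex (Fin.appendEquiv N n).symm (Fin.appendEquiv N n).symm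
  have e : ∀ {m : Measure (ℤ → A)}, Stat m → (fun x => (fun p : (Fin N → A) × (Fin n → A) =>
      wl m N p.1 * cnd m N n p.1 p.2) ((Fin.appendEquiv N n).symm x)) = wl m (N + n) := by
    intro m hm
    ext x
    obtain ⟨⟨u, v⟩, rfl⟩ := (Fin.appendEquiv N n).surjective x
    simp only [Equiv.symm_apply_apply, hm.wl_mul_cnd]
    rfl
  rw [e hν, e hμ] at h2
  refine h2.cost_mono fun x y => ?_
  obtain ⟨⟨u, v⟩, rfl⟩ := (Fin.appendEquiv N n).surjective x
  obtain ⟨⟨u', v'⟩, rfl⟩ := (Fin.appendEquiv N n).surjective y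
  simp only [Equiv.symm_apply_apply]
  exact (ham_append u u' v v').le

lemma Cpl.extend_crude (hμ : Stat μ) (hν : Stat ν) {N : ℕ} (n : ℕ) {t : ℝ}
    (h : Cpl (wl ν N) (wl μ N) ham t) : Cpl (wl ν (N + n)) (wl μ (N + n)) ham (t + n) := by
  have := Cpl.extend hμ hν (n := n) h (s := fun _ => (n : ℝ)) fun u u' =>
    Cpl.of_prod (cnd_nonneg _ _ _) (cnd_nonneg _ _ _) (hν.sum_cnd _ _ _) (hμ.sum_cnd _ _ _) ham_le
  rwa [← Finset.sum_mul, hν.sum_wl, one_mul] at this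

lemma KRep.cnd_eq (R : KRep μ) (N n : ℕ) (u : Fin N → A) :
    cnd μ N n u = R.k.law n (R.k.run N R.s₀ u) := by
  ext v
  rw [cnd, if_neg (R.wl_pos N u).ne', ← R.law_eq, ← R.law_eq, R.k.law_append]
  exact mul_div_cancel_left₀ _ (R.k.law_pos _ _ _).ne'

/-- The mean overlap of the conditional laws of two processes, given a far past for the first and
a near past for the second. -/
lemma mean_overlap (hν : Stat ν) (hμ : Stat μ) (j m n : ℕ) {η : ℝ}
    (hη : ∑ u, |wl ν (m + n) u - wl μ (m + n) u| ≤ η) {I : ℝ}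
    (hI : went ν (j + m) + went ν (m + n) - went ν m - went ν (j + m + n) ≤ I) :
    1 - √I - 2 * η ≤ ∑ a : Fin j → A, ∑ b : Fin m → A, wl ν (j + m) (Fin.append a b) *
      ∑ c, min (cnd ν (j + m) n (Fin.append a b) c) (cnd μ m n b c) := by
  have h1 := (hν.cond_mutual j m n rfl).2
  have h2 := Real.sqrt_le_sqrt hI
  have hm : ∑ b, |wl ν m b - wl μ m b| ≤ η := by
    refine le_trans ?_ hη
    rw [sum_append]
    refine Finset.sum_le_sum fun b _ => ?_
    rw [← hν.sum_wl_right m n b, ← hμ.sum_wl_right m n b, ← Finset.sum_sub_distrib]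
    exact Finset.abs_sum_le_sum_abs _ _
  have key : ∀ a b c, min (wl ν (j + m + n) (Fin.append (Fin.append a b) c))
        (wl ν (j + m) (Fin.append a b) * wl ν (m + n) (Fin.append b c) / wl ν m b) ≤
      wl ν (j + m) (Fin.append a b) *
        min (cnd ν (j + m) n (Fin.append a b) c) (cnd μ m n b c) +
      wl ν (j + m) (Fin.append a b) * |cnd ν m n b c - cnd μ m n b c| := by
    intro a b c
    have w0 := wl_nonneg ν (j + m) (Fin.append a b)
    rw [mul_min_of_nonneg _ _ w0, hν.wl_mul_cnd]
    by_cases h : wl ν m b = 0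
    · rw [h, div_zero]
      refine (min_le_right _ _).trans (add_nonneg (le_min (wl_nonneg _ _ _)
        (mul_nonneg w0 (cnd_nonneg _ _ _ _))) (mul_nonneg w0 (abs_nonneg _)))
    · have e : wl ν (j + m) (Fin.append a b) * wl ν (m + n) (Fin.append b c) / wl ν m b =
        wl ν (j + m) (Fin.append a b) * cnd ν m n b c := by
        rw [cnd, if_neg h, mul_div_assoc]
      rw [e, ← min_add_add_right]
      refine min_le_min ?_ ?_
      · exact le_add_of_nonneg_right (mul_nonneg w0 (abs_nonneg _))
      · rw [← mul_add]
        refine mul_le_mul_of_nonneg_left ?_ w0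
        linarith [le_abs_self (cnd ν m n b c - cnd μ m n b c)]
  have h3 : ∑ a : Fin j → A, ∑ b : Fin m → A, ∑ c, wl ν (j + m) (Fin.append a b) *
      |cnd ν m n b c - cnd μ m n b c| ≤ 2 * η := by
    calc _ = ∑ b : Fin m → A, ∑ c, wl ν m b * |cnd ν m n b c - cnd μ m n b c| := by
          rw [Finset.sum_comm]
          refine Finset.sum_congr rfl fun b _ => ?_
          simp only [← Finset.mul_sum, ← Finset.sum_mul, hν.sum_wl_left]
      _ ≤ ∑ b : Fin m → A, ∑ c, (|wl ν (m + n) (Fin.append b c) - wl μ (m + n) (Fin.append b c)| +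
          |wl ν m b - wl μ m b| * cnd μ m n b c) := by
          refine Finset.sum_le_sum fun b _ => Finset.sum_le_sum fun c _ => ?_
          rw [← abs_of_nonneg (wl_nonneg ν m b), ← abs_mul, mul_sub, hν.wl_mul_cnd,
            abs_of_nonneg (wl_nonneg ν m b), ← hμ.wl_mul_cnd]
          rw [← abs_of_nonneg (cnd_nonneg m n b c : 0 ≤ cnd μ m n b c), ← abs_mul,
            abs_of_nonneg (cnd_nonneg m n b c : 0 ≤ cnd μ m n b c)]
          rw [← abs_neg ((wl ν m b - wl μ m b) * _)]
          refine le_of_eq_of_le ?_ (abs_add_le _ _)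
          congr 1; ring
      _ ≤ 2 * η := by
          simp only [Finset.sum_add_distrib, ← Finset.mul_sum, hμ.sum_cnd, mul_one]
          rw [← sum_append (F := fun z => |wl ν (m + n) z - wl μ (m + n) z|)]
          linarith
  have h4 := Finset.sum_le_sum fun a (_ : a ∈ Finset.univ) => Finset.sum_le_sum
    fun b (_ : b ∈ Finset.univ) => Finset.sum_le_sum fun c (_ : c ∈ Finset.univ) => key a b c
  simp only [Finset.sum_add_distrib, ← Finset.mul_sum] at h4 h3
  linarith

/-- A process with a state kernel is finitely determined. -/
theorem KRep.finitely_determined (R : KRep μ) (hμ : Stat μ) {e : ℝ} (he : 0 < e) :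
    ∃ (w : ℕ) (η : ℝ), 0 < η ∧ ∀ ν : Measure (ℤ → A), Stat ν →
      ∑ u, |wl ν w u - wl μ w u| ≤ η → hrate μ - η ≤ hrate ν →
      ∃ C : ℝ, ∀ N : ℕ, Cpl (wl ν N) (wl μ N) ham (e * N + C) := by
  obtain ⟨K, K0, hK⟩ := R.k.veryWeakBernoulli (ε := e / 4) (by positivity)
  obtain ⟨n, hn⟩ := exists_nat_gt (K / (e / 4))
  have hnpos : (0 : ℝ) < n := lt_of_le_of_lt (by positivity) hn
  rw [div_lt_iff₀ (by positivity)] at hn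
  set γ := (e / 4) ^ 2 / 6 with hγ
  have γpos : 0 < γ := by positivity
  obtain ⟨m, hm⟩ := ((hμ.tendsto_incr_block n).eventually_lt_const
    (lt_add_of_pos_right _ γpos)).exists
  obtain ⟨η₁, hη₁, H₁⟩ := ent_continuous (α := Fin m → A) γ γpos
  obtain ⟨η₂, hη₂, H₂⟩ := ent_continuous (α := Fin (m + n) → A) γ γpos
  obtain ⟨η, η0, le1, le2, le3, le4⟩ : ∃ η > 0, η ≤ η₁ ∧ η ≤ η₂ ∧ η ≤ e / 8 ∧
      n * η ≤ (e / 4) ^ 2 / 2 := by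
    refine ⟨min (min η₁ η₂) (min (e / 8) ((e / 4) ^ 2 / 2 / n)), by positivity,
      (min_le_left _ _).trans (min_le_left _ _), (min_le_left _ _).trans (min_le_right _ _),
      (min_le_right _ _).trans (min_le_left _ _), ?_⟩
    rw [mul_comm, ← le_div_iff₀ hnpos]
    exact (min_le_right _ _).trans (min_le_right _ _)
  refine ⟨m + n, η, η0, fun ν hν hw hh => ⟨m + n, ?_⟩⟩
  have hwm : ∑ b, |wl ν m b - wl μ m b| ≤ η := by
    refine le_trans ?_ hw
    rw [sum_append]
    refine Finset.sum_le_sum fun b _ => ?_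
    rw [← hν.sum_wl_right m n b, ← hμ.sum_wl_right m n b, ← Finset.sum_sub_distrib]
    exact Finset.abs_sum_le_sum_abs _ _
  have hH₁ : -γ ≤ went ν m - went μ m := (abs_le.1 (H₁ _ _ (wl_nonneg ν m) (wl_nonneg μ m) (hν.sum_wl m) (hμ.sum_wl m)
    (hwm.trans le1))).1
  have hH₂ : went ν (m + n) - went μ (m + n) ≤ γ := (abs_le.1 (H₂ _ _ (wl_nonneg ν (m + n)) (wl_nonneg μ (m + n)) (hν.sum_wl _)
    (hμ.sum_wl _) (hw.trans le2))).2
  have block : ∀ j t, Cpl (wl ν (j + m)) (wl μ (j + m)) ham t →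
      Cpl (wl ν (j + m + n)) (wl μ (j + m + n)) ham (t + e * n) := by
    intro j t h
    set O : (Fin (j + m) → A) → ℝ := fun u => ∑ c, min (cnd ν (j + m) n u c)
      (cnd μ m n (fun i => u (Fin.natAdd j i)) c)
    have hs : ∀ u u', Cpl (cnd ν (j + m) n u) (cnd μ (j + m) n u') ham
        (n * (1 - O u) + (e / 4 * n + K)) := by
      intro u u'
      have c1 := Cpl.maximal (δ := 1 - O u) (C₀ := 0) (C₁ := (n : ℝ)) (c := ham)
        (cnd_nonneg (μ := ν) (j + m) n u) (cnd_nonneg (μ := μ) m n fun i => u (Fin.natAdd j i))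
        (hν.sum_cnd _ _ _) (hμ.sum_cnd _ _ _) (by rw [sub_sub_cancel]) hnpos.le
        (fun a => (ham_self a).le) ham_le
      have c2 := hK n (R.k.run m R.s₀ fun i => u (Fin.natAdd j i)) (R.k.run (j + m) R.s₀ u')
      rw [← R.cnd_eq, ← R.cnd_eq] at c2
      exact (c1.trans c2 ham_triangle).mono (by linarith)
    refine (Cpl.extend hμ hν h hs).mono ?_
    have hI := mean_overlap hν hμ j m n hw (I := (e / 4) ^ 2) (by
      have := hν.mul_hrate_le (j + m) n
      have : (n : ℝ) * (hrate μ - η) ≤ n * hrate ν := by gcongr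
      nlinarith)
    rw [Real.sqrt_sq (by positivity)] at hI
    have e1 : ∑ u, wl ν (j + m) u * O u = ∑ a : Fin j → A, ∑ b : Fin m → A,
        wl ν (j + m) (Fin.append a b) *
          ∑ c, min (cnd ν (j + m) n (Fin.append a b) c) (cnd μ m n b c) := by
      rw [sum_append]
      simp only [O, Fin.append_right]
    rw [← e1] at hI
    have e2 : ∑ u, wl ν (j + m) u * (n * (1 - O u) + (e / 4 * n + K)) =
        n * (1 - ∑ u, wl ν (j + m) u * O u) + (e / 4 * n + K) := by
      simp only [mul_add, mul_sub, Finset.sum_add_distrib, Finset.sum_sub_distrib,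
        ← Finset.sum_mul, hν.sum_wl, one_mul, mul_one, Finset.mul_sum]
      congr 2
      exact Finset.sum_congr rfl fun u _ => by ring
    rw [e2]
    nlinarith
  have zero : Cpl (wl ν 0) (wl μ 0) ham 0 := by
    have := Cpl.of_prod (wl_nonneg ν 0) (wl_nonneg μ 0) (hν.sum_wl 0) (hμ.sum_wl 0)
      (c := ham) (t := 0) fun a b => by simpa using ham_le a b
    exact this
  have main : ∀ k N, N = k * n + m → Cpl (wl ν N) (wl μ N) ham (m + k * (e * n)) := by
    intro k
    induction k with
    | zero =>
      rintro N rfl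
      have := Cpl.extend_crude hμ hν m zero
      rw [zero_mul]
      exact this.mono (by simp)
    | succ k ih =>
      rintro N hN
      obtain rfl : N = k * n + m + n := by rw [hN]; ring
      refine (block (k * n) _ (ih _ rfl)).mono (le_of_eq ?_)
      push_cast; ring
  intro N
  rcases lt_or_ge N m with h | h
  · refine Cpl.of_prod (wl_nonneg ν N) (wl_nonneg μ N) (hν.sum_wl N) (hμ.sum_wl N) fun a b =>
      (ham_le a b).trans ?_
    have : (N : ℝ) ≤ m := by exact_mod_cast h.le
    have : 0 ≤ e * N := by positivity
    linarith
  · obtain ⟨d, rfl⟩ := Nat.exists_eq_add_of_le h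
    have hd := Nat.div_add_mod d n
    have hlt : d % n < n := Nat.mod_lt _ (by exact_mod_cast hnpos)
    obtain ⟨q, r, rfl, hr⟩ : ∃ q r, d = q * n + r ∧ r < n := ⟨d / n, d % n, by
      rw [mul_comm]; exact hd.symm, hlt⟩
    have := Cpl.extend_crude hμ hν r (main q _ rfl)
    rw [show m + (q * n + r) = q * n + m + r by ring]
    refine this.mono ?_
    have h1 : (r : ℝ) ≤ n := by exact_mod_cast hr.le
    push_cast
    have h2 : 0 ≤ e * (r + m) := by positivity
    nlinarith

end FD

/-! ### Finite codes -/

section Codes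

variable {A B : Type} {β γ : Type*}

/-- `F` depends only on the coordinates in `[-W, W]`. -/
def Loc (W : ℕ) (F : (ℤ → A) → β) : Prop :=
  ∀ x y : ℤ → A, (∀ i : ℤ, |i| ≤ W → x i = y i) → F x = F y

lemma Loc.mono {W W' : ℕ} {F : (ℤ → A) → β} (h : Loc W F) (hW : W ≤ W') : Loc W' F :=
  fun x y hxy => h x y fun i hi => hxy i (hi.trans (by exact_mod_cast hW))

lemma Loc.comp {W : ℕ} {F : (ℤ → A) → β} (h : Loc W F) (g : β → γ) : Loc W fun x => g (F x) :=
  fun x y hxy => congrArg g (h x y hxy)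

lemma Loc.comp₂ {δ : Type*} {W : ℕ} {F : (ℤ → A) → β} {F' : (ℤ → A) → γ} (h : Loc W F)
    (h' : Loc W F') (g : β → γ → δ) : Loc W fun x => g (F x) (F' x) :=
  fun x y hxy => congrArg₂ g (h x y hxy) (h' x y hxy)

lemma Loc.const (b : β) (W : ℕ) : Loc W fun _ : ℤ → A => b := fun _ _ _ => rfl

lemma Loc.comp_shift {W W' : ℕ} {F : (ℤ → A) → β} (h : Loc W F) (t : ℤ) (ht : W + |t| ≤ W') :
    Loc W' fun x => F (shift t x) := by
  refine fun x y hxy => h _ _ fun i hi => hxy _ ?_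
  exact (abs_add_le i t).trans (le_trans (by gcongr) ht)

lemma Loc.of_word {W n : ℕ} {t : ℤ} (h : |t| + n ≤ W) : Loc W (word (A := A) t n) := by
  refine fun x y hxy => funext fun j => hxy _ ?_
  have := j.2
  refine (abs_add_le _ _).trans (le_trans ?_ h)
  rw [Nat.abs_cast]
  gcongr

/-- The factor map of the block code `F`. -/
def code (F : (ℤ → A) → β) (x : ℤ → A) : ℤ → β := fun i => F (shift i x)

lemma code_shift (F : (ℤ → A) → B) (t : ℤ) (x : ℤ → A) :
    code F (shift t x) = shift t (code F x) := by
  ext i; simp [code, shift_shift, shift]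

lemma Loc.of_word_code {W W' n : ℕ} {F : (ℤ → A) → B} (h : Loc W F) {t : ℤ} (ht : W + |t| + n ≤ W') :
    Loc W' fun x => word t n (code F x) := by
  refine fun x y hxy => funext fun j => (h.comp_shift (W' := W') (t + j) ?_) x y hxy
  have := j.2
  refine le_trans ?_ ht
  have h2 := abs_add_le t (j : ℤ)
  rw [Nat.abs_cast] at h2
  have : ((j : ℕ) : ℤ) ≤ n := by exact_mod_cast j.2.le
  linarith

lemma Loc.factor {W : ℕ} {F : (ℤ → A) → β} (h : Loc W F) :
    ∃ F' : (Fin (2 * W + 1) → A) → β,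
      ∀ x, F x = F' (word (-(W : ℤ)) (2 * W + 1) x) := by
  refine ⟨fun u => F fun i => u ⟨(i + W).toNat ⊓ (2 * W), by omega⟩, fun x => h _ _ fun i hi => ?_⟩
  rw [abs_le] at hi
  simp only [word]
  congr 1
  push_cast
  omega

section Meas

variable [Fintype A] [Nonempty A] [MeasurableSpace A] [MeasurableSingletonClass A]
  [Fintype B] [Nonempty B] [MeasurableSpace B] [MeasurableSingletonClass B]

lemma Loc.measurable [MeasurableSpace β] {W : ℕ} {F : (ℤ → A) → β} (h : Loc W F) :
    Measurable F := by
  obtain ⟨F', hF'⟩ := h.factor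
  rw [show F = fun x => F' (word (-(W : ℤ)) (2 * W + 1) x) from funext hF']
  exact (Measurable.of_discrete (f := F')).comp (measurable_word _ _)

lemma Loc.measurableSet {W : ℕ} {p : (ℤ → A) → Prop} (h : Loc W p) : MeasurableSet {x | p x} :=
  measurableSet_setOfPred.2 h.measurable

lemma Loc.integrable {μ : Measure (ℤ → A)} [IsProbabilityMeasure μ] {W : ℕ} {g : (ℤ → A) → ℝ}
    (h : Loc W g) : Integrable g μ := by
  obtain ⟨F', hF'⟩ := h.factor
  rw [show g = fun x => F' (word (-(W : ℤ)) (2 * W + 1) x) from funext hF']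
  exact integrable_word _ _ _

lemma measurable_code {F : (ℤ → A) → B} (h : Measurable F) : Measurable (code F) :=
  measurable_pi_lambda _ fun i => h.comp (measurable_shift i)

lemma Stat.map_code {μ : Measure (ℤ → A)} (hμ : Stat μ) {F : (ℤ → A) → B} (h : Measurable F) :
    Stat (μ.map (code F)) := by
  have := hμ.prob
  have hm := measurable_code h
  have : IsProbabilityMeasure (μ.map (code F)) := Measure.isProbabilityMeasure_map hm.aemeasurable
  refine Stat.of_one ?_
  rw [Measure.map_map (measurable_shift 1) hm]
  conv_rhs => rw [← (hμ.inv 1).map_eq, Measure.map_map hm (measurable_shift 1)]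
  congr 1
  ext1 x
  exact (code_shift F 1 x).symm

lemma wl_map_code {μ : Measure (ℤ → A)} {F : (ℤ → A) → B} (h : Measurable F) (n : ℕ) :
    wl (μ.map (code F)) n = dlaw μ fun x => word 0 n (code F x) := by
  ext u
  exact map_measureReal_apply (measurable_code h) (measurable_word 0 n (measurableSet_singleton u))

/-- The law of large numbers for local functions. -/
theorem KRep.lln_loc {μ : Measure (ℤ → A)} (R : KRep μ) (hμ : Stat μ) {W : ℕ} {Φ : (ℤ → A) → ℝ}
    (hΦ : Loc W Φ) {δ ε : ℝ} (hδ : 0 < δ) (hε : 0 < ε) : ∃ N₀ : ℕ, ∀ N ≥ N₀, μ.real {x | δ * N ≤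
      |∑ i ∈ Finset.range N, (Φ (shift i x) - ∫ y, Φ y ∂μ)|} ≤ ε := by
  obtain ⟨Φ', hΦ'⟩ := hΦ.factor
  obtain ⟨N₀, hN₀⟩ := R.lln hμ Φ' hδ hε
  refine ⟨N₀, fun N hN => ?_⟩
  have hi : ∫ y, Φ y ∂μ = ∑ v, wl μ (2 * W + 1) v * Φ' v := by
    rw [← hμ.integral_word (-(W : ℤ)), show Φ = _ from funext hΦ']
  have hm : MeasurableSet {x : ℤ → A | δ * N ≤ |∑ i ∈ Finset.range N,
      (Φ' (word i (2 * W + 1) x) - ∑ v, wl μ (2 * W + 1) v * Φ' v)|} := by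
    refine measurableSet_le measurable_const (Measurable.abs ?_)
    exact Finset.measurable_sum _ fun i _ =>
      ((Measurable.of_discrete (f := Φ')).comp (measurable_word _ _)).sub measurable_const
  have hs := hμ.prob_shift (-(W : ℤ)) hm
  rw [hi]
  refine le_trans (le_of_eq ?_) (hs.trans_le (hN₀ N hN))
  congr 1
  ext x
  simp only [Set.mem_ofPred_eq, hΦ', word_shift]
  simp only [add_comm]

end Meas

/-- Extension of a word to a configuration. -/
def zext [Nonempty A] {n : ℕ} (u : Fin n → A) : ℤ → A :=
  fun i => if h : 0 ≤ i ∧ i < n then u ⟨i.toNat, by omega⟩ else Classical.arbitrary A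

/-- The code `F` applied to a word. -/
def wcode [Nonempty A] (F : (ℤ → A) → B) {n : ℕ} (u : Fin n → A) : Fin n → B :=
  fun i => F (shift (i : ℕ) (zext u))

lemma wcode_eq [Nonempty A] {W n : ℕ} {F : (ℤ → A) → B} (h : Loc W F) (t : ℤ) (x : ℤ → A)
    (i : Fin n) (h1 : W ≤ (i : ℕ)) (h2 : (i : ℕ) + W < n) :
    wcode F (word t n x) i = word t n (code F x) i := by
  refine h _ _ fun j hj => ?_
  rw [abs_le] at hj
  simp only [shift, zext]
  rw [dif_pos (by omega)]
  simp only [word]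
  congr 1
  omega

lemma card_window (n W : ℕ) (a : ℤ) (s : Finset (Fin n)) (hs : ∀ i ∈ s, |(i : ℕ) - a| ≤ W) :
    s.card ≤ 2 * W + 1 := by
  have : (s.map (Fin.valEmbedding.trans Nat.castEmbedding)) ⊆ Finset.Icc (a - W) (a + W) := by
    intro z hz
    obtain ⟨i, hi, rfl⟩ := Finset.mem_map.1 hz
    have := abs_le.1 (hs i hi)
    rw [Finset.mem_Icc]
    change a - W ≤ ((i : ℕ) : ℤ) ∧ ((i : ℕ) : ℤ) ≤ a + W
    omega
  have h := Finset.card_le_card this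
  rw [Finset.card_map, Int.card_Icc] at h
  omega

lemma ham_eq_card [DecidableEq B] {n : ℕ} (u v : Fin n → B) :
    ham u v = ((Finset.univ.filter fun i => u i ≠ v i).card : ℝ) := by
  rw [ham, Finset.card_filter]
  push_cast
  refine Finset.sum_congr rfl fun i _ => ?_
  by_cases h : u i = v i <;> simp [h]

lemma ham_wcode [Nonempty A] [DecidableEq B] {W n : ℕ} {F : (ℤ → A) → B} (h : Loc W F) (t : ℤ)
    (x : ℤ → A) : ham (wcode F (word t n x)) (word t n (code F x)) ≤ 2 * W := by
  have hsub : (Finset.univ.filter fun i : Fin n => wcode F (word t n x) i ≠ word t n (code F x) i) ⊆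
      Finset.univ.filter fun i : Fin n => (i : ℕ) < W ∨ n ≤ (i : ℕ) + W := by
    intro i hi
    simp only [Finset.mem_filter, Finset.mem_univ, true_and] at hi ⊢
    by_contra hc
    push Not at hc
    exact hi (wcode_eq h t x i hc.1 hc.2)
  have hc : (Finset.univ.filter fun i : Fin n => (i : ℕ) < W ∨ n ≤ (i : ℕ) + W).card ≤ 2 * W := by
    have h1 : ((Finset.univ.filter fun i : Fin n => (i : ℕ) < W ∨ n ≤ (i : ℕ) + W).map
        Fin.valEmbedding) ⊆ Finset.range W ∪ Finset.Ico (n - W) n := by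
      intro z hz
      obtain ⟨i, hi, rfl⟩ := Finset.mem_map.1 hz
      have := i.2
      simp only [Finset.mem_filter, Finset.mem_univ, true_and] at hi
      simp only [Fin.valEmbedding_apply, Finset.mem_union, Finset.mem_range, Finset.mem_Ico]
      omega
    have := (Finset.card_le_card h1).trans (Finset.card_union_le _ _)
    rw [Finset.card_map, Finset.card_range, Nat.card_Ico] at this
    omega
  rw [ham_eq_card]
  exact_mod_cast (Finset.card_le_card hsub).trans hc

lemma ham_wcode_wcode [Nonempty A] [DecidableEq A] [DecidableEq B] {W n : ℕ} {F : (ℤ → A) → B}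
    (h : Loc W F) (u v : Fin n → A) : ham (wcode F u) (wcode F v) ≤ (2 * W + 1) * ham u v := by
  have hsub : (Finset.univ.filter fun i : Fin n => wcode F u i ≠ wcode F v i) ⊆
      (Finset.univ.filter fun j : Fin n => u j ≠ v j).biUnion fun j =>
        Finset.univ.filter fun i : Fin n => |(i : ℕ) - ((j : ℕ) : ℤ)| ≤ W := by
    intro i hi
    simp only [Finset.mem_filter, Finset.mem_univ, true_and] at hi
    by_contra hc
    refine hi (h _ _ fun j hj => ?_)
    simp only [shift, zext]
    by_cases hj2 : 0 ≤ j + ((i : ℕ) : ℤ) ∧ j + ((i : ℕ) : ℤ) < n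
    · rw [dif_pos hj2, dif_pos hj2]
      by_contra hne
      refine hc (Finset.mem_biUnion.2 ⟨⟨(j + ((i : ℕ) : ℤ)).toNat, by omega⟩, by simpa using hne, ?_⟩)
      simp only [Finset.mem_filter, Finset.mem_univ, true_and]
      rw [abs_le] at hj ⊢
      omega
    · rw [dif_neg hj2, dif_neg hj2]
  have hc := (Finset.card_le_card hsub).trans (Finset.card_biUnion_le_card_mul _ _ (2 * W + 1)
    fun j _ => card_window n W j _ fun i hi => (Finset.mem_filter.1 hi).2)
  rw [ham_eq_card, ham_eq_card, mul_comm]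
  exact_mod_cast hc

end Codes

/-! ### Markers -/

section Marker

variable {A : Type}

/-- The position `0` is at distance congruent to `φ` modulo `n` from the last visit to `E` before
time `n`. -/
def Mark (E : (ℤ → A) → Prop) (n K φ : ℕ) (x : ℤ → A) : Prop :=
  ∃ j : ℕ, j ≤ K ∧ φ ≤ j ∧ (j - φ) % n = 0 ∧ E (shift (-(j : ℤ)) x) ∧
    ∀ t : ℤ, -(j : ℤ) < t → t < n → ¬ E (shift t x)

variable {E : (ℤ → A) → Prop} {n K : ℕ}

lemma Mark.spaced {φ : ℕ} {x : ℤ → A} {d : ℤ} (h0 : 0 < d) (hd : d < n) (h : Mark E n K φ x) :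
    ¬ Mark E n K φ (shift d x) := by
  rintro ⟨j', hj'K, hφ', hmod', hE', hlast'⟩
  obtain ⟨j, hjK, hφ, hmod, hE, hlast⟩ := h
  rw [shift_shift] at hE'
  have h1 : ¬ (-(j : ℤ) < -(j' : ℤ) + d) := fun hlt => hlast _ hlt (by omega) hE'
  have h2 : ¬ (-(j' : ℤ) + d < -(j : ℤ)) := fun hlt =>
    hlast' (-(j : ℤ) - d) (by omega) (by omega) (by rw [shift_shift]; simpa using hE)
  have e : j' = j + d.toNat := by omega
  obtain ⟨m, hm⟩ := Nat.dvd_of_mod_eq_zero hmod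
  obtain ⟨m', hm'⟩ := Nat.dvd_of_mod_eq_zero hmod'
  have e2 : d.toNat = n * m' - n * m := by omega
  rw [← Nat.mul_sub] at e2
  have : n ≤ d.toNat := by
    rw [e2]
    exact Nat.le_mul_of_pos_right _ (Nat.pos_of_ne_zero fun h => by rw [h] at e2; omega)
  omega

lemma Mark.unique {φ φ' : ℕ} {x : ℤ → A} (hφn : φ < n) (hφn' : φ' < n) (h : Mark E n K φ x)
    (h' : Mark E n K φ' x) : φ = φ' := by
  obtain ⟨j', hj'K, hφ', hmod', hE', hlast'⟩ := h'
  obtain ⟨j, hjK, hφ, hmod, hE, hlast⟩ := h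
  have h1 : ¬ (-(j : ℤ) < -(j' : ℤ)) := fun hlt => hlast _ hlt (by omega) hE'
  have h2 : ¬ (-(j' : ℤ) < -(j : ℤ)) := fun hlt => hlast' _ hlt (by omega) hE
  have e : j' = j := by omega
  subst e
  have := (Nat.modEq_iff_dvd' hφ).2 (Nat.dvd_of_mod_eq_zero hmod)
  have h'' := (Nat.modEq_iff_dvd' hφ').2 (Nat.dvd_of_mod_eq_zero hmod')
  have := this.trans h''.symm
  rwa [Nat.ModEq, Nat.mod_eq_of_lt hφn, Nat.mod_eq_of_lt hφn'] at this

lemma Mark.cover {φ : ℕ} {x : ℤ → A} (hφn : φ < n)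
    (h1 : ∀ t : ℤ, -(2 * n : ℤ) < t → t < n → ¬ E (shift t x))
    (h2 : ∃ m : ℕ, m ≤ K ∧ E (shift (-(m : ℤ)) x)) :
    ∃ s : ℕ, s < n ∧ Mark E n K φ (shift (-(s : ℤ)) x) := by
  classical
  set m := Nat.find h2 with hm
  obtain ⟨hmK, hmE⟩ := Nat.find_spec h2
  rw [← hm] at hmK hmE
  have hlast : ∀ t : ℤ, -(m : ℤ) < t → t < n → ¬ E (shift t x) := by
    intro t ht1 ht2 hE
    by_cases ht : 0 ≤ t
    · exact h1 t (by omega) ht2 hE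
    · have := Nat.find_min h2 (m := (-t).toNat) (by omega)
      refine this ⟨by omega, ?_⟩
      rwa [show (-((-t).toNat : ℤ)) = t by omega]
  have h2n : 2 * n ≤ m := by
    by_contra hlt
    exact h1 _ (by omega) (by omega) hmE
  have hs : (m - φ) % n < n := Nat.mod_lt _ (by omega)
  refine ⟨(m - φ) % n, hs, m - (m - φ) % n, by omega, by omega, ?_, ?_, fun t ht1 ht2 => ?_⟩
  · rw [show m - (m - φ) % n - φ = (m - φ) - (m - φ) % n by omega]
    exact Nat.sub_mod_eq_zero_of_mod_eq (by simp)
  · rw [shift_shift]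
    convert hmE using 2
    omega
  · rw [shift_shift]
    exact hlast _ (by omega) (by omega)

lemma Loc.mark {L W φ : ℕ} (hE : Loc L E) (hW : L + (n + K) ≤ W) : Loc W (Mark E n K φ) := by
  have key : ∀ x y : ℤ → A, (∀ i : ℤ, |i| ≤ W → x i = y i) → ∀ t : ℤ, -(K : ℤ) ≤ t → t < n →
      (E (shift t x) ↔ E (shift t y)) := by
    intro x y hxy t h1 h2
    refine iff_of_eq ((hE.comp_shift (W' := W) t ?_) x y hxy)
    have : |t| ≤ (n + K : ℕ) := by rw [abs_le]; push_cast; omega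
    zify at hW
    push_cast at this
    omega
  have imp : ∀ x y : ℤ → A, (∀ i : ℤ, |i| ≤ W → x i = y i) → Mark E n K φ x → Mark E n K φ y := by
    rintro x y hxy ⟨j, hjK, hφ, hmod, hEj, hlast⟩
    by_cases hn : n = 0
    · subst hn
      refine ⟨j, hjK, hφ, hmod, ?_, fun t h1 h2 => ?_⟩
      · refine (iff_of_eq ((hE.comp_shift (W' := W) (-(j : ℤ)) ?_) x y hxy)).1 hEj
        rw [abs_neg, Nat.abs_cast]; omega
      · rw [← key x y hxy t (by omega) h2]; exact hlast t h1 h2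
    · exact ⟨j, hjK, hφ, hmod, (key x y hxy (-(j : ℤ)) (by omega) (by omega)).1 hEj, fun t h1 h2 => by
        rw [← key x y hxy t (by omega) h2]; exact hlast t h1 h2⟩
  exact fun x y hxy => propext ⟨imp x y hxy, imp y x fun i hi => (hxy i hi).symm⟩

variable [Fintype A] [Nonempty A] [MeasurableSpace A] [MeasurableSingletonClass A]
  {μ : Measure (ℤ → A)}

lemma exists_rare_word (hμ : Stat μ) (hA : 2 ≤ Fintype.card A) {η : ℝ} (hη : 0 < η) :
    ∃ (L : ℕ) (u : Fin L → A), wl μ L u ≤ η := by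
  obtain ⟨L, hL⟩ := exists_pow_lt_of_lt_one hη (show (1 / 2 : ℝ) < 1 by norm_num)
  refine ⟨L, ?_⟩
  by_contra! hc
  have h1 := hμ.sum_wl L
  have h2 : ∑ u : Fin L → A, η < ∑ u : Fin L → A, wl μ L u :=
    Finset.sum_lt_sum_of_nonempty Finset.univ_nonempty fun u _ => hc u
  rw [h1, Finset.sum_const, nsmul_eq_mul, Finset.card_univ, Fintype.card_fun, Fintype.card_fin] at h2
  have h3 : (2 : ℝ) ^ L ≤ ((Fintype.card A ^ L : ℕ) : ℝ) := by
    exact_mod_cast Nat.pow_le_pow_left hA L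
  have h4 : (1 : ℝ) < 2 ^ L * η := by
    calc (1 : ℝ) = 2 ^ L * (1 / 2) ^ L := by rw [← mul_pow]; norm_num
      _ < 2 ^ L * η := by gcongr
  have := mul_le_mul_of_nonneg_right h3 hη.le
  linarith

open Classical in
/-- Existence of markers with gap `n` covering most of the line and sampling a given function of
the following word in an unbiased way. -/
theorem KRep.exists_marker (R : KRep μ) (hμ : Stat μ) (hA : 2 ≤ Fintype.card A) {n : ℕ}
    (hn : 0 < n) {η : ℝ} (hη : 0 < η) (g : (Fin n → A) → ℝ) (hg : ∀ u, 0 ≤ g u) :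
    ∃ (W : ℕ) (M : (ℤ → A) → Prop), Loc W M ∧
      (∀ (x : ℤ → A) (d : ℤ), 0 < d → d < n → M x → ¬ M (shift d x)) ∧
      μ.real {x | ∀ s : ℕ, s < n → ¬ M (shift (-(s : ℤ)) x)} ≤ η ∧
      n * ∫ x, (if M x then g (word 0 n x) else 0) ∂μ ≤ ∑ u, wl μ n u * g u := by
  have := hμ.prob
  have hnR : (0 : ℝ) < n := by exact_mod_cast hn
  obtain ⟨L, u, hu⟩ := exists_rare_word hμ hA (η := η / 2 / (3 * n)) (by positivity)
  set E : (ℤ → A) → Prop := fun x => word 0 L x = u with hE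
  have hEloc : Loc L E := (Loc.of_word (A := A) (n := L) (t := 0) (W := L) (by simp)).comp fun v => v = u
  have hPE : μ.real {x | E x} = wl μ L u := rfl
  obtain ⟨K, hK⟩ := R.lln hμ (k₀ := L) (fun v => if v = u then 1 else 0) (R.wl_pos L u)
    (half_pos hη)
  replace hK := hK K le_rfl
  have hloc : ∀ φ, Loc (L + (n + K)) (Mark E n K φ) := fun φ => hEloc.mark le_rfl
  have hcov : ∀ φ < n, μ.real {x | ∀ s : ℕ, s < n → ¬ Mark E n K φ (shift (-(s : ℤ)) x)} ≤ η := by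
    intro φ hφ
    have hsub : {x | ∀ s : ℕ, s < n → ¬ Mark E n K φ (shift (-(s : ℤ)) x)} ⊆
        (⋃ t ∈ Finset.Ioo (-(2 * n : ℤ)) n, {x | E (shift t x)}) ∪
        {x | ∀ m : ℕ, m ≤ K → ¬ E (shift (-(m : ℤ)) x)} := by
      intro x hx
      by_contra hc
      rw [Set.mem_union, not_or] at hc
      simp only [Set.mem_iUnion, Set.mem_ofPred_eq, not_exists, not_forall, not_not,
        Finset.mem_Ioo] at hc
      obtain ⟨hc1, m, hmK, hmE⟩ := hc
      obtain ⟨s, hs, hsM⟩ := Mark.cover (K := K) hφ (fun t h1 h2 => hc1 t ⟨h1, h2⟩) ⟨m, hmK, hmE⟩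
      exact hx s hs hsM
    have hb1 : μ.real (⋃ t ∈ Finset.Ioo (-(2 * n : ℤ)) n, {x | E (shift t x)}) ≤ η / 2 := by
      refine (measureReal_biUnion_finset_le _ _).trans ?_
      have : ∀ t ∈ Finset.Ioo (-(2 * n : ℤ)) n, μ.real {x | E (shift t x)} ≤ η / 2 / (3 * n) :=
        fun t _ => (hμ.prob_shift t hEloc.measurableSet).trans_le (hPE.trans_le hu)
      refine (Finset.sum_le_card_nsmul _ _ _ this).trans ?_
      rw [nsmul_eq_mul, Int.card_Ioo]
      have h3 : (((n : ℤ) - -(2 * n : ℤ) - 1).toNat : ℝ) ≤ 3 * n := by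
        have : ((n : ℤ) - -(2 * n : ℤ) - 1).toNat ≤ 3 * n := by omega
        exact_mod_cast this
      refine (mul_le_mul_of_nonneg_right h3 (by positivity)).trans (le_of_eq ?_)
      field_simp
    have hb2 : μ.real {x | ∀ m : ℕ, m ≤ K → ¬ E (shift (-(m : ℤ)) x)} ≤ η / 2 := by
      have hEm : Loc (L + K) fun x : ℤ → A => ∀ m : ℕ, m ≤ K → ¬ E (shift (m : ℤ) x) := by
        intro x y hxy
        refine propext (forall₂_congr fun m hm => not_congr (iff_of_eq ?_))
        exact (hEloc.comp_shift (W' := L + K) (m : ℤ) (by rw [Nat.abs_cast]; push_cast; omega)) x y hxy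
      have e := hμ.prob_shift (-(K : ℤ)) hEm.measurableSet
      have e2 : {x : ℤ → A | ∀ m : ℕ, m ≤ K → ¬ E (shift (m : ℤ) (shift (-(K : ℤ)) x))} =
          {x | ∀ m : ℕ, m ≤ K → ¬ E (shift (-(m : ℤ)) x)} := by
        ext x
        simp only [Set.mem_ofPred_eq, shift_shift]
        constructor
        · intro h m hm
          have := h (K - m) (by omega)
          rwa [show ((K - m : ℕ) : ℤ) + -(K : ℤ) = -(m : ℤ) by omega] at this
        · intro h m hm
          have := h (K - m) (by omega)
          rwa [show -((K - m : ℕ) : ℤ) = (m : ℤ) + -(K : ℤ) by omega] at this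
      rw [← e2, e]
      refine (measureReal_mono ?_).trans hK
      intro x hx
      have h0 : ∀ i ∈ Finset.range K, ((if word i L x = u then (1 : ℝ) else 0) -
          ∑ v, wl μ L v * if v = u then 1 else 0) = - wl μ L u := by
        intro i hi
        have := hx i (Finset.mem_range.1 hi).le
        rw [hE] at this
        simp only [word_shift, zero_add] at this
        rw [if_neg this]; simp
      change wl μ L u * K ≤ |∑ i ∈ Finset.range K, ((if word i L x = u then (1 : ℝ) else 0) -
          ∑ v, wl μ L v * if v = u then 1 else 0)|
      rw [Finset.sum_congr rfl h0, Finset.sum_const, Finset.card_range, nsmul_eq_mul, mul_neg,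
        abs_neg, abs_of_nonneg (mul_nonneg (Nat.cast_nonneg _) (wl_nonneg _ _ _)), mul_comm]
    calc _ ≤ _ := measureReal_mono hsub
      _ ≤ _ := measureReal_union_le _ _
      _ ≤ η := by linarith
  set I : ℕ → (ℤ → A) → ℝ := fun φ x => if Mark E n K φ x then g (word 0 n x) else 0 with hI
  have hIloc : ∀ φ, Loc (L + (n + K)) (I φ) := fun φ =>
    (hloc φ).comp₂ (Loc.of_word (n := n) (t := 0) (by rw [abs_zero]; omega)) fun p w => if p then g w else 0
  have hsum : ∑ φ ∈ Finset.range n, ∫ x, I φ x ∂μ ≤ ∑ u, wl μ n u * g u := by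
    rw [← integral_finsetSum _ fun φ _ => (hIloc φ).integrable, ← hμ.integral_word 0 n g]
    refine integral_mono (integrable_finsetSum _ fun φ _ => (hIloc φ).integrable)
      (integrable_word _ _ _) fun x => ?_
    by_cases hx : ∃ φ ∈ Finset.range n, Mark E n K φ x
    · obtain ⟨φ, hφ, hφx⟩ := hx
      dsimp only
      rw [Finset.sum_eq_single_of_mem φ hφ fun φ' hφ' hne => if_neg fun h' =>
        hne (Mark.unique (Finset.mem_range.1 hφ') (Finset.mem_range.1 hφ) h' hφx)]
      exact (if_pos hφx).le
    · push Not at hx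
      dsimp only
      rw [Finset.sum_eq_zero fun φ hφ => if_neg (hx φ hφ)]
      exact hg _
  obtain ⟨φ, hφ, hφle⟩ := Finset.exists_le_of_sum_le (s := Finset.range n)
    (f := fun φ => ∫ x, I φ x ∂μ) (g := fun _ => (∑ u, wl μ n u * g u) / n)
    ⟨0, Finset.mem_range.2 hn⟩ (by
      rw [Finset.sum_const, Finset.card_range, nsmul_eq_mul, mul_div_cancel₀ _ hnR.ne']
      exact hsum)
  refine ⟨_, Mark E n K φ, hloc φ, fun x d h0 hd h => h.spaced h0 hd,
    hcov φ (Finset.mem_range.1 hφ), ?_⟩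
  rw [le_div_iff₀ hnR, mul_comm] at hφle
  exact hφle

end Marker

/-! ### An assignment lemma -/

section Assign

variable {α β : Type*} [DecidableEq α] [DecidableEq β]

lemma exists_assign_le (s : Finset α) (t : Finset β) [Nonempty β] {M : ℕ}
    (h : s.card ≤ M * t.card) : ∃ g : α → β, (∀ u ∈ s, g u ∈ t) ∧
      ∀ v, (s.filter fun u => g u = v).card ≤ M := by
  have hc : Fintype.card s ≤ Fintype.card (t × Fin M) := by
    rw [Fintype.card_prod, Fintype.card_coe, Fintype.card_coe, Fintype.card_fin, mul_comm]
    exact h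
  obtain ⟨e⟩ := Function.Embedding.nonempty_of_card_le hc
  refine ⟨fun u => if h : u ∈ s then (e ⟨u, h⟩).1 else Classical.arbitrary β, fun u hu => ?_,
    fun v => ?_⟩
  · dsimp only
    rw [dif_pos hu]; exact (e ⟨u, hu⟩).1.2
  · rw [← Fintype.card_coe]
    conv_rhs => rw [← Fintype.card_fin M]
    refine Fintype.card_le_of_injective
      (fun u => (e ⟨u.1, (Finset.mem_filter.1 u.2).1⟩).2) fun u u' huu => ?_
    obtain ⟨u, hu⟩ := u
    obtain ⟨u', hu'⟩ := u'
    simp only [Finset.mem_filter] at hu hu'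
    have h1 := hu.2
    have h1' := hu'.2
    rw [dif_pos hu.1] at h1
    rw [dif_pos hu'.1] at h1'
    have := e.injective (Prod.ext (Subtype.ext (h1.trans h1'.symm)) huu)
    simpa using this

open Classical in
lemma exists_assign (s : Finset α) (t : Finset β) [Nonempty β] (P : α → β → Prop) {M : ℕ}
    (h : s.card ≤ M * t.card) : ∃ (f : α → β) (D : Finset α) (T : Finset β),
      (∀ u ∈ s, f u ∈ t) ∧ (∀ v, (s.filter fun u => f u = v).card ≤ 2 * M) ∧ D ⊆ s ∧
      (∀ u ∈ D, P u (f u)) ∧ T ⊆ t ∧ T.card * M ≤ s.card ∧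
      ∀ u ∈ s, u ∉ D → ∀ v ∈ t, P u v → v ∈ T := by
  obtain ⟨g, hgt, hgM⟩ := exists_assign_le s t h
  set Q : Finset α → Prop := fun D => ∃ f : α → β, (∀ u ∈ D, f u ∈ t ∧ P u (f u)) ∧
    ∀ v, (D.filter fun u => f u = v).card ≤ M with hQ
  obtain ⟨D, hD, hmax⟩ := Finset.exists_max_image (s.powerset.filter Q) Finset.card
    ⟨∅, Finset.mem_filter.2 ⟨Finset.empty_mem_powerset _, g, by simp, by simp⟩⟩
  rw [Finset.mem_filter, Finset.mem_powerset] at hD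
  obtain ⟨hDs, f, hf, hfM⟩ := hD
  refine ⟨fun u => if u ∈ D then f u else g u, D,
    t.filter fun v => (D.filter fun u => f u = v).card = M, fun u hu => ?_, fun v => ?_, hDs,
    fun u hu => ?_, Finset.filter_subset _ _, ?_, fun u hu huD v hv hP => ?_⟩
  · dsimp only
    split_ifs with hD
    exacts [(hf u hD).1, hgt u hu]
  · have : (s.filter fun u => (if u ∈ D then f u else g u) = v) ⊆
        (D.filter fun u => f u = v) ∪ s.filter fun u => g u = v := by
      intro u hu
      rw [Finset.mem_filter] at hu
      rw [Finset.mem_union, Finset.mem_filter, Finset.mem_filter]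
      by_cases hD : u ∈ D
      · rw [if_pos hD] at hu; exact Or.inl ⟨hD, hu.2⟩
      · rw [if_neg hD] at hu; exact Or.inr hu
    have := (Finset.card_le_card this).trans (Finset.card_union_le _ _)
    have := hfM v
    have := hgM v
    dsimp only at *
    omega
  · dsimp only
    rw [if_pos hu]; exact (hf u hu).2
  · set T := t.filter fun v => (D.filter fun u => f u = v).card = M with hT
    calc T.card * M = ∑ v ∈ T, (D.filter fun u => f u = v).card := by
          rw [Finset.sum_congr rfl fun v hv => (Finset.mem_filter.1 hv).2, Finset.sum_const,
            smul_eq_mul]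
      _ = (T.biUnion fun v => D.filter fun u => f u = v).card := by
          rw [Finset.card_biUnion]
          intro v _ v' _ hne
          rw [Function.onFun, Finset.disjoint_left]
          intro u hu hu'
          exact hne ((Finset.mem_filter.1 hu).2.symm.trans (Finset.mem_filter.1 hu').2)
      _ ≤ s.card := by
          refine Finset.card_le_card fun u hu => ?_
          obtain ⟨v, _, hu⟩ := Finset.mem_biUnion.1 hu
          exact hDs (Finset.mem_filter.1 hu).1
  · refine Finset.mem_filter.2 ⟨hv, le_antisymm (hfM v) ?_⟩
    by_contra hlt
    push Not at hlt
    have hne : ∀ u' ∈ D, u' ≠ u := fun u' hu' he => huD (he ▸ hu')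
    have : insert u D ∈ s.powerset.filter Q := by
      refine Finset.mem_filter.2 ⟨Finset.mem_powerset.2 (Finset.insert_subset hu hDs),
        Function.update f u v, fun u' hu' => ?_, fun v' => ?_⟩
      · rcases Finset.mem_insert.1 hu' with rfl | hu'
        · simpa using ⟨hv, hP⟩
        · rw [Function.update_of_ne (hne u' hu')]; exact hf u' hu'
      · rw [Finset.filter_insert]
        have e : (D.filter fun u' => Function.update f u v u' = v') =
            D.filter fun u' => f u' = v' :=
          Finset.filter_congr fun u' hu' => by rw [Function.update_of_ne (hne u' hu')]
        rw [e, Function.update_self]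
        split_ifs with hvv
        · subst hvv
          exact (Finset.card_insert_le _ _).trans hlt
        · exact hfM v'
    have := hmax _ this
    rw [Finset.card_insert_of_notMem huD] at this
    omega

lemma exists_index (s : Finset α) (f : α → β) {k : ℕ} (hk : 0 < k)
    (h : ∀ v, (s.filter fun u => f u = v).card ≤ k) :
    ∃ idx : α → Fin k, ∀ u ∈ s, ∀ u' ∈ s, f u = f u' → idx u = idx u' → u = u' := by
  have he : ∀ v, Nonempty ((s.filter fun u => f u = v) ↪ Fin k) := fun v =>
    Function.Embedding.nonempty_of_card_le (by
      rw [Fintype.card_coe, Fintype.card_fin]; exact h v)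
  set e := fun v => (he v).some
  refine ⟨fun u => if hu : u ∈ s then e (f u) ⟨u, Finset.mem_filter.2 ⟨hu, rfl⟩⟩ else ⟨0, hk⟩,
    fun u hu u' hu' hf hi => ?_⟩
  simp only [dif_pos hu, dif_pos hu'] at hi
  have key : ∀ v (hv : f u = v), e v ⟨u, Finset.mem_filter.2 ⟨hu, hv⟩⟩ =
      e (f u) ⟨u, Finset.mem_filter.2 ⟨hu, rfl⟩⟩ := by
    rintro v rfl; rfl
  have := (e (f u')).injective ((key (f u') hf).trans hi)
  simpa using this

open Classical in
/-- Finite form of the matching of typical words of two processes of equal entropy. -/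
lemma exists_typical_assign [Fintype α] [Fintype β] [Nonempty β] {p : α → ℝ} {q : β → ℝ}
    {P : α → β → Prop} {b : ℝ} (hcpl : Cpl p q (fun u v => if P u v then 0 else 1) b)
    (hp : ∀ u, 0 ≤ p u) (hp1 : ∑ u, p u = 1) (hq1 : ∑ v, q v = 1)
    {H c ε : ℝ} (hε : ε ≤ 1 / 4) (hc2 : 2 ≤ Real.exp c) (hcε : Real.exp (-c) ≤ ε) (Q : β → Prop)
    (hA : ∑ u, p u * (if Real.exp (-(H + c)) ≤ p u then 0 else 1) ≤ ε)
    (hB : ∑ v, q v * (if q v ≤ Real.exp (-(H - c)) ∧ Q v then 0 else 1) ≤ 2 * ε) :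
    ∃ (s D : Finset α) (f : α → β) (k : ℕ) (idx : α → Fin k), 0 < k ∧
      Real.log k ≤ 3 * c + Real.log 4 ∧
      (∀ u ∈ s, ∀ u' ∈ s, f u = f u' → idx u = idx u' → u = u') ∧
      (∀ u ∈ s, Q (f u)) ∧ (∀ u ∈ D, P u (f u)) ∧
      ∑ u, p u * (if u ∈ s then 0 else 1) ≤ ε ∧
      ∑ u, p u * (if u ∈ D then 0 else 1) ≤ b + 4 * ε := by
  set s : Finset α := Finset.univ.filter fun u => Real.exp (-(H + c)) ≤ p u with hs
  set t : Finset β := Finset.univ.filter fun v => q v ≤ Real.exp (-(H - c)) ∧ Q v with ht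
  set M : ℕ := ⌈Real.exp (3 * c)⌉₊ with hM
  have hMe : Real.exp (3 * c) ≤ M := Nat.le_ceil _
  have hM0 : 0 < M := Nat.ceil_pos.2 (Real.exp_pos _)
  have hsc : (s.card : ℝ) ≤ Real.exp (H + c) := by
    have h1 : (s.card : ℝ) * Real.exp (-(H + c)) ≤ 1 := by
      rw [← hp1, ← nsmul_eq_mul]
      exact (Finset.card_nsmul_le_sum s p _ fun u hu => (Finset.mem_filter.1 hu).2).trans
        (Finset.sum_le_univ_sum_of_nonneg hp)
    rw [Real.exp_neg, ← div_eq_mul_inv, div_le_one (Real.exp_pos _)] at h1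
    exact h1
  have htc : Real.exp (H - c) / 2 ≤ t.card := by
    have h1 : 1 / 2 ≤ ∑ v ∈ t, q v := by
      have : ∑ v ∈ t, q v = 1 - ∑ v, q v * (if q v ≤ Real.exp (-(H - c)) ∧ Q v then 0 else 1) := by
        rw [eq_sub_iff_add_eq, ht, Finset.sum_filter, ← Finset.sum_add_distrib]
        refine Eq.trans ?_ hq1
        refine Finset.sum_congr rfl fun v _ => ?_
        split_ifs with h <;> simp
      linarith
    have h2 : ∑ v ∈ t, q v ≤ t.card * Real.exp (-(H - c)) := by
      rw [← nsmul_eq_mul]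
      exact Finset.sum_le_card_nsmul t q _ fun v hv => (Finset.mem_filter.1 hv).2.1
    rw [Real.exp_neg, ← div_eq_mul_inv, le_div_iff₀ (Real.exp_pos _)] at h2
    have := Real.exp_pos (H - c)
    nlinarith
  have hcard : s.card ≤ M * t.card := by
    have : (s.card : ℝ) ≤ M * t.card := by
      calc (s.card : ℝ) ≤ Real.exp (H + c) := hsc
        _ = Real.exp (H + c) * 1 := (mul_one _).symm
        _ ≤ Real.exp (H + c) * (Real.exp c / 2) := by gcongr; linarith
        _ = Real.exp (3 * c) * (Real.exp (H - c) / 2) := by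
          rw [mul_div_assoc', mul_div_assoc', ← Real.exp_add, ← Real.exp_add]; ring_nf
        _ ≤ M * t.card := by gcongr
    exact_mod_cast this
  obtain ⟨f, D, T, hft, hfM, hDs, hD, hTt, hTM, hrest⟩ := exists_assign s t P hcard
  obtain ⟨idx, hidx⟩ := exists_index s f (k := 2 * M) (by omega) hfM
  have hsε : ∑ u, p u * (if u ∈ s then 0 else 1) ≤ ε := by
    simpa only [hs, Finset.mem_filter, Finset.mem_univ, true_and] using hA
  refine ⟨s, D, f, 2 * M, idx, by omega, ?_, hidx, fun u hu => (Finset.mem_filter.1 (hft u hu)).2.2,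
    hD, hsε, ?_⟩
  · have h1 : (1 : ℝ) ≤ Real.exp (3 * c) := by
      have : 0 ≤ c := by
        by_contra! hneg
        have := Real.exp_lt_one_iff.2 hneg
        linarith
      exact Real.one_le_exp (by linarith)
    have h2 : (M : ℝ) ≤ 2 * Real.exp (3 * c) := by
      have := Nat.ceil_lt_add_one (Real.exp_pos (3 * c)).le
      rw [← hM] at this
      linarith
    have h3 : ((2 * M : ℕ) : ℝ) ≤ 4 * Real.exp (3 * c) := by push_cast; linarith
    calc Real.log ((2 * M : ℕ) : ℝ) ≤ Real.log (4 * Real.exp (3 * c)) :=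
          Real.log_le_log (by exact_mod_cast (by omega : 0 < 2 * M)) h3
      _ = 3 * c + Real.log 4 := by
          rw [Real.log_mul (by norm_num) (Real.exp_pos _).ne', Real.log_exp]; ring
  · have hT : ∑ v, q v * (if v ∈ T then 1 else 0) ≤ ε := by
      have e : ∑ v, q v * (if v ∈ T then 1 else 0) = ∑ v ∈ T, q v := by simp
      rw [e]
      have h2 : ∑ v ∈ T, q v ≤ T.card * Real.exp (-(H - c)) := by
        rw [← nsmul_eq_mul]
        exact Finset.sum_le_card_nsmul T q _ fun v hv => (Finset.mem_filter.1 (hTt hv)).2.1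
      have h3 : (T.card : ℝ) * Real.exp (3 * c) ≤ Real.exp (H + c) := by
        calc (T.card : ℝ) * Real.exp (3 * c) ≤ T.card * M := by gcongr
          _ ≤ s.card := by exact_mod_cast hTM
          _ ≤ _ := hsc
      rw [← le_div_iff₀ (Real.exp_pos _), ← Real.exp_sub] at h3
      refine (h2.trans (mul_le_mul_of_nonneg_right h3 (Real.exp_pos _).le)).trans ?_
      rw [← Real.exp_add]
      refine le_trans (le_of_eq ?_) hcε
      ring_nf
    obtain ⟨w, h0, h1, h2, h3⟩ := hcpl
    have e1 : ∀ F : α → ℝ, ∑ u, p u * F u = ∑ u, ∑ v, w u v * F u := fun F =>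
      Finset.sum_congr rfl fun u _ => by rw [← Finset.sum_mul, h1]
    have e2 : ∀ F : β → ℝ, ∑ v, q v * F v = ∑ u, ∑ v, w u v * F v := fun F => by
      rw [Finset.sum_comm]
      exact Finset.sum_congr rfl fun u _ => by rw [← Finset.sum_mul, h2]
    rw [e1] at hsε ⊢
    rw [e2] at hB hT
    have key : ∑ u, ∑ v, w u v * (if u ∈ D then 0 else 1) ≤
        ∑ u, ∑ v, (w u v * (if P u v then 0 else 1) + w u v * (if u ∈ s then 0 else 1) +
          w u v * (if q v ≤ Real.exp (-(H - c)) ∧ Q v then 0 else 1) +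
          w u v * (if v ∈ T then 1 else 0)) := by
      refine Finset.sum_le_sum fun u _ => Finset.sum_le_sum fun v _ => ?_
      rw [← mul_add, ← mul_add, ← mul_add]
      refine mul_le_mul_of_nonneg_left ?_ (h0 u v)
      by_cases hu : u ∈ D
      · rw [if_pos hu]
        refine add_nonneg (add_nonneg (add_nonneg ?_ ?_) ?_) ?_ <;> split_ifs <;> norm_num
      · rw [if_neg hu]
        by_cases hus : u ∈ s
        · by_cases hP : P u v
          · by_cases hv : q v ≤ Real.exp (-(H - c)) ∧ Q v
            · rw [if_pos hP, if_pos hus, if_pos hv, if_pos (hrest u hus hu v (Finset.mem_filter.2 ⟨Finset.mem_univ _, hv⟩) hP)]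
              norm_num
            · rw [if_neg hv]; split_ifs <;> norm_num
          · rw [if_neg hP]; split_ifs <;> norm_num
        · rw [if_neg hus]; split_ifs <;> norm_num
    simp only [Finset.sum_add_distrib] at key
    linarith

end Assign

/-! ### Block codes -/

section Block

variable {A B : Type} {n : ℕ} {M : (ℤ → A) → Prop}

/-- The origin is not covered by a block. -/
def Unc (M : (ℤ → A) → Prop) (n : ℕ) (x : ℤ → A) : Prop :=
  ∀ s : ℕ, s < n → ¬ M (shift (-(s : ℤ)) x)

/-- Blocks of length `n` starting at the markers do not overlap. -/
def Spaced (M : (ℤ → A) → Prop) (n : ℕ) : Prop :=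
  ∀ (x : ℤ → A) (d : ℤ), 0 < d → d < n → M x → ¬ M (shift d x)

lemma Spaced.unique (h : Spaced M n) {x : ℤ → A} {s t : ℕ} (hs : s < n) (ht : t < n)
    (hMs : M (shift (-(s : ℤ)) x)) (hMt : M (shift (-(t : ℤ)) x)) : s = t := by
  have key : ∀ {s t : ℕ}, s < t → t < n → M (shift (-(s : ℤ)) x) → ¬ M (shift (-(t : ℤ)) x) := by
    intro s t hst ht h1 h2
    refine h _ ((t : ℤ) - s) (by omega) (by omega) h2 ?_
    rw [shift_shift]
    convert h1 using 2
    ring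
  rcases lt_trichotomy s t with hlt | he | hlt
  · exact absurd hMt (key hlt ht hMs)
  · exact he
  · exact absurd hMs (key hlt hs hMt)

lemma Loc.unc {W W' : ℕ} (h : Loc W M) (hW : W + n ≤ W') : Loc W' (Unc M n) := by
  intro x y hxy
  refine propext (forall₂_congr fun s hs => not_congr (iff_of_eq ?_))
  exact (h.comp_shift (W' := W') (-(s : ℤ)) (by rw [abs_neg, Nat.abs_cast]; omega)) x y hxy

open Classical in
/-- The code applying `κ` to the blocks. -/
def blockCode (M : (ℤ → A) → Prop) (κ : (Fin n → A) → (Fin n → B)) (b₀ : B) (x : ℤ → A) : B :=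
  if h : ∃ s : Fin n, M (shift (-((s : ℕ) : ℤ)) x) then
    κ (word (-((h.choose : ℕ) : ℤ)) n x) h.choose else b₀

lemma word_blockCode (h : Spaced M n) (κ : (Fin n → A) → (Fin n → B)) (b₀ : B) {x : ℤ → A}
    (hx : M x) : word 0 n (code (blockCode M κ b₀) x) = κ (word 0 n x) := by
  ext s
  have hex : ∃ t : Fin n, M (shift (-((t : ℕ) : ℤ)) (shift (0 + (s : ℕ)) x)) :=
    ⟨s, by rw [shift_shift]; simpa [shift_zero] using hx⟩
  have e : hex.choose = s := Fin.ext (h.unique hex.choose.2 s.2 hex.choose_spec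
    (by rw [shift_shift]; simpa [shift_zero] using hx))
  simp only [word, code, blockCode]
  rw [dif_pos hex]
  simp only [e]
  congr 1
  ext i
  simp only [word, shift]
  congr 1
  ring

open Classical in
lemma Loc.blockCode {W W' : ℕ} (h : Loc W M) (κ : (Fin n → A) → (Fin n → B)) (b₀ : B)
    (hW : W + 2 * n ≤ W') : Loc W' (blockCode M κ b₀) := by
  intro x y hxy
  have e : (fun s : Fin n => M (shift (-((s : ℕ) : ℤ)) x)) =
      fun s : Fin n => M (shift (-((s : ℕ) : ℤ)) y) := by
    ext1 s
    have := s.2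
    exact (h.comp_shift (W' := W') (-((s : ℕ) : ℤ)) (by rw [abs_neg, Nat.abs_cast]; omega)) x y hxy
  have e2 : ∀ s : Fin n, word (-((s : ℕ) : ℤ)) n x = word (-((s : ℕ) : ℤ)) n y := fun s => by
    have := s.2
    exact Loc.of_word (W := W') (by rw [abs_neg, Nat.abs_cast]; omega) x y hxy
  have key : ∀ p q : Fin n → Prop, p = q → (if h : ∃ s, p s then κ
      (word (-((h.choose : ℕ) : ℤ)) n y) h.choose else b₀) = if h : ∃ s, q s then κ
      (word (-((h.choose : ℕ) : ℤ)) n y) h.choose else b₀ := by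
    rintro _ _ rfl
    rfl
  simp only [GibbsFormal.blockCode, e2]
  exact key _ _ e

variable [Fintype A] [Nonempty A] [MeasurableSpace A] [MeasurableSingletonClass A]
  {μ : Measure (ℤ → A)}

open Classical in
lemma block_mean (hμ : Stat μ) {W : ℕ} (hM : Loc W M) (hsp : Spaced M n)
    {Ψ : (ℤ → A) → ℝ} (hΨ : Loc W Ψ) : ∫ x, Ψ x ∂μ = ∫ x, (if Unc M n x then Ψ x else 0) ∂μ +
      ∫ x, (if M x then ∑ s ∈ Finset.range n, Ψ (shift s x) else 0) ∂μ := by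
  have := hμ.prob
  have hMs : ∀ s < n, Loc (W + n) fun x => M (shift (-(s : ℤ)) x) := fun s hs =>
    hM.comp_shift _ (by rw [abs_neg, Nat.abs_cast]; push_cast; omega)
  have hΨs : ∀ s < n, Loc (W + n) fun x => Ψ (shift (s : ℤ) x) := fun s hs =>
    hΨ.comp_shift _ (by rw [Nat.abs_cast]; push_cast; omega)
  have hI1 : Loc (W + n) fun x => if Unc M n x then Ψ x else 0 :=
    (hM.unc le_rfl).comp₂ (hΨ.mono (Nat.le_add_right _ _)) fun p a => if p then a else 0
  have hI2 : ∀ s < n, Loc (W + n) fun x => if M (shift (-(s : ℤ)) x) then Ψ x else 0 := fun s hs =>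
    (hMs s hs).comp₂ (hΨ.mono (Nat.le_add_right _ _)) fun p a => if p then a else 0
  have hI3 : ∀ s < n, Loc (W + n) fun x => if M x then Ψ (shift (s : ℤ) x) else 0 := fun s hs =>
    (hM.mono (Nat.le_add_right _ _)).comp₂ (hΨs s hs) fun p a => if p then a else 0
  have e : ∀ x, Ψ x = (if Unc M n x then Ψ x else 0) +
      ∑ s ∈ Finset.range n, if M (shift (-(s : ℤ)) x) then Ψ x else 0 := by
    intro x
    by_cases hu : Unc M n x
    · rw [if_pos hu, Finset.sum_eq_zero fun s hs => if_neg (hu s (Finset.mem_range.1 hs)), add_zero]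
    · rw [if_neg hu, zero_add]
      simp only [Unc, not_forall, not_not] at hu
      obtain ⟨s, hs, hMs⟩ := hu
      rw [Finset.sum_eq_single_of_mem s (Finset.mem_range.2 hs) fun t ht hne => if_neg fun h =>
        hne (hsp.unique (Finset.mem_range.1 ht) hs h hMs), if_pos hMs]
  rw [integral_congr_ae (Eventually.of_forall e), integral_add hI1.integrable
    (integrable_finsetSum _ fun s hs => (hI2 s (Finset.mem_range.1 hs)).integrable),
    integral_finsetSum _ fun s hs => (hI2 s (Finset.mem_range.1 hs)).integrable]
  congr 1
  trans ∑ s ∈ Finset.range n, ∫ x, (if M x then Ψ (shift (s : ℤ) x) else 0) ∂μ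
  · refine Finset.sum_congr rfl fun s hs => ?_
    have := hμ.integral_shift (-(s : ℤ)) (hI3 s (Finset.mem_range.1 hs)).measurable
    simpa only [shift_shift, add_neg_cancel, shift_zero] using this
  · rw [← integral_finsetSum _ fun s hs => (hI3 s (Finset.mem_range.1 hs)).integrable]
    refine integral_congr_ae (Eventually.of_forall fun x => ?_)
    by_cases h : M x <;> simp [h]

lemma measurableSet_unc {W : ℕ} (hM : Loc W M) : MeasurableSet {x | Unc M n x} :=
  (hM.unc le_rfl).measurableSet

lemma integral_ite_one {p : (ℤ → A) → Prop} [DecidablePred p] (hp : MeasurableSet {x | p x}) :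
    ∫ x, (if p x then (1 : ℝ) else 0) ∂μ = μ.real {x | p x} := by
  rw [← integral_indicator_one hp]
  refine integral_congr_ae (Eventually.of_forall fun x => ?_)
  simp [Set.indicator]

lemma block_prob (hμ : Stat μ) {W : ℕ} (hM : Loc W M) (hsp : Spaced M n) :
    μ.real {x | Unc M n x} + n * μ.real {x | M x} = 1 := by
  classical
  have := hμ.prob
  have h := block_mean hμ hM hsp (Loc.const (1 : ℝ) W)
  rw [integral_const, integral_ite_one (measurableSet_unc hM)] at h
  have e : ∫ x, (if M x then ∑ s ∈ Finset.range n, (1 : ℝ) else 0) ∂μ =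
      n * ∫ x, (if M x then (1 : ℝ) else 0) ∂μ := by
    rw [← integral_const_mul]
    refine integral_congr_ae (Eventually.of_forall fun x => ?_)
    by_cases hx : M x <;> simp [hx]
  rw [e, integral_ite_one hM.measurableSet] at h
  simpa using h.symm

open Classical in
lemma block_le (hμ : Stat μ) {W : ℕ} (hM : Loc W M) (hsp : Spaced M n)
    {Ψ b : (ℤ → A) → ℝ} (hΨ : Loc W Ψ) (hb : Loc W b) (hΨ1 : ∀ x, Ψ x ≤ 1) {a : ℝ} (ha : 0 ≤ a)
    (h : ∀ x, M x → ∑ s ∈ Finset.range n, Ψ (shift s x) ≤ n * a + n * b x) :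
    ∫ x, Ψ x ∂μ ≤ μ.real {x | Unc M n x} + a + n * ∫ x, (if M x then b x else 0) ∂μ := by
  have := hμ.prob
  have hΨs : ∀ s ∈ Finset.range n, Loc (W + n) fun x => Ψ (shift (s : ℤ) x) := fun s hs =>
    hΨ.comp_shift _ (by rw [Nat.abs_cast]; have := Finset.mem_range.1 hs; push_cast; omega)
  have hsum : Loc (W + n) fun x => ∑ s ∈ Finset.range n, Ψ (shift (s : ℤ) x) := fun x y hxy =>
    Finset.sum_congr rfl fun s hs => hΨs s hs x y hxy
  have hM' : Loc (W + n) M := hM.mono (Nat.le_add_right _ _)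
  have hI1 : Loc (W + n) fun x => if Unc M n x then Ψ x else 0 :=
    (hM.unc le_rfl).comp₂ (hΨ.mono (Nat.le_add_right _ _)) fun p a => if p then a else 0
  have hI1' : Loc (W + n) fun x => if Unc M n x then (1 : ℝ) else 0 :=
    (hM.unc le_rfl).comp fun p => if p then (1 : ℝ) else 0
  have hI3 : Loc (W + n) fun x => if M x then ∑ s ∈ Finset.range n, Ψ (shift (s : ℤ) x) else 0 :=
    hM'.comp₂ hsum fun p a => if p then a else 0
  have hI4 : Loc (W + n) fun x => if M x then (1 : ℝ) else 0 :=
    hM'.comp fun p => if p then (1 : ℝ) else 0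
  have hI5 : Loc (W + n) fun x => if M x then b x else 0 :=
    hM'.comp₂ (hb.mono (Nat.le_add_right _ _)) fun p a => if p then a else 0
  rw [block_mean hμ hM hsp hΨ, add_assoc]
  refine add_le_add ?_ ?_
  · rw [← integral_ite_one (measurableSet_unc hM)]
    refine integral_mono hI1.integrable hI1'.integrable fun x => ?_
    by_cases hx : Unc M n x
    · simpa [hx] using hΨ1 x
    · simp [hx]
  · have h1 : ∫ x, (if M x then ∑ s ∈ Finset.range n, Ψ (shift s x) else 0) ∂μ ≤
        ∫ x, (n * a * (if M x then (1 : ℝ) else 0) + n * (if M x then b x else 0)) ∂μ := by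
      refine integral_mono hI3.integrable ((hI4.integrable.const_mul _).add
        (hI5.integrable.const_mul _)) fun x => ?_
      by_cases hx : M x
      · simpa [hx] using h x hx
      · simp [hx]
    rw [integral_add (hI4.integrable.const_mul _) (hI5.integrable.const_mul _), integral_const_mul,
      integral_const_mul, integral_ite_one hM.measurableSet] at h1
    have hp := block_prob hμ hM hsp
    have : 0 ≤ μ.real {x | Unc M n x} := measureReal_nonneg
    have : n * a * μ.real {x | M x} ≤ a := by
      calc n * a * μ.real {x | M x} = a * (n * μ.real {x | M x}) := by ring
        _ ≤ a * 1 := by gcongr; linarith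
        _ = a := mul_one a
    linarith

lemma block_abs_le (hμ : Stat μ) {W : ℕ} (hM : Loc W M) (hsp : Spaced M n)
    {Ψ : (ℤ → A) → ℝ} (hΨ : Loc W Ψ) (hΨ1 : ∀ x, |Ψ x| ≤ 1) {a : ℝ} (ha : 0 ≤ a)
    (h : ∀ x, M x → |∑ s ∈ Finset.range n, Ψ (shift s x)| ≤ n * a) :
    |∫ x, Ψ x ∂μ| ≤ μ.real {x | Unc M n x} + a := by
  classical
  rw [abs_le']
  constructor
  · have := block_le hμ hM hsp hΨ (Loc.const 0 W) (fun x => (abs_le.1 (hΨ1 x)).2) ha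
      fun x hx => by rw [mul_zero, add_zero]; exact (abs_le.1 (h x hx)).2
    simpa using this
  · rw [← integral_neg]
    have := block_le hμ hM hsp (hΨ.comp fun a => -a) (Loc.const 0 W)
      (fun x => by linarith [(abs_le.1 (hΨ1 x)).1]) ha
      fun x hx => by
        rw [mul_zero, add_zero, Finset.sum_neg_distrib]; linarith [(abs_le.1 (h x hx)).1]
    simpa using this

/-! #### Entropy of block codes -/

open Classical in
/-- The information lost by a block code. -/
def lostInfo (M : (ℤ → A) → Prop) {k : ℕ} (idx : (Fin n → A) → Fin k) (hk : 0 < k)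
    (x : ℤ → A) : Fin 3 × Fin k × A :=
  if M x then (1, idx (word 0 n x), Classical.arbitrary A)
  else if Unc M n x then (2, ⟨0, hk⟩, x 0) else (0, ⟨0, hk⟩, Classical.arbitrary A)

lemma Loc.lostInfo {W W' : ℕ} (hM : Loc W M) (hW : W + n ≤ W') {k : ℕ}
    (idx : (Fin n → A) → Fin k) (hk : 0 < k) : Loc W' (lostInfo M idx hk) := by
  intro x y hxy
  have e1 : M x ↔ M y := iff_of_eq (hM.mono (by omega : W ≤ W') x y hxy)
  have e2 : Unc M n x ↔ Unc M n y := iff_of_eq (hM.unc hW x y hxy)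
  have e3 : word 0 n x = word 0 n y := Loc.of_word (W := W') (by simp; omega) x y hxy
  have e4 : x 0 = y 0 := hxy 0 (by simp)
  unfold GibbsFormal.lostInfo
  rw [e3, e4]
  by_cases h1 : M y
  · rw [if_pos h1, if_pos (e1.2 h1)]
  · rw [if_neg h1, if_neg (mt e1.1 h1)]
    by_cases h2 : Unc M n y
    · rw [if_pos h2, if_pos (e2.2 h2)]
    · rw [if_neg h2, if_neg (mt e2.1 h2)]

lemma eq_of_lostInfo {s : Finset (Fin n → A)} {κ : (Fin n → A) → (Fin n → B)} {b₀ : B} {k : ℕ}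
    {idx : (Fin n → A) → Fin k} {hk : 0 < k} (hsp : Spaced M n)
    (hinj : ∀ u ∈ s, ∀ u' ∈ s, κ u = κ u' → idx u = idx u' → u = u')
    (hs : ∀ x, M x → word 0 n x ∈ s) {N : ℕ} {x y : ℤ → A}
    (h1 : word 0 N (code (blockCode M κ b₀) x) = word 0 N (code (blockCode M κ b₀) y))
    (h2 : ∀ j : ℕ, j < N → lostInfo M idx hk (shift j x) = lostInfo M idx hk (shift j y))
    {i : ℕ} (hi : n ≤ i) (hi2 : i + n ≤ N) (hn : 0 < n) : x i = y i := by
  have hM : ∀ j : ℕ, j < N → M (shift j x) → M (shift j y) := by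
    intro j hj hx
    have := congrArg Prod.fst (h2 j hj)
    by_contra hy
    simp only [lostInfo, if_pos hx, if_neg hy] at this
    split_ifs at this <;> simp at this
  by_cases hu : Unc M n (shift i x)
  · have hx : ¬ M (shift i x) := by
      simpa [shift_zero] using hu 0 hn
    have := h2 i (by omega)
    simp only [lostInfo, if_neg hx, if_pos hu] at this
    split_ifs at this
    · simp at this
    · have := congrArg (fun a => a.2.2) this
      simpa [shift] using this
    · simp at this
  · simp only [Unc, not_forall, not_not] at hu
    obtain ⟨t, ht, hMx⟩ := hu
    rw [shift_shift, show (-(t : ℤ) + (i : ℕ)) = ((i - t : ℕ) : ℤ) by omega] at hMx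
    have hMy := hM _ (by omega) hMx
    have hj := h2 (i - t) (by omega)
    simp only [lostInfo, if_pos hMx, if_pos hMy] at hj
    have hidx := congrArg (fun a => a.2.1) hj
    have hκ : κ (word 0 n (shift ((i - t : ℕ) : ℤ) x)) = κ (word 0 n (shift ((i - t : ℕ) : ℤ) y)) := by
      rw [← word_blockCode hsp κ b₀ hMx, ← word_blockCode hsp κ b₀ hMy]
      ext r
      have hr := r.2
      have := congrFun h1 ⟨i - t + r, by omega⟩
      simp only [word, code, shift_shift] at this ⊢
      convert this using 3 <;> push_cast <;> ring
    have := congrFun (hinj _ (hs _ hMx) _ (hs _ hMy) hκ hidx) ⟨t, ht⟩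
    simp only [word, shift] at this
    convert this using 2 <;> omega

lemma ent_dlaw_word_le (hμ : Stat μ) {β : Type} [Fintype β] [Nonempty β] [MeasurableSpace β]
    [MeasurableSingletonClass β] {J : (ℤ → A) → β} (hJ : Measurable J) (N : ℕ) :
    ent (dlaw μ fun x => word 0 N (code J x)) ≤ N * ent (dlaw μ J) := by
  have := hμ.prob
  have hw : ∀ N, Measurable fun x => word 0 N (code J x) := fun N =>
    (measurable_word 0 N).comp (measurable_code hJ)
  induction N with
  | zero =>
    have := ent_le_log_card (p := dlaw μ fun x => word 0 0 (code J x)) (dlaw_nonneg _ _)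
      (sum_dlaw (hw 0))
    simpa using this
  | succ N ih =>
    have hs : Measurable fun x => J (shift (N : ℤ) x) := hJ.comp (measurable_shift _)
    have e : (fun x => word 0 (N + 1) (code J x)) = fun x =>
        (fun p : (Fin N → β) × β => (Fin.snoc p.1 p.2 : Fin (N + 1) → β))
          (word 0 N (code J x), J (shift (N : ℤ) x)) := by
      ext x i
      refine Fin.lastCases ?_ (fun i => ?_) i
      · simp [word, code]
      · simp [word]
    rw [e]
    have h1 := ent_dlaw_comp_le (μ := μ) ((hw N).prodMk hs)
      fun p : (Fin N → β) × β => (Fin.snoc p.1 p.2 : Fin (N + 1) → β)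
    have h2 := ent_dlaw_pair_le (μ := μ) (hw N) hs
    refine h1.trans (h2.trans ?_)
    rw [hμ.dlaw_shift _ hJ]
    push_cast
    linarith

lemma ent_lostInfo_le (hμ : Stat μ) {W : ℕ} (hM : Loc W M) {k : ℕ}
    (idx : (Fin n → A) → Fin k) (hk : 0 < k) {γ η : ℝ}
    (hη : ∀ p q : Fin 3 → ℝ, (∀ a, 0 ≤ p a) → (∀ a, 0 ≤ q a) → ∑ a, p a = 1 → ∑ a, q a = 1 →
      ∑ a, |p a - q a| ≤ η → |ent p - ent q| ≤ γ)
    (h : 2 * (μ.real {x | M x} + μ.real {x | Unc M n x}) ≤ η) :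
    ent (dlaw μ (lostInfo M idx hk)) ≤ γ + μ.real {x | M x} * Real.log k +
      μ.real {x | Unc M n x} * Real.log (Fintype.card A) := by
  classical
  have := hμ.prob
  set J := lostInfo M idx hk with hJ
  have hJm : Measurable J := (hM.lostInfo le_rfl idx hk).measurable
  let sup : Finset (Fin 3 × Fin k × A) := Finset.univ.filter fun a =>
    (a.1 = 1 → a.2.2 = Classical.arbitrary A) ∧ (a.1 = 2 → a.2.1 = ⟨0, hk⟩) ∧
      (a.1 = 0 → a.2 = (⟨0, hk⟩, Classical.arbitrary A))
  have hsupp : ∀ x, J x ∈ sup := by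
    intro x
    simp only [sup, Finset.mem_filter, Finset.mem_univ, true_and, hJ, lostInfo]
    split_ifs <;> simp
  let N : Fin 3 → ℝ := ![1, k, Fintype.card A]
  have h1 := ent_le_ent_push_add (Prod.fst : Fin 3 × Fin k × A → Fin 3) (p := dlaw μ J)
    (dlaw_nonneg _ _) (sum_dlaw hJm) sup (fun a ha => by
      have : J ⁻¹' {a} = ∅ := by
        ext x
        simp only [Set.mem_preimage, Set.mem_singleton_iff, Set.mem_empty_iff_false, iff_false]
        rintro rfl
        exact ha (hsupp x)
      rw [dlaw, this, measureReal_empty]) N (by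
      rintro ⟨i, j, a⟩ -
      fin_cases i
      · have : (sup.filter fun a' => a'.1 = 0) ⊆ {(0, ⟨0, hk⟩, Classical.arbitrary A)} := by
          rintro ⟨i', b⟩ hb
          simp only [sup, Finset.mem_filter, Finset.mem_univ, true_and] at hb
          simp [hb.2, hb.1.2.2 hb.2]
        simpa [N] using Finset.card_le_card this
      · have : (sup.filter fun a' => a'.1 = 1).card ≤ (Finset.univ : Finset (Fin k)).card := by
          refine Finset.card_le_card_of_injOn (fun a => a.2.1) (fun _ _ => by simp) ?_
          rintro ⟨i1, j1, a1⟩ h1 ⟨i2, j2, a2⟩ h2 he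
          simp only [sup, Finset.mem_filter, Finset.mem_univ, true_and, Finset.coe_filter,
            Set.mem_ofPred_eq] at h1 h2 he
          simp [h1.2, h2.2, h1.1.1 h1.2, h2.1.1 h2.2, he]
        simpa [N] using this
      · have : (sup.filter fun a' => a'.1 = 2).card ≤ (Finset.univ : Finset A).card := by
          refine Finset.card_le_card_of_injOn (fun a => a.2.2) (fun _ _ => by simp) ?_
          rintro ⟨i1, j1, a1⟩ h1 ⟨i2, j2, a2⟩ h2 he
          simp only [sup, Finset.mem_filter, Finset.mem_univ, true_and, Finset.coe_filter,
            Set.mem_ofPred_eq] at h1 h2 he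
          simp [h1.2, h2.2, h1.1.2.1 h1.2, h2.1.2.1 h2.2, he]
        simpa [N] using this)
  rw [← integral_dcomp hJm fun a => Real.log (N a.1), ← dlaw_comp hJm] at h1
  have hI1 : Loc (W + n) fun x => if M x then (1 : ℝ) else 0 :=
    (hM.mono (Nat.le_add_right _ _)).comp fun p => if p then (1 : ℝ) else 0
  have hI2 : Loc (W + n) fun x => if Unc M n x then (1 : ℝ) else 0 :=
    (hM.unc le_rfl).comp fun p => if p then (1 : ℝ) else 0
  have hk1 : 0 ≤ Real.log k := Real.log_natCast_nonneg _
  have hA1 : 0 ≤ Real.log (Fintype.card A) := Real.log_natCast_nonneg _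
  have h2 : ∫ x, Real.log (N (J x).1) ∂μ ≤ ∫ x, ((if M x then (1 : ℝ) else 0) * Real.log k +
      (if Unc M n x then (1 : ℝ) else 0) * Real.log (Fintype.card A)) ∂μ := by
    refine integral_mono (integrable_dcomp hJm fun a => Real.log (N a.1))
      ((hI1.integrable.mul_const _).add (hI2.integrable.mul_const _)) fun x => ?_
    simp only [hJ, lostInfo, N]
    split_ifs <;> simp [hA1]
  rw [integral_add (hI1.integrable.mul_const _) (hI2.integrable.mul_const _), integral_mul_const,
    integral_mul_const, integral_ite_one hM.measurableSet,
    integral_ite_one (measurableSet_unc hM)] at h2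
  have hfm : Measurable fun x => (J x).1 := measurable_fst.comp hJm
  set p := dlaw μ fun x => (J x).1 with hp
  have hp1 : ∑ a, p a = 1 := sum_dlaw hfm
  have hp0 : ∀ a, 0 ≤ p a := dlaw_nonneg _ _
  have e1 : p 1 ≤ μ.real {x | M x} := by
    refine measureReal_mono fun x hx => ?_
    simp only [Set.mem_preimage, Set.mem_singleton_iff, hJ, lostInfo] at hx
    by_contra hM
    rw [Set.mem_ofPred_eq] at hM
    rw [if_neg hM] at hx
    split_ifs at hx <;> simp at hx
  have e2 : p 2 ≤ μ.real {x | Unc M n x} := by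
    refine measureReal_mono fun x hx => ?_
    simp only [Set.mem_preimage, Set.mem_singleton_iff, hJ, lostInfo] at hx
    by_contra hM
    rw [Set.mem_ofPred_eq] at hM
    rw [if_neg hM] at hx
    split_ifs at hx <;> simp at hx
  have h3 := hη p ![1, 0, 0] hp0 (fun a => by fin_cases a <;> simp) hp1
    (by simp [Fin.sum_univ_three]) (by
      rw [Fin.sum_univ_three] at hp1 ⊢
      have := hp0 0
      have := hp0 1
      have := hp0 2
      simp only [Matrix.cons_val_zero, Matrix.cons_val_one, Matrix.cons_val, sub_zero]
      rw [abs_of_nonneg (hp0 1), abs_of_nonneg (hp0 2), abs_of_nonpos (by linarith)]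
      linarith)
  have h4 : ent (![1, 0, 0] : Fin 3 → ℝ) = 0 := by simp [ent, Fin.sum_univ_three]
  rw [h4, sub_zero] at h3
  have := (abs_le.1 h3).2
  linarith

lemma hrate_le_hrate_blockCode [Fintype B] [Nonempty B] [MeasurableSpace B]
    [MeasurableSingletonClass B] (hμ : Stat μ) {W : ℕ} (hM : Loc W M) (hsp : Spaced M n)
    (hn : 0 < n) {s : Finset (Fin n → A)} {κ : (Fin n → A) → (Fin n → B)} (b₀ : B) {k : ℕ}
    {idx : (Fin n → A) → Fin k} (hk : 0 < k)
    (hinj : ∀ u ∈ s, ∀ u' ∈ s, κ u = κ u' → idx u = idx u' → u = u')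
    (hs : ∀ x, M x → word 0 n x ∈ s) :
    hrate μ ≤ hrate (μ.map (code (blockCode M κ b₀))) + ent (dlaw μ (lostInfo M idx hk)) := by
  have := hμ.prob
  set F := blockCode M κ b₀
  set J := lostInfo M idx hk
  have hF : Loc (W + 2 * n) F := hM.blockCode κ b₀ le_rfl
  have hJ : Loc (W + n) J := hM.lostInfo le_rfl idx hk
  have : Nonempty (Fin k) := ⟨⟨0, hk⟩⟩
  have hν : Stat (μ.map (code F)) := hμ.map_code hF.measurable
  have hJ0 : 0 ≤ ent (dlaw μ J) := ent_nonneg (dlaw_nonneg _ _) (sum_dlaw hJ.measurable)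
  have hh := hμ.hrate_nonneg
  have := hν.le_hrate (r := hrate μ - ent (dlaw μ J)) (C := 2 * n * hrate μ) fun N => by
    have hν0 := hν.went_nonneg N
    by_cases hN : N < 2 * n
    · have : (N : ℝ) ≤ 2 * n := by exact_mod_cast hN.le
      nlinarith [mul_nonneg (Nat.cast_nonneg (α := ℝ) N) hJ0, mul_le_mul_of_nonneg_right this hh]
    · push Not at hN
      obtain ⟨m, rfl⟩ := Nat.exists_eq_add_of_le hN
      have h1 := hμ.mul_hrate_le 0 m
      rw [zero_add, hμ.went_zero, sub_zero] at h1
      have hZ : Measurable fun x => word 0 (2 * n + m) (code F x) :=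
        (measurable_word _ _).comp (measurable_code hF.measurable)
      have hJm : Measurable fun x => word 0 (2 * n + m) (code J x) :=
        (measurable_word _ _).comp (measurable_code hJ.measurable)
      have hfac : Function.FactorsThrough (word (A := A) n m)
          fun x => (word 0 (2 * n + m) (code F x), word 0 (2 * n + m) (code J x)) := by
        intro x y hxy
        obtain ⟨h1, h2⟩ := Prod.ext_iff.1 hxy
        ext i
        have hi := i.2
        have := eq_of_lostInfo (i := n + i) (idx := idx) (hk := hk) hsp hinj hs h1 (fun j hj => by
          have := congrFun h2 ⟨j, hj⟩
          simpa [word, code] using this) (by omega) (by omega) hn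
        simpa [word] using this
      obtain ⟨φ, hφ⟩ := (Function.factorsThrough_iff _).1 hfac
      have h2 : went μ m ≤ ent (dlaw μ fun x =>
          (word 0 (2 * n + m) (code F x), word 0 (2 * n + m) (code J x))) := by
        rw [went, ← hμ.dlaw_word n m, hφ]
        exact ent_dlaw_comp_le (hZ.prodMk hJm) φ
      have h3 := ent_dlaw_pair_le (μ := μ) hZ hJm
      have h4 := ent_dlaw_word_le hμ hJ.measurable (2 * n + m)
      rw [went, wl_map_code hF.measurable]
      push_cast at h4 ⊢
      nlinarith
  linarith

end Block

/-! ### Typical words -/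

section Typical

variable {B : Type} [Fintype B] [Nonempty B] [DecidableEq B] [MeasurableSpace B]
  [MeasurableSingletonClass B]

/-- The number of occurrences of a symbol. -/
def occ {C : Type} [DecidableEq C] {n : ℕ} (u : Fin n → C) (c : C) : ℝ := ∑ i, if u i = c then 1 else 0

lemma abs_occ_sub_le {C : Type} [DecidableEq C] {n : ℕ} (u v : Fin n → C) (c : C) :
    |occ u c - occ v c| ≤ ham u v := by
  rw [occ, occ, ← Finset.sum_sub_distrib, ham]
  refine (Finset.abs_sum_le_sum_abs _ _).trans (Finset.sum_le_sum fun i _ => ?_)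
  by_cases h : u i = v i
  · simp [h]
  · rw [if_neg h]
    split_ifs <;> simp

lemma loc_word_self (w : ℕ) : Loc w (word (A := B) 0 w) := Loc.of_word (by simp)

/-- The word has approximately the right frequencies of subwords. -/
def FreqOK (ρ : Measure (ℤ → B)) (w : ℕ) (a : ℝ) {n : ℕ} (v : Fin n → B) : Prop :=
  ∀ v₀ : Fin w → B, |occ (wcode (word 0 w) v) v₀ - n * wl ρ w v₀| ≤ a

lemma occ_code (w n : ℕ) (v₀ : Fin w → B) (y : ℤ → B) :
    occ (word 0 n (code (word 0 w) y)) v₀ =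
      ∑ i ∈ Finset.range n, if word 0 w (shift i y) = v₀ then 1 else 0 := by
  rw [occ, ← Fin.sum_univ_eq_sum_range fun i : ℕ => if word 0 w (shift i y) = v₀ then (1 : ℝ) else 0]
  simp [word, code]

open Classical in
lemma KRep.exists_freqOK {ρ : Measure (ℤ → B)} (R : KRep ρ) (hρ : Stat ρ) (w : ℕ) {θ ε : ℝ}
    (hθ : 0 < θ) (hε : 0 < ε) : ∃ N₀ : ℕ, ∀ n ≥ N₀,
      ∑ v, wl ρ n v * (if FreqOK ρ w (2 * θ * n) v then 0 else 1) ≤ ε := by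
  have := hρ.prob
  have hc : (0 : ℝ) < Fintype.card (Fin w → B) := by exact_mod_cast Fintype.card_pos
  have hloc : ∀ v₀ : Fin w → B, Loc w fun y : ℤ → B => if word 0 w y = v₀ then (1 : ℝ) else 0 :=
    fun v₀ => (loc_word_self w).comp fun v => if v = v₀ then (1 : ℝ) else 0
  choose N hN using fun v₀ : Fin w → B =>
    R.lln_loc hρ (hloc v₀) (δ := θ) (ε := ε / Fintype.card (Fin w → B)) hθ (by positivity)
  obtain ⟨K, hK⟩ := exists_nat_ge (2 * w / θ)
  refine ⟨max (Finset.univ.sup N) K, fun n hn => ?_⟩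
  have hn1 : ∀ v₀, N v₀ ≤ n := fun v₀ =>
    (Finset.le_sup (Finset.mem_univ v₀)).trans ((le_max_left _ _).trans hn)
  have hnK : 2 * w / θ ≤ (n : ℝ) := hK.trans (by exact_mod_cast (le_max_right _ _).trans hn)
  rw [div_le_iff₀ hθ] at hnK
  have e : ∑ v, wl ρ n v * (if FreqOK ρ w (2 * θ * n) v then (0 : ℝ) else 1) =
      ρ.real {y | ¬ FreqOK ρ w (2 * θ * n) (word 0 n y)} := by
    rw [prob_dcomp (measurable_word 0 n) fun v => ¬ FreqOK ρ w (2 * θ * n) v]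
    simp only [ite_not, wl]
  rw [e]
  have hsub : {y | ¬ FreqOK ρ w (2 * θ * n) (word 0 n y)} ⊆ ⋃ v₀ : Fin w → B,
      {y | θ * n ≤ |∑ i ∈ Finset.range n, ((if word 0 w (shift i y) = v₀ then (1 : ℝ) else 0) -
        ∫ y, (if word 0 w y = v₀ then (1 : ℝ) else 0) ∂ρ)|} := by
    intro y hy
    rw [Set.mem_ofPred_eq, FreqOK] at hy
    push Not at hy
    obtain ⟨v₀, hv⟩ := hy
    refine Set.mem_iUnion.2 ⟨v₀, ?_⟩
    have e1 : ∫ y, (if word 0 w y = v₀ then (1 : ℝ) else 0) ∂ρ = wl ρ w v₀ :=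
      integral_ite_one (p := fun y => word 0 w y = v₀)
        ((measurable_word 0 w) (measurableSet_singleton v₀))
    rw [Set.mem_ofPred_eq, Finset.sum_sub_distrib, ← occ_code, e1, Finset.sum_const,
      Finset.card_range, nsmul_eq_mul]
    have h1 := abs_occ_sub_le (wcode (word 0 w) (word 0 n y)) (word 0 n (code (word 0 w) y)) v₀
    have h2 := ham_wcode (loc_word_self (B := B) w) (n := n) 0 y
    have h3 := abs_sub_abs_le_abs_sub (occ (wcode (word 0 w) (word 0 n y)) v₀ - n * wl ρ w v₀)
      (occ (word 0 n (code (word 0 w) y)) v₀ - n * wl ρ w v₀)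
    rw [sub_sub_sub_cancel_right] at h3
    linarith
  refine (measureReal_mono hsub).trans ((measureReal_iUnion_fintype_le _).trans
    ((Finset.sum_le_sum fun v₀ _ => hN v₀ n (hn1 v₀)).trans ?_))
  rw [Finset.sum_const, Finset.card_univ, nsmul_eq_mul]
  field_simp
  exact le_rfl

lemma KRep.exists_typical {ρ : Measure (ℤ → B)} (R : KRep ρ) (hρ : Stat ρ) {γ ε : ℝ}
    (hγ : 0 < γ) (hε : 0 < ε) : ∃ N₀ : ℕ, ∀ n ≥ N₀,
      ∑ v, wl ρ n v * (if Real.exp (-(n * hrate ρ + γ * n)) ≤ wl ρ n v ∧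
        wl ρ n v ≤ Real.exp (-(n * hrate ρ - γ * n)) then 0 else 1) ≤ ε := by
  classical
  have := hρ.prob
  obtain ⟨N₀, hN₀⟩ := R.aep hρ hγ hε
  refine ⟨N₀, fun n hn => le_trans ?_ (hN₀ n hn)⟩
  have e : ∑ v, wl ρ n v * (if Real.exp (-(n * hrate ρ + γ * n)) ≤ wl ρ n v ∧
        wl ρ n v ≤ Real.exp (-(n * hrate ρ - γ * n)) then (0 : ℝ) else 1) =
      ρ.real {y | ¬ (Real.exp (-(n * hrate ρ + γ * n)) ≤ wl ρ n (word 0 n y) ∧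
        wl ρ n (word 0 n y) ≤ Real.exp (-(n * hrate ρ - γ * n)))} := by
    rw [prob_dcomp (measurable_word 0 n) fun v => ¬ (Real.exp (-(n * hrate ρ + γ * n)) ≤ wl ρ n v ∧
        wl ρ n v ≤ Real.exp (-(n * hrate ρ - γ * n)))]
    refine Finset.sum_congr rfl fun v _ => ?_
    rw [ite_not]
    rfl
  rw [e]
  refine measureReal_mono fun y hy => ?_
  rw [Set.mem_ofPred_eq] at hy ⊢
  by_contra hlt
  push Not at hlt
  rw [abs_lt] at hlt
  have hpos := R.wl_pos n (word 0 n y)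
  refine hy ⟨?_, ?_⟩
  · rw [← Real.le_log_iff_exp_le hpos]; linarith
  · rw [← Real.log_le_iff_le_exp hpos]; linarith

end Typical

/-! ### The coding lemma -/

section Coding

variable {A B : Type} [Fintype A] [Nonempty A] [DecidableEq A] [MeasurableSpace A]
  [MeasurableSingletonClass A] [Fintype B] [Nonempty B] [DecidableEq B] [MeasurableSpace B]
  [MeasurableSingletonClass B] {μ : Measure (ℤ → A)} {ρ : Measure (ℤ → B)} {n : ℕ}

lemma Loc.code_comp {C : Type*} {W W' : ℕ} {F : (ℤ → A) → B} {G : (ℤ → B) → C} (hF : Loc W F)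
    (hG : Loc W' G) : Loc (W + W') fun x => G (code F x) := by
  intro x y hxy
  refine hG _ _ fun i hi => ?_
  exact hF.comp_shift (W' := W + W') i (by push_cast; linarith) x y hxy

lemma sum_ite_ne_eq_ham {C : Type} [DecidableEq C] (X Y : (ℤ → A) → C) (n : ℕ) (x : ℤ → A) :
    ∑ s ∈ Finset.range n, (if X (shift s x) = Y (shift s x) then (0 : ℝ) else 1) =
      ham (word 0 n (code X x)) (word 0 n (code Y x)) := by
  rw [ham, ← Fin.sum_univ_eq_sum_range
    fun s : ℕ => if X (shift s x) = Y (shift s x) then (0 : ℝ) else 1]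
  simp [word, code]

open Classical in
lemma block_ham_le {M : (ℤ → A) → Prop} (hμ : Stat μ) {W : ℕ} (hM : Loc W M) (hsp : Spaced M n)
    {C : Type} [DecidableEq C] {X Y : (ℤ → A) → C} (hX : Loc W X) (hY : Loc W Y)
    {D : Finset (Fin n → A)} (hW : n ≤ W) {a : ℝ} (ha : 0 ≤ a)
    (h : ∀ x, M x → ham (word 0 n (code X x)) (word 0 n (code Y x)) ≤
      n * a + n * (if word 0 n x ∈ D then 0 else 1)) :
    μ.real {x | X x ≠ Y x} ≤ μ.real {x | Unc M n x} + a +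
      n * ∫ x, (if M x then (if word 0 n x ∈ D then 0 else 1) else 0) ∂μ := by
  have hΨ : Loc W fun x => if X x = Y x then (0 : ℝ) else 1 :=
    hX.comp₂ hY fun a b => if a = b then (0 : ℝ) else 1
  have hb : Loc W fun x : ℤ → A => if word 0 n x ∈ D then (0 : ℝ) else 1 :=
    (Loc.of_word (A := A) (n := n) (t := 0) (W := W) (by simpa using hW)).comp
      fun u => if u ∈ D then (0 : ℝ) else 1
  have := block_le hμ hM hsp hΨ hb (fun x => by split_ifs <;> norm_num) ha fun x hx => by
    rw [sum_ite_ne_eq_ham]; exact h x hx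
  rw [← integral_ite_one (hX.comp₂ hY fun a b => a ≠ b).measurableSet]
  simpa only [ite_not] using this

/-- For infinitely many lengths, words of `μ` and `ρ` can be coupled so that the codes `F` and `G`
make few errors. -/
def Good (μ : Measure (ℤ → A)) (ρ : Measure (ℤ → B)) (F : (ℤ → A) → B) (δF : ℝ)
    (G : (ℤ → B) → A) (δG β : ℝ) : Prop :=
  ∃ᶠ n : ℕ in atTop, Cpl (wl μ n) (wl ρ n)
    (fun u v => if ham (wcode F u) v ≤ δF * n ∧ ham u (wcode G v) ≤ δG * n then 0 else 1) β

set_option maxHeartbeats 400000 in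
open Classical in
/-- One block length of the coding lemma. -/
lemma exists_coding_aux (R : KRep μ) (hμ : Stat μ) (hρ : Stat ρ)
    (hA : 2 ≤ Fintype.card A)
    (hh : hrate μ = hrate ρ) {WF WG : ℕ} {F : (ℤ → A) → B} (hF : Loc WF F) {G : (ℤ → B) → A}
    (hG : Loc WG G) {δF δG β : ℝ} (hδF : 0 ≤ δF) (hδG : 0 ≤ δG) {n : ℕ} (hn : 0 < n)
    (hcpl : Cpl (wl μ n) (wl ρ n) (fun u v => if ham (wcode F u) v ≤ δF * n ∧
      ham u (wcode G v) ≤ δG * n then 0 else 1) β) {θ γ γ' : ℝ} (hθ : 0 < θ) (hθ2 : θ ≤ 1 / 2)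
    (w : ℕ) (hγ2 : 2 ≤ Real.exp (γ * n)) (hγε : Real.exp (-(γ * n)) ≤ θ ^ 2)
    (hn1 : 1 ≤ θ * n) (hnF : 2 * WF ≤ θ * n) (hnG : 2 * WG ≤ θ * n) (hnw : 2 * w ≤ θ * n)
    (hT : ∑ v, wl μ n v * (if Real.exp (-(n * hrate μ + γ * n)) ≤ wl μ n v ∧
        wl μ n v ≤ Real.exp (-(n * hrate μ - γ * n)) then 0 else 1) ≤ θ ^ 2)
    (hT' : ∑ v, wl ρ n v * (if Real.exp (-(n * hrate ρ + γ * n)) ≤ wl ρ n v ∧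
        wl ρ n v ≤ Real.exp (-(n * hrate ρ - γ * n)) then 0 else 1) ≤ θ ^ 2)
    (hQ : ∑ v, wl ρ n v * (if FreqOK ρ w (2 * θ * n) v then 0 else 1) ≤ θ ^ 2)
    (hη : ∀ p q : Fin 3 → ℝ, (∀ a, 0 ≤ p a) → (∀ a, 0 ≤ q a) → ∑ a, p a = 1 → ∑ a, q a = 1 →
      ∑ a, |p a - q a| ≤ 8 * θ → |ent p - ent q| ≤ γ') :
    ∃ (W : ℕ) (F₂ : (ℤ → A) → B), Loc W F₂ ∧
      (∀ v, |wl (μ.map (code F₂)) w v - wl ρ w v| ≤ 6 * θ) ∧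
      hrate μ - (γ' + 3 * γ + Real.log 4 / n + 3 * θ * Real.log (Fintype.card A)) ≤
        hrate (μ.map (code F₂)) ∧
      μ.real {x | F₂ x ≠ F x} ≤ δF + β + 9 * θ ∧
      μ.real {x | G (code F₂ x) ≠ x 0} ≤ δG + β + 9 * θ := by
  have := hμ.prob
  have hnR : (0 : ℝ) < n := by exact_mod_cast hn
  have hθθ : θ ^ 2 ≤ θ / 2 := by nlinarith
  obtain ⟨s, D, f, k, idx, hk, hlogk, hinj, hfQ, hfD, hps, hpD⟩ := exists_typical_assign
    (P := fun u v => ham (wcode F u) v ≤ δF * n ∧ ham u (wcode G v) ≤ δG * n) (H := n * hrate μ)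
    (c := γ * n) (ε := θ ^ 2) (b := β) (by convert hcpl) (wl_nonneg μ n) (hμ.sum_wl n) (hρ.sum_wl n)
    (by nlinarith) hγ2 hγε (FreqOK ρ w (2 * θ * n))
    (le_trans (Finset.sum_le_sum fun u _ => mul_le_mul_of_nonneg_left (by
      split_ifs with h1 h2 h2
      · exact le_rfl
      · norm_num
      · exact absurd h2.1 h1
      · exact le_rfl) (wl_nonneg μ n u)) hT)
    (by
      rw [hh]
      refine le_trans ?_ ((add_le_add hT' hQ).trans (two_mul (θ ^ 2)).ge)
      rw [← Finset.sum_add_distrib]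
      refine Finset.sum_le_sum fun v _ => ?_
      rw [← mul_add]
      refine mul_le_mul_of_nonneg_left ?_ (wl_nonneg ρ n v)
      by_cases h1 : FreqOK ρ w (2 * θ * n) v
      · by_cases h2 : wl ρ n v ≤ Real.exp (-(n * hrate ρ - γ * n))
        · simp only [h1, h2, and_self, if_true]
          split_ifs <;> norm_num
        · rw [if_neg fun h => h2 h.1, if_neg fun h => h2 h.2, if_pos h1]
          norm_num
      · simp only [h1, and_false, if_false]
        split_ifs <;> norm_num)
  set g : (Fin n → A) → ℝ := fun u => (if u ∈ D then 0 else 1) + θ⁻¹ * (if u ∈ s then 0 else 1) with hg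
  have hg0 : ∀ u, 0 ≤ g u := fun u => by
    have : 0 < θ⁻¹ := inv_pos.2 hθ
    simp only [hg]
    split_ifs <;> simp <;> linarith
  obtain ⟨W, M, hM, hsp, hMu, hMg⟩ := R.exists_marker hμ hA hn (η := θ ^ 2) (by positivity) g hg0
  -- integrals over the markers
  have hwD : Loc (W + n) fun x : ℤ → A => if word 0 n x ∈ D then (0 : ℝ) else 1 :=
    (Loc.of_word (A := A) (n := n) (t := 0) (W := W + n) (by simp)).comp
      fun u => if u ∈ D then (0 : ℝ) else 1
  have hws : Loc (W + n) fun x : ℤ → A => if word 0 n x ∈ s then (0 : ℝ) else 1 :=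
    (Loc.of_word (A := A) (n := n) (t := 0) (W := W + n) (by simp)).comp
      fun u => if u ∈ s then (0 : ℝ) else 1
  have hMn : Loc (W + n) M := hM.mono (Nat.le_add_right _ _)
  have hID : Loc (W + n) fun x => if M x then (if word 0 n x ∈ D then (0 : ℝ) else 1) else 0 :=
    hMn.comp₂ hwD fun p a => if p then a else 0
  have hIs : Loc (W + n) fun x => if M x then (if word 0 n x ∈ s then (0 : ℝ) else 1) else 0 :=
    hMn.comp₂ hws fun p a => if p then a else 0
  set ID := ∫ x, (if M x then (if word 0 n x ∈ D then (0 : ℝ) else 1) else 0) ∂μ with hIDdef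
  set Is := ∫ x, (if M x then (if word 0 n x ∈ s then (0 : ℝ) else 1) else 0) ∂μ with hIsdef
  have hID0 : 0 ≤ ID := integral_nonneg fun x => by dsimp only; split_ifs <;> norm_num
  have hIs0 : 0 ≤ Is := integral_nonneg fun x => by dsimp only; split_ifs <;> norm_num
  have hMg' : n * ID + θ⁻¹ * (n * Is) ≤ (∑ u, wl μ n u * (if u ∈ D then 0 else 1)) +
      θ⁻¹ * ∑ u, wl μ n u * (if u ∈ s then 0 else 1) := by
    have e1 : ∫ x, (if M x then g (word 0 n x) else 0) ∂μ = ID + θ⁻¹ * Is := by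
      rw [hIDdef, hIsdef, ← integral_const_mul, ← integral_add hID.integrable
        (hIs.integrable.const_mul _)]
      refine integral_congr_ae (Eventually.of_forall fun x => ?_)
      by_cases h : M x <;> simp [h, hg]
    have e2 : ∑ u, wl μ n u * g u = (∑ u, wl μ n u * (if u ∈ D then 0 else 1)) +
        θ⁻¹ * ∑ u, wl μ n u * (if u ∈ s then 0 else 1) := by
      rw [Finset.mul_sum, ← Finset.sum_add_distrib]
      refine Finset.sum_congr rfl fun u _ => ?_
      simp only [hg]
      ring
    rw [e1, e2] at hMg
    linarith
  have hθs : θ⁻¹ * ∑ u, wl μ n u * (if u ∈ s then 0 else 1) ≤ θ := by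
    calc _ ≤ θ⁻¹ * θ ^ 2 := by gcongr
      _ = θ := by field_simp
  have hD1 : ∑ u, wl μ n u * (if u ∈ D then 0 else 1) ≤ 1 := by
    refine (Finset.sum_le_sum fun u _ => ?_).trans (hμ.sum_wl n).le
    split_ifs
    · simpa using wl_nonneg μ n u
    · simp
  have hnID : n * ID ≤ β + 3 * θ := by
    have : 0 ≤ θ⁻¹ * (n * Is) := by positivity
    linarith
  have hnIs : n * Is ≤ 2 * θ := by
    have h1 : θ⁻¹ * (n * Is) ≤ 1 + θ := by
      have : 0 ≤ n * ID := by positivity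
      linarith
    have h2 : n * Is ≤ θ * (1 + θ) := by
      rwa [inv_mul_le_iff₀ hθ] at h1
    nlinarith
  -- restrict the markers to typical blocks
  obtain ⟨M', hM'def⟩ : ∃ M' : (ℤ → A) → Prop, M' = fun x => M x ∧ word 0 n x ∈ s := ⟨_, rfl⟩
  have hM' : Loc (W + n) M' := hM'def ▸ hMn.comp₂
    (Loc.of_word (A := A) (n := n) (t := 0) (W := W + n) (by simp)) fun p u => p ∧ u ∈ s
  have hsp' : Spaced M' n := by
    subst hM'def
    exact fun x d h1 h2 h3 h4 => hsp x d h1 h2 h3.1 h4.1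
  have hM's : ∀ x, M' x → word 0 n x ∈ s := fun x hx => by
    subst hM'def
    exact hx.2
  have hb := block_prob hμ hM hsp
  have hb' := block_prob hμ hM' hsp'
  have hsplit : μ.real {x | M x} = μ.real {x | M' x} + Is := by
    rw [← integral_ite_one hMn.measurableSet, ← integral_ite_one hM'.measurableSet, hIsdef,
      ← integral_add (hM'.comp fun p => if p then (1 : ℝ) else 0).integrable hIs.integrable]
    refine integral_congr_ae (Eventually.of_forall fun x => ?_)
    by_cases h : M x <;> by_cases h' : word 0 n x ∈ s <;> simp [h, h', hM'def]
  have hU : μ.real {x | Unc M' n x} ≤ 3 * θ := by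
    have : μ.real {x | Unc M n x} ≤ θ ^ 2 := hMu
    rw [hsplit] at hb
    linarith
  have hID' : n * ∫ x, (if M' x then (if word 0 n x ∈ D then (0 : ℝ) else 1) else 0) ∂μ ≤
      β + 3 * θ := by
    refine le_trans (mul_le_mul_of_nonneg_left ?_ hnR.le) hnID
    refine integral_mono (hM'.comp₂ hwD fun p a => if p then a else 0).integrable hID.integrable
      fun x => ?_
    by_cases h : M x <;> by_cases h' : word 0 n x ∈ s <;> simp [h, h', hM'def]
    split_ifs <;> norm_num
  obtain ⟨b₀⟩ := (inferInstance : Nonempty B)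
  set F₂ := blockCode M' f b₀ with hF₂
  have hF₂loc : Loc (W + n + 2 * n) F₂ := hM'.blockCode f b₀ le_rfl
  have hword : ∀ x, M' x → word 0 n (code F₂ x) = f (word 0 n x) := fun x hx =>
    word_blockCode hsp' f b₀ hx
  set W' := W + n + 2 * n + WF + WG + w with hW'
  have hM'W : Loc W' M' := hM'.mono (by omega)
  have hP0 : 0 ≤ μ.real {x | Unc M' n x} := measureReal_nonneg
  have hPM : μ.real {x | M' x} ≤ 1 / n := by
    rw [le_div_iff₀ hnR]; linarith
  have hwF : 2 * (WF : ℝ) / n ≤ θ := by rwa [div_le_iff₀ hnR]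
  have hwG : 2 * (WG : ℝ) / n ≤ θ := by rwa [div_le_iff₀ hnR]
  have hww : 2 * (w : ℝ) / n ≤ θ := by rwa [div_le_iff₀ hnR]
  refine ⟨_, F₂, hF₂loc, fun v => ?_, ?_, ?_, ?_⟩
  · have hloc : Loc W' fun x => word 0 w (code F₂ x) :=
      hF₂loc.of_word_code (by simp; omega)
    have hΨ : Loc W' fun x => (if word 0 w (code F₂ x) = v then (1 : ℝ) else 0) - wl ρ w v :=
      hloc.comp fun u => (if u = v then (1 : ℝ) else 0) - wl ρ w v
    have hI : Loc W' fun x => (if word 0 w (code F₂ x) = v then (1 : ℝ) else 0) :=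
      hloc.comp fun u => (if u = v then (1 : ℝ) else 0)
    have hwl1 : wl ρ w v ≤ 1 := by
      rw [← hρ.sum_wl w]
      exact Finset.single_le_sum (fun u _ => wl_nonneg ρ w u) (Finset.mem_univ v)
    have hwl0 := wl_nonneg ρ w v
    have := block_abs_le hμ hM'W hsp' hΨ (fun x => by rw [abs_le]; split_ifs <;> constructor <;> linarith)
      (a := 3 * θ) (by positivity) fun x hx => by
        rw [Finset.sum_sub_distrib, Finset.sum_const, Finset.card_range, nsmul_eq_mul]
        simp only [code_shift]
        have e := occ_code w n v (code F₂ x)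
        have e' : (∑ i ∈ Finset.range n, if word 0 w (shift i (code F₂ x)) = v then (1 : ℝ) else 0) =
          occ (word 0 n (code (word 0 w) (code F₂ x))) v := by
            rw [e]
        rw [e']
        have h1 := abs_occ_sub_le (word 0 n (code (word 0 w) (code F₂ x)))
          (wcode (word 0 w) (word 0 n (code F₂ x))) v
        have h2 := ham_wcode (loc_word_self (B := B) w) (n := n) 0 (code F₂ x)
        rw [ham_comm] at h2
        have h3 := hfQ _ (hM's x hx) v
        rw [← hword x hx] at h3
        have h4 := abs_sub_le (occ (word 0 n (code (word 0 w) (code F₂ x))) v)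
          (occ (wcode (word 0 w) (word 0 n (code F₂ x))) v) (n * wl ρ w v)
        linarith
    rw [integral_sub hI.integrable (integrable_const _), integral_ite_one
      (hloc.comp fun u => u = v).measurableSet, integral_const, probReal_univ, one_smul] at this
    rw [wl_map_code hF₂loc.measurable]
    refine le_trans this ?_
    linarith
  · have h1 := hrate_le_hrate_blockCode hμ hM' hsp' hn b₀ (idx := idx) hk hinj hM's
    have hn1' : 1 / (n : ℝ) ≤ θ := by rwa [div_le_iff₀ hnR]
    have h2 := ent_lostInfo_le hμ hM' idx hk hη (by linarith)
    have hk1 : 0 ≤ Real.log k := Real.log_natCast_nonneg _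
    have hA1 : 0 ≤ Real.log (Fintype.card A) := Real.log_natCast_nonneg _
    have h3 : μ.real {x | M' x} * Real.log k ≤ 3 * γ + Real.log 4 / n := by
      calc _ ≤ 1 / n * (3 * (γ * n) + Real.log 4) :=
            mul_le_mul hPM hlogk hk1 (by positivity)
        _ = _ := by field_simp
    have h4 := mul_le_mul_of_nonneg_right hU hA1
    linarith
  · refine (block_ham_le hμ hM'W hsp' (hF₂loc.mono (by omega)) (hF.mono (by omega)) (D := D)
      (a := δF + 2 * WF / n) (by omega) (by positivity) fun x hx => ?_).trans ?_
    · rw [hword x hx]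
      split_ifs with hD
      · have h1 := (hfD _ hD).1
        have h2 := ham_wcode hF (n := n) 0 x
        have h3 := ham_triangle (f (word 0 n x)) (wcode F (word 0 n x)) (word 0 n (code F x))
        rw [ham_comm] at h1
        have e : (n : ℝ) * (δF + 2 * WF / n) = δF * n + 2 * WF := by field_simp
        linarith
      · have := ham_le (f (word 0 n x)) (word 0 n (code F x))
        have : 0 ≤ (n : ℝ) * (δF + 2 * WF / n) := by positivity
        linarith
    · linarith
  · refine (block_ham_le hμ hM'W hsp' (X := fun x => G (code F₂ x)) (Y := fun x => x 0)
      ((hF₂loc.code_comp hG).mono (by omega)) (fun x y h => h 0 (by simp)) (D := D)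
      (a := δG + 2 * WG / n) (by omega) (by positivity) fun x hx => ?_).trans ?_
    · have e1 : code (fun x => G (code F₂ x)) x = code G (code F₂ x) := by
        ext i; simp [code, ← code_shift]
      have e2 : code (fun x : ℤ → A => x 0) x = x := by
        ext i; simp [code, shift]
      rw [e1, e2]
      split_ifs with hD
      · have h1 := (hfD _ hD).2
        have h2 := ham_wcode hG (n := n) 0 (code F₂ x)
        rw [hword x hx] at h2
        have h3 := ham_triangle (word 0 n (code G (code F₂ x))) (wcode G (f (word 0 n x)))
          (word 0 n x)
        rw [ham_comm] at h1 h2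
        have e : (n : ℝ) * (δG + 2 * WG / n) = δG * n + 2 * WG := by field_simp
        linarith
      · have := ham_le (word 0 n (code G (code F₂ x))) (word 0 n x)
        have : 0 ≤ (n : ℝ) * (δG + 2 * WG / n) := by positivity
        linarith
    · linarith

/-- The coding lemma: a partial matching of long words is realised by a stationary code. -/
lemma exists_coding (R : KRep μ) (hμ : Stat μ) (R' : KRep ρ) (hρ : Stat ρ)
    (hA : 2 ≤ Fintype.card A) (hh : hrate μ = hrate ρ) {WF WG : ℕ} {F : (ℤ → A) → B}
    (hF : Loc WF F) {G : (ℤ → B) → A} (hG : Loc WG G) {δF δG β : ℝ} (hδF : 0 ≤ δF) (hδG : 0 ≤ δG)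
    (hgood : Good μ ρ F δF G δG β) (w : ℕ) {η : ℝ} (hη : 0 < η) :
    ∃ (W : ℕ) (F₂ : (ℤ → A) → B), Loc W F₂ ∧
      (∑ v, |wl (μ.map (code F₂)) w v - wl ρ w v|) ≤ η ∧
      hrate ρ - η ≤ hrate (μ.map (code F₂)) ∧
      μ.real {x | F₂ x ≠ F x} ≤ δF + β + η ∧
      μ.real {x | G (code F₂ x) ≠ x 0} ≤ δG + β + η := by
  obtain ⟨η₁, hη₁, hent⟩ := ent_continuous (α := Fin 3) (η / 4) (by positivity)
  have hl0 : 0 ≤ Real.log (Fintype.card A) := Real.log_natCast_nonneg _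
  have hc : (0 : ℝ) < Fintype.card (Fin w → B) := by exact_mod_cast Fintype.card_pos
  obtain ⟨θ, hθ, hθ1, hθ2, hθ3, hθ4, hθ5⟩ : ∃ θ : ℝ, 0 < θ ∧ θ ≤ 1 / 2 ∧ 8 * θ ≤ η₁ ∧ 9 * θ ≤ η ∧
      3 * θ * Real.log (Fintype.card A) ≤ η / 4 ∧ Fintype.card (Fin w → B) * (6 * θ) ≤ η := by
    refine ⟨min (min (1 / 2) (η₁ / 8)) (min (η / 9) (min (η / (12 * (Real.log (Fintype.card A) + 1)))
      (η / (6 * Fintype.card (Fin w → B))))), by positivity, ?_, ?_, ?_, ?_, ?_⟩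
    · exact (min_le_left _ _).trans (min_le_left _ _)
    · have := (min_le_left (min (1 / 2) (η₁ / 8)) (min (η / 9)
        (min (η / (12 * (Real.log (Fintype.card A) + 1)))
        (η / (6 * Fintype.card (Fin w → B)))))).trans (min_le_right _ _)
      linarith
    · have := (min_le_right (min (1 / 2) (η₁ / 8)) (min (η / 9)
        (min (η / (12 * (Real.log (Fintype.card A) + 1)))
        (η / (6 * Fintype.card (Fin w → B)))))).trans (min_le_left _ _)
      linarith
    · have := ((min_le_right (min (1 / 2) (η₁ / 8)) (min (η / 9)
        (min (η / (12 * (Real.log (Fintype.card A) + 1)))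
        (η / (6 * Fintype.card (Fin w → B)))))).trans (min_le_right _ _)).trans (min_le_left _ _)
      rw [le_div_iff₀ (by positivity)] at this
      have h0 : 0 < min (min (1 / 2) (η₁ / 8)) (min (η / 9)
        (min (η / (12 * (Real.log (Fintype.card A) + 1)))
        (η / (6 * Fintype.card (Fin w → B))))) := by positivity
      linarith
    · have := ((min_le_right (min (1 / 2) (η₁ / 8)) (min (η / 9)
        (min (η / (12 * (Real.log (Fintype.card A) + 1)))
        (η / (6 * Fintype.card (Fin w → B)))))).trans (min_le_right _ _)).trans (min_le_right _ _)
      rw [le_div_iff₀ (by positivity)] at this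
      linarith
  have hγ : 0 < η / 24 := by positivity
  obtain ⟨N₁, hN₁⟩ := R.exists_typical hμ hγ (ε := θ ^ 2) (by positivity)
  obtain ⟨N₂, hN₂⟩ := R'.exists_typical hρ hγ (ε := θ ^ 2) (by positivity)
  obtain ⟨N₃, hN₃⟩ := R'.exists_freqOK hρ w hθ (ε := θ ^ 2) (by positivity)
  have ht : ∀ c : ℝ, 0 < c → Tendsto (fun n : ℕ => c * (n : ℝ)) atTop atTop := fun c hc =>
    tendsto_natCast_atTop_atTop.const_mul_atTop hc
  have hev : ∀ᶠ n : ℕ in atTop, N₁ ≤ n ∧ N₂ ≤ n ∧ N₃ ≤ n ∧ 0 < n ∧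
      max (max 1 (2 * (WF : ℝ))) (max (2 * (WG : ℝ)) (2 * (w : ℝ))) ≤ θ * n ∧
      max (Real.log 2) (-Real.log (θ ^ 2)) ≤ η / 24 * n ∧ Real.log 4 ≤ η / 8 * n := by
    filter_upwards [eventually_ge_atTop N₁, eventually_ge_atTop N₂, eventually_ge_atTop N₃,
      eventually_gt_atTop 0, (ht θ hθ).eventually_ge_atTop _, (ht _ hγ).eventually_ge_atTop _,
      (ht (η / 8) (by positivity)).eventually_ge_atTop _] with n h1 h2 h3 h4 h5 h6 h7
    exact ⟨h1, h2, h3, h4, h5, h6, h7⟩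
  obtain ⟨n, hcpl, h1, h2, h3, h4, h5, h6, h7⟩ := (hgood.and_eventually hev).exists
  simp only [max_le_iff] at h5 h6
  have hnR : (0 : ℝ) < n := by exact_mod_cast h4
  obtain ⟨W, F₂, hL, ha, hb, hcF, hd⟩ := exists_coding_aux R hμ hρ hA hh hF hG hδF hδG h4 hcpl hθ hθ1
    (γ := η / 24) (γ' := η / 4) w ((Real.le_exp_log 2).trans (Real.exp_le_exp.2 h6.1))
    (by
      rw [← Real.le_log_iff_exp_le (by positivity)]
      linarith [h6.2]) h5.1.1 h5.1.2 h5.2.1 h5.2.2 (by convert hN₁ n h1) (by convert hN₂ n h2)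
    (by convert hN₃ n h3) fun p q hp hq hp1 hq1 h => hent p q hp hq hp1 hq1 (h.trans hθ2)
  refine ⟨W, F₂, hL, ?_, ?_, ?_, ?_⟩
  · refine (Finset.sum_le_sum fun v _ => ha v).trans ?_
    rwa [Finset.sum_const, Finset.card_univ, nsmul_eq_mul]
  · rw [← hh]
    have : Real.log 4 / n ≤ η / 8 := by rwa [div_le_iff₀ hnR]
    linarith
  · linarith
  · linarith

end Coding

/-! ### Improving a pair of codes -/

section Step

lemma sum_abs_push_sub_le {α β : Type*} [Fintype α] [Fintype β] [DecidableEq β] (f : α → β)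
    (p q : α → ℝ) : ∑ b, |push f p b - push f q b| ≤ ∑ a, |p a - q a| := by
  calc _ ≤ ∑ b, push f (fun a => |p a - q a|) b := Finset.sum_le_sum fun b _ => by
        rw [push, push, push, ← Finset.sum_sub_distrib]
        refine (Finset.abs_sum_le_sum_abs _ _).trans (Finset.sum_le_sum fun a _ => ?_)
        split_ifs <;> simp
    _ = _ := sum_push _ _

variable {A B : Type} [Fintype A] [Nonempty A] [DecidableEq A] [MeasurableSpace A]
  [MeasurableSingletonClass A] [Fintype B] [Nonempty B] [DecidableEq B] [MeasurableSpace B]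
  [MeasurableSingletonClass B] {μ : Measure (ℤ → A)} {ρ : Measure (ℤ → B)}

lemma wl_dist_mono {ν : Measure (ℤ → B)} (hν : Stat ν) (hρ : Stat ρ) {w w' : ℕ} (h : w ≤ w') :
    ∑ v, |wl ν w v - wl ρ w v| ≤ ∑ v, |wl ν w' v - wl ρ w' v| := by
  have := hν.prob
  have := hρ.prob
  have e : ∀ (κ : Measure (ℤ → B)) [IsProbabilityMeasure κ],
      wl κ w = push (fun u : Fin w' → B => fun i : Fin w => u (Fin.castLE h i)) (wl κ w') :=
    fun κ _ => by rw [wl, wl, ← dlaw_comp (measurable_word 0 w')]; rfl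
  rw [e ν, e ρ]
  exact sum_abs_push_sub_le _ _ _

lemma Cpl.markov {α β : Type*} [Fintype α] [Fintype β] {p : α → ℝ} {q : β → ℝ} {c : α → β → ℝ}
    {t a : ℝ} (h : Cpl p q c t) (hc : ∀ x y, 0 ≤ c x y) (ha : 0 < a) :
    Cpl p q (fun x y => if c x y ≤ a then 0 else 1) (t / a) := by
  obtain ⟨w, h0, h1, h2, h3⟩ := h
  refine ⟨w, h0, h1, h2, ?_⟩
  rw [le_div_iff₀ ha, Finset.sum_mul]
  refine le_trans (Finset.sum_le_sum fun x _ => ?_) h3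
  rw [Finset.sum_mul]
  refine Finset.sum_le_sum fun y _ => ?_
  rw [mul_assoc]
  refine mul_le_mul_of_nonneg_left ?_ (h0 x y)
  dsimp only
  split_ifs with hxy
  · simpa using hc x y
  · linarith

set_option maxHeartbeats 400000 in
/-- The code of the coding lemma is itself part of a good pair. -/
lemma good_of_code (R : KRep μ) (hμ : Stat μ) {G : (ℤ → B) → A} {WG : ℕ}
    (hG : Loc WG G) {W : ℕ} {F : (ℤ → A) → B} (hF : Loc W F) {ε θ e C d : ℝ} (hε : 0 < ε)
    (hθ : 0 < θ) (hθ1 : θ ≤ ε / 2) (hθ2 : θ * (2 * WG + 1) ≤ ε / 4) (he : e ≤ θ * ε / 8)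
    (hfd : ∀ N : ℕ, Cpl (wl (μ.map (code F)) N) (wl ρ N) ham (e * N + C))
    (hd : μ.real {x | G (code F x) ≠ x 0} ≤ d) : Good μ ρ F ε G (d + ε) ε := by
  classical
  have := hμ.prob
  have hν := hμ.map_code hF.measurable
  have h0 : Loc (W + WG) fun x : ℤ → A => x 0 := fun x y h => h 0 (by simp; positivity)
  have hL : Loc (W + WG) fun x => if G (code F x) = x 0 then (0 : ℝ) else 1 :=
    (hF.code_comp hG).comp₂ h0 fun a b => if a = b then (0 : ℝ) else 1
  obtain ⟨N₀, hN₀⟩ := R.lln_loc hμ hL (δ := ε / 4) (ε := ε / 2) (by positivity) (by positivity)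
  have hm : ∫ x, (if G (code F x) = x 0 then (0 : ℝ) else 1) ∂μ ≤ d := by
    rw [← integral_ite_one ((hF.code_comp hG).comp₂ h0 fun a b => a ≠ b).measurableSet] at hd
    simpa only [ite_not, ne_eq] using hd
  have ht : ∀ c : ℝ, 0 < c → Tendsto (fun n : ℕ => c * (n : ℝ)) atTop atTop := fun c hc =>
    tendsto_natCast_atTop_atTop.const_mul_atTop hc
  refine Eventually.frequently ?_
  filter_upwards [eventually_ge_atTop N₀, eventually_gt_atTop 0,
    (ht (θ * (ε / 4)) (by positivity)).eventually_ge_atTop C,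
    (ht (ε / 2) (by positivity)).eventually_ge_atTop (2 * W),
    (ht (ε / 4) (by positivity)).eventually_ge_atTop (2 * WG)] with N h1 h2 h3 h4 h5
  have hN : (0 : ℝ) < N := by exact_mod_cast h2
  have c1 : Cpl (wl μ N) (wl (μ.map (code F)) N) (fun u y => if ham (wcode F u) y ≤ 2 * W ∧
      ham u (wcode G y) ≤ (d + ε / 4) * N + 2 * WG then 0 else 1) (ε / 2) := by
    rw [wl_map_code hF.measurable]
    refine Cpl.of_joint (measurable_word 0 N) ((measurable_word 0 N).comp
      (measurable_code hF.measurable)) ?_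
    set m := ∫ x, (if G (code F x) = x 0 then (0 : ℝ) else 1) ∂μ
    have hE : MeasurableSet {x : ℤ → A | ε / 4 * N ≤ |∑ i ∈ Finset.range N,
        ((if G (code F (shift i x)) = shift i x 0 then (0 : ℝ) else 1) - m)|} :=
      measurableSet_le measurable_const (Measurable.abs (Finset.measurable_sum _ fun i _ =>
        (hL.measurable.comp (measurable_shift i)).sub measurable_const))
    refine le_trans ?_ (hN₀ N h1)
    rw [← integral_ite_one hE]
    refine integral_mono (integrable_dcomp ((measurable_word 0 N).prodMk ((measurable_word 0 N).comp
      (measurable_code hF.measurable))) fun p : (Fin N → A) × (Fin N → B) =>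
        if ham (wcode F p.1) p.2 ≤ 2 * W ∧ ham p.1 (wcode G p.2) ≤ (d + ε / 4) * N + 2 * WG
        then (0 : ℝ) else 1) ?_ fun x => ?_
    · have := (integrable_const (1 : ℝ) (μ := μ)).indicator hE
      refine this.congr (Eventually.of_forall fun x => ?_)
      simp [Set.indicator]
    · dsimp only [Function.comp_apply]
      by_cases k : ham (wcode F (word 0 N x)) (word 0 N (code F x)) ≤ 2 * W ∧
          ham (word 0 N x) (wcode G (word 0 N (code F x))) ≤ (d + ε / 4) * N + 2 * WG
      · rw [if_pos k]
        split_ifs <;> norm_num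
      · rw [if_neg k, if_pos]
        by_contra! hlt
        refine k ⟨ham_wcode hF 0 x, ?_⟩
        have e1 := sum_ite_ne_eq_ham (fun x => G (code F x)) (fun x : ℤ → A => x 0) N x
        have e2 : code (fun x => G (code F x)) x = code G (code F x) := by
          ext i; simp [code, ← code_shift]
        have e3 : code (fun x : ℤ → A => x 0) x = x := by
          ext i; simp [code, shift]
        rw [e2, e3] at e1
        rw [Finset.sum_sub_distrib, e1, Finset.sum_const, Finset.card_range, nsmul_eq_mul] at hlt
        have t1 := ham_triangle (word 0 N x) (word 0 N (code G (code F x)))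
          (wcode G (word 0 N (code F x)))
        have t2 := ham_wcode hG (n := N) 0 (code F x)
        rw [ham_comm] at t2
        rw [ham_comm (word 0 N x) (word 0 N (code G (code F x)))] at t1
        have t3 := (abs_lt.1 hlt).2
        have t4 : N * m ≤ N * d := by gcongr
        linarith
  have c2 := (hfd N).markov (a := θ * N) ham_nonneg (by positivity)
  refine ((c1.trans c2 fun u y z => ?_).mono (t' := ε) ?_)
  · have t1 := ham_triangle (wcode F u) y z
    have t2 := ham_triangle u (wcode G y) (wcode G z)
    have t3 := ham_wcode_wcode hG y z
    have n1 : (0 : ℝ) ≤ if ham (wcode F u) y ≤ 2 * W ∧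
      ham u (wcode G y) ≤ (d + ε / 4) * N + 2 * WG then 0 else 1 := by split_ifs <;> norm_num
    have n2 : (0 : ℝ) ≤ if ham y z ≤ θ * N then 0 else 1 := by split_ifs <;> norm_num
    by_cases k1 : ham (wcode F u) y ≤ 2 * W ∧ ham u (wcode G y) ≤ (d + ε / 4) * N + 2 * WG
    · by_cases k2 : ham y z ≤ θ * N
      · rw [if_pos]
        · linarith
        · constructor
          · have : θ * N ≤ ε / 2 * N := by gcongr
            linarith [k1.1]
          · have : (2 * WG + 1) * ham y z ≤ (2 * WG + 1) * (θ * N) := by gcongr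
            have h' : θ * (2 * WG + 1) * N ≤ ε / 4 * N := by gcongr
            have := k1.2
            linarith
      · rw [if_neg k2]
        split_ifs <;> linarith
    · rw [if_neg k1]
      split_ifs <;> linarith
  · have : (e * N + C) / (θ * N) ≤ ε / 2 := by
      rw [div_le_iff₀ (by positivity)]
      have : e * N ≤ θ * ε / 8 * N := by gcongr
      have h0 : 0 ≤ θ * ε * N := by positivity
      linarith
    linarith

/-- Improving one of the two codes of a good pair. -/
lemma exists_half_step (R : KRep μ) (hμ : Stat μ) (R' : KRep ρ) (hρ : Stat ρ)
    (hA : 2 ≤ Fintype.card A) (hh : hrate μ = hrate ρ) {WF WG : ℕ} {F : (ℤ → A) → B}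
    (hF : Loc WF F) {G : (ℤ → B) → A} (hG : Loc WG G) {δF δG β : ℝ} (hδF : 0 ≤ δF) (hδG : 0 ≤ δG)
    (hgood : Good μ ρ F δF G δG β) (w : ℕ) {ε : ℝ} (hε : 0 < ε) :
    ∃ (W : ℕ) (F₂ : (ℤ → A) → B), Loc W F₂ ∧
      (∑ v, |wl (μ.map (code F₂)) w v - wl ρ w v|) ≤ ε ∧
      μ.real {x | F₂ x ≠ F x} ≤ δF + β + ε ∧
      μ.real {x | G (code F₂ x) ≠ x 0} ≤ δG + β + ε ∧
      Good μ ρ F₂ ε G (δG + β + 2 * ε) ε := by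
  obtain ⟨θ, hθ, hθ1, hθ2⟩ : ∃ θ : ℝ, 0 < θ ∧ θ ≤ ε / 2 ∧ θ * (2 * WG + 1) ≤ ε / 4 := by
    refine ⟨ε / (4 * (2 * WG + 1)), by positivity, ?_, ?_⟩
    · rw [div_le_iff₀ (by positivity)]
      have : 0 ≤ ε * WG := by positivity
      linarith
    · field_simp
      rfl
  obtain ⟨w₀, η, hη, hfd⟩ := R'.finitely_determined hρ (e := θ * ε / 8) (by positivity)
  obtain ⟨W, F₂, hL, h1, h2, h3, h4⟩ := exists_coding R hμ R' hρ hA hh hF hG hδF hδG hgood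
    (max w w₀) (η := min ε η) (by positivity)
  have hν := hμ.map_code hL.measurable
  have hε' := min_le_left ε η
  have hη' := min_le_right ε η
  obtain ⟨C, hC⟩ := hfd _ hν
    (((wl_dist_mono hν hρ (le_max_right w w₀)).trans h1).trans hη') (by linarith)
  have h4' : μ.real {x | G (code F₂ x) ≠ x 0} ≤ δG + β + ε := by linarith
  refine ⟨W, F₂, hL, ((wl_dist_mono hν hρ (le_max_left w w₀)).trans h1).trans hε', by linarith,
    h4', ?_⟩
  have := good_of_code R hμ hG hL hε hθ hθ1 hθ2 le_rfl hC h4'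
  rwa [show δG + β + 2 * ε = δG + β + ε + ε by ring]

lemma Good.symm {F : (ℤ → A) → B} {G : (ℤ → B) → A} {δF δG β : ℝ} (h : Good μ ρ F δF G δG β) :
    Good ρ μ G δG F δF β :=
  h.mono fun _ hn => hn.symm.cost_mono fun v u => by
    rw [ham_comm (wcode G v) u, ham_comm v (wcode F u)]
    refine le_of_eq ?_
    simp only [and_comm]

lemma Good.mono {F : (ℤ → A) → B} {G : (ℤ → B) → A} {δF δG β δF' δG' β' : ℝ}
    (h : Good μ ρ F δF G δG β) (hF : δF ≤ δF') (hG : δG ≤ δG') (hβ : β ≤ β') :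
    Good μ ρ F δF' G δG' β' :=
  Filter.Frequently.mono h fun n hn => (hn.mono hβ).cost_mono fun u v => by
    have h1 : δF * n ≤ δF' * n := by gcongr
    have h2 : δG * n ≤ δG' * n := by gcongr
    by_cases hk : ham (wcode F u) v ≤ δF * n ∧ ham u (wcode G v) ≤ δG * n
    · rw [if_pos hk, if_pos ⟨hk.1.trans h1, hk.2.trans h2⟩]
    · rw [if_neg hk]
      split_ifs <;> norm_num

/-- Improving both codes of a good pair. -/
lemma exists_full_step (R : KRep μ) (hμ : Stat μ) (R' : KRep ρ) (hρ : Stat ρ)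
    (hA : 2 ≤ Fintype.card A) (hB : 2 ≤ Fintype.card B) (hh : hrate μ = hrate ρ) {WF WG : ℕ}
    {F : (ℤ → A) → B} (hF : Loc WF F) {G : (ℤ → B) → A} (hG : Loc WG G) {δF δG : ℝ}
    (hδF : 0 ≤ δF) (hδG : 0 ≤ δG) (hgood : Good μ ρ F δF G δG δF) (w : ℕ) {ε : ℝ} (hε : 0 < ε) :
    ∃ (W' : ℕ) (F' : (ℤ → A) → B) (V' : ℕ) (G' : (ℤ → B) → A), Loc W' F' ∧ Loc V' G' ∧
      (∑ v, |wl (μ.map (code F')) w v - wl ρ w v|) ≤ ε ∧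
      μ.real {x | F' x ≠ F x} ≤ 2 * δF + ε ∧
      μ.real {x | G (code F' x) ≠ x 0} ≤ δG + δF + ε ∧
      ρ.real {y | G' y ≠ G y} ≤ δG + δF + 4 * ε ∧
      Good μ ρ F' (4 * ε) G' ε (4 * ε) := by
  obtain ⟨W', F', hF', h1, h2, h3, h4⟩ := exists_half_step R hμ R' hρ hA hh hF hG hδF hδG hgood w hε
  obtain ⟨V', G', hG', k1, k2, k3, k4⟩ := exists_half_step R' hρ R hμ hB hh.symm hG hF'
    (by positivity) hε.le h4.symm w hε
  exact ⟨W', F', V', G', hF', hG', h1, by linarith, by linarith, by linarith,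
    k4.symm.mono (by linarith) le_rfl (by linarith)⟩

end Step

/-! ### The isomorphism -/

section Iso

lemma eq_of_restrict_eq {ι : Type*} {X : Type*} [MeasurableSpace X] {ν ρ : Measure (ι → X)}
    [IsProbabilityMeasure ν]
    (h : ∀ I : Finset ι, ρ.map I.restrict = ν.map I.restrict) : ν = ρ := by
  have h1 : IsProjectiveLimit (α := fun _ : ι => X) ν fun I => ν.map I.restrict := fun _ => rfl
  have h2 : IsProjectiveLimit (α := fun _ : ι => X) ρ fun I => ν.map I.restrict := h
  have : ∀ I : Finset ι, IsFiniteMeasure (ν.map (I.restrict (π := fun _ => X))) := fun I => inferInstance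
  exact h1.unique h2

variable {A B : Type} [Fintype A] [Nonempty A] [DecidableEq A] [MeasurableSpace A]
  [MeasurableSingletonClass A] [Fintype B] [Nonempty B] [DecidableEq B] [MeasurableSpace B]
  [MeasurableSingletonClass B] {μ : Measure (ℤ → A)} {ρ : Measure (ℤ → B)}

lemma eq_of_word_eq {ν ρ : Measure (ℤ → B)} [IsProbabilityMeasure ν] [IsProbabilityMeasure ρ]
    (h : ∀ (t : ℤ) (n : ℕ), dlaw ν (word t n) = dlaw ρ (word t n)) : ν = ρ := by
  have hw : ∀ (t : ℤ) (n : ℕ), ρ.map (word t n) = ν.map (word t n) := fun t n => by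
    have := Measure.isProbabilityMeasure_map (μ := ρ) (measurable_word (A := B) t n).aemeasurable
    have := Measure.isProbabilityMeasure_map (μ := ν) (measurable_word (A := B) t n).aemeasurable
    refine Measure.ext_of_singleton fun u => ?_
    rw [← measureReal_eq_measureReal_iff, map_measureReal_apply (measurable_word t n) (measurableSet_singleton u),
      map_measureReal_apply (measurable_word t n) (measurableSet_singleton u)]
    exact (congrFun (h t n) u).symm
  refine eq_of_restrict_eq fun I => ?_
  obtain ⟨n, hn⟩ : ∃ n : ℕ, ∀ i ∈ I, |i| < n := by
    refine ⟨I.sup Int.natAbs + 1, fun i hi => ?_⟩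
    have := Finset.le_sup (f := Int.natAbs) hi
    rw [Int.abs_eq_natAbs]
    omega
  have hn' : ∀ i : I, ((i : ℤ) + n).toNat < 2 * n := fun i => by
    have := abs_lt.1 (hn i i.2); omega
  have e : (I.restrict : (ℤ → B) → I → B) =
      (fun (u : Fin (2 * n) → B) (i : I) => u ⟨((i : ℤ) + n).toNat, hn' i⟩) ∘ word (-(n : ℤ)) (2 * n) := by
    ext x i
    have := abs_lt.1 (hn i i.2)
    simp only [Finset.restrict, Function.comp, word]
    congr 1
    omega
  rw [e, ← Measure.map_map (by fun_prop) (measurable_word _ _), hw,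
    Measure.map_map (by fun_prop) (measurable_word _ _)]

lemma Stat.eq_of_wl {ν : Measure (ℤ → B)} (hν : Stat ν) (hρ : Stat ρ)
    (h : ∀ n, wl ν n = wl ρ n) : ν = ρ := by
  have := hν.prob
  have := hρ.prob
  exact eq_of_word_eq fun t n => by rw [hν.dlaw_word, hρ.dlaw_word, h]

open Classical in
/-- The eventual value of a sequence. -/
def evLim (b₀ : B) (b : ℕ → B) : B := if h : ∃ c, ∀ᶠ k in atTop, b k = c then h.choose else b₀

lemma evLim_eq {b₀ : B} {b : ℕ → B} {c : B} (h : ∀ᶠ k in atTop, b k = c) : evLim b₀ b = c := by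
  have h' : ∃ c, ∀ᶠ k in atTop, b k = c := ⟨c, h⟩
  rw [evLim, dif_pos h']
  obtain ⟨k, h1, h2⟩ := (h'.choose_spec.and h).exists
  rw [← h1, h2]

lemma measurable_evLim {Ω : Type*} [MeasurableSpace Ω] (b₀ : B) {F : ℕ → Ω → B}
    (hF : ∀ k, Measurable (F k)) : Measurable fun x => evLim b₀ fun k => F k x := by
  classical
  have hm : ∀ c, MeasurableSet {x | ∀ᶠ k in atTop, F k x = c} := fun c => by
    have : {x | ∀ᶠ k in atTop, F k x = c} = ⋃ n, ⋂ k, {x | n ≤ k → F k x = c} := by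
      ext x
      simp [eventually_atTop]
    rw [this]
    refine MeasurableSet.iUnion fun n => MeasurableSet.iInter fun k => ?_
    by_cases h : n ≤ k
    · simp only [h, true_imp_iff]
      exact hF k (measurableSet_singleton c)
    · simp [h]
  refine measurable_to_countable' fun c => ?_
  have : (fun x => evLim b₀ fun k => F k x) ⁻¹' {c} = {x | ∀ᶠ k in atTop, F k x = c} ∪
      ({x | ¬ ∃ c, ∀ᶠ k in atTop, F k x = c} ∩ {_x | b₀ = c}) := by
    ext x
    simp only [Set.mem_preimage, Set.mem_singleton_iff, Set.mem_union, Set.mem_inter_iff,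
      Set.mem_ofPred_eq]
    by_cases h : ∃ c, ∀ᶠ k in atTop, F k x = c
    · obtain ⟨d, hd⟩ := h
      rw [evLim_eq hd]
      constructor
      · rintro rfl
        exact Or.inl hd
      · rintro (h' | h')
        · obtain ⟨k, h1, h2⟩ := (hd.and h').exists
          rw [← h1, h2]
        · exact absurd ⟨d, hd⟩ h'.1
    · rw [evLim, dif_neg h]
      constructor
      · exact fun h' => Or.inr ⟨h, h'⟩
      · rintro (h' | h')
        · exact absurd ⟨c, h'⟩ h
        · exact h'.2
  rw [this]
  refine (hm c).union (MeasurableSet.inter ?_ (MeasurableSet.const _))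
  have : {x | ¬ ∃ c, ∀ᶠ k in atTop, F k x = c} = (⋃ c, {x | ∀ᶠ k in atTop, F k x = c})ᶜ := by
    ext x; simp
  rw [this]
  exact (MeasurableSet.iUnion hm).compl

lemma ae_eventually_of_le {Ω : Type*} [MeasurableSpace Ω] {P : Measure Ω} [IsProbabilityMeasure P]
    {E : ℕ → Set Ω} {a : ℕ → ℝ} (ha : Summable a) (h : ∀ k, P.real (E k) ≤ a k) :
    ∀ᵐ x ∂P, ∀ᶠ k in atTop, x ∉ E k := by
  refine ae_eventually_notMem ?_
  have h1 : ∀ k, P (E k) ≤ ENNReal.ofReal (a k) := fun k => by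
    rw [← ofReal_measureReal]
    exact ENNReal.ofReal_le_ofReal (h k)
  refine ne_top_of_le_ne_top ?_ (ENNReal.tsum_le_tsum h1)
  rw [← ENNReal.ofReal_tsum_of_nonneg (fun k => measureReal_nonneg.trans (h k)) ha]
  exact ENNReal.ofReal_ne_top

lemma Stat.ae_shift (hμ : Stat μ) {p : (ℤ → A) → Prop} (hp : ∀ᵐ x ∂μ, p x) :
    ∀ᵐ x ∂μ, ∀ t : ℤ, p (shift t x) :=
  ae_all_iff.2 fun t => (hμ.inv t).quasiMeasurePreserving.ae hp

/-- The stages of the construction of the isomorphism. -/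
structure Stage (μ : Measure (ℤ → A)) (ρ : Measure (ℤ → B)) where
  F : (ℤ → A) → B
  W : ℕ
  G : (ℤ → B) → A
  V : ℕ
  ε : ℝ
  locF : Loc W F
  locG : Loc V G
  pos : 0 < ε
  good : Good μ ρ F (4 * ε) G ε (4 * ε)

/-- The relation between two successive stages. -/
structure Stage.Next (k : ℕ) (s s' : Stage μ ρ) : Prop where
  eps : s'.ε = (1 / 2) ^ (k + 1) / (2 * s.V + 1)
  mono : s.V + 1 ≤ s'.V
  law : (∑ v, |wl (μ.map (code s'.F)) k v - wl ρ k v|) ≤ s'.ε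
  dF : μ.real {x | s'.F x ≠ s.F x} ≤ 8 * s.ε + s'.ε
  dG : ρ.real {x | s'.G x ≠ s.G x} ≤ 5 * s.ε + 4 * s'.ε
  inv : μ.real {x | s.G (code s'.F x) ≠ x 0} ≤ 5 * s.ε + s'.ε

lemma exists_next (R : KRep μ) (hμ : Stat μ) (R' : KRep ρ) (hρ : Stat ρ)
    (hA : 2 ≤ Fintype.card A) (hB : 2 ≤ Fintype.card B) (hh : hrate μ = hrate ρ) (k : ℕ)
    (s : Stage μ ρ) : ∃ s' : Stage μ ρ, s.Next k s' := by
  have hs := s.pos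
  obtain ⟨W', F', V', G', h1, h2, h3, h4, h5, h6, h7⟩ := exists_full_step R hμ R' hρ hA hB hh s.locF s.locG
    (by positivity) s.pos.le s.good k (ε := (1 / 2) ^ (k + 1) / (2 * s.V + 1)) (by positivity)
  exact ⟨⟨F', W', G', V' + s.V + 1, (1 / 2) ^ (k + 1) / (2 * s.V + 1), h1, h2.mono (by omega),
    by positivity, h7⟩, rfl, by simp only; omega, h3, by simp only; linarith, by simp only; linarith,
    by simp only; linarith⟩

lemma exists_stages (R : KRep μ) (hμ : Stat μ) (R' : KRep ρ) (hρ : Stat ρ)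
    (hA : 2 ≤ Fintype.card A) (hB : 2 ≤ Fintype.card B) (hh : hrate μ = hrate ρ) :
    ∃ s : ℕ → Stage μ ρ, (s 0).ε = 1 ∧ ∀ k, (s k).Next k (s (k + 1)) := by
  choose f hf using exists_next R hμ R' hρ hA hB hh
  obtain ⟨a⟩ := (inferInstance : Nonempty A)
  obtain ⟨b⟩ := (inferInstance : Nonempty B)
  have hμ' := hμ.prob
  have hρ' := hρ.prob
  let s₀ : Stage μ ρ := ⟨fun _ => b, 0, fun _ => a, 0, 1, Loc.const b 0, Loc.const a 0, one_pos,
    Frequently.of_forall fun n => Cpl.of_prod (wl_nonneg μ n) (wl_nonneg ρ n) (hμ.sum_wl n)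
      (hρ.sum_wl n) fun u v => by split_ifs <;> norm_num⟩
  exact ⟨fun k => Nat.rec s₀ (fun k s => f k s) k, rfl, fun k => hf k _⟩

/-- Two processes with state kernels and the same entropy rate are isomorphic. -/
theorem exists_iso (R : KRep μ) (hμ : Stat μ) (R' : KRep ρ) (hρ : Stat ρ)
    (hA : 2 ≤ Fintype.card A) (hB : 2 ≤ Fintype.card B) (hh : hrate μ = hrate ρ) :
    ∃ (φ : (ℤ → A) → ℤ → B) (ψ : (ℤ → B) → ℤ → A), Measurable φ ∧ Measurable ψ ∧ μ.map φ = ρ ∧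
      (∀ x, φ (shift 1 x) = shift 1 (φ x)) ∧ (∀ᵐ x ∂μ, ψ (φ x) = x) ∧ ∀ᵐ y ∂ρ, φ (ψ y) = y := by
  have hμ' := hμ.prob
  have hρ' := hρ.prob
  obtain ⟨s, hs0, hs⟩ := exists_stages R hμ R' hρ hA hB hh
  obtain ⟨a₀⟩ := (inferInstance : Nonempty A)
  obtain ⟨b₀⟩ := (inferInstance : Nonempty B)
  have hε : ∀ k, (s k).ε ≤ (1 / 2) ^ k := fun k => by
    cases k with
    | zero => simp [hs0]
    | succ k =>
      rw [(hs k).eps]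
      exact div_le_self (by positivity) (by linarith [(Nat.cast_nonneg (s k).V : (0 : ℝ) ≤ _)])
  have hεs : ∀ k, (s (k + 1)).ε ≤ (1 / 2) ^ k := fun k => (hε _).trans
    (pow_le_pow_of_le_one (by norm_num) (by norm_num) (Nat.le_succ k))
  have hV : Monotone fun k => (s k).V := monotone_nat_of_le_succ fun k => by have := (hs k).mono; omega
  have hVk : ∀ k, k ≤ (s k).V := fun k => by
    induction k with
    | zero => omega
    | succ k ih => have := (hs k).mono; omega
  have hsum : ∀ c : ℝ, Summable fun k : ℕ => c * (1 / 2 : ℝ) ^ k := fun c =>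
    (summable_geometric_of_lt_one (by norm_num) (by norm_num)).mul_left c
  -- the codes on `A` stabilise, uniformly on the windows of the codes on `B`
  have hF : ∀ᵐ x ∂μ, ∀ᶠ k in atTop, ∀ i : ℤ, |i| ≤ (s k).V →
      (s (k + 2)).F (shift i x) = (s (k + 1)).F (shift i x) := by
    have := ae_eventually_of_le (P := μ) (E := fun k => ⋃ i ∈ Finset.Icc (-((s k).V : ℤ)) (s k).V,
      {x | (s (k + 2)).F (shift i x) ≠ (s (k + 1)).F (shift i x)}) (hsum 9) fun k => by
        refine (measureReal_biUnion_finset_le _ _).trans ?_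
        have hm : MeasurableSet {x | (s (k + 2)).F x ≠ (s (k + 1)).F x} :=
          (measurableSet_eq_fun (s (k + 2)).locF.measurable (s (k + 1)).locF.measurable).compl
        rw [Finset.sum_congr rfl fun i _ => hμ.prob_shift i hm, Finset.sum_const, Int.card_Icc,
          nsmul_eq_mul]
        have h1 := (hs (k + 1)).dF
        have h2 : (s (k + 2)).ε ≤ (s (k + 1)).ε := by
          rw [(hs (k + 1)).eps, (hs k).eps]
          have : ((s k).V : ℝ) ≤ (s (k + 1)).V := by exact_mod_cast hV (Nat.le_succ k)
          gcongr ?_ / (2 * ?_ + 1)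
          exact pow_le_pow_of_le_one (by norm_num) (by norm_num) (Nat.le_succ _)
        have h3 : ((((s k).V : ℤ) + 1 - -((s k).V : ℤ)).toNat : ℝ) = 2 * (s k).V + 1 := by
          rw [show ((s k).V : ℤ) + 1 - -((s k).V : ℤ) = ((2 * (s k).V + 1 : ℕ) : ℤ) by push_cast; ring,
            Int.toNat_natCast]
          push_cast
          rfl
        rw [h3]
        have h4 : (2 * (s k).V + 1 : ℝ) * (s (k + 1)).ε = (1 / 2) ^ (k + 1) := by
          rw [(hs k).eps]; field_simp
        calc _ ≤ (2 * (s k).V + 1 : ℝ) * (9 * (s (k + 1)).ε) := by gcongr; linarith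
          _ = 9 * (1 / 2) ^ (k + 1) := by rw [← h4]; ring
          _ ≤ _ := by
            gcongr 9 * ?_
            exact pow_le_pow_of_le_one (by norm_num) (by norm_num) (Nat.le_succ k)
    filter_upwards [this] with x hx
    filter_upwards [hx] with k hk i hi
    by_contra h
    refine hk (Set.mem_biUnion (Finset.mem_coe.2 (Finset.mem_Icc.2 (abs_le.1 hi))) h)
  set F := fun x : ℤ → A => evLim b₀ fun k => (s k).F x with hFdef
  set G := fun y : ℤ → B => evLim a₀ fun k => (s k).G y with hGdef
  have hFm : Measurable F := measurable_evLim b₀ fun k => (s k).locF.measurable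
  have hGm : Measurable G := measurable_evLim a₀ fun k => (s k).locG.measurable
  have hF' : ∀ᵐ x ∂μ, ∀ᶠ k in atTop, ∀ i : ℤ, |i| ≤ (s k).V →
      F (shift i x) = (s (k + 1)).F (shift i x) := by
    filter_upwards [hF] with x hx
    obtain ⟨K, hK⟩ := eventually_atTop.1 hx
    filter_upwards [eventually_ge_atTop K] with k hk i hi
    refine evLim_eq ?_
    filter_upwards [eventually_ge_atTop (k + 1)] with j hj
    induction j, hj using Nat.le_induction with
    | base => rfl
    | succ j hj ih =>
      obtain ⟨j, rfl⟩ : ∃ l, j = l + 1 := ⟨j - 1, by omega⟩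
      rw [← ih]
      exact hK j (by omega) i (hi.trans (by exact_mod_cast hV (by omega : k ≤ j)))
  have hG : ∀ᵐ y ∂ρ, ∀ᶠ k in atTop, (s k).G y = G y := by
    have := ae_eventually_of_le (P := ρ) (E := fun k => {y | (s (k + 1)).G y ≠ (s k).G y}) (hsum 9)
      fun k => ((hs k).dG).trans (by linarith [hε k, hεs k])
    filter_upwards [this] with y hy
    obtain ⟨K, hK⟩ := eventually_atTop.1 hy
    have h1 : ∀ k ≥ K, (s k).G y = (s K).G y := fun k hk => by
      induction k, hk using Nat.le_induction with
      | base => rfl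
      | succ j hj ih => rw [← ih]; exact not_not.1 (hK j hj)
    have h2 : ∀ᶠ k in atTop, (s k).G y = (s K).G y := eventually_atTop.2 ⟨K, h1⟩
    have h3 : G y = (s K).G y := evLim_eq h2
    rwa [h3]
  have hinv : ∀ᵐ x ∂μ, ∀ᶠ k in atTop, (s k).G (code (s (k + 1)).F x) = x 0 := by
    have := ae_eventually_of_le (P := μ) (E := fun k => {x | (s k).G (code (s (k + 1)).F x) ≠ x 0})
      (hsum 6) fun k => ((hs k).inv).trans (by linarith [hε k, hεs k])
    filter_upwards [this] with x hx
    filter_upwards [hx] with k hk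
    exact not_not.1 hk
  have hmap : μ.map (code F) = ρ := by
    refine (hμ.map_code hFm).eq_of_wl hρ fun n => ?_
    ext u
    have hmF : ∀ k, Measurable fun x => word 0 n (code (s k).F x) := fun k =>
      (measurable_word 0 n).comp (measurable_code (s k).locF.measurable)
    have t1 : Tendsto (fun k => wl (μ.map (code (s (k + 1)).F)) n u) atTop
        (nhds (wl (μ.map (code F)) n u)) := by
      have e : ∀ {H : (ℤ → A) → B}, Measurable H → wl (μ.map (code H)) n u =
          ∫ x, (if word 0 n (code H x) = u then (1 : ℝ) else 0) ∂μ := fun {H} hH => by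
        rw [wl_map_code hH, integral_ite_one (p := fun x => word 0 n (code H x) = u)
          (((measurable_word 0 n).comp (measurable_code hH)) (measurableSet_singleton u))]
        rfl
      rw [e hFm]
      simp only [e (s _).locF.measurable]
      refine tendsto_integral_of_dominated_convergence (fun _ => 1) (fun k => ?_) (integrable_const _)
        (fun k => Eventually.of_forall fun x => ?_) ?_
      · exact (Measurable.ite ((hmF (k + 1)) (measurableSet_singleton u)) measurable_const
          measurable_const).aestronglyMeasurable
      · split_ifs <;> simp
      · filter_upwards [hF'] with x hx
        refine tendsto_const_nhds.congr' ?_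
        filter_upwards [hx, eventually_ge_atTop n] with k hk hkn
        have : word 0 n (code F x) = word 0 n (code (s (k + 1)).F x) := by
          ext i
          simp only [word, code, zero_add]
          refine hk _ ?_
          have := hVk k
          have := i.2
          rw [abs_le]
          constructor <;> omega
        rw [this]
    have t2 : Tendsto (fun k => wl (μ.map (code (s (k + 1)).F)) n u) atTop (nhds (wl ρ n u)) := by
      rw [tendsto_iff_norm_sub_tendsto_zero]
      refine squeeze_zero' (Eventually.of_forall fun _ => norm_nonneg _) ?_
        (tendsto_pow_atTop_nhds_zero_of_lt_one (r := (1 / 2 : ℝ)) (by norm_num) (by norm_num))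
      filter_upwards [eventually_ge_atTop n] with k hk
      refine le_trans ?_ (((wl_dist_mono (hμ.map_code (s (k + 1)).locF.measurable) hρ hk).trans
        (hs k).law).trans (hεs k))
      exact Finset.single_le_sum
        (f := fun v => |wl (μ.map (code (s (k + 1)).F)) n v - wl ρ n v|) (fun _ _ => abs_nonneg _)
        (Finset.mem_univ u)
    exact tendsto_nhds_unique t1 t2
  have hcF := measurable_code hFm
  have hcG := measurable_code hGm
  have h0 : ∀ᵐ x ∂μ, G (code F x) = x 0 := by
    have hG' : ∀ᵐ x ∂μ, ∀ᶠ k in atTop, (s k).G (code F x) = G (code F x) := by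
      exact ae_of_ae_map hcF.aemeasurable (by rw [hmap]; exact hG)
    filter_upwards [hF', hG', hinv] with x h1 h2 h3
    obtain ⟨k, k1, k2, k3⟩ := (h1.and (h2.and h3)).exists
    rw [← k2, ← k3]
    exact (s k).locG _ _ fun i hi => k1 i hi
  have hid : ∀ᵐ x ∂μ, code G (code F x) = x := by
    filter_upwards [hμ.ae_shift h0] with x hx
    ext i
    have := hx i
    rw [code_shift] at this
    simpa [shift] using! this
  refine ⟨code F, code G, hcF, hcG, hmap, fun x => code_shift F 1 x, hid, ?_⟩
  rw [← hmap]
  have hm : MeasurableSet {y : ℤ → B | code F (code G y) = y} :=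
    measurableSet_eq_fun (hcF.comp hcG) measurable_id
  rw [ae_map_iff hcF.aemeasurable hm]
  filter_upwards [hid] with x hx
  rw [hx]

end Iso

/-! ### Independent processes and Bernoulli systems -/

section Iid

variable {B : Type} [Fintype B] [Nonempty B] [DecidableEq B] [MeasurableSpace B]
  [MeasurableSingletonClass B] (ν : Measure B) [IsProbabilityMeasure ν]

/-- The i.i.d. process with letter law `ν`. -/
def iid : Measure (ℤ → B) := Measure.infinitePi fun _ => ν

instance : IsProbabilityMeasure (iid ν) := by unfold iid; infer_instance

lemma iid_pi (Λ : Finset ℤ) (g : ℤ → B) :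
    iid ν (Set.pi Λ fun i => {g i}) = ∏ i ∈ Λ, ν {g i} :=
  Measure.infinitePi_pi (fun _ => ν) fun _ _ => measurableSet_singleton _

lemma iid_cyl (Λ : Finset ℤ) (ζ : Λ → B) :
    iid ν {y | ∀ i : Λ, y i = ζ i} = ∏ i : Λ, ν {ζ i} := by
  set g : ℤ → B := fun i => if h : i ∈ Λ then ζ ⟨i, h⟩ else Classical.arbitrary B with hg
  have hg' : ∀ i : Λ, g i = ζ i := fun i => by simp [hg]
  have e : {y : ℤ → B | ∀ i : Λ, y i = ζ i} = Set.pi Λ fun i => {g i} := by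
    ext y
    simp only [Set.mem_ofPred_eq, Set.mem_pi, Set.mem_singleton_iff, Finset.mem_coe]
    exact ⟨fun h i hi => (h ⟨i, hi⟩).trans (hg' ⟨i, hi⟩).symm, fun h i => (h i i.2).trans (hg' i)⟩
  rw [e, iid_pi, ← Finset.prod_coe_sort]
  exact Finset.prod_congr rfl fun i _ => by rw [hg']

lemma iid_stat : Stat (iid ν) := by
  refine Stat.of_one ?_
  refine Measure.eq_infinitePi _ fun s t ht => ?_
  rw [Measure.map_apply (measurable_shift 1) (.pi s.countable_toSet fun i _ => ht i)]
  have e : shift 1 ⁻¹' (Set.pi (s : Set ℤ) t) =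
      Set.pi (s.map (addRightEmbedding (1 : ℤ)) : Finset ℤ) fun i => t (i - 1) := by
    ext x
    simp only [Set.mem_preimage, Set.mem_pi, shift, Finset.coe_map, Set.mem_image, Finset.mem_coe,
      addRightEmbedding_apply]
    constructor
    · rintro h _ ⟨i, hi, rfl⟩
      simpa using h i hi
    · intro h i hi
      simpa using h (i + 1) ⟨i, hi, rfl⟩
  rw [e, iid, Measure.infinitePi_pi _ fun i _ => ht _, Finset.prod_map]
  simp

lemma iid_wl (n : ℕ) (u : Fin n → B) : wl (iid ν) n u = ∏ i, ν.real {u i} := by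
  obtain ⟨E, hE⟩ : ∃ E : Fin n ↪ ℤ, ∀ i, E i = ((i : ℕ) : ℤ) :=
    ⟨⟨fun i => ((i : ℕ) : ℤ), fun i j h => by simpa [Fin.ext_iff] using h⟩, fun _ => rfl⟩
  have e : word (A := B) 0 n ⁻¹' {u} =
      Set.pi (Finset.univ.map E : Finset ℤ) fun i => {wext u i.toNat} := by
    ext x
    simp only [Set.mem_preimage, Set.mem_singleton_iff, funext_iff, word, zero_add, Set.mem_pi,
      Finset.coe_map, Finset.coe_univ, Set.image_univ, Set.forall_mem_range, hE,
      Int.toNat_natCast, wext_fin]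
  rw [wl, dlaw, e, Measure.real, iid_pi, Finset.prod_map, ENNReal.toReal_prod]
  simp only [Measure.real, hE, Int.toNat_natCast, wext_fin]

/-- The i.i.d. process is represented by a kernel with a single state. -/
def iidRep {c : ℝ} (hc : 0 < c) (h : ∀ b, c ≤ ν.real {b}) : KRep (iid ν) where
  σ := Unit
  k :=
    { step := fun _ _ => ()
      κ := fun _ b => ν.real {b}
      c := c
      c_pos := hc
      c_le := fun _ => h
      sum_one := fun _ => by
        exact sum_dlaw (μ := ν) (Z := fun b => b) measurable_id
      Ag := fun _ _ _ => True
      ag_zero := fun _ _ => trivial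
      ag_symm := fun _ _ _ _ => trivial
      ag_step := fun _ _ _ _ _ => trivial
      ω := fun _ => 0
      ω_nonneg := fun _ => le_rfl
      ratio := fun _ _ _ _ _ => by simp
      dyadic := by simp }
  s₀ := ()
  law_eq := fun n u => by
    rw [iid_wl, StateKernel.law, StateKernel.lw, Finset.prod_range]
    simp

lemma iid_went_succ (n : ℕ) : went (iid ν) (n + 1) = went (iid ν) n + went (iid ν) 1 := by
  have hs := iid_stat ν
  rw [went_eq_sum]
  have e : ∀ (u : Fin n → B) (v : Fin 1 → B), wl (iid ν) (n + 1) (Fin.append u v) =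
      wl (iid ν) n u * wl (iid ν) 1 v := fun u v => by
    simp only [iid_wl, Fin.prod_univ_add, Fin.append_left, Fin.append_right]
  simp only [e, Real.negMulLog_mul, Finset.sum_add_distrib, ← Finset.mul_sum, ← Finset.sum_mul,
    hs.sum_wl, one_mul]
  rfl

lemma iid_went_one : went (iid ν) 1 = ent fun b => ν.real {b} := by
  have := ent_equiv (Equiv.funUnique (Fin 1) B) fun b => ν.real {b}
  rw [← this, went]
  congr 1; ext u
  simp [iid_wl]

lemma iid_hrate : hrate (iid ν) = ent fun b => ν.real {b} := by
  have h : ∀ n, went (iid ν) (n + 1) - went (iid ν) n = went (iid ν) 1 := fun n => by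
    rw [iid_went_succ, add_sub_cancel_left]
  rw [hrate, iInf_congr h, ciInf_const, iid_went_one]

end Iid

section Bernoulli

/-- There is a fully supported law on a finite alphabet with prescribed positive entropy. -/
lemma exists_law_of_entropy {h : ℝ} (hh : 0 < h) : ∃ (m : ℕ) (p : Fin m → ℝ), 2 ≤ m ∧
    (∀ a, 0 < p a) ∧ ∑ a, p a = 1 ∧ ent p = h := by
  obtain ⟨n, hn⟩ := exists_nat_ge (Real.exp h)
  have hm : h ≤ Real.log ((n + 2 : ℕ) : ℝ) := by
    rw [Real.le_log_iff_exp_le (by positivity)]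
    push_cast; linarith
  set m := n + 2
  have hm0 : (m : ℝ) ≠ 0 := by positivity
  let q : ℝ → Fin m → ℝ := fun t a => (1 - t) * (if a = 0 then 1 else 0) + t * (m : ℝ)⁻¹
  have q1 : ∀ t, ∑ a, q t a = 1 := fun t => by
    simp only [q, Finset.sum_add_distrib, ← Finset.mul_sum, Finset.sum_ite_eq', Finset.mem_univ,
      if_true, Finset.sum_const, Finset.card_univ, Fintype.card_fin, nsmul_eq_mul]
    field_simp
    ring
  have hc : Continuous fun t => ent (q t) := by
    unfold ent
    exact continuous_finsetSum _ fun a _ => Real.continuous_negMulLog.comp (by fun_prop)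
  have h0 : ent (q 0) = 0 := by
    unfold ent
    refine Finset.sum_eq_zero fun a _ => ?_
    by_cases ha : a = 0 <;> simp [q, ha]
  have hq1 : ent (q 1) = Real.log m := by
    simp only [ent, q, sub_self, zero_mul, zero_add, one_mul, Finset.sum_const, Finset.card_univ,
      Fintype.card_fin, nsmul_eq_mul, Real.negMulLog, Real.log_inv]
    field_simp
  obtain ⟨t, ht, e⟩ := intermediate_value_Icc zero_le_one hc.continuousOn
    (show h ∈ Set.Icc (ent (q 0)) (ent (q 1)) from ⟨by rw [h0]; exact hh.le, by rw [hq1]; exact hm⟩)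
  have ht0 : 0 < t := lt_of_le_of_ne ht.1 fun h' => by
    subst h'
    dsimp only at e
    linarith
  refine ⟨m, q t, by omega, fun a => ?_, q1 t, e⟩
  have h1 : 0 ≤ (1 - t) * (if a = 0 then (1 : ℝ) else 0) :=
    mul_nonneg (by linarith [ht.2]) (by split_ifs <;> norm_num)
  have h2 : 0 < t * (m : ℝ)⁻¹ := by positivity
  exact add_pos_of_nonneg_of_pos h1 h2

lemma exists_measure_of_law {m : ℕ} (p : Fin m → ℝ) (hp : ∀ a, 0 ≤ p a) (h1 : ∑ a, p a = 1) :
    ∃ ν : Measure (Fin m), IsProbabilityMeasure ν ∧ ∀ a, ν.real {a} = p a := by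
  have hs : ∑ a, ENNReal.ofReal (p a) = 1 := by
    rw [← ENNReal.ofReal_sum_of_nonneg fun a _ => hp a, h1, ENNReal.ofReal_one]
  refine ⟨(PMF.ofFintype (fun a => ENNReal.ofReal (p a)) hs).toMeasure, inferInstance, fun a => ?_⟩
  rw [Measure.real, PMF.toMeasure_apply_singleton _ _ (measurableSet_singleton a)]
  simp [ENNReal.toReal_ofReal (hp a)]

variable {A : Type} [Fintype A] [Nonempty A] [DecidableEq A] [MeasurableSpace A]
  [MeasurableSingletonClass A] {μ : Measure (ℤ → A)}

lemma KRep.hrate_pos (R : KRep μ) (hμ : Stat μ) (hA : 2 ≤ Fintype.card A) : 0 < hrate μ := by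
  have hk : ∀ s a, R.k.κ s a ≤ 1 - R.k.c := fun s a => by
    have : Nontrivial A := Fintype.one_lt_card_iff_nontrivial.1 hA
    obtain ⟨b, hb⟩ := exists_ne a
    have h1 := R.k.sum_one s
    have h2 := Finset.sum_le_sum_of_subset_of_nonneg (f := R.k.κ s) (Finset.subset_univ {a, b})
      fun i _ _ => R.k.c_pos.le.trans (R.k.c_le s i)
    rw [Finset.sum_pair hb.symm] at h2
    linarith [R.k.c_le s b]
  have hc : 0 < 1 - R.k.c := by
    have a := Classical.arbitrary A
    linarith [hk R.s₀ a, R.k.c_le R.s₀ a, R.k.c_pos]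
  have hl : Real.log (1 - R.k.c) < 0 := Real.log_neg hc (by linarith [R.k.c_pos])
  have hw : ∀ n u, wl μ n u ≤ (1 - R.k.c) ^ n := fun n u => by
    rw [← R.law_eq, StateKernel.law, StateKernel.lw]
    refine (Finset.prod_le_prod (fun i _ => R.k.c_pos.le.trans (R.k.c_le _ _)) fun i _ => hk _ _).trans ?_
    simp
  refine (neg_pos.2 hl).trans_le (hμ.le_hrate (C := 0) fun n => ?_)
  rw [add_zero, went, ent]
  calc (n : ℝ) * -Real.log (1 - R.k.c) = ∑ u, wl μ n u * (n * -Real.log (1 - R.k.c)) := by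
        rw [← Finset.sum_mul, hμ.sum_wl, one_mul]
    _ ≤ ∑ u, Real.negMulLog (wl μ n u) := by
        refine Finset.sum_le_sum fun u _ => ?_
        rw [Real.negMulLog, neg_mul, ← mul_neg]
        refine mul_le_mul_of_nonneg_left ?_ (wl_nonneg _ _ _)
        have := Real.log_le_log (R.wl_pos n u) (hw n u)
        rw [Real.log_pow] at this
        linarith

/-- A process with a state kernel is Bernoulli. -/
theorem KRep.isBernoulliSystem (R : KRep μ) (hμ : Stat μ) : IsBernoulliSystem μ := by
  have hprob := hμ.prob
  rcases lt_or_ge (Fintype.card A) 2 with hA | hA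
  · have hsub : Subsingleton A := Fintype.card_le_one_iff_subsingleton.1 (by omega)
    obtain ⟨ν, hν, hν1⟩ := exists_measure_of_law (m := 1) (fun _ => 1) (fun _ => zero_le_one) (by simp)
    have hs : ∀ a b : Measure (ℤ → Fin 1), a Set.univ = 1 → b Set.univ = 1 → a = b := by
      refine fun a b ha hb => Measure.ext fun t _ => ?_
      rcases t.eq_empty_or_nonempty with rfl | ht
      · simp
      · rw [Subsingleton.eq_univ_of_nonempty ht, ha, hb]
    refine ⟨1, fun a => ν {a}, iid ν, inferInstance, ?_, iid_cyl ν, fun _ _ => 0,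
      fun _ _ => Classical.arbitrary A, measurable_const, measurable_const, ?_, ?_, ?_, ?_⟩
    · rw [sum_measure_singleton, Finset.coe_univ, measure_univ]
    · exact hs _ _ (by rw [Measure.map_const]; simp) measure_univ
    · exact ae_of_all _ fun x => rfl
    · exact ae_of_all _ fun x => Subsingleton.elim _ _
    · exact ae_of_all _ fun x => Subsingleton.elim _ _
  · obtain ⟨m, p, hm, hp, hp1, he⟩ := exists_law_of_entropy (R.hrate_pos hμ hA)
    obtain ⟨ν, hν, hνp⟩ := exists_measure_of_law p (fun a => (hp a).le) hp1
    have : Nonempty (Fin m) := ⟨⟨0, by omega⟩⟩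
    obtain ⟨a₀, ha₀⟩ := Finite.exists_min p
    have R' := iidRep ν (hp a₀) fun b => by rw [hνp]; exact ha₀ b
    obtain ⟨φ, ψ, h1, h2, h3, h4, h5, h6⟩ := exists_iso R hμ R' (iid_stat ν) hA (by simpa using hm) (by
      rw [iid_hrate, ← he]; congr 1; ext a; exact (hνp a).symm)
    refine ⟨m, fun a => ν {a}, iid ν, inferInstance, ?_, iid_cyl ν, φ, ψ, h1, h2, h3,
      ae_of_all _ fun x => h4 x, h5, h6⟩
    rw [sum_measure_singleton, Finset.coe_univ, measure_univ]

end Bernoulli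

/-! ### A renewal sequence -/

section Renewal

variable (v : ℕ → ℝ)

/-- The partial products of `v`. -/
def pprod (n : ℕ) : ℝ := ∏ i ∈ Finset.range n, v i

/-- The renewal sequence: `∑ t ≤ n, pprod v t * ren v (n - t) = 1`. -/
def ren (n : ℕ) : ℝ := 1 - ∑ t : Fin n, pprod v (n - t) * ren t
termination_by n
decreasing_by exact t.2

/-- The tail sums of the renewal identity. -/
def renTail (n k : ℕ) : ℝ := ∑ t ∈ Finset.Ico k (n + 1), pprod v t * ren v (n - t)

lemma pprod_zero : pprod v 0 = 1 := by simp [pprod]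

lemma pprod_succ (n : ℕ) : pprod v (n + 1) = pprod v n * v n := Finset.prod_range_succ _ _

lemma renTail_zero (n : ℕ) : renTail v n 0 = 1 := by
  have h : ∑ t : Fin n, pprod v (n - t) * ren v t = ∑ t ∈ Finset.range n, pprod v (t + 1) * ren v (n - (t + 1)) := by
    rw [← Finset.sum_range fun t => pprod v (n - t) * ren v t, ← Finset.sum_range_reflect]
    refine Finset.sum_congr rfl fun t ht => ?_
    have := Finset.mem_range.1 ht
    rw [show n - (n - 1 - t) = t + 1 by omega, show n - 1 - t = n - (t + 1) by omega]
  rw [renTail, Nat.Ico_zero_eq_range, Finset.sum_range_succ', ← h, pprod_zero, Nat.sub_zero, ren]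
  ring

lemma renTail_gt {n k : ℕ} (h : n < k) : renTail v n k = 0 := by
  rw [renTail, Finset.Ico_eq_empty (by omega), Finset.sum_empty]

lemma renTail_sub {n k : ℕ} (h : k ≤ n) :
    renTail v n k - renTail v n (k + 1) = pprod v k * ren v (n - k) := by
  rw [renTail, renTail, Finset.sum_eq_sum_Ico_succ_bot (by omega)]
  ring

lemma ren_eq (n : ℕ) : ren v n = 1 - renTail v n 1 := by
  have := renTail_sub v (Nat.zero_le n)
  rw [renTail_zero, pprod_zero, Nat.sub_zero] at this
  linarith

lemma renTail_succ (n k : ℕ) : renTail v (n + 1) (k + 1) =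
    ∑ l ∈ Finset.Ico k (n + 1), (renTail v n l - renTail v n (l + 1)) * v l := by
  rw [renTail, ← Finset.sum_Ico_add' (fun t => pprod v t * ren v (n + 1 - t)) k (n + 1) 1]
  refine Finset.sum_congr rfl fun l hl => ?_
  rw [renTail_sub v (by have := Finset.mem_Ico.1 hl; omega), pprod_succ,
    show n + 1 - (l + 1) = n - l by omega]
  ring

/-- The weights after a summation by parts. -/
def abelW (k l : ℕ) : ℝ := if l = k then v k else v l - v (l - 1)

lemma abel_sum {e : ℕ → ℝ} {n k : ℕ} (hk : k ≤ n) (he : e (n + 1) = 0) :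
    ∑ l ∈ Finset.Ico k (n + 1), (e l - e (l + 1)) * v l =
      ∑ l ∈ Finset.Ico k (n + 1), abelW v k l * e l := by
  have : ∀ j, k ≤ j → ∑ l ∈ Finset.Ico k (j + 1), (e l - e (l + 1)) * v l + e (j + 1) * v j =
      ∑ l ∈ Finset.Ico k (j + 1), abelW v k l * e l := by
    intro j hj
    induction j, hj using Nat.le_induction with
    | base => simp [abelW]; ring
    | succ j hj ih =>
      rw [Finset.sum_Ico_succ_top (show k ≤ j + 1 by omega),
        Finset.sum_Ico_succ_top (show k ≤ j + 1 by omega), ← ih, abelW, if_neg (by omega), Nat.add_sub_cancel]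
      ring
  rw [← this n hk, he]
  ring

variable {v}

lemma pprod_pos (hv0 : ∀ n, 0 < v n) (n : ℕ) : 0 < pprod v n := Finset.prod_pos fun i _ => hv0 i

lemma abelW_nonneg (hv0 : ∀ n, 0 < v n) (hvm : Monotone v)
    (k l : ℕ) : 0 ≤ abelW v k l := by
  rw [abelW]
  split_ifs
  · exact (hv0 k).le
  · exact sub_nonneg.2 (hvm (by omega))

lemma ren_nonneg_and (hv0 : ∀ n, 0 < v n) (hv1 : ∀ n, v n ≤ 1) (hvm : Monotone v)
    (n : ℕ) : 0 ≤ ren v n ∧ ∀ j ≤ n, 0 ≤ ren v j := by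
  induction n with
  | zero =>
    have : ren v 0 = 1 := by rw [ren_eq, renTail_gt v (by omega), sub_zero]
    refine ⟨by rw [this]; norm_num, fun j hj => ?_⟩
    rw [Nat.le_zero.1 hj, this]; norm_num
  | succ n ih =>
    have hE : ∀ l, renTail v n l ≤ 1 := fun l => by
      rw [← renTail_zero v n]
      refine Finset.sum_le_sum_of_subset_of_nonneg
        (Finset.Ico_subset_Ico_left (Nat.zero_le l)) fun t _ _ => ?_
      exact mul_nonneg (pprod_pos hv0 t).le (ih.2 _ (Nat.sub_le _ _))
    have h1 : renTail v (n + 1) 1 ≤ 1 := by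
      rw [renTail_succ, abel_sum v (Nat.zero_le n) (renTail_gt v (by omega))]
      calc ∑ l ∈ Finset.Ico 0 (n + 1), abelW v 0 l * renTail v n l
          ≤ ∑ l ∈ Finset.Ico 0 (n + 1), abelW v 0 l :=
            Finset.sum_le_sum fun l _ =>
              mul_le_of_le_one_right (abelW_nonneg hv0 hvm _ _) (hE l)
        _ = v n := by
            rw [Nat.Ico_zero_eq_range, Finset.sum_range_succ']
            simp only [abelW, Nat.add_sub_cancel, Nat.succ_ne_zero, if_false, if_true]
            rw [Finset.sum_range_sub]
            ring
        _ ≤ 1 := hv1 n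
    have h2 : 0 ≤ ren v (n + 1) := by rw [ren_eq]; linarith
    refine ⟨h2, fun j hj => ?_⟩
    rcases Nat.le_succ_iff.1 hj with h | h
    · exact ih.2 j h
    · exact h ▸ h2

lemma ren_nonneg (hv0 : ∀ n, 0 < v n) (hv1 : ∀ n, v n ≤ 1) (hvm : Monotone v)
    (n : ℕ) : 0 ≤ ren v n := (ren_nonneg_and hv0 hv1 hvm n).1

lemma renTail_nonneg (hv0 : ∀ n, 0 < v n) (hv1 : ∀ n, v n ≤ 1) (hvm : Monotone v)
    (n k : ℕ) : 0 ≤ renTail v n k :=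
  Finset.sum_nonneg fun _ _ => mul_nonneg (pprod_pos hv0 _).le (ren_nonneg hv0 hv1 hvm _)

lemma renTail_mono (hv0 : ∀ n, 0 < v n) (hv1 : ∀ n, v n ≤ 1) (hvm : Monotone v)
    (n k : ℕ) : renTail v n k ≤ renTail v (n + 1) k := by
  induction n generalizing k with
  | zero =>
    rcases k with _ | k
    · rw [renTail_zero, renTail_zero]
    · rw [renTail_gt v (by omega)]; exact renTail_nonneg hv0 hv1 hvm _ _
  | succ n ih =>
    rcases k with _ | k
    · rw [renTail_zero, renTail_zero]
    · rcases le_or_gt k n with h | h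
      · rw [renTail_succ, renTail_succ, abel_sum v h (renTail_gt v (by omega)),
          abel_sum v (by omega) (renTail_gt v (by omega))]
        calc ∑ l ∈ Finset.Ico k (n + 1), abelW v k l * renTail v n l
            ≤ ∑ l ∈ Finset.Ico k (n + 1), abelW v k l * renTail v (n + 1) l :=
              Finset.sum_le_sum fun l hl => mul_le_mul_of_nonneg_left (ih l)
                (abelW_nonneg hv0 hvm _ _)
          _ ≤ _ := Finset.sum_le_sum_of_subset_of_nonneg
              (Finset.Ico_subset_Ico_right (by omega)) fun l hl _ =>
              mul_nonneg (abelW_nonneg hv0 hvm _ _)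
                (renTail_nonneg hv0 hv1 hvm _ _)
      · rw [renTail_gt v (by omega)]; exact renTail_nonneg hv0 hv1 hvm _ _

lemma ren_antitone (hv0 : ∀ n, 0 < v n) (hv1 : ∀ n, v n ≤ 1) (hvm : Monotone v) :
    Antitone (ren v) := antitone_nat_of_succ_le fun n => by
  rw [ren_eq, ren_eq]; linarith [renTail_mono hv0 hv1 hvm n 1]

lemma le_one_sub_ren (hv0 : ∀ n, 0 < v n) (hv1 : ∀ n, v n ≤ 1) (hvm : Monotone v)
    {n : ℕ} (hn : 1 ≤ n) : v 0 ≤ 1 - ren v n := by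
  have h := ren_antitone hv0 hv1 hvm hn
  have h1 : ren v 1 = 1 - v 0 := by
    rw [ren_eq, renTail_succ]
    simp [renTail_zero, renTail_gt]
  linarith

lemma pprod_antitone (hv0 : ∀ n, 0 < v n) (hv1 : ∀ n, v n ≤ 1) :
    Antitone (pprod v) := antitone_nat_of_succ_le fun n => by
  rw [pprod_succ]; exact mul_le_of_le_one_right (pprod_pos hv0 n).le (hv1 n)

lemma pprod_mul_sum_ren_le (hv0 : ∀ n, 0 < v n) (hv1 : ∀ n, v n ≤ 1) (hvm : Monotone v)
    (n : ℕ) : pprod v n * ∑ t ∈ Finset.range (n + 1), ren v t ≤ 1 := by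
  rw [← renTail_zero v n, renTail, Nat.Ico_zero_eq_range, Finset.mul_sum,
    ← Finset.sum_range_reflect]
  refine Finset.sum_le_sum fun t ht => ?_
  have := Finset.mem_range.1 ht
  rw [show n + 1 - 1 - t = n - t by omega]
  exact mul_le_mul_of_nonneg_right (pprod_antitone hv0 hv1 (by omega)) (ren_nonneg hv0 hv1 hvm _)

lemma mul_pprod_mul_ren_le (hv0 : ∀ n, 0 < v n) (hv1 : ∀ n, v n ≤ 1) (hvm : Monotone v)
    (n : ℕ) : (n + 1) * (pprod v n * ren v n) ≤ 1 := by
  refine le_trans ?_ (pprod_mul_sum_ren_le hv0 hv1 hvm n)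
  rw [mul_left_comm]
  refine mul_le_mul_of_nonneg_left ?_ (pprod_pos hv0 n).le
  have := Finset.card_nsmul_le_sum (Finset.range (n + 1)) (ren v) (ren v n) fun t ht =>
    ren_antitone hv0 hv1 hvm (by have := Finset.mem_range.1 ht; omega)
  simpa using this

end Renewal

/-! ### Transfer operators and their dependence on the right boundary -/

/-- `h` depends only on the sites left of `t`. -/
def DepLT (h : Conf S → ℝ) (t : ℤ) : Prop := ∀ x y, (∀ i < t, x i = y i) → h x = h y

lemma upd_ne (a : S) {j t : ℤ} (x : Conf S) (h : t ≠ j) : upd a j x t = x t := if_neg h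

lemma upd_self (a : S) (j : ℤ) (x : Conf S) : upd a j x j = a := if_pos rfl

lemma upd_agree (a : S) (j : ℤ) {t : ℤ} {x y : Conf S} (h : t ≠ j → x t = y t) :
    upd a j x t = upd a j y t := by
  rw [upd, upd]
  split_ifs with h'
  · rfl
  · exact h h'

/-- Summation over the symbol at site `j` with weight `g j`. -/
def siteOp (g : ℕ → Conf S → ℝ) (j : ℕ) : (Conf S → ℝ) →ₗ[ℝ] (Conf S → ℝ) where
  toFun h x := ∑ a, g j (upd a j x) * h (upd a j x)
  map_add' h k := by
    funext x
    simp only [Pi.add_apply, mul_add, Finset.sum_add_distrib]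
  map_smul' c h := by
    funext x
    simp only [Pi.smul_apply, smul_eq_mul, RingHom.id_apply, Finset.mul_sum]
    exact Finset.sum_congr rfl fun a _ => by ring

/-- Summation over the symbols at the sites `m, …, m + n - 1`. -/
def rangeOp (g : ℕ → Conf S → ℝ) (m : ℕ) : ℕ → (Conf S → ℝ) →ₗ[ℝ] (Conf S → ℝ)
  | 0 => LinearMap.id
  | n + 1 => (siteOp g (m + n)).comp (rangeOp g m n)

lemma siteOp_apply (g : ℕ → Conf S → ℝ) (j : ℕ) (h : Conf S → ℝ) (x : Conf S) :
    siteOp g j h x = ∑ a, g j (upd a j x) * h (upd a j x) := rfl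

lemma rangeOp_succ (g : ℕ → Conf S → ℝ) (m n : ℕ) (h : Conf S → ℝ) :
    rangeOp g m (n + 1) h = siteOp g (m + n) (rangeOp g m n h) := rfl

lemma rangeOp_succ' (g : ℕ → Conf S → ℝ) (m n : ℕ) (h : Conf S → ℝ) :
    rangeOp g m (n + 1) h = rangeOp g (m + 1) n (siteOp g m h) := by
  induction n with
  | zero => rfl
  | succ n ih => rw [rangeOp_succ, ih, rangeOp_succ, show m + (n + 1) = m + 1 + n by ring]

lemma rangeOp_add (g : ℕ → Conf S → ℝ) (m n p : ℕ) (h : Conf S → ℝ) :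
    rangeOp g m (n + p) h = rangeOp g (m + n) p (rangeOp g m n h) := by
  induction p with
  | zero => rfl
  | succ p ih => rw [← add_assoc, rangeOp_succ, ih, rangeOp_succ, add_assoc]

lemma rangeOp_congr {g g' : ℕ → Conf S → ℝ} (m n : ℕ) (hg : ∀ j, m ≤ j → j < m + n → g j = g' j)
    (h : Conf S → ℝ) : rangeOp g m n h = rangeOp g' m n h := by
  induction n with
  | zero => rfl
  | succ n ih =>
    rw [rangeOp_succ, rangeOp_succ, ih fun j h1 h2 => hg j h1 (by omega)]
    funext x
    simp only [siteOp_apply, hg (m + n) (by omega) (by omega)]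

lemma exists_rangeOp_repr {g : ℕ → Conf S → ℝ} (hg : ∀ j x, 0 < g j x) (m n : ℕ) (y : Conf S) :
    ∃ (ι : Type) (_ : Fintype ι) (w : ι → ℝ) (z : ι → Conf S), (∀ i, 0 < w i) ∧
      (∀ i t, t < (m : ℤ) → z i t = y t) ∧ ∀ k, rangeOp g m n k y = ∑ i, w i * k (z i) := by
  induction n generalizing m with
  | zero =>
    exact ⟨Unit, inferInstance, fun _ => 1, fun _ => y, fun _ => one_pos, fun _ _ _ => rfl,
      fun k => by simp [rangeOp]⟩
  | succ n ih =>
    obtain ⟨ι, hι, w, z, hw, hz, hk⟩ := ih (m + 1)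
    refine ⟨ι × S, inferInstance, fun p => w p.1 * g m (upd p.2 m (z p.1)),
      fun p => upd p.2 m (z p.1), fun p => mul_pos (hw _) (hg _ _), fun p t ht => ?_, fun k => ?_⟩
    · dsimp only
      rw [upd_ne _ _ ht.ne, hz _ _ (by push_cast; omega)]
    · rw [rangeOp_succ', hk, Fintype.sum_prod_type]
      refine Finset.sum_congr rfl fun i _ => ?_
      rw [siteOp_apply, Finset.mul_sum]
      exact Finset.sum_congr rfl fun a _ => by ring

lemma rangeOp_nonneg {g : ℕ → Conf S → ℝ} (hg : ∀ j x, 0 < g j x) (m n : ℕ) {h : Conf S → ℝ}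
    (hh : ∀ x, 0 ≤ h x) (x : Conf S) : 0 ≤ rangeOp g m n h x := by
  obtain ⟨ι, _, w, z, hw, -, hk⟩ := exists_rangeOp_repr hg m n x
  rw [hk]
  exact Finset.sum_nonneg fun i _ => mul_nonneg (hw i).le (hh _)

lemma rangeOp_mono {g : ℕ → Conf S → ℝ} (hg : ∀ j x, 0 < g j x) (m n : ℕ) {h k : Conf S → ℝ}
    (hh : ∀ x, h x ≤ k x) (x : Conf S) : rangeOp g m n h x ≤ rangeOp g m n k x := by
  have := rangeOp_nonneg hg m n (h := k - h) (fun x => sub_nonneg.2 (hh x)) x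
  rw [map_sub] at this
  exact sub_nonneg.1 this

lemma rangeOp_pos {g : ℕ → Conf S → ℝ} (hg : ∀ j x, 0 < g j x) (m n : ℕ) {h : Conf S → ℝ}
    (hh : ∀ x, 0 < h x) (x : Conf S) : 0 < rangeOp g m n h x := by
  induction n generalizing x with
  | zero => exact hh x
  | succ n ih =>
    rw [rangeOp_succ, siteOp_apply]
    exact Finset.sum_pos (fun a _ => mul_pos (hg _ _) (ih _)) Finset.univ_nonempty

lemma rangeOp_of_depLT (g : ℕ → Conf S → ℝ) (m n : ℕ) {h : Conf S → ℝ} (hh : DepLT h m)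
    (x : Conf S) : rangeOp g m n h x = h x * rangeOp g m n (fun _ => 1) x := by
  induction n generalizing x with
  | zero => simp [rangeOp]
  | succ n ih =>
    rw [rangeOp_succ, rangeOp_succ, siteOp_apply, siteOp_apply, Finset.mul_sum]
    refine Finset.sum_congr rfl fun a _ => ?_
    rw [ih, hh (upd a _ x) x fun i hi => upd_ne _ _ (by push_cast; omega)]
    ring

section Layers

/-- The infimum of `g` over the configurations that agree with `x` up to `t`. -/
def layer (g : Conf S → ℝ) (t : ℤ) (x : Conf S) : ℝ :=
  ⨅ w : {w : Conf S // ∀ i ≤ t, w i = x i}, g w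

variable {g : Conf S → ℝ}

lemma layer_le_apply (hg : ∀ x, 0 < g x) {t : ℤ} {x w : Conf S} (h : ∀ i ≤ t, w i = x i) :
    layer g t x ≤ g w :=
  ciInf_le (f := fun w : {w : Conf S // ∀ i ≤ t, w i = x i} => g w)
    ⟨0, by rintro _ ⟨w, rfl⟩; exact (hg _).le⟩ ⟨w, h⟩

lemma le_layer {t : ℤ} {x : Conf S} {c : ℝ} (h : ∀ w : Conf S, (∀ i ≤ t, w i = x i) → c ≤ g w) :
    c ≤ layer g t x :=
  haveI : Nonempty {w : Conf S // ∀ i ≤ t, w i = x i} := ⟨⟨x, fun _ _ => rfl⟩⟩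
  le_ciInf fun w => h w w.2

lemma layer_congr {t : ℤ} {x y : Conf S} (h : ∀ i ≤ t, x i = y i) : layer g t x = layer g t y := by
  have : {w : Conf S | ∀ i ≤ t, w i = x i} = {w | ∀ i ≤ t, w i = y i} := by
    ext w
    exact forall₂_congr fun i hi => by rw [h i hi]
  unfold layer
  exact congrArg (fun A : Set (Conf S) => ⨅ w : A, g w) this

lemma layer_mono (hg : ∀ x, 0 < g x) {t t' : ℤ} (htt : t ≤ t') (x : Conf S) :
    layer g t x ≤ layer g t' x :=
  le_layer fun _ hw => layer_le_apply hg fun i hi => hw i (hi.trans htt)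

end Layers

variable {g : ℕ → Conf S → ℝ} {v : ℕ → ℝ}

/-- One summation step for a lower bound on ratios at two boundary conditions. -/
lemma ratio_step (hg : ∀ j x, 0 < g j x)
    (hgv : ∀ (j l : ℕ) (x y : Conf S), (∀ i : ℤ, i ≤ j + l → x i = y i) → v l * g j y ≤ g j x)
    (m n : ℕ) {x y : Conf S} {e : ℕ → ℝ} (ha : Antitone e) (hz : ∀ k, n < k → e k = 0)
    (hval : ∀ (k : ℕ) (h : Conf S → ℝ), (∀ x, 0 ≤ h x) → DepLT h ((m + 1 : ℕ) + k) →
      e k * rangeOp g (m + 1) n h y ≤ rangeOp g (m + 1) n h x)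
    (k : ℕ) {h : Conf S → ℝ} (hh : ∀ x, 0 ≤ h x) (hd : DepLT h (m + 1 + k)) :
    (∑ l ∈ Finset.Ico k (n + 1), (e l - e (l + 1)) * v l) * rangeOp g m (n + 1) h y ≤
      rangeOp g m (n + 1) h x := by
  rcases lt_or_ge n k with hk | hk
  · rw [Finset.Ico_eq_empty (by omega), Finset.sum_empty, zero_mul]
    exact rangeOp_nonneg hg _ _ hh x
  set G : ℕ → Conf S → ℝ := fun l z =>
    ∑ a, layer (g m) (m + l) (upd a m z) * h (upd a m z) with hG
  have hlay : ∀ l z, 0 ≤ layer (g m) (m + l) z := fun l z => le_layer fun w _ => (hg _ _).le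
  have hG0 : ∀ l z, 0 ≤ G l z := fun l z =>
    Finset.sum_nonneg fun a _ => mul_nonneg (hlay _ _) (hh _)
  have hGd : ∀ l, k ≤ l → DepLT (G l) ((m + 1 : ℕ) + l) := fun l hl x y hxy =>
    Finset.sum_congr rfl fun a _ => by
      rw [layer_congr fun i hi => upd_agree a m fun _ => hxy i (by push_cast; omega),
        hd (upd a m x) (upd a m y) fun i hi => upd_agree a m fun _ => hxy i (by push_cast; omega)]
  have hGm : ∀ l z, G l z ≤ G (l + 1) z := fun l z => Finset.sum_le_sum fun a _ =>
    mul_le_mul_of_nonneg_right (layer_mono (hg m) (by push_cast; omega) _) (hh _)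
  have hGg : ∀ l z, G l z ≤ siteOp g m h z := fun l z => Finset.sum_le_sum fun a _ =>
    mul_le_mul_of_nonneg_right (layer_le_apply (hg m) fun _ _ => rfl) (hh _)
  have hgG : ∀ l z, (v l • siteOp g m h) z ≤ G l z := fun l z => by
    rw [Pi.smul_apply, smul_eq_mul, siteOp_apply, Finset.mul_sum]
    refine Finset.sum_le_sum fun a _ => ?_
    rw [← mul_assoc]
    exact mul_le_mul_of_nonneg_right (le_layer fun w hw => hgv m l w _ hw) (hh _)
  have main : ∀ j, k ≤ j → ∑ l ∈ Finset.Ico k j, (e l - e (l + 1)) * rangeOp g (m + 1) n (G l) y +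
      e j * rangeOp g (m + 1) n (G j) y ≤ rangeOp g (m + 1) n (G j) x := by
    intro j hj
    induction j, hj using Nat.le_induction with
    | base =>
      rw [Finset.Ico_self, Finset.sum_empty, zero_add]
      exact hval k _ (hG0 k) (hGd k le_rfl)
    | succ j hj ih =>
      have h1 := hval (j + 1) (G (j + 1) - G j) (fun z => sub_nonneg.2 (hGm j z))
        (fun x y hxy => by
          rw [Pi.sub_apply, Pi.sub_apply, hGd (j + 1) (by omega) x y hxy,
            hGd j hj x y fun i hi => hxy i (by push_cast at hi ⊢; omega)])
      rw [map_sub, Pi.sub_apply, Pi.sub_apply] at h1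
      rw [Finset.sum_Ico_succ_top hj]
      nlinarith
  have hn := main n hk
  have hen : e (n + 1) = 0 := hz _ (by omega)
  rw [rangeOp_succ']
  calc (∑ l ∈ Finset.Ico k (n + 1), (e l - e (l + 1)) * v l) * rangeOp g (m + 1) n (siteOp g m h) y
      ≤ ∑ l ∈ Finset.Ico k (n + 1), (e l - e (l + 1)) * rangeOp g (m + 1) n (G l) y := by
        rw [Finset.sum_mul]
        refine Finset.sum_le_sum fun l _ => ?_
        rw [mul_assoc]
        refine mul_le_mul_of_nonneg_left ?_ (sub_nonneg.2 (ha (Nat.le_succ l)))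
        have := rangeOp_mono hg (m + 1) n (hgG l) y
        rwa [map_smul] at this
    _ = ∑ l ∈ Finset.Ico k n, (e l - e (l + 1)) * rangeOp g (m + 1) n (G l) y +
          e n * rangeOp g (m + 1) n (G n) y := by
        rw [Finset.sum_Ico_succ_top hk, hen, sub_zero]
    _ ≤ rangeOp g (m + 1) n (G n) x := hn
    _ ≤ _ := rangeOp_mono hg (m + 1) n (hGg n) x

/-- The lower bounds obtained from the renewal recursion. -/
lemma exists_ratio_bounds (hg : ∀ j x, 0 < g j x) (hv0 : ∀ n, 0 < v n) (hvm : Monotone v)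
    (hgv : ∀ (j l : ℕ) (x y : Conf S), (∀ i : ℤ, i ≤ j + l → x i = y i) → v l * g j y ≤ g j x)
    (n : ℕ) : ∀ (m : ℕ) (x y : Conf S), (∀ i : ℤ, i < m + n → x i = y i) →
    ∃ e e' : ℕ → ℝ, Antitone e ∧ Antitone e' ∧ (∀ k, n < k → e k = 0) ∧ (∀ k, n < k → e' k = 0) ∧
      (∀ (k : ℕ) (h : Conf S → ℝ), (∀ x, 0 ≤ h x) → DepLT h (m + k) →
        e k * rangeOp g m n h y ≤ rangeOp g m n h x ∧
        e' k * rangeOp g m n h x ≤ rangeOp g m n h y) ∧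
      ∀ k, renTail v n k ^ 2 ≤ e k * e' k := by
  induction n with
  | zero =>
    intro m x y hxy
    have hanti : Antitone fun k : ℕ => if k = 0 then (1 : ℝ) else 0 :=
      antitone_nat_of_succ_le fun k => by
        rw [if_neg (by omega)]
        split_ifs <;> norm_num
    have hzero : ∀ k : ℕ, 0 < k → (if k = 0 then (1 : ℝ) else 0) = 0 := fun k hk => if_neg (by omega)
    refine ⟨_, _, hanti, hanti, hzero, hzero, fun k h hh hd => ?_, fun k => ?_⟩
    · rcases Nat.eq_zero_or_pos k with rfl | hk
      · rw [if_pos rfl, one_mul, one_mul]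
        have : h x = h y := hd x y fun i hi => hxy i (by simpa using hi)
        exact ⟨this.ge, this.le⟩
      · rw [hzero k hk, zero_mul, zero_mul]
        exact ⟨hh x, hh y⟩
    · rcases Nat.eq_zero_or_pos k with rfl | hk
      · simp [renTail_zero]
      · rw [renTail_gt v hk, hzero k hk, mul_zero, sq, mul_zero]
  | succ n ih =>
    intro m x y hxy
    obtain ⟨e, e', ha, ha', hz, hz', hval, hprod⟩ :=
      ih (m + 1) x y fun i hi => hxy i (by push_cast at hi ⊢; omega)
    have he0 : ∀ k, 0 ≤ e k := fun k => by
      rw [← hz (k + n + 1) (by omega)]; exact ha (by omega)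
    have he0' : ∀ k, 0 ≤ e' k := fun k => by
      rw [← hz' (k + n + 1) (by omega)]; exact ha' (by omega)
    have hx1 := rangeOp_pos hg m (n + 1) (h := fun _ => 1) (fun _ => one_pos) x
    have hy1 := rangeOp_pos hg m (n + 1) (h := fun _ => 1) (fun _ => one_pos) y
    set X := rangeOp g m (n + 1) (fun _ => 1) x
    set Y := rangeOp g m (n + 1) (fun _ => 1) y
    have hstep := fun k (h : Conf S → ℝ) hh hd => ratio_step hg hgv m n ha hz
      (fun k h hh hd => (hval k h hh hd).1) k (h := h) hh hd
    have hstep' := fun k (h : Conf S → ℝ) hh hd => ratio_step hg hgv m n ha' hz'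
      (fun k h hh hd => (hval k h hh hd).2) k (h := h) hh hd
    set N : (ℕ → ℝ) → ℕ → ℝ := fun e k => ∑ l ∈ Finset.Ico k (n + 1), (e l - e (l + 1)) * v l with hN
    have hNa : ∀ e : ℕ → ℝ, Antitone e → Antitone (N e) := fun e he k k' hkk =>
      Finset.sum_le_sum_of_subset_of_nonneg (Finset.Ico_subset_Ico_left hkk) fun l _ _ =>
        mul_nonneg (sub_nonneg.2 (he (Nat.le_succ l))) (hv0 l).le
    have hNz : ∀ (e : ℕ → ℝ) k, n < k → N e k = 0 := fun e k hk => by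
      rw [hN]; dsimp only
      rw [Finset.Ico_eq_empty (by omega), Finset.sum_empty]
    have hone : ∀ t, DepLT (fun _ : Conf S => (1 : ℝ)) t := fun t x y _ => rfl
    have hN0 : N e 0 ≤ X / Y := by
      rw [le_div_iff₀ hy1]; exact hstep 0 _ (fun _ => zero_le_one) (hone _)
    have hN0' : N e' 0 ≤ Y / X := by
      rw [le_div_iff₀ hx1]; exact hstep' 0 _ (fun _ => zero_le_one) (hone _)
    have hanti : ∀ (e : ℕ → ℝ) (c : ℝ), Antitone e → N e 0 ≤ c →
        Antitone fun k : ℕ => if k = 0 then c else N e (k - 1) := fun e c he hc =>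
      antitone_nat_of_succ_le fun k => by
        rw [if_neg (by omega), Nat.add_sub_cancel]
        split_ifs with hk
        · rw [hk]; exact hc
        · exact hNa e he (by omega)
    refine ⟨_, _, hanti e _ ha hN0, hanti e' _ ha' hN0', fun k hk => ?_, fun k hk => ?_,
      fun k h hh hd => ?_, fun k => ?_⟩
    · rw [if_neg (by omega)]; exact hNz _ _ (by omega)
    · rw [if_neg (by omega)]; exact hNz _ _ (by omega)
    · rcases k with _ | k
      · rw [if_pos rfl, if_pos rfl]
        have hd0 : DepLT h m := by simpa using hd
        have hxy' : h x = h y := hd0 x y fun i hi => hxy i (by push_cast; omega)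
        rw [rangeOp_of_depLT g m (n + 1) hd0 x, rangeOp_of_depLT g m (n + 1) hd0 y, hxy']
        refine ⟨le_of_eq ?_, le_of_eq ?_⟩
        · change X / Y * (h y * Y) = h y * X
          field_simp
        · change Y / X * (h y * X) = h y * Y
          field_simp
      · rw [if_neg (by omega), if_neg (by omega), Nat.add_sub_cancel]
        have hd' : DepLT h (m + 1 + k) := by
          have : (m : ℤ) + ((k + 1 : ℕ) : ℤ) = m + 1 + k := by push_cast; ring
          rwa [this] at hd
        exact ⟨hstep k h hh hd', hstep' k h hh hd'⟩
    · rcases k with _ | k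
      · rw [if_pos rfl, if_pos rfl, renTail_zero, div_mul_div_cancel₀ hy1.ne', div_self hx1.ne']
        norm_num
      · rw [if_neg (by omega), if_neg (by omega), Nat.add_sub_cancel, renTail_succ]
        rcases le_or_gt k n with hk | hk
        · rw [hN]; dsimp only
          rw [abel_sum v hk (renTail_gt v (by omega)), abel_sum v hk (hz _ (by omega)),
            abel_sum v hk (hz' _ (by omega))]
          refine Finset.sum_sq_le_sum_mul_sum_of_sq_le_mul _ (fun l hl => ?_) (fun l hl => ?_)
            fun l hl => ?_
          · exact mul_nonneg (abelW_nonneg hv0 hvm _ _) (he0 l)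
          · exact mul_nonneg (abelW_nonneg hv0 hvm _ _) (he0' l)
          · rw [mul_pow, mul_mul_mul_comm, ← sq]
            exact mul_le_mul_of_nonneg_left (hprod l) (sq_nonneg _)
        · rw [Finset.Ico_eq_empty (by omega), hNz _ _ hk]
          simp

/-- The effect of the right boundary on the odds of two events at the first site. -/
theorem odds_right (hg : ∀ j x, 0 < g j x) (hv0 : ∀ n, 0 < v n) (hvm : Monotone v)
    (hgv : ∀ (j l : ℕ) (x y : Conf S), (∀ i : ℤ, i ≤ j + l → x i = y i) → v l * g j y ≤ g j x)
    (n : ℕ) {x y : Conf S} (hxy : ∀ i : ℤ, i < n → x i = y i) {h k : Conf S → ℝ}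
    (hh : ∀ x, 0 ≤ h x) (hk : ∀ x, 0 ≤ k x) (hdh : DepLT h 1) (hdk : DepLT k 1) :
    (1 - ren v n) ^ 2 * (rangeOp g 0 n h y * rangeOp g 0 n k x) ≤
      rangeOp g 0 n h x * rangeOp g 0 n k y := by
  obtain ⟨e, e', ha, ha', hz, hz', hval, hprod⟩ :=
    exists_ratio_bounds hg hv0 hvm hgv n 0 x y fun i hi => hxy i (by simpa using hi)
  have h0 : 0 ≤ e 1 := by rw [← hz (1 + n) (by omega)]; exact ha (by omega)
  have h0' : 0 ≤ e' 1 := by rw [← hz' (1 + n) (by omega)]; exact ha' (by omega)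
  have h1 := (hval 1 h hh (by simpa using hdh)).1
  have h2 := (hval 1 k hk (by simpa using hdk)).2
  have hp := hprod 1
  have hy := rangeOp_nonneg hg 0 n hh y
  have hx := rangeOp_nonneg hg 0 n hk x
  rw [ren_eq, sub_sub_cancel]
  calc renTail v n 1 ^ 2 * (rangeOp g 0 n h y * rangeOp g 0 n k x)
      ≤ e 1 * e' 1 * (rangeOp g 0 n h y * rangeOp g 0 n k x) :=
        mul_le_mul_of_nonneg_right hp (mul_nonneg hy hx)
    _ = (e 1 * rangeOp g 0 n h y) * (e' 1 * rangeOp g 0 n k x) := by ring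
    _ ≤ _ := mul_le_mul h1 h2 (mul_nonneg h0' hx) (rangeOp_nonneg hg 0 n hh x)

/-! ### The effect of the left boundary -/

lemma cross_sum_le {ι : Type*} [Fintype ι] {W F G u : ι → ℝ} {θ c : ℝ} (hW : ∀ z, 0 ≤ W z)
    (hF : ∀ z, 0 ≤ F z) (hG : ∀ z, 0 ≤ G z) (hu : ∀ z, 0 ≤ u z) (hθ : 0 ≤ θ) (hc : 0 ≤ c)
    (hFG : ∀ z w, F z * G w ≤ (1 + θ) * (F w * G z)) (huu : ∀ z w, u z ≤ (1 + c) * u w) :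
    (∑ z, W z * (F z * u z)) * ∑ w, W w * G w ≤
      (1 + θ * c) * ((∑ z, W z * F z) * ∑ w, W w * (G w * u w)) := by
  have key : ∀ z w, u w ≤ u z → F z * G w * u z + F w * G z * u w ≤
      F z * G w * u w + F w * G z * u z + θ * c * (F w * G z * u z) := fun z w h => by
    have h1 : (F z * G w - F w * G z) * (u z - u w) ≤ θ * (F w * G z) * (c * u w) := by
      have hp := mul_nonneg (hF w) (hG z)
      refine mul_le_mul ?_ ?_ (sub_nonneg.2 h) (mul_nonneg hθ hp)
      · linarith [hFG z w]
      · linarith [huu z w]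
    have h2 : θ * (F w * G z) * (c * u w) ≤ θ * c * (F w * G z * u z) := by
      have := mul_le_mul_of_nonneg_left h
        (mul_nonneg (mul_nonneg hθ hc) (mul_nonneg (hF w) (hG z)))
      linarith
    linarith
  have pt : ∀ z w, F z * G w * u z + F w * G z * u w ≤
      (1 + θ * c) * (F z * G w * u w + F w * G z * u z) := fun z w => by
    have hz := mul_nonneg (mul_nonneg hθ hc) (mul_nonneg (mul_nonneg (hF w) (hG z)) (hu z))
    have hw := mul_nonneg (mul_nonneg hθ hc) (mul_nonneg (mul_nonneg (hF z) (hG w)) (hu w))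
    rcases le_total (u w) (u z) with h | h
    · linarith [key z w h]
    · linarith [key w z h]
  have e1 : (∑ z, W z * (F z * u z)) * ∑ w, W w * G w =
      ∑ z, ∑ w, W z * W w * (F z * G w * u z) := by
    rw [Finset.sum_mul_sum]
    exact Finset.sum_congr rfl fun z _ => Finset.sum_congr rfl fun w _ => by ring
  have e1' : (∑ z, W z * (F z * u z)) * ∑ w, W w * G w =
      ∑ z, ∑ w, W z * W w * (F w * G z * u w) := by
    rw [e1, Finset.sum_comm]
    exact Finset.sum_congr rfl fun z _ => Finset.sum_congr rfl fun w _ => by ring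
  have e2 : (∑ z, W z * F z) * ∑ w, W w * (G w * u w) =
      ∑ z, ∑ w, W z * W w * (F z * G w * u w) := by
    rw [Finset.sum_mul_sum]
    exact Finset.sum_congr rfl fun z _ => Finset.sum_congr rfl fun w _ => by ring
  have e2' : (∑ z, W z * F z) * ∑ w, W w * (G w * u w) =
      ∑ z, ∑ w, W z * W w * (F w * G z * u z) := by
    rw [e2, Finset.sum_comm]
    exact Finset.sum_congr rfl fun z _ => Finset.sum_congr rfl fun w _ => by ring
  have tot : ∑ z, ∑ w, W z * W w * (F z * G w * u z + F w * G z * u w) ≤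
      ∑ z, ∑ w, W z * W w * ((1 + θ * c) * (F z * G w * u w + F w * G z * u z)) :=
    Finset.sum_le_sum fun z _ => Finset.sum_le_sum fun w _ =>
      mul_le_mul_of_nonneg_left (pt z w) (mul_nonneg (hW z) (hW w))
  have tl : ∑ z, ∑ w, W z * W w * (F z * G w * u z + F w * G z * u w) =
      2 * ((∑ z, W z * (F z * u z)) * ∑ w, W w * G w) := by
    simp only [mul_add, Finset.sum_add_distrib]
    rw [← e1, ← e1']
    ring
  have tr : ∑ z, ∑ w, W z * W w * ((1 + θ * c) * (F z * G w * u w + F w * G z * u z)) =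
      2 * ((1 + θ * c) * ((∑ z, W z * F z) * ∑ w, W w * (G w * u w))) := by
    have : ∀ z w, W z * W w * ((1 + θ * c) * (F z * G w * u w + F w * G z * u z)) =
        (1 + θ * c) * (W z * W w * (F z * G w * u w) + W z * W w * (F w * G z * u z)) :=
      fun z w => by ring
    simp only [this, ← Finset.mul_sum, Finset.sum_add_distrib]
    rw [← e2, ← e2']
    ring
  linarith

/-- The family that equals `g` left of `l` and `g'` from `l` on. -/
def hybrid (g g' : ℕ → Conf S → ℝ) (l : ℕ) : ℕ → Conf S → ℝ := fun j => if j < l then g j else g' j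

lemma rangeOp_hybrid (g g' : ℕ → Conf S → ℝ) {l n : ℕ} (hl : l < n) (h : Conf S → ℝ) :
    rangeOp (hybrid g g' l) 0 n h =
      rangeOp g' (l + 1) (n - (l + 1)) (siteOp g' l (rangeOp g 0 l h)) := by
  obtain ⟨p, rfl⟩ := Nat.exists_eq_add_of_lt hl
  rw [show l + p + 1 = l + (p + 1) by ring, rangeOp_add, rangeOp_succ', rangeOp_congr (g' := g) 0 l, rangeOp_congr (g' := g') _ p]
  · rw [show l + (p + 1) - (l + 1) = p by omega, Nat.zero_add]
    congr 1
    funext x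
    simp only [siteOp_apply, hybrid, lt_irrefl, if_false]
  · intro j hj _
    funext x
    rw [hybrid, if_neg (by omega)]
  · intro j _ hj
    funext x
    rw [hybrid, if_pos (by omega)]

lemma rangeOp_hybrid' (g g' : ℕ → Conf S → ℝ) {l n : ℕ} (hl : l < n) (h : Conf S → ℝ) :
    rangeOp (hybrid g g' (l + 1)) 0 n h =
      rangeOp g' (l + 1) (n - (l + 1)) (siteOp g l (rangeOp g 0 l h)) := by
  obtain ⟨p, rfl⟩ := Nat.exists_eq_add_of_lt hl
  rw [show l + p + 1 = (l + 1) + p by ring, rangeOp_add, rangeOp_congr (g' := g) 0 (l + 1),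
    rangeOp_congr (g' := g') _ p]
  · rw [show l + 1 + p - (l + 1) = p by omega, Nat.zero_add, rangeOp_succ, Nat.zero_add]
  · intro j hj _
    funext x
    rw [hybrid, if_neg (by omega)]
  · intro j _ hj
    funext x
    rw [hybrid, if_pos (by omega)]

variable {g g' : ℕ → Conf S → ℝ} {v b : ℕ → ℝ}

/-- The effect of replacing one weight on the odds of two events at the first site. -/
lemma hybrid_step (hg : ∀ j x, 0 < g j x) (hg' : ∀ j x, 0 < g' j x)
    (hb : ∀ j x, g' j x ≤ Real.exp (b j) * g j x) (hb' : ∀ j x, g j x ≤ Real.exp (b j) * g' j x)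
    (hb0 : ∀ j, 0 ≤ b j) {l n : ℕ} (hl : l < n) (y : Conf S) {h k : Conf S → ℝ} {θ : ℝ}
    (hh : ∀ x, 0 ≤ h x) (hk : ∀ x, 0 ≤ k x) (hθ : 0 ≤ θ)
    (hhk : ∀ x z : Conf S, (∀ i : ℤ, i < l → x i = z i) → rangeOp g 0 l h x * rangeOp g 0 l k z ≤
      (1 + θ) * (rangeOp g 0 l h z * rangeOp g 0 l k x)) :
    rangeOp (hybrid g g' l) 0 n h y * rangeOp (hybrid g g' (l + 1)) 0 n k y ≤
      (1 + θ * (Real.exp (2 * b l) - 1)) *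
        (rangeOp (hybrid g g' (l + 1)) 0 n h y * rangeOp (hybrid g g' l) 0 n k y) := by
  simp only [rangeOp_hybrid g g' hl, rangeOp_hybrid' g g' hl]
  obtain ⟨ι, _, w, z, hw, hz, hrep⟩ := exists_rangeOp_repr hg' (l + 1) (n - (l + 1)) y
  have e1 : ∀ f : Conf S → ℝ, rangeOp g' (l + 1) (n - (l + 1)) (siteOp g l f) y =
      ∑ p : ι × S, (w p.1 * g l (upd p.2 l (z p.1))) * f (upd p.2 l (z p.1)) := fun f => by
    rw [hrep, Fintype.sum_prod_type]
    refine Finset.sum_congr rfl fun i _ => ?_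
    rw [siteOp_apply, Finset.mul_sum]
    exact Finset.sum_congr rfl fun a _ => by ring
  have e2 : ∀ f : Conf S → ℝ, rangeOp g' (l + 1) (n - (l + 1)) (siteOp g' l f) y =
      ∑ p : ι × S, (w p.1 * g l (upd p.2 l (z p.1))) * (f (upd p.2 l (z p.1)) *
        (g' l (upd p.2 l (z p.1)) / g l (upd p.2 l (z p.1)))) := fun f => by
    rw [hrep, Fintype.sum_prod_type]
    refine Finset.sum_congr rfl fun i _ => ?_
    rw [siteOp_apply, Finset.mul_sum]
    refine Finset.sum_congr rfl fun a _ => ?_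
    have := (hg l (upd a l (z i))).ne'
    field_simp
  rw [e1, e1, e2, e2]
  refine cross_sum_le (fun p => (mul_pos (hw _) (hg _ _)).le) (fun p => rangeOp_nonneg hg _ _ hh _)
    (fun p => rangeOp_nonneg hg _ _ hk _) (fun p => (div_pos (hg' _ _) (hg _ _)).le) hθ
    (by rw [sub_nonneg]; exact Real.one_le_exp (by linarith [hb0 l])) (fun p q => ?_) fun p q => ?_
  · refine hhk _ _ fun i hi => ?_
    rw [upd_ne _ _ hi.ne, upd_ne _ _ hi.ne, hz _ _ (by push_cast; omega), hz _ _ (by push_cast; omega)]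
  · rw [add_sub_cancel]
    calc g' l (upd p.2 l (z p.1)) / g l (upd p.2 l (z p.1)) ≤ Real.exp (b l) := by
          rw [div_le_iff₀ (hg _ _)]; exact hb _ _
      _ = Real.exp (2 * b l) * Real.exp (-b l) := by rw [← Real.exp_add]; ring_nf
      _ ≤ _ := by
          refine mul_le_mul_of_nonneg_left ?_ (Real.exp_pos _).le
          rw [Real.exp_neg, le_div_iff₀ (hg _ _), inv_mul_le_iff₀ (Real.exp_pos _)]
          exact hb' _ _

lemma hybrid_zero (hg : ∀ j x, 0 < g j x) (hg' : ∀ j x, 0 < g' j x)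
    (hb : ∀ j x, g' j x ≤ Real.exp (b j) * g j x) (hb' : ∀ j x, g j x ≤ Real.exp (b j) * g' j x)
    {n : ℕ} (hn : 0 < n) (y : Conf S) {h k : Conf S → ℝ}
    (hh : ∀ x, 0 ≤ h x) (hk : ∀ x, 0 ≤ k x) :
    rangeOp (hybrid g g' 0) 0 n h y * rangeOp (hybrid g g' 1) 0 n k y ≤
      Real.exp (2 * b 0) *
        (rangeOp (hybrid g g' 1) 0 n h y * rangeOp (hybrid g g' 0) 0 n k y) := by
  simp only [rangeOp_hybrid g g' hn, rangeOp_hybrid' g g' hn]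
  have key : ∀ (g g' : ℕ → Conf S → ℝ), (∀ x, g' 0 x ≤ Real.exp (b 0) * g 0 x) →
      ∀ (q : ℕ → Conf S → ℝ), (∀ j x, 0 < q j x) → ∀ f : Conf S → ℝ, (∀ x, 0 ≤ f x) →
      rangeOp q (0 + 1) (n - (0 + 1)) (siteOp g' 0 f) y ≤
        Real.exp (b 0) * rangeOp q (0 + 1) (n - (0 + 1)) (siteOp g 0 f) y := by
    intro g g' hgg q hq f hf
    have h1 : ∀ x, siteOp g' 0 f x ≤ (Real.exp (b 0) • siteOp g 0 f) x := fun x => by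
      rw [Pi.smul_apply, smul_eq_mul, siteOp_apply, siteOp_apply, Finset.mul_sum]
      refine Finset.sum_le_sum fun a _ => ?_
      rw [← mul_assoc]
      exact mul_le_mul_of_nonneg_right (hgg _) (hf _)
    have := rangeOp_mono hq (0 + 1) (n - (0 + 1)) h1 y
    rwa [map_smul] at this
  have h1 := key g g' (hb 0) g' hg' _ hh
  have h2 := key g' g (hb' 0) g' hg' _ hk
  have hs : ∀ (q : ℕ → Conf S → ℝ), (∀ j x, 0 < q j x) → ∀ f : Conf S → ℝ, (∀ x, 0 ≤ f x) →
      0 ≤ rangeOp g' (0 + 1) (n - (0 + 1)) (siteOp q 0 f) y := fun q hq f hf =>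
    rangeOp_nonneg hg' _ _ (fun x => Finset.sum_nonneg fun a _ => mul_nonneg (hq _ _).le (hf _)) _
  calc _ ≤ _ := mul_le_mul h1 h2 (hs g hg _ hk) (mul_nonneg (Real.exp_pos _).le (hs g hg _ hh))
    _ = _ := by
      rw [show 2 * b 0 = b 0 + b 0 by ring, Real.exp_add]
      simp only [rangeOp, LinearMap.id_apply]
      ring

/-- The effect of the left boundary on the odds of two events at the first site. -/
theorem odds_left (hg : ∀ j x, 0 < g j x) (hg' : ∀ j x, 0 < g' j x) (hv0 : ∀ n, 0 < v n)
    (hv1 : ∀ n, v n ≤ 1) (hvm : Monotone v)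
    (hgv : ∀ (j l : ℕ) (x y : Conf S), (∀ i : ℤ, i ≤ j + l → x i = y i) → v l * g j y ≤ g j x)
    (hb : ∀ j x, g' j x ≤ Real.exp (b j) * g j x) (hb' : ∀ j x, g j x ≤ Real.exp (b j) * g' j x)
    (hb0 : ∀ j, 0 ≤ b j) {n : ℕ} (hn : 0 < n) (y : Conf S) {h k : Conf S → ℝ}
    (hh : ∀ x, 0 ≤ h x) (hk : ∀ x, 0 ≤ k x) (hdh : DepLT h 1) (hdk : DepLT k 1)
    (hhp : ∀ j ≤ n, 0 < rangeOp (hybrid g g' j) 0 n h y)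
    (hkp : ∀ j ≤ n, 0 < rangeOp (hybrid g g' j) 0 n k y) :
    rangeOp g' 0 n h y * rangeOp g 0 n k y ≤
      Real.exp (2 * b 0 + ∑ l ∈ Finset.Ico 1 n, 2 / v 0 ^ 2 * ren v l * (Real.exp (2 * b l) - 1)) *
        (rangeOp g 0 n h y * rangeOp g' 0 n k y) := by
  have hind : ∀ j, 1 ≤ j → j ≤ n →
      rangeOp (hybrid g g' 0) 0 n h y * rangeOp (hybrid g g' j) 0 n k y ≤
      Real.exp (2 * b 0 + ∑ l ∈ Finset.Ico 1 j, 2 / v 0 ^ 2 * ren v l * (Real.exp (2 * b l) - 1)) *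
        (rangeOp (hybrid g g' j) 0 n h y * rangeOp (hybrid g g' 0) 0 n k y) := by
    intro j hj
    induction j, hj using Nat.le_induction with
    | base =>
      intro _
      rw [Finset.Ico_self, Finset.sum_empty, add_zero]
      exact hybrid_zero hg hg' hb hb' hn y hh hk
    | succ j hj ih =>
      intro hjn
      have ih := ih (by omega)
      have hv := le_one_sub_ren hv0 hv1 hvm hj
      have hr := ren_nonneg hv0 hv1 hvm j
      have hv0' := hv0 0
      have hp : 0 < 1 - ren v j := by linarith
      have hc : 0 ≤ Real.exp (2 * b j) - 1 := by
        rw [sub_nonneg]; exact Real.one_le_exp (by linarith [hb0 j])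
      have hθ : 0 ≤ 1 / (1 - ren v j) ^ 2 - 1 := by
        rw [sub_nonneg, le_div_iff₀ (by positivity), one_mul, sq_le_one_iff₀ hp.le]; linarith
      have hθ' : 1 / (1 - ren v j) ^ 2 - 1 ≤ 2 / v 0 ^ 2 * ren v j := by
        have e : 1 / (1 - ren v j) ^ 2 - 1 = (1 - (1 - ren v j) ^ 2) / (1 - ren v j) ^ 2 := by
          field_simp
        rw [e, div_mul_eq_mul_div]
        refine div_le_div₀ (by positivity) (by nlinarith) (by positivity) ?_
        exact pow_le_pow_left₀ hv0'.le hv 2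
      have hst := hybrid_step hg hg' hb hb' hb0 (l := j) (n := n) (by omega) y hh hk hθ
        fun x z hxz => by
          have := odds_right hg hv0 hvm hgv j (fun i hi => (hxz i hi).symm) hh hk hdh hdk
          rw [add_sub_cancel, one_div, ← div_eq_inv_mul, le_div_iff₀ (by positivity), mul_comm]
          exact this
      have hfac : 1 + (1 / (1 - ren v j) ^ 2 - 1) * (Real.exp (2 * b j) - 1) ≤
          Real.exp (2 / v 0 ^ 2 * ren v j * (Real.exp (2 * b j) - 1)) := by
        have h1 := mul_le_mul_of_nonneg_right hθ' hc
        have h2 := Real.add_one_le_exp (2 / v 0 ^ 2 * ren v j * (Real.exp (2 * b j) - 1))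
        linarith
      have hst' := hst.trans (mul_le_mul_of_nonneg_right hfac
        (mul_pos (hhp (j + 1) hjn) (hkp j (by omega))).le)
      rw [Finset.sum_Ico_succ_top hj, ← add_assoc, Real.exp_add]
      have hA := hhp j (by omega)
      have hB := hkp j (by omega)
      set A := rangeOp (hybrid g g' j) 0 n h y
      set B := rangeOp (hybrid g g' j) 0 n k y
      set A' := rangeOp (hybrid g g' (j + 1)) 0 n h y
      set B' := rangeOp (hybrid g g' (j + 1)) 0 n k y
      set A₀ := rangeOp (hybrid g g' 0) 0 n h y
      set B₀ := rangeOp (hybrid g g' 0) 0 n k y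
      set E := Real.exp (2 * b 0 +
        ∑ l ∈ Finset.Ico 1 j, 2 / v 0 ^ 2 * ren v l * (Real.exp (2 * b l) - 1))
      set E' := Real.exp (2 / v 0 ^ 2 * ren v j * (Real.exp (2 * b j) - 1))
      have hB0 : 0 < B₀ := hkp 0 (by omega)
      have hB' : 0 < B' := hkp (j + 1) hjn
      have hE : 0 < E := Real.exp_pos _
      have h3 : A₀ * B * (A * B') ≤ E * (A * B₀) * (E' * (A' * B)) :=
        mul_le_mul ih hst' (mul_pos hA hB').le (by positivity)
      have h4 : 0 < A * B := mul_pos hA hB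
      nlinarith [h3, h4, le_of_mul_le_mul_right (a := A * B) (b := A₀ * B') (c := E * E' * (A' * B₀))
        (by linarith) h4]
  have h0 : ∀ f, rangeOp (hybrid g g' 0) 0 n f = rangeOp g' 0 n f := fun f =>
    rangeOp_congr 0 n (fun j _ _ => by funext x; rw [hybrid, if_neg (by omega)]) f
  have h1 : ∀ f, rangeOp (hybrid g g' n) 0 n f = rangeOp g 0 n f := fun f =>
    rangeOp_congr 0 n (fun j _ hj => by funext x; rw [hybrid, if_pos (by omega)]) f
  have := hind n hn le_rfl
  simpa only [h0, h1] using this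

/-! ### Variations of a positive continuous function -/

section Variation

variable {f : Conf S → ℝ}

lemma exists_ratio_le (hfc : Continuous f) (hfp : ∀ x, 0 < f x) :
    ∃ M, 1 ≤ M ∧ ∀ x y, f x ≤ M * f y := by
  have x₀ : Conf S := Classical.arbitrary _
  obtain ⟨u, -, hu⟩ := isCompact_univ.exists_isMaxOn ⟨x₀, mem_univ _⟩ hfc.continuousOn
  obtain ⟨l, -, hl⟩ := isCompact_univ.exists_isMinOn ⟨x₀, mem_univ _⟩ hfc.continuousOn
  have hul : f l ≤ f u := hu (mem_univ l)
  refine ⟨f u / f l, (one_le_div (hfp l)).2 hul, fun x y => ?_⟩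
  rw [div_mul_eq_mul_div, le_div_iff₀ (hfp l)]
  exact mul_le_mul (hu (mem_univ x)) (hl (mem_univ y)) (hfp l).le (hfp u).le

lemma bddAbove_ratio (hfc : Continuous f) (hfp : ∀ x, 0 < f x) (Λ : Set ℤ) :
    BddAbove {r : ℝ | ∃ x y : Conf S, (∀ i ∈ Λ, x i = y i) ∧ f x / f y = r} := by
  obtain ⟨M, -, hM⟩ := exists_ratio_le hfc hfp
  refine ⟨M, ?_⟩
  rintro _ ⟨x, y, -, rfl⟩
  exact (div_le_iff₀ (hfp y)).2 (hM x y)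

lemma le_rSup_mul (hfc : Continuous f) (hfp : ∀ x, 0 < f x)
    {Λ : Set ℤ} {x y : Conf S} (h : ∀ i ∈ Λ, x i = y i) : f x ≤ rSup Λ f * f y := by
  rw [← div_le_iff₀ (hfp y)]
  exact le_csSup (bddAbove_ratio hfc hfp Λ) ⟨x, y, h, rfl⟩

lemma one_le_rSup (hfc : Continuous f) (hfp : ∀ x, 0 < f x) (Λ : Set ℤ) : 1 ≤ rSup Λ f := by
  have x₀ : Conf S := Classical.arbitrary _
  have := le_rSup_mul hfc hfp (Λ := Λ) (x := x₀) (y := x₀) fun _ _ => rfl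
  nlinarith [hfp x₀]

lemma rSup_anti (hfc : Continuous f) (hfp : ∀ x, 0 < f x)
    {Λ Λ' : Set ℤ} (h : Λ ⊆ Λ') : rSup Λ' f ≤ rSup Λ f := by
  have x₀ : Conf S := Classical.arbitrary _
  refine csSup_le_csSup (bddAbove_ratio hfc hfp Λ) ⟨_, x₀, x₀, fun _ _ => rfl, rfl⟩ ?_
  rintro _ ⟨x, y, hxy, rfl⟩
  exact ⟨x, y, fun i hi => hxy i (h hi), rfl⟩

end Variation

/-! ### The weights of a specification -/

/-- The configuration with the symbol `s` on the sites `0, …, j - 1`. -/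
def fillS (s : S) (j : ℕ) (x : Conf S) : Conf S := fun i => if 0 ≤ i ∧ i < j then s else x i

/-- The weights obtained from a single-site ratio function. -/
def siteW (f : Conf S → ℝ) (s : S) (j : ℕ) (x : Conf S) : ℝ := f (shift j (fillS s j x))

lemma rangeOp_congr_off {g : ℕ → Conf S → ℝ}
    (hgi : ∀ (j : ℕ) (x y : Conf S), (∀ i : ℤ, ¬ (0 ≤ i ∧ i < j) → x i = y i) → g j x = g j y)
    (n : ℕ) (h : Conf S → ℝ) : ∀ {x y : Conf S}, (∀ i : ℤ, ¬ (0 ≤ i ∧ i < n) → x i = y i) →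
      rangeOp g 0 n h x = rangeOp g 0 n h y := by
  induction n with
  | zero =>
    intro x y hxy
    have : x = y := funext fun i => hxy i (by push_cast; omega)
    rw [this]
  | succ n ih =>
    intro x y hxy
    rw [rangeOp_succ, siteOp_apply, siteOp_apply, Nat.zero_add]
    refine Finset.sum_congr rfl fun a _ => ?_
    have hag : ∀ i : ℤ, ¬ (0 ≤ i ∧ i < n) → upd a (n : ℕ) x i = upd a (n : ℕ) y i :=
      fun i hi => upd_agree a _ fun hne => hxy i (by push_cast at hne ⊢; omega)
    rw [ih hag, hgi n _ _ hag]

lemma rangeOp_comp (g : ℕ → Conf S → ℝ) (τ : Conf S → Conf S)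
    (hτ : ∀ (a : S) (j : ℕ) w, τ (upd a j w) = upd a j (τ w)) (m n : ℕ) (h : Conf S → ℝ)
    (y : Conf S) :
    rangeOp g m n h (τ y) = rangeOp (fun j => g j ∘ τ) m n (h ∘ τ) y := by
  induction n generalizing y with
  | zero => rfl
  | succ n ih =>
    rw [rangeOp_succ, rangeOp_succ, siteOp_apply, siteOp_apply]
    refine Finset.sum_congr rfl fun a _ => ?_
    rw [← ih, Function.comp_apply, hτ]

section SiteWeights

variable {f : Conf S → ℝ}

lemma siteW_congr_off (f : Conf S → ℝ) (s : S) (j : ℕ) (x y : Conf S)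
    (h : ∀ i : ℤ, ¬ (0 ≤ i ∧ i < j) → x i = y i) : siteW f s j x = siteW f s j y := by
  have : fillS s j x = fillS s j y := by
    funext i
    rw [fillS, fillS]
    split_ifs with hi
    · rfl
    · exact h i hi
  rw [siteW, siteW, this]

lemma fillS_agree (s : S) (j : ℕ) {x y : Conf S} {i : ℤ} (h : x i = y i) :
    fillS s j x i = fillS s j y i := by
  rw [fillS, fillS, h]

lemma siteW_right (hfc : Continuous f) (hfp : ∀ x, 0 < f x) (s : S)
    (j l : ℕ) (x y : Conf S) (h : ∀ i : ℤ, i ≤ j + l → x i = y i) :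
    1 / rSup (Iic (l : ℤ)) f * siteW f s j y ≤ siteW f s j x := by
  rw [one_div, inv_mul_le_iff₀ (zero_lt_one.trans_le (one_le_rSup hfc hfp _))]
  exact le_rSup_mul hfc hfp fun i hi =>
    fillS_agree s j (h (i + j) (by have := mem_Iic.1 hi; omega)).symm

lemma siteW_left (hfc : Continuous f) (hfp : ∀ x, 0 < f x) (s : S)
    (j i : ℕ) (x y : Conf S) (h : ∀ t : ℤ, -(i : ℤ) ≤ t → x t = y t) :
    siteW f s j x ≤ Real.exp (Real.log (rSup (Ici (-((i + j : ℕ) : ℤ))) f)) * siteW f s j y := by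
  rw [Real.exp_log (zero_lt_one.trans_le (one_le_rSup hfc hfp _))]
  exact le_rSup_mul hfc hfp fun t ht =>
    fillS_agree s j (h (t + j) (by have := mem_Ici.1 ht; push_cast at this; omega))

end SiteWeights

/-- The indicator of the symbol `a` at the origin. -/
def sym0 (a : S) (x : Conf S) : ℝ := if x 0 = a then 1 else 0

lemma sym0_nonneg (a : S) (x : Conf S) : 0 ≤ sym0 a x := by
  rw [sym0]; split_ifs <;> norm_num

lemma depLT_sym0 (a : S) : DepLT (sym0 a) 1 := fun x y h => by rw [sym0, sym0, h 0 one_pos]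

lemma rangeOp_sym0_pos {g : ℕ → Conf S → ℝ} (hg : ∀ j x, 0 < g j x) {n : ℕ} (hn : 0 < n) (a : S)
    (x : Conf S) : 0 < rangeOp g 0 n (sym0 a) x := by
  obtain ⟨n, rfl⟩ := Nat.exists_eq_succ_of_ne_zero hn.ne'
  rw [Nat.succ_eq_add_one, rangeOp_succ']
  refine rangeOp_pos hg _ _ (fun x => ?_) x
  rw [siteOp_apply]
  refine Finset.sum_pos' (fun b _ => mul_nonneg (hg _ _).le (sym0_nonneg _ _))
    ⟨a, Finset.mem_univ _, ?_⟩
  rw [sym0, if_pos (by exact upd_self a 0 x), mul_one]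
  exact hg _ _

/-- The odds of two symbols at the origin under two boundary conditions that agree on the sites
`-i, …, -1`. -/
lemma odds_le {f : Conf S → ℝ} (hfc : Continuous f) (hfp : ∀ x, 0 < f x) (s : S) :
    ∃ C, 0 ≤ C ∧ ∀ (i n : ℕ), 0 < n → ∀ (x y : Conf S),
      (∀ t : ℤ, -(i : ℤ) ≤ t → t < 0 → x t = y t) → ∀ a b : S,
      rangeOp (siteW f s) 0 n (sym0 a) x * rangeOp (siteW f s) 0 n (sym0 b) y ≤
        Real.exp (C * (Real.log (rSup (Ici (-(i : ℤ))) f) *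
          (1 + ∑ l ∈ Finset.range n, ren (fun l : ℕ => 1 / rSup (Iic (l : ℤ)) f) l) +
          ren (fun l : ℕ => 1 / rSup (Iic (l : ℤ)) f) n)) *
        (rangeOp (siteW f s) 0 n (sym0 b) x * rangeOp (siteW f s) 0 n (sym0 a) y) := by
  set v : ℕ → ℝ := fun l => 1 / rSup (Iic (l : ℤ)) f with hv
  set A : ℕ → ℝ := fun i => Real.log (rSup (Ici (-(i : ℤ))) f) with hA
  have hr1 := one_le_rSup hfc hfp
  have hv0 : ∀ n, 0 < v n := fun n => one_div_pos.2 (zero_lt_one.trans_le (hr1 _))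
  have hv1 : ∀ n, v n ≤ 1 := fun n => by
    rw [hv]; exact (div_le_one (zero_lt_one.trans_le (hr1 _))).2 (hr1 _)
  have hvm : Monotone v := fun m n hmn =>
    one_div_le_one_div_of_le (zero_lt_one.trans_le (hr1 _))
      (rSup_anti hfc hfp (Iic_subset_Iic.2 (by exact_mod_cast hmn)))
  have hA0 : ∀ i, 0 ≤ A i := fun i => Real.log_nonneg (hr1 _)
  have hAm : Antitone A := fun i j hij =>
    Real.log_le_log (zero_lt_one.trans_le (hr1 _))
      (rSup_anti hfc hfp (Ici_subset_Ici.2 (by omega)))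
  have hwp : ∀ j x, 0 < siteW f s j x := fun j x => hfp _
  have hr0 := ren_nonneg hv0 hv1 hvm
  have hv00 := hv0 0
  set c := 2 / v 0 ^ 2 with hc
  have hc0 : 0 < c := by positivity
  refine ⟨2 + c * (2 * Real.exp (2 * A 0)) + c, by positivity, fun i n hn x y hxy a b => ?_⟩
  have hA00 := hA0 0
  set R := fun (c : S) (z : Conf S) => rangeOp (siteW f s) 0 n (sym0 c) z with hR
  have hRp : ∀ c z, 0 < R c z := fun c z => rangeOp_sym0_pos hwp hn c z
  set x' : Conf S := fun t => if t < n then x t else y t with hx'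
  set τ : Conf S → Conf S := fun w t => if t < -(i : ℤ) then x t else w t with hτ
  have hτu : ∀ (a : S) (j : ℕ) w, τ (upd a j w) = upd a j (τ w) := fun a j w => by
    funext t
    simp only [hτ, upd]
    split_ifs <;> first | rfl | omega
  set g' : ℕ → Conf S → ℝ := fun j => siteW f s j ∘ τ with hg'
  have hg'p : ∀ j x, 0 < g' j x := fun j x => hwp _ _
  have hsτ : ∀ c : S, sym0 c ∘ τ = sym0 c := fun c => by
    funext w
    have : τ w 0 = w 0 := if_neg (by omega)
    rw [Function.comp_apply, sym0, sym0, this]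
  have hx'R : ∀ c, R c x' = rangeOp g' 0 n (sym0 c) y := fun c => by
    have h1 : R c x' = R c (τ y) := by
      refine rangeOp_congr_off (siteW_congr_off f s) n _ fun t ht => ?_
      simp only [hx', hτ]
      split_ifs with h1 h2 h2
      · rfl
      · exact hxy t (by omega) (by omega)
      · omega
      · rfl
    rw [h1, hR]
    dsimp only
    rw [rangeOp_comp _ τ hτu, hsτ]
  have hright := odds_right hwp hv0 hvm (siteW_right hfc hfp s) n (x := x') (y := x)
    (fun t ht => if_pos ht) (sym0_nonneg a) (sym0_nonneg b) (depLT_sym0 a) (depLT_sym0 b)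
  have hleft := odds_left (g := siteW f s) (g' := g') (b := fun j => A (i + j)) hwp hg'p hv0 hv1 hvm
    (siteW_right hfc hfp s)
    (fun j w => siteW_left hfc hfp s j i _ _ fun t ht => if_neg (by omega))
    (fun j w => siteW_left hfc hfp s j i _ _ fun t ht => (if_neg (by omega)).symm)
    (fun j => hA0 _) hn y (sym0_nonneg a) (sym0_nonneg b) (depLT_sym0 a) (depLT_sym0 b)
    (fun j _ => rangeOp_sym0_pos (fun t z => by rw [hybrid]; split_ifs; exacts [hwp _ _, hg'p _ _]) hn a y)
    (fun j _ => rangeOp_sym0_pos (fun t z => by rw [hybrid]; split_ifs; exacts [hwp _ _, hg'p _ _]) hn b y)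
  rw [← hx'R, ← hx'R] at hleft
  have hlr : (1 - ren v n) ^ 2 * (R a x * R b y) ≤ Real.exp (2 * A (i + 0) +
      ∑ l ∈ Finset.Ico 1 n, c * ren v l * (Real.exp (2 * A (i + l)) - 1)) * (R b x * R a y) := by
    have h1 : (1 - ren v n) ^ 2 * (R a x * R b x') ≤ R a x' * R b x := hright
    have h2 : R a x' * R b y ≤ Real.exp (2 * A (i + 0) +
      ∑ l ∈ Finset.Ico 1 n, c * ren v l * (Real.exp (2 * A (i + l)) - 1)) * (R a y * R b x') := hleft
    have p1 := hRp a x'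
    have p2 := hRp b x'
    have p3 := hRp b x
    have p4 := hRp b y
    have p5 := hRp a y
    have h3 := mul_le_mul h1 h2 (mul_pos p1 p4).le (mul_pos p1 p3).le
    refine le_of_mul_le_mul_right ?_ (mul_pos p1 p2)
    linarith
  have hexp : 2 * A (i + 0) + ∑ l ∈ Finset.Ico 1 n, c * ren v l * (Real.exp (2 * A (i + l)) - 1) ≤
      2 * A i + c * (2 * Real.exp (2 * A 0)) * (A i * ∑ l ∈ Finset.range n, ren v l) := by
    rw [add_zero]
    refine add_le_add_right ?_ _
    calc ∑ l ∈ Finset.Ico 1 n, c * ren v l * (Real.exp (2 * A (i + l)) - 1)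
        ≤ ∑ l ∈ Finset.Ico 1 n, c * ren v l * (2 * A i * Real.exp (2 * A 0)) := by
          refine Finset.sum_le_sum fun l _ => mul_le_mul_of_nonneg_left ?_
            (mul_nonneg hc0.le (hr0 l))
          have h1 : Real.exp (2 * A (i + l)) - 1 ≤ 2 * A (i + l) * Real.exp (2 * A (i + l)) := by
            have h2 := Real.add_one_le_exp (-(2 * A (i + l)))
            have h3 : Real.exp (-(2 * A (i + l))) * Real.exp (2 * A (i + l)) = 1 := by
              rw [← Real.exp_add]; simp
            nlinarith [Real.exp_pos (2 * A (i + l))]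
          refine h1.trans (mul_le_mul ?_ (Real.exp_le_exp.2 ?_) (Real.exp_pos _).le ?_)
          · linarith [hAm (Nat.le_add_right i l)]
          · linarith [hAm (Nat.zero_le (i + l))]
          · linarith [hA0 i]
      _ ≤ ∑ l ∈ Finset.range n, c * ren v l * (2 * A i * Real.exp (2 * A 0)) := by
          refine Finset.sum_le_sum_of_subset_of_nonneg (fun l hl => ?_) fun l _ _ => ?_
          · exact Finset.mem_range.2 (Finset.mem_Ico.1 hl).2
          · exact mul_nonneg (mul_nonneg hc0.le (hr0 l))
              (mul_nonneg (by linarith [hA0 i]) (Real.exp_pos _).le)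
      _ = _ := by
          rw [← Finset.sum_mul, ← Finset.mul_sum]; ring
  have hrn : 0 < 1 - ren v n := by linarith [le_one_sub_ren hv0 hv1 hvm hn]
  have hinv : 1 ≤ Real.exp (c * ren v n) * (1 - ren v n) ^ 2 := by
    have h1 := Real.add_one_le_exp (c * ren v n)
    have h2 : 1 ≤ (c * ren v n + 1) * (1 - ren v n) ^ 2 := by
      have h3 : v 0 ^ 2 ≤ (1 - ren v n) ^ 2 :=
        pow_le_pow_left₀ hv00.le (le_one_sub_ren hv0 hv1 hvm hn) 2
      have h4 : c * v 0 ^ 2 = 2 := by rw [hc]; field_simp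
      have h5 : 2 ≤ c * (1 - ren v n) ^ 2 := by
        rw [← h4]; exact mul_le_mul_of_nonneg_left h3 hc0.le
      nlinarith [hr0 n, mul_le_mul_of_nonneg_right h5 (hr0 n)]
    exact h2.trans (mul_le_mul_of_nonneg_right h1 (sq_nonneg _))
  have hfin : R a x * R b y ≤ Real.exp (c * ren v n) * (Real.exp (2 * A (i + 0) +
      ∑ l ∈ Finset.Ico 1 n, c * ren v l * (Real.exp (2 * A (i + l)) - 1)) * (R b x * R a y)) := by
    refine le_trans ?_ (mul_le_mul_of_nonneg_left hlr (Real.exp_pos _).le)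
    rw [← mul_assoc]
    exact le_mul_of_one_le_left (mul_pos (hRp _ _) (hRp _ _)).le hinv
  refine hfin.trans ?_
  rw [← mul_assoc, ← Real.exp_add]
  refine mul_le_mul_of_nonneg_right (Real.exp_le_exp.2 ?_) (mul_pos (hRp _ _) (hRp _ _)).le
  refine (add_le_add_right hexp _).trans ?_
  have hs : 0 ≤ ∑ l ∈ Finset.range n, ren v l := Finset.sum_nonneg fun l _ => hr0 l
  have e1 : 0 ≤ A i * ∑ l ∈ Finset.range n, ren v l := mul_nonneg (hA0 i) hs
  have e2 := hA0 i
  have e3 := hr0 n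
  have e4 : 0 ≤ c * (2 * Real.exp (2 * A 0)) := by positivity
  change c * ren v n + (2 * A i + c * (2 * Real.exp (2 * A 0)) * (A i * ∑ l ∈ Finset.range n, ren v l))
    ≤ (2 + c * (2 * Real.exp (2 * A 0)) + c) * (A i * (1 + ∑ l ∈ Finset.range n, ren v l) + ren v n)
  rw [mul_add (A i), mul_one]
  generalize A i * ∑ l ∈ Finset.range n, ren v l = Q at e1 ⊢
  generalize c * (2 * Real.exp (2 * A 0)) = K at e4 ⊢
  linarith [mul_nonneg e4 e2, mul_nonneg e4 e3, mul_nonneg hc0.le e2, mul_nonneg hc0.le e1,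
    mul_nonneg e4 e1]

/-- Growth of the renewal sequence under a polynomial bound on the inverse products. -/
lemma ren_growth {v : ℕ → ℝ} (hv0 : ∀ n, 0 < v n) (hv1 : ∀ n, v n ≤ 1) (hvm : Monotone v) {α : ℝ}
    (hα1 : α ≤ 1)
    (h : (fun n => (pprod v (n + 1))⁻¹) =O[atTop] fun n : ℕ => (n : ℝ) ^ ((1 : ℝ) - α)) :
    ∃ C, 0 ≤ C ∧ ∀ n : ℕ, 0 < n → ren v n ≤ C * (n : ℝ) ^ (-α) ∧
      ∑ l ∈ Finset.range n, ren v l ≤ C * (n : ℝ) ^ (1 - α) := by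
  obtain ⟨C, hC0, hC⟩ := h.exists_pos
  obtain ⟨N, hN⟩ := eventually_atTop.1 hC.bound
  have hpp := pprod_pos hv0
  have hpa := pprod_antitone hv0 hv1
  set D := max C (pprod v (N + 1))⁻¹
  have hD : ∀ n : ℕ, 0 < n → (pprod v n)⁻¹ ≤ D * (n : ℝ) ^ (1 - α) := fun n hn => by
    have hn1 : (1 : ℝ) ≤ n := by exact_mod_cast hn
    have hp1 : 1 ≤ (n : ℝ) ^ (1 - α) := Real.one_le_rpow hn1 (by linarith)
    rcases le_total N n with h' | h'
    · have := hN n h'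
      rw [Real.norm_of_nonneg (inv_pos.2 (hpp _)).le, Real.norm_of_nonneg (by positivity)] at this
      refine ((inv_le_inv₀ (hpp n) (hpp _)).2 (hpa (Nat.le_succ n))).trans (this.trans ?_)
      exact mul_le_mul_of_nonneg_right (le_max_left _ _) (by positivity)
    · have h1 : (pprod v n)⁻¹ ≤ (pprod v (N + 1))⁻¹ :=
        (inv_le_inv₀ (hpp n) (hpp _)).2 (hpa (by omega))
      refine h1.trans ((le_max_right C _).trans (le_mul_of_one_le_right ?_ hp1))
      exact hC0.le.trans (le_max_left _ _)
  refine ⟨D, hC0.le.trans (le_max_left _ _), fun n hn => ⟨?_, ?_⟩⟩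
  · have hn0 : (0 : ℝ) < n := by exact_mod_cast hn
    have h1 := mul_pprod_mul_ren_le hv0 hv1 hvm n
    have h2 : n * ren v n ≤ (pprod v n)⁻¹ := by
      rw [← one_div, le_div_iff₀ (hpp n)]
      nlinarith [mul_nonneg (hpp n).le (ren_nonneg hv0 hv1 hvm n)]
    have h3 : (n : ℝ) ^ (1 - α) = n * (n : ℝ) ^ (-α) := by
      rw [sub_eq_add_neg, Real.rpow_add hn0, Real.rpow_one]
    have h4 := h2.trans (hD n hn)
    rw [h3, mul_left_comm] at h4
    exact le_of_mul_le_mul_left h4 hn0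
  · refine le_trans ?_ (hD n hn)
    rw [← one_div, le_div_iff₀ (hpp n), mul_comm]
    refine le_trans (mul_le_mul_of_nonneg_left ?_ (hpp n).le) (pprod_mul_sum_ren_le hv0 hv1 hvm n)
    rw [Finset.sum_range_succ]
    linarith [ren_nonneg hv0 hv1 hvm n]

lemma exists_block_length {α B c : ℝ} (hα0 : 0 < α) (hα1 : α ≤ 1) (hc0 : 0 < c) (hcB : c ≤ B)
    (hB : 1 ≤ B) : ∃ n : ℕ, 0 < n ∧ (n : ℝ) ^ (-α) ≤ c ^ α ∧
      c * (1 + (n : ℝ) ^ (1 - α)) ≤ 3 * B * c ^ α := by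
  refine ⟨⌈c⁻¹⌉₊, Nat.ceil_pos.2 (inv_pos.2 hc0), ?_, ?_⟩
  · have h1 : c⁻¹ ≤ ⌈c⁻¹⌉₊ := Nat.le_ceil _
    have h2 := Real.rpow_le_rpow_of_nonpos (inv_pos.2 hc0) h1 (neg_nonpos.2 hα0.le)
    rwa [Real.inv_rpow hc0.le, ← Real.rpow_neg hc0.le, neg_neg] at h2
  · have h1 : (⌈c⁻¹⌉₊ : ℝ) ≤ c⁻¹ * (2 * B) := by
      have h2 := (Nat.ceil_lt_add_one (inv_pos.2 hc0).le).le
      have h3 : 1 ≤ c⁻¹ * B := by rw [inv_mul_eq_div, one_le_div hc0]; exact hcB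
      have h4 : c⁻¹ ≤ c⁻¹ * B := le_mul_of_one_le_right (inv_pos.2 hc0).le hB
      linarith
    have h2 : (⌈c⁻¹⌉₊ : ℝ) ^ (1 - α) ≤ c⁻¹ ^ (1 - α) * (2 * B) := by
      refine (Real.rpow_le_rpow (Nat.cast_nonneg _) h1 (by linarith)).trans ?_
      rw [Real.mul_rpow (inv_pos.2 hc0).le (by linarith)]
      refine mul_le_mul_of_nonneg_left ?_ (Real.rpow_nonneg (inv_pos.2 hc0).le _)
      exact (Real.rpow_le_rpow_of_exponent_le (by linarith) (show 1 - α ≤ 1 by linarith)).trans_eq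
        (Real.rpow_one _)
    have h3 : c * c⁻¹ ^ (1 - α) = c ^ α := by
      rw [Real.inv_rpow hc0.le, ← Real.rpow_neg hc0.le]
      nth_rewrite 1 [← Real.rpow_one c]
      rw [← Real.rpow_add hc0]
      ring_nf
    have h4 : c ≤ B * c ^ α := by
      have h5 : c = c ^ (1 - α) * c ^ α := by
        rw [← Real.rpow_add hc0, sub_add_cancel, Real.rpow_one]
      have h6 : c ^ (1 - α) ≤ B :=
        (Real.rpow_le_rpow hc0.le hcB (by linarith)).trans
          ((Real.rpow_le_rpow_of_exponent_le hB (show 1 - α ≤ 1 by linarith)).trans_eq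
            (Real.rpow_one _))
      calc c = c ^ (1 - α) * c ^ α := h5
        _ ≤ _ := mul_le_mul_of_nonneg_right h6 (Real.rpow_nonneg hc0.le _)
    have h5 := mul_le_mul_of_nonneg_left h2 hc0.le
    rw [← mul_assoc, h3] at h5
    linarith

lemma tendsto_dyadic_of_summable {q : ℕ → ℝ} (h0 : ∀ n, 0 ≤ q n) (h : Summable q) :
    Tendsto (fun n : ℕ => ∑ i ∈ Finset.Icc (2 ^ n) (2 ^ (n + 1)), q i) atTop (nhds 0) := by
  have h1 : Tendsto (fun n : ℕ => ∑' i, q (i + 2 ^ n)) atTop (nhds 0) :=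
    (tendsto_sum_nat_add q).comp (tendsto_pow_atTop_atTop_of_one_lt one_lt_two)
  refine squeeze_zero (fun n => Finset.sum_nonneg fun i _ => h0 i) (fun n => ?_) h1
  have h2 : Summable fun i => q (i + 2 ^ n) := (summable_nat_add_iff (2 ^ n)).2 h
  rw [← Finset.Ico_add_one_right_eq_Icc, Finset.sum_Ico_eq_sum_range]
  simp only [add_comm (2 ^ n)]
  exact h2.sum_le_tsum _ fun i _ => h0 _

/-- The odds of two symbols at the origin depend weakly on the distant past. -/
theorem exists_odds_memory {f : Conf S → ℝ} (hfc : Continuous f) (hfp : ∀ x, 0 < f x) (s : S)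
    (α : ℝ) (hα0 : 0 < α) (hα1 : α ≤ 1)
    (h1 : (fun n : ℕ => ∏ i ∈ Finset.range (n + 1), rSup (Set.Iic (i : ℤ)) f)
        =O[atTop] fun n : ℕ => (n : ℝ) ^ ((1 : ℝ) - α))
    (h2 : Tendsto
        (fun n : ℕ => ∑ i ∈ Finset.Icc (2 ^ n : ℕ) (2 ^ (n + 1)),
          Real.log (rSup (Set.Ici (-((i : ℕ) : ℤ))) f) ^ (2 * α))
        atTop (nhds 0)) :
    ∃ ω : ℕ → ℝ, (∀ i, 0 ≤ ω i) ∧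
      Tendsto (fun n : ℕ => ∑ i ∈ Finset.Icc (2 ^ n) (2 ^ (n + 1)), ω i ^ 2) atTop (nhds 0) ∧
      ∀ i : ℕ, ∃ n : ℕ, 0 < n ∧ ∀ (x y : Conf S),
        (∀ t : ℤ, -(i : ℤ) ≤ t → t < 0 → x t = y t) → ∀ a b : S,
        rangeOp (siteW f s) 0 n (sym0 a) x * rangeOp (siteW f s) 0 n (sym0 b) y ≤
          Real.exp (ω i) *
            (rangeOp (siteW f s) 0 n (sym0 b) x * rangeOp (siteW f s) 0 n (sym0 a) y) := by
  obtain ⟨C, hC0, hC⟩ := odds_le hfc hfp s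
  have hr1 := one_le_rSup hfc hfp
  have hrp : ∀ Λ, 0 < rSup Λ f := fun Λ => zero_lt_one.trans_le (hr1 Λ)
  have hv0 : ∀ n : ℕ, 0 < 1 / rSup (Iic (n : ℤ)) f := fun n => one_div_pos.2 (hrp _)
  have hv1 : ∀ n : ℕ, 1 / rSup (Iic (n : ℤ)) f ≤ 1 := fun n => (div_le_one (hrp _)).2 (hr1 _)
  have hvm : Monotone fun n : ℕ => 1 / rSup (Iic (n : ℤ)) f := fun m n hmn =>
    one_div_le_one_div_of_le (hrp _)
      (rSup_anti hfc hfp (Iic_subset_Iic.2 (by exact_mod_cast hmn)))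
  set A : ℕ → ℝ := fun i => Real.log (rSup (Ici (-(i : ℤ))) f) with hA
  have hA0 : ∀ i, 0 ≤ A i := fun i => Real.log_nonneg (hr1 _)
  have hAm : Antitone A := fun i j hij =>
    Real.log_le_log (hrp _) (rSup_anti hfc hfp (Ici_subset_Ici.2 (by omega)))
  obtain ⟨D, hD0, hD⟩ := ren_growth hv0 hv1 hvm hα1 (by
    convert h1 using 2 with n
    rw [pprod, ← Finset.prod_inv_distrib]
    exact Finset.prod_congr rfl fun i _ => by rw [one_div, inv_inv])
  set B := max 1 (A 0)
  set c : ℕ → ℝ := fun i => max (A i) ((1 / 2) ^ i) with hc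
  have hc0 : ∀ i, 0 < c i := fun i => lt_max_of_lt_right (by positivity)
  have hcB : ∀ i, c i ≤ B := fun i => by
    refine max_le ((hAm (Nat.zero_le i)).trans (le_max_right _ _)) (le_trans ?_ (le_max_left _ _))
    exact pow_le_one₀ (by norm_num) (by norm_num)
  have hB1 : 1 ≤ B := le_max_left _ _
  set K := C * ((1 + D) * (3 * B) + D) with hK
  have hK0 : 0 ≤ K := by positivity
  refine ⟨fun i => K * c i ^ α, fun i => mul_nonneg hK0 (Real.rpow_nonneg (hc0 i).le _), ?_, fun i => ?_⟩
  · have hsum : Summable fun i : ℕ => ((1 / 2 : ℝ) ^ (2 * α)) ^ i :=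
      summable_geometric_of_lt_one (by positivity)
        (Real.rpow_lt_one (by norm_num) (by norm_num) (by linarith))
    have h3 := (h2.add (tendsto_dyadic_of_summable (fun n => by positivity) hsum)).const_mul (K ^ 2)
    rw [add_zero, mul_zero] at h3
    refine squeeze_zero (fun n => Finset.sum_nonneg fun i _ => sq_nonneg _) (fun n => ?_) h3
    rw [← Finset.sum_add_distrib, Finset.mul_sum]
    refine Finset.sum_le_sum fun i _ => ?_
    dsimp only
    rw [mul_pow, ← Real.rpow_natCast (c i ^ α) 2, ← Real.rpow_mul (hc0 i).le,
      show α * ((2 : ℕ) : ℝ) = 2 * α by push_cast; ring]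
    refine mul_le_mul_of_nonneg_left ?_ (sq_nonneg K)
    have e0 : ((1 / 2 : ℝ) ^ (2 * α)) ^ i = ((1 / 2 : ℝ) ^ i) ^ (2 * α) := by
      rw [← Real.rpow_natCast, ← Real.rpow_natCast, ← Real.rpow_mul (by norm_num),
        ← Real.rpow_mul (by norm_num), mul_comm]
    rw [e0]
    have e1 : 0 ≤ A i ^ (2 * α) := Real.rpow_nonneg (hA0 i) _
    have e2 : 0 ≤ ((1 / 2 : ℝ) ^ i) ^ (2 * α) := by positivity
    change max (A i) _ ^ (2 * α) ≤ A i ^ (2 * α) + _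
    rcases max_choice (A i) ((1 / 2 : ℝ) ^ i) with h | h <;> rw [h] <;> linarith
  · obtain ⟨n, hn, hn1, hn2⟩ := exists_block_length hα0 hα1 (hc0 i) (hcB i) hB1
    refine ⟨n, hn, fun x y hxy a b => (hC i n hn x y hxy a b).trans ?_⟩
    have hwp : ∀ j x, 0 < siteW f s j x := fun j x => hfp _
    refine mul_le_mul_of_nonneg_right (Real.exp_le_exp.2 ?_)
      (mul_pos (rangeOp_sym0_pos hwp hn _ _) (rangeOp_sym0_pos hwp hn _ _)).le
    obtain ⟨hD1, hD2⟩ := hD n hn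
    dsimp only
    rw [hK, mul_assoc]
    refine mul_le_mul_of_nonneg_left ?_ hC0
    have hnp : 0 ≤ (n : ℝ) ^ (1 - α) := by positivity
    have e1 : A i * (1 + ∑ l ∈ Finset.range n, ren (fun l : ℕ => 1 / rSup (Iic (l : ℤ)) f) l) ≤
        (1 + D) * (3 * B * c i ^ α) := by
      have e2 : 1 + ∑ l ∈ Finset.range n, ren (fun l : ℕ => 1 / rSup (Iic (l : ℤ)) f) l ≤
          (1 + D) * (1 + (n : ℝ) ^ (1 - α)) := by nlinarith
      calc _ ≤ c i * ((1 + D) * (1 + (n : ℝ) ^ (1 - α))) :=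
            mul_le_mul (le_max_left _ _) e2
              (add_nonneg zero_le_one (Finset.sum_nonneg fun l _ => ren_nonneg hv0 hv1 hvm l)) (hc0 i).le
        _ = (1 + D) * (c i * (1 + (n : ℝ) ^ (1 - α))) := by ring
        _ ≤ _ := mul_le_mul_of_nonneg_left hn2 (by linarith)
    have e3 := hD1.trans (mul_le_mul_of_nonneg_left hn1 hD0)
    change A i * _ + _ ≤ _
    linarith

/-! ### Sums over the configurations in a finite window -/

/-- The sum of `H` over all the configurations which agree with `y` off `Λ`. -/
def tot (Λ : Finset ℤ) (H : Conf S → ℝ) (y : Conf S) : ℝ := ∑ ζ : Λ → S, H (ov y Λ ζ)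

lemma ov_of_mem (x : Conf S) {Λ : Finset ℤ} (ζ : Λ → S) {i : ℤ} (h : i ∈ Λ) :
    ov x Λ ζ i = ζ ⟨i, h⟩ := dif_pos h

lemma ov_of_notMem (x : Conf S) {Λ : Finset ℤ} (ζ : Λ → S) {i : ℤ} (h : i ∉ Λ) :
    ov x Λ ζ i = x i := dif_neg h

lemma ov_congr {x y : Conf S} {Λ : Finset ℤ} (h : ∀ i, i ∉ Λ → x i = y i) (ζ : Λ → S) :
    ov x Λ ζ = ov y Λ ζ := by
  funext i
  by_cases hi : i ∈ Λ
  · rw [ov_of_mem _ _ hi, ov_of_mem _ _ hi]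
  · rw [ov_of_notMem _ _ hi, ov_of_notMem _ _ hi, h i hi]

lemma ov_self (x : Conf S) (Λ : Finset ℤ) : ov x Λ (fun i => x i) = x := by
  funext i
  by_cases hi : i ∈ Λ
  · rw [ov_of_mem _ _ hi]
  · rw [ov_of_notMem _ _ hi]

lemma tot_congr {x y : Conf S} {Λ : Finset ℤ} (h : ∀ i, i ∉ Λ → x i = y i) (H : Conf S → ℝ) :
    tot Λ H x = tot Λ H y :=
  Finset.sum_congr rfl fun ζ _ => by rw [ov_congr h]

lemma tot_ov (y : Conf S) (Λ : Finset ℤ) (ζ : Λ → S) (H : Conf S → ℝ) :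
    tot Λ H (ov y Λ ζ) = tot Λ H y := tot_congr (fun _ hi => ov_of_notMem _ _ hi) H

lemma tot_mul_left {Λ : Finset ℤ} {F : Conf S → ℝ} {y : Conf S}
    (hF : ∀ ζ, F (ov y Λ ζ) = F y) (H : Conf S → ℝ) :
    tot Λ (fun x => F x * H x) y = F y * tot Λ H y := by
  rw [tot, tot, Finset.mul_sum]
  exact Finset.sum_congr rfl fun ζ _ => by rw [hF]

lemma tot_empty (H : Conf S → ℝ) (y : Conf S) : tot ∅ H y = H y := by
  have : ∀ ζ, ov y ∅ ζ = y := fun ζ => funext fun i => ov_of_notMem _ _ (Finset.notMem_empty i)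
  simp [tot, this]

lemma tot_insert {j : ℤ} {Λ : Finset ℤ} (hj : j ∉ Λ) (H : Conf S → ℝ) (y : Conf S) :
    tot (insert j Λ) H y = ∑ a, tot Λ H (upd a j y) := by
  simp only [tot]
  rw [← Fintype.sum_prod_type']
  symm
  refine Fintype.sum_bijective (fun (p : S × (Λ → S)) (i : (insert j Λ : Finset ℤ)) =>
    ov (upd p.1 j y) Λ p.2 i) ⟨fun p q h => ?_, fun ζ => ?_⟩ _ _ fun p => ?_
  · refine Prod.ext ?_ (funext fun i => ?_)
    · have := congrFun h ⟨j, Finset.mem_insert_self _ _⟩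
      simpa [ov_of_notMem _ _ hj, upd_self] using this
    · have := congrFun h ⟨i, Finset.mem_insert_of_mem i.2⟩
      simpa [ov_of_mem _ _ i.2] using this
  · refine ⟨(ζ ⟨j, Finset.mem_insert_self _ _⟩, fun i => ζ ⟨i, Finset.mem_insert_of_mem i.2⟩),
      funext fun i => ?_⟩
    dsimp only
    by_cases hi : (i : ℤ) ∈ Λ
    · rw [ov_of_mem _ _ hi]
    · rw [ov_of_notMem _ _ hi]
      obtain rfl : i = ⟨j, Finset.mem_insert_self _ _⟩ :=
        Subtype.ext ((Finset.mem_insert.1 i.2).resolve_right hi)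
      exact upd_self _ _ _
  · congr 1
    funext i
    by_cases hi : i ∈ insert j Λ
    · rw [ov_of_mem _ _ hi]
    · have hi' := Finset.mem_insert.not.1 hi
      push Not at hi'
      rw [ov_of_notMem _ _ hi, ov_of_notMem _ _ hi'.2, upd_ne _ _ hi'.1]

lemma ov_upd {j : ℤ} {Λ : Finset ℤ} (hj : j ∉ Λ) (a : S) (y : Conf S) (ζ : Λ → S) :
    ov (upd a j y) Λ ζ = upd a j (ov y Λ ζ) := by
  funext i
  by_cases hi : i ∈ Λ
  · rw [ov_of_mem _ _ hi, upd_ne _ _ (by rintro rfl; exact hj hi), ov_of_mem _ _ hi]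
  · rw [ov_of_notMem _ _ hi]
    exact upd_agree a j fun _ => (ov_of_notMem _ _ hi).symm

lemma tot_union {K M : Finset ℤ} (h : Disjoint K M) (H : Conf S → ℝ) (y : Conf S) :
    tot (K ∪ M) H y = tot M (tot K H) y := by
  induction K using Finset.induction_on generalizing y with
  | empty =>
    rw [Finset.empty_union]
    exact congrArg (fun H => tot M H y) (funext fun x => (tot_empty H x).symm)
  | insert j K hj ih =>
    rw [Finset.disjoint_insert_left] at h
    rw [Finset.insert_union, tot_insert (by simp [hj, h.1])]
    have e : tot (insert j K) H = fun x => ∑ a, tot K H (upd a j x) :=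
      funext fun x => tot_insert hj H x
    simp_rw [ih h.2, e, tot]
    rw [Finset.sum_comm]
    refine Finset.sum_congr rfl fun ζ _ => Finset.sum_congr rfl fun a _ => ?_
    rw [ov_upd h.1]

lemma shift_upd (n j : ℤ) (a : S) (y : Conf S) :
    shift n (upd a (n + j) y) = upd a j (shift n y) := by
  funext i
  by_cases hi : i = j
  · subst hi; rw [upd_self, shift, add_comm i, upd_self]
  · rw [upd_ne _ _ hi, shift, shift, upd_ne _ _ (by omega)]

lemma tot_shift (n : ℤ) (Λ : Finset ℤ) (H : Conf S → ℝ) (y : Conf S) :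
    tot (Λ.image fun i => n + i) (fun x => H (shift n x)) y = tot Λ H (shift n y) := by
  induction Λ using Finset.induction_on generalizing y with
  | empty => rw [Finset.image_empty, tot_empty, tot_empty]
  | insert j Λ hj ih =>
    rw [Finset.image_insert, tot_insert (by simpa using hj), tot_insert hj]
    exact Finset.sum_congr rfl fun a _ => by rw [ih, shift_upd]

lemma continuous_ov (Λ : Finset ℤ) (ζ : Λ → S) : Continuous fun x : Conf S => ov x Λ ζ := by
  refine continuous_pi fun i => ?_
  by_cases hi : i ∈ Λ
  · simp only [ov_of_mem _ _ hi]; exact continuous_const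
  · simp only [ov_of_notMem _ _ hi]; exact continuous_apply i

lemma continuous_tot (Λ : Finset ℤ) {H : Conf S → ℝ} (hH : Continuous H) :
    Continuous (tot Λ H) :=
  continuous_finsetSum _ fun ζ _ => hH.comp (continuous_ov Λ ζ)

/-! ### Specifications and single-site ratios -/

variable {V : Specification S}

lemma Specification.consistent_tot (V : Specification S) {K Λ : Finset ℤ} (h : K ⊆ Λ)
    (x : Conf S) : V.φ Λ x = V.φ K x * tot K (V.φ Λ) x := V.consistent K Λ h x

lemma Specification.tot_eq_one (V : Specification S) (Λ : Finset ℤ) (x : Conf S) :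
    tot Λ (V.φ Λ) x = 1 := V.sum_one Λ x

/-- Averaging over a smaller window first changes nothing. -/
lemma Specification.tot_tot (V : Specification S) {K Λ : Finset ℤ} (h : K ⊆ Λ)
    (H : Conf S → ℝ) (y : Conf S) :
    tot Λ (fun x => V.φ Λ x * H x) y =
      tot Λ (fun x => V.φ Λ x * tot K (fun x => V.φ K x * H x) x) y := by
  have hd : Disjoint K (Λ \ K) := Finset.disjoint_sdiff
  rw [← Finset.union_sdiff_of_subset h, tot_union hd, tot_union hd,
    Finset.union_sdiff_of_subset h]
  congr 1
  funext z
  have e1 : (fun x => V.φ Λ x * H x) = fun x => tot K (V.φ Λ) x * (V.φ K x * H x) := by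
    funext x
    rw [V.consistent_tot h]
    ring
  have e2 : (fun x => V.φ Λ x * tot K (fun x => V.φ K x * H x) x) =
      fun x => tot K (fun x => V.φ K x * H x) x * V.φ Λ x := funext fun x => mul_comm _ _
  rw [e1, e2, tot_mul_left fun ζ => tot_ov _ _ ζ _, tot_mul_left fun ζ => tot_ov _ _ ζ _, mul_comm]

lemma Specification.φ_upd (hpos : V.Positive) (hinv : V.TInvariant) {s : S} {f : Conf S → ℝ}
    (hf : ∀ x, f x = V.φ {0} x / V.φ {0} (upd s 0 x)) {Λ : Finset ℤ} {j : ℤ} (hj : j ∈ Λ)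
    (x : Conf S) : V.φ Λ x = f (shift j x) * V.φ Λ (upd s j x) := by
  have e : ∀ z, V.φ {j} z = V.φ {0} (shift j z) := fun z => by
    rw [← hinv, Finset.image_singleton, add_zero]
  have h1 := V.consistent_tot (Finset.singleton_subset_iff.2 hj) x
  have h2 := V.consistent_tot (Finset.singleton_subset_iff.2 hj) (upd s j x)
  rw [tot_congr (x := upd s j x) (y := x) fun i hi => upd_ne _ _ (by simpa using hi)] at h2
  have e2 := shift_upd j 0 s x
  rw [add_zero] at e2
  rw [h1, h2, hf, e, e, e2]
  have := (hpos {0} (upd s 0 (shift j x))).ne'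
  field_simp

lemma upd_fillS (s : S) (j : ℕ) (x : Conf S) : upd s j (fillS s j x) = fillS s (j + 1) x := by
  funext i
  by_cases hi : i = j
  · subst hi
    rw [upd_self, fillS, if_pos (by push_cast; omega)]
  · rw [upd_ne _ _ hi, fillS, fillS]
    exact if_congr (by push_cast; omega) rfl rfl

lemma Specification.φ_eq_prod (hpos : V.Positive) (hinv : V.TInvariant) {s : S} {f : Conf S → ℝ}
    (hf : ∀ x, f x = V.φ {0} x / V.φ {0} (upd s 0 x)) (Λ : Finset ℤ) (n : ℕ)
    (hn : ∀ j : ℕ, j < n → (j : ℤ) ∈ Λ) (x : Conf S) :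
    V.φ Λ x = V.φ Λ (fillS s n x) * ∏ j ∈ Finset.range n, siteW f s j x := by
  induction n with
  | zero =>
    have : fillS s 0 x = x := funext fun i => if_neg (by push_cast; omega)
    rw [this, Finset.prod_range_zero, mul_one]
  | succ n ih =>
    rw [ih fun j hj => hn j (by omega), φ_upd hpos hinv hf (hn n (by omega)) (fillS s n x),
      upd_fillS, Finset.prod_range_succ, siteW]
    ring

lemma tot_prod_siteW (f : Conf S → ℝ) (s : S) (n : ℕ) (h : Conf S → ℝ) (y : Conf S) :
    tot (Finset.Ico 0 (n : ℤ)) (fun x => (∏ j ∈ Finset.range n, siteW f s j x) * h x) y =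
      rangeOp (siteW f s) 0 n h y := by
  induction n generalizing y with
  | zero =>
    rw [show Finset.Ico 0 ((0 : ℕ) : ℤ) = ∅ by simp, tot_empty]
    simp [rangeOp]
  | succ n ih =>
    have hI : Finset.Ico 0 ((n + 1 : ℕ) : ℤ) = insert (n : ℤ) (Finset.Ico 0 (n : ℤ)) := by
      ext i; simp only [Finset.mem_Ico, Finset.mem_insert]; push_cast; omega
    rw [hI, tot_insert (by simp), rangeOp_succ, siteOp_apply, Nat.zero_add]
    refine Finset.sum_congr rfl fun a _ => ?_
    rw [← ih, ← tot_mul_left]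
    · congr 1
      funext x
      rw [Finset.prod_range_succ]
      ring
    · intro ζ
      exact siteW_congr_off f s n _ _ fun i hi => ov_of_notMem _ _ (by simpa using hi)

lemma Specification.tot_φ_mul (hpos : V.Positive) (hinv : V.TInvariant) {s : S} {f : Conf S → ℝ}
    (hf : ∀ x, f x = V.φ {0} x / V.φ {0} (upd s 0 x)) (n : ℕ) (h : Conf S → ℝ) (y : Conf S) :
    tot (Finset.Ico 0 (n : ℤ)) (fun x => V.φ (Finset.Ico 0 (n : ℤ)) x * h x) y =
      V.φ (Finset.Ico 0 (n : ℤ)) (fillS s n y) * rangeOp (siteW f s) 0 n h y := by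
  rw [← tot_prod_siteW, ← tot_mul_left (F := fun x => V.φ (Finset.Ico 0 (n : ℤ)) (fillS s n x))]
  · congr 1
    funext x
    rw [φ_eq_prod hpos hinv hf _ n (fun j hj => by simpa using hj) x]
    ring
  · intro ζ
    congr 1
    funext i
    rw [fillS, fillS]
    split_ifs with hi
    · rfl
    · exact ov_of_notMem _ _ (by simpa using hi)

/-! ### The Gibbs condition in terms of continuous observables -/

lemma integrable_of_continuous {ν : Measure (Conf S)} [IsFiniteMeasure ν] {H : Conf S → ℝ}
    (hH : Continuous H) : Integrable H ν :=
  (BoundedContinuousFunction.mkOfCompact ⟨H, hH⟩).integrable ν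

/-- `ν` is preserved by all the finite-volume averages of the specification. -/
def Dlr (V : Specification S) (ν : Measure (Conf S)) : Prop :=
  ∀ Λ : Finset ℤ, ∀ H : Conf S → ℝ, Continuous H →
    ∫ x, H x ∂ν = ∫ x, tot Λ (fun y => V.φ Λ y * H y) x ∂ν

lemma cylSA_le (T : Set ℤ) : cylSA (S := S) T ≤ MeasurableSpace.pi :=
  (measurable_restrict T).comap_le

lemma measurable_ov (Λ : Finset ℤ) (ζ : Λ → S) :
    Measurable[cylSA (Λ : Set ℤ)ᶜ] fun x : Conf S => ov x Λ ζ := by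
  refine @measurable_pi_lambda _ _ _ (cylSA (Λ : Set ℤ)ᶜ) _ _ fun i => ?_
  by_cases hi : i ∈ Λ
  · simp only [ov_of_mem _ _ hi]; exact measurable_const
  · simp only [ov_of_notMem _ _ hi]
    exact (measurable_pi_apply (⟨i, by simpa using hi⟩ : ((Λ : Set ℤ)ᶜ : Set ℤ))).comp
      (comap_measurable (fun x : Conf S => ((Λ : Set ℤ)ᶜ : Set ℤ).domRestrict x))

lemma ov_mem_iff {Λ : Finset ℤ} {s : Set (Conf S)} (hs : MeasurableSet[cylSA (Λ : Set ℤ)ᶜ] s)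
    (x : Conf S) (ζ : Λ → S) : ov x Λ ζ ∈ s ↔ x ∈ s := by
  obtain ⟨t, -, rfl⟩ := hs
  have : ((Λ : Set ℤ)ᶜ : Set ℤ).domRestrict (ov x Λ ζ) =
      ((Λ : Set ℤ)ᶜ : Set ℤ).domRestrict x :=
    funext fun i => ov_of_notMem _ _ fun hi => i.2 hi
  exact iff_of_eq (congrArg (· ∈ t) this)

/-- The indicator of `cylEvent Λ ζ`. -/
def cylInd (Λ : Finset ℤ) (ζ : Λ → S) : Conf S → ℝ := (cylEvent Λ ζ).indicator fun _ => 1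

lemma isClopen_cylEvent (Λ : Finset ℤ) (ζ : Λ → S) : IsClopen (cylEvent Λ ζ) := by
  have : cylEvent Λ ζ = ⋂ i : Λ, (fun y : Conf S => y i) ⁻¹' {ζ i} := by
    ext y; simp [cylEvent]
  rw [this]
  exact isClopen_iInter_of_finite fun i => (isClopen_discrete _).preimage (continuous_apply _)

lemma continuous_cylInd (Λ : Finset ℤ) (ζ : Λ → S) : Continuous (cylInd Λ ζ) :=
  continuous_const.indicator (fun x hx => absurd hx (by
    rw [(isClopen_cylEvent Λ ζ).frontier_eq]; exact notMem_empty x))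

lemma measurableSet_cylEvent (Λ : Finset ℤ) (ζ : Λ → S) : MeasurableSet (cylEvent Λ ζ) :=
  (isClopen_cylEvent Λ ζ).isOpen.measurableSet

lemma cylInd_ov (x : Conf S) (Λ : Finset ℤ) (ζ η : Λ → S) :
    cylInd Λ ζ (ov x Λ η) = if η = ζ then 1 else 0 := by
  have : ov x Λ η ∈ cylEvent Λ ζ ↔ η = ζ :=
    ⟨fun h => funext fun i => by rw [← h i, ov_of_mem _ _ i.2], fun h i => by
      rw [ov_of_mem _ _ i.2, h]⟩
  by_cases h : η = ζ
  · rw [if_pos h, cylInd, indicator_of_mem (this.2 h)]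
  · rw [if_neg h, cylInd, indicator_of_notMem (mt this.1 h)]

lemma tot_cylInd (Λ : Finset ℤ) (ζ : Λ → S) (F : Conf S → ℝ) (x : Conf S) :
    tot Λ (fun y => F y * cylInd Λ ζ y) x = F (ov x Λ ζ) := by
  simp [tot, cylInd_ov]

lemma ov_of_mem_cylEvent {Λ : Finset ℤ} {ζ : Λ → S} {x : Conf S} (h : x ∈ cylEvent Λ ζ) :
    ov x Λ ζ = x := by
  conv_rhs => rw [← ov_self x Λ]
  congr 1
  exact (funext h).symm

lemma cylInd_mul (Λ : Finset ℤ) (ζ : Λ → S) (F : Conf S → ℝ) (x : Conf S) :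
    cylInd Λ ζ x * F (ov x Λ ζ) = cylInd Λ ζ x * F x := by
  by_cases h : x ∈ cylEvent Λ ζ
  · rw [ov_of_mem_cylEvent h]
  · rw [cylInd, indicator_of_notMem h, zero_mul, zero_mul]

lemma sum_cylInd_mul (Λ : Finset ℤ) (F : Conf S → ℝ) (x : Conf S) :
    ∑ ζ, cylInd Λ ζ x * F (ov x Λ ζ) = F x := by
  simp_rw [cylInd_mul]
  rw [← Finset.sum_mul]
  have : ∀ ζ, cylInd Λ ζ x = if (fun i : Λ => x i) = ζ then 1 else 0 := fun ζ => by
    conv_lhs => rw [← ov_self x Λ]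
    exact cylInd_ov _ _ _ _
  simp [this]

variable {V : Specification S}

theorem IsGibbs.dlr (hcont : V.IsCont) {ν : Measure (Conf S)} (h : IsGibbs V ν) : Dlr V ν := by
  have := h.1
  intro Λ H hH
  rcases Λ.eq_empty_or_nonempty with rfl | hΛ
  · have : ∀ x, V.φ ∅ x = 1 := fun x => by
      rw [← V.tot_eq_one ∅ x, tot_empty]
    simp [tot_empty, this]
  have hm := cylSA_le (S := S) (Λ : Set ℤ)ᶜ
  have key : ∀ ζ : Λ → S, ∫ x, cylInd Λ ζ x * H (ov x Λ ζ) ∂ν =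
      ∫ x, V.φ Λ (ov x Λ ζ) * H (ov x Λ ζ) ∂ν := by
    intro ζ
    have hc := continuous_cylInd Λ ζ
    have h1 := condExp_mul_of_stronglyMeasurable_right (μ := ν) (m := cylSA (Λ : Set ℤ)ᶜ)
      (f := cylInd Λ ζ) (g := fun x => H (ov x Λ ζ))
      ((hH.measurable.comp (measurable_ov Λ ζ)).stronglyMeasurable)
      (integrable_of_continuous (hc.mul (hH.comp (continuous_ov Λ ζ))))
      (integrable_of_continuous hc)
    have h2 := integral_condExp (μ := ν) hm (f := cylInd Λ ζ * fun x => H (ov x Λ ζ))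
    refine h2.symm.trans (integral_congr_ae ?_)
    filter_upwards [h1, h.2 Λ hΛ ζ] with x h3 h4
    rw [h3, Pi.mul_apply, h4]
    rfl
  have e : ∀ x, H x = ∑ ζ, cylInd Λ ζ x * H (ov x Λ ζ) := fun x => (sum_cylInd_mul Λ H x).symm
  have i1 : ∀ ζ : Λ → S, Integrable (fun x => cylInd Λ ζ x * H (ov x Λ ζ)) ν := fun ζ =>
    integrable_of_continuous ((continuous_cylInd Λ ζ).mul (hH.comp (continuous_ov Λ ζ)))
  have i2 : ∀ ζ : Λ → S, Integrable (fun x => V.φ Λ (ov x Λ ζ) * H (ov x Λ ζ)) ν := fun ζ =>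
    integrable_of_continuous (((hcont Λ).mul hH).comp (continuous_ov Λ ζ))
  rw [integral_congr_ae (ae_of_all _ e), integral_finsetSum _ fun ζ _ => i1 ζ]
  simp_rw [key, tot]
  rw [integral_finsetSum _ fun ζ _ => i2 ζ]

theorem Dlr.isGibbs (hcont : V.IsCont) {ν : Measure (Conf S)} [IsProbabilityMeasure ν]
    (h : Dlr V ν) : IsGibbs V ν := by
  refine ⟨inferInstance, fun Λ _ ζ => ?_⟩
  have hm := cylSA_le (S := S) (Λ : Set ℤ)ᶜ
  have hov : Measurable fun x : Conf S => ov x Λ ζ := (continuous_ov Λ ζ).measurable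
  have hφ : Continuous fun x => V.φ Λ (ov x Λ ζ) := (hcont Λ).comp (continuous_ov Λ ζ)
  have hφm : Measurable fun x => ENNReal.ofReal (V.φ Λ (ov x Λ ζ)) :=
    hφ.measurable.ennreal_ofReal
  have : IsFiniteMeasure (ν.withDensity fun x => ENNReal.ofReal (V.φ Λ (ov x Λ ζ))) :=
    isFiniteMeasure_withDensity_ofReal (integrable_of_continuous hφ).2
  have hρ : (ν.restrict (cylEvent Λ ζ)).map (fun x => ov x Λ ζ) =
      (ν.withDensity fun x => ENNReal.ofReal (V.φ Λ (ov x Λ ζ))).map fun x => ov x Λ ζ := by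
    refine ext_of_forall_integral_eq_of_IsFiniteMeasure fun H => ?_
    have hH := H.continuous
    rw [integral_map hov.aemeasurable hH.aestronglyMeasurable,
      integral_map hov.aemeasurable hH.aestronglyMeasurable,
      integral_withDensity_eq_integral_toReal_smul hφm (ae_of_all _ fun _ => ENNReal.ofReal_lt_top),
      ← integral_indicator (measurableSet_cylEvent Λ ζ)]
    have h1 := h Λ (fun x => H x * cylInd Λ ζ x) (hH.mul (continuous_cylInd Λ ζ))
    have e : ∀ x, tot Λ (fun y => V.φ Λ y * (H y * cylInd Λ ζ y)) x =
        V.φ Λ (ov x Λ ζ) * H (ov x Λ ζ) := fun x => by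
      rw [← tot_cylInd Λ ζ (fun y => V.φ Λ y * H y)]
      simp only [mul_assoc]
    simp_rw [e] at h1
    simp_rw [ENNReal.toReal_ofReal (V.nonneg _ _), smul_eq_mul]
    rw [← h1]
    refine integral_congr_ae (ae_of_all _ fun x => ?_)
    change (cylEvent Λ ζ).indicator (fun x => H (ov x Λ ζ)) x = _
    dsimp only
    rw [mul_comm, ← cylInd_mul, cylInd]
    by_cases hx : x ∈ cylEvent Λ ζ
    · rw [indicator_of_mem hx, indicator_of_mem hx, one_mul]
    · rw [indicator_of_notMem hx, indicator_of_notMem hx, zero_mul]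
  refine ae_eq_condExp_of_forall_setIntegral_eq hm
    (integrable_of_continuous (continuous_cylInd Λ ζ))
    (fun s _ _ => (integrable_of_continuous hφ).integrableOn) (fun s hs _ => ?_)
    (((hcont Λ).measurable.comp (measurable_ov Λ ζ)).stronglyMeasurable.aestronglyMeasurable)
  have hs' : MeasurableSet s := hm s hs
  have hpre : (fun x => ov x Λ ζ) ⁻¹' s = s := Set.ext fun x => ov_mem_iff hs x ζ
  have h2 := congrArg (fun ρ : Measure (Conf S) => ρ s) hρ
  rw [Measure.map_apply hov hs', Measure.map_apply hov hs', hpre, Measure.restrict_apply hs',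
    withDensity_apply _ hs'] at h2
  rw [integral_indicator (measurableSet_cylEvent Λ ζ), setIntegral_const, smul_eq_mul, mul_one,
    measureReal_restrict_apply (measurableSet_cylEvent Λ ζ), inter_comm, measureReal_def, h2,
    integral_eq_lintegral_of_nonneg_ae (ae_of_all _ fun _ => V.nonneg _ _)
      hφ.aestronglyMeasurable]

lemma continuous_shift (n : ℤ) : Continuous (shift n : Conf S → Conf S) :=
  continuous_pi fun i => continuous_apply (i + n)

theorem IsGibbs.map_shift (hcont : V.IsCont) (hinv : V.TInvariant) {ν : Measure (Conf S)}
    (h : IsGibbs V ν) (n : ℤ) : IsGibbs V (ν.map (shift n)) := by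
  have := h.1
  have hs : Measurable (shift n : Conf S → Conf S) := (continuous_shift n).measurable
  have : IsProbabilityMeasure (ν.map (shift n)) := Measure.isProbabilityMeasure_map hs.aemeasurable
  refine Dlr.isGibbs hcont fun Λ H hH => ?_
  have hT : Continuous (tot Λ fun y => V.φ Λ y * H y) := continuous_tot Λ ((hcont Λ).mul hH)
  rw [integral_map hs.aemeasurable hH.aestronglyMeasurable,
    integral_map hs.aemeasurable hT.aestronglyMeasurable]
  refine (h.dlr hcont (Λ.image fun i => n + i) _ (hH.comp (continuous_shift n))).trans ?_
  refine integral_congr_ae (ae_of_all _ fun x => ?_)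
  refine Eq.trans ?_ (tot_shift n Λ (fun y => V.φ Λ y * H y) x)
  congr 1
  funext y
  exact congrArg (· * H (shift n y)) (hinv n Λ y)

/-! ### Existence -/

theorem exists_isGibbs (V : Specification S) (hcont : V.IsCont) : ∃ μ, IsGibbs V μ := by
  obtain ⟨y⟩ : Nonempty (Conf S) := inferInstance
  have hW : ∀ n : ℕ, ∃ ρ : ProbabilityMeasure (Conf S), ∀ H : Conf S → ℝ, Continuous H →
      ∫ x, H x ∂(ρ : Measure (Conf S)) =
        tot (Finset.Ico (-(n : ℤ)) n) (fun x => V.φ (Finset.Ico (-(n : ℤ)) n) x * H x) y := by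
    intro n
    set Λ := Finset.Ico (-(n : ℤ)) n
    set ρ : Measure (Conf S) := ∑ ζ : Λ → S,
      ENNReal.ofReal (V.φ Λ (ov y Λ ζ)) • Measure.dirac (ov y Λ ζ) with hρ
    have hprob : IsProbabilityMeasure ρ := by
      refine ⟨?_⟩
      rw [hρ, Measure.finsetSum_apply]
      simp only [Measure.smul_apply, measure_univ, smul_eq_mul, mul_one]
      rw [← ENNReal.ofReal_sum_of_nonneg fun ζ _ => V.nonneg _ _, V.sum_one, ENNReal.ofReal_one]
    refine ⟨⟨ρ, hprob⟩, fun H hH => ?_⟩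
    change ∫ x, H x ∂ρ = _
    rw [hρ, integral_finsetSum_measure fun ζ _ =>
      (integrable_of_continuous hH).smul_measure ENNReal.ofReal_ne_top]
    refine Finset.sum_congr rfl fun ζ _ => ?_
    rw [integral_smul_measure, integral_dirac, ENNReal.toReal_ofReal (V.nonneg _ _), smul_eq_mul]
  choose ρ hρ using hW
  obtain ⟨μ, -, hμ⟩ := isCompact_univ.ultrafilter_le_nhds ((hyperfilter ℕ).map ρ)
    (by simp)
  have hlim : ∀ H : Conf S → ℝ, Continuous H → Tendsto (fun n => ∫ x, H x ∂(ρ n : Measure (Conf S)))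
      (hyperfilter ℕ) (nhds (∫ x, H x ∂(μ : Measure (Conf S)))) := fun H hH =>
    ProbabilityMeasure.tendsto_iff_forall_integral_tendsto.1 hμ
      (BoundedContinuousFunction.mkOfCompact ⟨H, hH⟩)
  refine ⟨μ, Dlr.isGibbs hcont fun Λ H hH => ?_⟩
  have hT : Continuous (tot Λ fun y => V.φ Λ y * H y) := continuous_tot Λ ((hcont Λ).mul hH)
  refine tendsto_nhds_unique (hlim H hH) ((hlim _ hT).congr' ?_)
  obtain ⟨N, hN⟩ : ∃ N : ℕ, ∀ n ≥ N, Λ ⊆ Finset.Ico (-(n : ℤ)) n := by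
    refine ⟨Λ.sup (fun i => i.natAbs + 1), fun n hn i hi => ?_⟩
    have := (Finset.le_sup (f := fun i : ℤ => i.natAbs + 1) hi).trans hn
    rw [Finset.mem_Ico]
    omega
  have hev : ∀ᶠ n in (hyperfilter ℕ : Filter ℕ), N ≤ n :=
    Nat.hyperfilter_le_atTop (eventually_ge_atTop N)
  filter_upwards [hev] with n hn
  rw [hρ n H hH, hρ n _ hT]
  exact (V.tot_tot (hN n hn) H y).symm

/-! ### Gibbs states as processes with a state kernel -/

/-- The configurations which agree with `x` on the `n` sites before the origin. -/
def pastSet (n : ℕ) (x : Conf S) : Set (Conf S) := {y | ∀ j : ℤ, -(n : ℤ) ≤ j → j < 0 → y j = x j}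

lemma pastSet_eq (n : ℕ) (x : Conf S) :
    pastSet n x = cylEvent (Finset.Ico (-(n : ℤ)) 0) fun i => x i := by
  ext y
  simp only [pastSet, cylEvent, mem_ofPred_eq]
  exact ⟨fun h i => h i (Finset.mem_Ico.1 i.2).1 (Finset.mem_Ico.1 i.2).2, fun h j h1 h2 =>
    h ⟨j, Finset.mem_Ico.2 ⟨h1, h2⟩⟩⟩

lemma measurableSet_pastSet (n : ℕ) (x : Conf S) : MeasurableSet (pastSet n x) := by
  rw [pastSet_eq]; exact measurableSet_cylEvent _ _

lemma continuous_pastSet (n : ℕ) (x : Conf S) :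
    Continuous ((pastSet n x).indicator fun _ => (1 : ℝ)) := by
  rw [pastSet_eq]; exact continuous_cylInd _ _

lemma continuous_sym0 (a : S) : Continuous (sym0 a : Conf S → ℝ) := by
  have : Continuous fun b : S => if b = a then (1 : ℝ) else 0 := continuous_of_discreteTopology
  exact this.comp (continuous_apply (0 : ℤ))

lemma measurableSet_zero_eq (a : S) : MeasurableSet {y : Conf S | y 0 = a} :=
  ((isClopen_discrete {a}).preimage (continuous_apply (0 : ℤ))).isOpen.measurableSet

/-- The probability of the last `n` letters of `x`. -/
def past (ν : Measure (Conf S)) (n : ℕ) (x : Conf S) : ℝ := ν.real (pastSet n x)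

lemma past_step (ν : Measure (Conf S)) (n : ℕ) (x : Conf S) (a : S) :
    past (ν.map (shift 1)) (n + 1) (shift 1 (upd a 0 x)) =
      ν.real (pastSet n x ∩ {y | y 0 = a}) := by
  rw [past, map_measureReal_apply (continuous_shift 1).measurable (measurableSet_pastSet _ _)]
  congr 1
  ext y
  simp only [pastSet, mem_preimage, mem_ofPred_eq, mem_inter_iff, shift, upd]
  push_cast
  constructor
  · intro h
    refine ⟨fun j h1 h2 => ?_, ?_⟩
    · have := h (j - 1) (by omega) (by omega)
      rwa [sub_add_cancel, if_neg h2.ne] at this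
    · simpa using h (-1) (by omega) (by omega)
  · rintro ⟨h1, h2⟩ j h3 h4
    split_ifs with h5
    · rw [h5]; exact h2
    · exact h1 _ (by omega) (by omega)

lemma sum_past_step (ν : Measure (Conf S)) [IsFiniteMeasure ν] (n : ℕ) (x : Conf S) :
    ∑ a, ν.real (pastSet n x ∩ {y | y 0 = a}) = past ν n x := by
  rw [past, ← measureReal_biUnion_finset]
  · congr 1
    ext y
    simp
  · intro a _ b _ hab
    refine Set.disjoint_left.2 fun y h1 h2 => hab ?_
    rw [← h1.2, ← h2.2]
  · exact fun a _ => (measurableSet_pastSet n x).inter (measurableSet_zero_eq a)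

variable {V : Specification S}

lemma Dlr.real_cylEvent {ν : Measure (Conf S)} (h : Dlr V ν) (Λ : Finset ℤ) (ζ : Λ → S) :
    ν.real (cylEvent Λ ζ) = ∫ x, V.φ Λ (ov x Λ ζ) ∂ν := by
  have := h Λ (cylInd Λ ζ) (continuous_cylInd Λ ζ)
  simp_rw [tot_cylInd] at this
  rw [← this, cylInd, integral_indicator_const _ (measurableSet_cylEvent Λ ζ), smul_eq_mul, mul_one]

lemma IsGibbs.past_pos (hpos : V.Positive) (hcont : V.IsCont) {ν : Measure (Conf S)}
    (h : IsGibbs V ν) (n : ℕ) (x : Conf S) : 0 < past ν n x := by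
  have := h.1
  rw [past, pastSet_eq, (h.dlr hcont).real_cylEvent, integral_pos_iff_support_of_nonneg
    (fun x => (hpos _ _).le) (integrable_of_continuous ((hcont _).comp (continuous_ov _ _)))]
  have : (Function.support fun y => V.φ (Finset.Ico (-(n : ℤ)) 0)
      (ov y (Finset.Ico (-(n : ℤ)) 0) fun i => x i)) = univ :=
    eq_univ_of_forall fun y => (hpos _ _).ne'
  rw [this, measure_univ]
  exact one_pos

/-- The weight of the symbol `a` at the origin in the box `[0, N)`, given the configuration
outside of the box. -/
def boxWeight (V : Specification S) (N : ℕ) (a : S) : Conf S → ℝ :=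
  tot (Finset.Ico 0 (N : ℤ)) fun z => V.φ (Finset.Ico 0 (N : ℤ)) z * sym0 a z

lemma Dlr.real_inter {ν : Measure (Conf S)} (h : Dlr V ν) (n N : ℕ) (x : Conf S) (a : S) :
    ν.real (pastSet n x ∩ {y | y 0 = a}) = ∫ y in pastSet n x, boxWeight V N a y ∂ν := by
  have hC := continuous_pastSet n x
  have h1 := h (Finset.Ico 0 (N : ℤ))
    (fun y => (pastSet n x).indicator (fun _ => (1 : ℝ)) y * sym0 a y) (hC.mul (continuous_sym0 a))
  have e1 : ∀ y : Conf S, (pastSet n x).indicator (fun _ => (1 : ℝ)) y * sym0 a y =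
      (pastSet n x ∩ {y | y 0 = a}).indicator (fun _ => (1 : ℝ)) y := fun y => by
    by_cases h1 : y ∈ pastSet n x <;> by_cases h2 : y 0 = a <;> simp [sym0, indicator, h1, h2]
  have e2 : ∀ y, tot (Finset.Ico 0 (N : ℤ)) (fun z => V.φ (Finset.Ico 0 (N : ℤ)) z *
      ((pastSet n x).indicator (fun _ => (1 : ℝ)) z * sym0 a z)) y =
      (pastSet n x).indicator (fun y => boxWeight V N a y) y := fun y => by
    have e3 : ∀ ζ : Finset.Ico 0 (N : ℤ) → S,
        (pastSet n x).indicator (fun _ => (1 : ℝ)) (ov y (Finset.Ico 0 (N : ℤ)) ζ) =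
          (pastSet n x).indicator (fun _ => (1 : ℝ)) y := fun ζ => by
      have : ov y (Finset.Ico 0 (N : ℤ)) ζ ∈ pastSet n x ↔ y ∈ pastSet n x :=
        forall_congr' fun j => forall_congr' fun _ => forall_congr' fun hj => by
          rw [ov_of_notMem _ _ (by simp; omega)]
      by_cases hy : y ∈ pastSet n x
      · rw [indicator_of_mem hy, indicator_of_mem (this.2 hy)]
      · rw [indicator_of_notMem hy, indicator_of_notMem (mt this.1 hy)]
    simp_rw [mul_left_comm (V.φ _ _)]
    rw [tot_mul_left e3]
    by_cases hy : y ∈ pastSet n x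
    · rw [indicator_of_mem hy, indicator_of_mem hy, one_mul, boxWeight]
    · rw [indicator_of_notMem hy, indicator_of_notMem hy, zero_mul]
  simp_rw [e1] at h1
  simp_rw [← e1, e2] at h1
  rw [← integral_indicator (measurableSet_pastSet n x), ← h1]
  simp_rw [e1]
  rw [integral_indicator_const _ ((measurableSet_pastSet n x).inter (measurableSet_zero_eq a)),
    smul_eq_mul, mul_one]

/-- A pointwise comparison of products integrates over two sets. -/
lemma setIntegral_mul_le {Ω : Type*} [MeasurableSpace Ω] {ν ν' : Measure Ω} {C C' : Set Ω}
    (hC : MeasurableSet C) (hC' : MeasurableSet C') {f g : Ω → ℝ} {K : ℝ}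
    (hf : IntegrableOn f C ν) (hg : IntegrableOn g C ν)
    (hf' : IntegrableOn f C' ν') (hg' : IntegrableOn g C' ν')
    (h : ∀ x ∈ C, ∀ y ∈ C', f x * g y ≤ K * (g x * f y)) :
    (∫ x in C, f x ∂ν) * ∫ y in C', g y ∂ν' ≤
      K * ((∫ x in C, g x ∂ν) * ∫ y in C', f y ∂ν') := by
  have h1 : ∀ x ∈ C, f x * ∫ y in C', g y ∂ν' ≤ (K * ∫ y in C', f y ∂ν') * g x := fun x hx => by
    rw [← integral_const_mul, show (K * ∫ y in C', f y ∂ν') * g x = ∫ y in C', K * g x * f y ∂ν' by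
      rw [integral_const_mul]; ring]
    exact setIntegral_mono_on (hg'.const_mul _) (hf'.const_mul _) hC' fun y hy => by
      rw [mul_assoc]; exact h x hx y hy
  rw [← integral_mul_const, show K * ((∫ x in C, g x ∂ν) * ∫ y in C', f y ∂ν') =
    ∫ x in C, (K * ∫ y in C', f y ∂ν') * g x ∂ν by rw [integral_const_mul]; ring]
  exact setIntegral_mono_on (hf.mul_const _) (hg.const_mul _) hC h1

/-- The comparison of conditional odds which the decay of memory provides. -/
def OddsMemory (V : Specification S) (ω : ℕ → ℝ) : Prop :=
  ∀ k : ℕ, ∃ N : ℕ, ∀ x y : Conf S, (∀ t : ℤ, -(k : ℤ) ≤ t → t < 0 → x t = y t) → ∀ a b : S,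
    boxWeight V N a x * boxWeight V N b y ≤
      Real.exp (ω k) * (boxWeight V N b x * boxWeight V N a y)

lemma OddsMemory.past_ratio {ω : ℕ → ℝ} (hω : OddsMemory V ω) (hcont : V.IsCont)
    {ν ν' : Measure (Conf S)} (hν : IsGibbs V ν) (hν' : IsGibbs V ν') {k n n' : ℕ} (hn : k ≤ n)
    (hn' : k ≤ n') {x x' : Conf S} (hx : ∀ t : ℤ, -(k : ℤ) ≤ t → t < 0 → x t = x' t) (a : S) :
    ν.real (pastSet n x ∩ {y | y 0 = a}) * past ν' n' x' ≤
      Real.exp (ω k) * (past ν n x * ν'.real (pastSet n' x' ∩ {y | y 0 = a})) := by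
  have := hν.1
  have := hν'.1
  obtain ⟨N, hN⟩ := hω k
  have hG : ∀ a, Continuous (boxWeight V N a) := fun a =>
    continuous_tot _ ((hcont _).mul (continuous_sym0 a))
  rw [← sum_past_step ν, ← sum_past_step ν', Finset.mul_sum, Finset.sum_mul, Finset.mul_sum]
  refine Finset.sum_le_sum fun b _ => ?_
  rw [(hν.dlr hcont).real_inter n N, (hν.dlr hcont).real_inter n N,
    (hν'.dlr hcont).real_inter n' N, (hν'.dlr hcont).real_inter n' N]
  refine setIntegral_mul_le (measurableSet_pastSet _ _) (measurableSet_pastSet _ _)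
    (integrable_of_continuous (hG a)).integrableOn (integrable_of_continuous (hG b)).integrableOn
    (integrable_of_continuous (hG a)).integrableOn (integrable_of_continuous (hG b)).integrableOn
    fun y hy y' hy' => hN y y' (fun t h1 h2 => ?_) a b
  rw [hy t (by omega) h2, hy' t (by omega) h2, hx t h1 h2]

/-- A Gibbs state together with the number of letters read and the letters themselves, placed
before the origin. -/
abbrev GState (V : Specification S) := {ν : Measure (Conf S) // IsGibbs V ν} × ℕ × Conf S

/-- Reading a letter. -/
def gstep (hcont : V.IsCont) (hinv : V.TInvariant) (p : GState V) (a : S) : GState V :=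
  (⟨p.1.1.map (shift 1), p.1.2.map_shift hcont hinv 1⟩, p.2.1 + 1, shift 1 (upd a 0 p.2.2))

/-- The probability of the letters read. -/
def gpast (p : GState V) : ℝ := past p.1.1 p.2.1 p.2.2

lemma gpast_step (hcont : V.IsCont) (hinv : V.TInvariant) (p : GState V) (a : S) :
    gpast (gstep hcont hinv p a) = p.1.1.real (pastSet p.2.1 p.2.2 ∩ {y | y 0 = a}) :=
  past_step _ _ _ _

lemma gpast_pos (hpos : V.Positive) (hcont : V.IsCont) (p : GState V) : 0 < gpast p :=
  p.1.2.past_pos hpos hcont _ _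

lemma exists_stateKernel (hpos : V.Positive) (hcont : V.IsCont) (hinv : V.TInvariant)
    {ω : ℕ → ℝ} (hω0 : ∀ i, 0 ≤ ω i)
    (hω2 : Tendsto (fun n : ℕ => ∑ i ∈ Finset.Icc (2 ^ n) (2 ^ (n + 1)), ω i ^ 2) atTop (nhds 0))
    (hω : OddsMemory V ω) :
    ∃ k : StateKernel (GState V) S, k.step = gstep hcont hinv ∧
      ∀ p a, k.κ p a = gpast (gstep hcont hinv p a) / gpast p := by
  have hp := gpast_pos hpos hcont
  let Ag : ℕ → GState V → GState V → Prop := fun k p q => k ≤ p.2.1 ∧ k ≤ q.2.1 ∧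
    ∀ t : ℤ, -(k : ℤ) ≤ t → t < 0 → p.2.2 t = q.2.2 t
  have hr : ∀ k p q a, Ag k p q → gpast (gstep hcont hinv p a) / gpast p ≤
      Real.exp (ω k) * (gpast (gstep hcont hinv q a) / gpast q) := fun k p q a h => by
    have := hω.past_ratio hcont p.1.2 q.1.2 h.1 h.2.1 h.2.2 a
    rw [← gpast_step hcont hinv p, ← gpast_step hcont hinv q] at this
    rw [← mul_div_assoc, div_le_div_iff₀ (hp p) (hp q)]
    exact this.trans_eq (by simp only [← gpast.eq_1]; ring)
  obtain ⟨μ, hμ⟩ := exists_isGibbs V hcont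
  let q : GState V := (⟨μ, hμ⟩, 0, Classical.arbitrary _)
  obtain ⟨b, hb⟩ := Finite.exists_min fun a => gpast (gstep hcont hinv q a) / gpast q
  refine ⟨{ step := gstep hcont hinv
            κ := fun p a => gpast (gstep hcont hinv p a) / gpast p
            c := Real.exp (-ω 0) * (gpast (gstep hcont hinv q b) / gpast q)
            c_pos := mul_pos (Real.exp_pos _) (div_pos (hp _) (hp _))
            c_le := fun p a => ?_
            sum_one := fun p => ?_
            Ag := Ag
            ag_zero := fun p q => ⟨Nat.zero_le _, Nat.zero_le _, fun t h1 h2 => by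
              rw [Nat.cast_zero] at h1; omega⟩
            ag_symm := fun k p q h => ⟨h.2.1, h.1, fun t h1 h2 => (h.2.2 t h1 h2).symm⟩
            ag_step := fun k p q a h => ⟨Nat.succ_le_succ h.1, Nat.succ_le_succ h.2.1,
              fun t h1 h2 => ?_⟩
            ω := ω
            ω_nonneg := hω0
            ratio := hr
            dyadic := hω2 }, rfl, fun _ _ => rfl⟩
  · rw [Real.exp_neg, inv_mul_le_iff₀ (Real.exp_pos _)]
    refine (hb a).trans (hr 0 q p a ⟨Nat.zero_le _, Nat.zero_le _, fun t h1 h2 => ?_⟩)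
    rw [Nat.cast_zero] at h1; omega
  · have := p.1.2.1
    rw [← Finset.sum_div, div_eq_one_iff_eq (hp p).ne']
    simp_rw [gpast_step]
    exact sum_past_step _ _ _
  · push_cast at h1
    simp only [gstep, shift, upd]
    split_ifs with h3
    · rfl
    · exact h.2.2 _ (by omega) (by omega)

section Represent

variable {hcont : V.IsCont} {hinv : V.TInvariant} {k : StateKernel (GState V) S}

lemma lw_eq_gpast (hpos : V.Positive) (hs : k.step = gstep hcont hinv)
    (hκ : ∀ p a, k.κ p a = gpast (gstep hcont hinv p a) / gpast p) (p : GState V) (x : ℕ → S)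
    (n : ℕ) : k.lw p x n = gpast (k.st p x n) / gpast p := by
  induction n with
  | zero => rw [StateKernel.lw, Finset.prod_range_zero, StateKernel.st,
      div_self (gpast_pos hpos hcont p).ne']
  | succ n ih =>
    rw [StateKernel.lw, Finset.prod_range_succ, ← StateKernel.lw, ih, hκ, StateKernel.st, hs]
    have := (gpast_pos hpos hcont (k.st p x n)).ne'
    have := (gpast_pos hpos hcont p).ne'
    field_simp

lemma st_eq (hs : k.step = gstep hcont hinv) {ν : Measure (Conf S)} (hν : IsGibbs V ν)
    (y : Conf S) (x : ℕ → S) (n : ℕ) :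
    (k.st (⟨ν, hν⟩, 0, y) x n).1.1 = ν.map (shift n) ∧ (k.st (⟨ν, hν⟩, 0, y) x n).2.1 = n ∧
      ∀ j < n, (k.st (⟨ν, hν⟩, 0, y) x n).2.2 ((j : ℤ) - n) = x j := by
  induction n with
  | zero =>
    refine ⟨?_, rfl, fun j hj => absurd hj (Nat.not_lt_zero _)⟩
    change ν = ν.map (shift ((0 : ℕ) : ℤ))
    have : (shift ((0 : ℕ) : ℤ) : Conf S → Conf S) = id := by ext; simp [shift]
    rw [this, Measure.map_id]
  | succ n ih =>
    obtain ⟨h1, h2, h3⟩ := ih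
    rw [StateKernel.st, hs]
    refine ⟨?_, ?_, fun j hj => ?_⟩
    · change (k.st (⟨ν, hν⟩, 0, y) x n).1.1.map (shift 1) = _
      rw [h1, Measure.map_map (continuous_shift 1).measurable (continuous_shift _).measurable]
      congr 1
      funext z i
      simp only [Function.comp, shift]
      congr 1
      push_cast
      ring
    · exact congrArg (· + 1) h2
    · simp only [gstep, shift, upd]
      split_ifs with h
      · congr 1
        push_cast at h
        omega
      · rw [show (j : ℤ) - (n + 1 : ℕ) + 1 = j - n by push_cast; ring]
        exact h3 j (by push_cast at h; omega)

lemma law_eq_wl (hpos : V.Positive) (hs : k.step = gstep hcont hinv)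
    (hκ : ∀ p a, k.κ p a = gpast (gstep hcont hinv p a) / gpast p)
    {ν : Measure (Conf S)} (hν : IsGibbs V ν) (y : Conf S) (n : ℕ) (u : Fin n → S) :
    k.law n (⟨ν, hν⟩, 0, y) u = wl ν n u := by
  have := hν.1
  obtain ⟨h1, h2, h3⟩ := st_eq hs hν y (wext u) n
  rw [StateKernel.law, lw_eq_gpast hpos hs hκ]
  have e0 : gpast ((⟨ν, hν⟩, 0, y) : GState V) = 1 := by
    have : pastSet 0 y = univ := eq_univ_of_forall fun z j h1 h2 => by
      rw [Nat.cast_zero] at h1; omega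
    rw [gpast, past]
    dsimp only
    rw [this, probReal_univ]
  rw [e0, div_one, gpast, h1, h2, past,
    map_measureReal_apply (continuous_shift _).measurable (measurableSet_pastSet _ _), wl, dlaw]
  congr 1
  ext z
  simp only [pastSet, mem_preimage, mem_ofPred_eq, mem_singleton_iff, shift]
  constructor
  · intro h
    funext i
    have := h ((i : ℕ) - (n : ℤ)) (by omega) (by have := i.2; omega)
    rw [h3 i i.2, sub_add_cancel, wext_fin] at this
    simpa [word] using this
  · rintro rfl j hj1 hj2
    obtain ⟨i, hi⟩ : ∃ i : ℕ, (i : ℤ) = j + n := ⟨(j + n).toNat, by omega⟩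
    have hin : i < n := by omega
    rw [← hi, show j = (i : ℤ) - n by omega, h3 i hin, wext_lt _ hin]
    simp [word]

lemma avg_look_eq (hpos : V.Positive) (hs : k.step = gstep hcont hinv)
    (hκ : ∀ p a, k.κ p a = gpast (gstep hcont hinv p a) / gpast p)
    {ν : Measure (Conf S)} (hν : IsGibbs V ν) (y : Conf S) (n m : ℕ) (v : Fin m → S) :
    k.avg (k.look fun w => if w = v then 1 else 0) n (⟨ν, hν⟩, 0, y) = dlaw ν (word n m) v := by
  have := hν.1
  have e := integral_dcomp (μ := ν) (measurable_word 0 (n + m)) fun z =>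
    if (fun i => z (Fin.natAdd n i)) = v then (1 : ℝ) else 0
  have e1 : ∀ x : Conf S, (fun i => word 0 (n + m) x (Fin.natAdd n i)) = word n m x := fun x => by
    ext i; simp [word]
  simp only [e1] at e
  have e2 := integral_dcomp (μ := ν) (measurable_word n m) fun z => if z = v then (1 : ℝ) else 0
  rw [e2] at e
  simp only [mul_ite, mul_one, mul_zero, Finset.sum_ite_eq', Finset.mem_univ, if_true] at e
  rw [e, sum_append, StateKernel.avg]
  refine Finset.sum_congr rfl fun u _ => ?_
  rw [StateKernel.look, Finset.mul_sum]
  refine Finset.sum_congr rfl fun w _ => ?_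
  rw [← mul_assoc, ← k.law_append, law_eq_wl hpos hs hκ hν]
  simp only [Fin.append_right, wl, mul_ite, mul_one, mul_zero]

lemma wl_unique (hpos : V.Positive) (hs : k.step = gstep hcont hinv)
    (hκ : ∀ p a, k.κ p a = gpast (gstep hcont hinv p a) / gpast p)
    {ν ν' : Measure (Conf S)} (hν : IsGibbs V ν) (hν' : IsGibbs V ν') (t : ℤ) (m : ℕ)
    (v : Fin m → S) : dlaw ν (word t m) v ≤ dlaw ν' (word t m) v := by
  refine le_of_forall_pos_le_add fun ε hε => ?_
  obtain ⟨n, hn⟩ := k.loss_of_memory (h := fun w => if w = v then 1 else 0)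
    (fun w => by split_ifs <;> norm_num) (fun w => by split_ifs <;> norm_num) hε
  have hsh : ∀ {ρ : Measure (Conf S)}, dlaw (ρ.map (shift (t - n))) (word n m) v =
      dlaw ρ (word t m) v := fun {ρ} => by
    rw [dlaw, map_measureReal_apply (continuous_shift _).measurable
      (measurable_word _ _ (measurableSet_singleton v)), dlaw]
    congr 1
    ext z
    simp only [mem_preimage, mem_singleton_iff]
    have : word n m (shift (t - n) z) = word t m z := by
      funext i
      simp only [word, shift]
      congr 1
      ring
    rw [this]
  have y : Conf S := Classical.arbitrary _
  have := hn n le_rfl (⟨_, hν.map_shift hcont hinv (t - n)⟩, 0, y)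
    (⟨_, hν'.map_shift hcont hinv (t - n)⟩, 0, y)
  rw [avg_look_eq hpos hs hκ, avg_look_eq hpos hs hκ, hsh, hsh] at this
  linarith

theorem gibbs_unique (hpos : V.Positive) (hs : k.step = gstep hcont hinv)
    (hκ : ∀ p a, k.κ p a = gpast (gstep hcont hinv p a) / gpast p)
    {ν ν' : Measure (Conf S)} (hν : IsGibbs V ν) (hν' : IsGibbs V ν') : ν = ν' := by
  have := hν.1
  have := hν'.1
  refine eq_of_word_eq fun t m => ?_
  funext v
  exact (wl_unique hpos hs hκ hν hν' t m v).antisymm (wl_unique hpos hs hκ hν' hν t m v)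

end Represent

/-- The decay of memory of the single-site ratio, transferred to the specification. -/
theorem exists_oddsMemory (hpos : V.Positive) (hcont : V.IsCont)
    (hinv : V.TInvariant) (s : S) (f : Conf S → ℝ)
    (hf : ∀ x, f x = V.φ {0} x / V.φ {0} (upd s 0 x))
    (α : ℝ) (hα0 : 0 < α) (hα1 : α ≤ 1)
    (h1 : (fun n : ℕ => ∏ i ∈ Finset.range (n + 1), rSup (Set.Iic (i : ℤ)) f)
        =O[atTop] fun n : ℕ => (n : ℝ) ^ ((1 : ℝ) - α))
    (h2 : Tendsto
        (fun n : ℕ => ∑ i ∈ Finset.Icc (2 ^ n : ℕ) (2 ^ (n + 1)),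
          Real.log (rSup (Set.Ici (-((i : ℕ) : ℤ))) f) ^ (2 * α))
        atTop (nhds 0)) :
    ∃ ω : ℕ → ℝ, (∀ i, 0 ≤ ω i) ∧
      Tendsto (fun n : ℕ => ∑ i ∈ Finset.Icc (2 ^ n) (2 ^ (n + 1)), ω i ^ 2) atTop (nhds 0) ∧
      OddsMemory V ω := by
  have hfp : ∀ x, 0 < f x := fun x => by rw [hf]; exact div_pos (hpos _ _) (hpos _ _)
  have hu : Continuous (upd s 0 : Conf S → Conf S) := by
    refine continuous_pi fun i => ?_
    by_cases h : i = 0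
    · simp only [upd, if_pos h]; exact continuous_const
    · simp only [upd, if_neg h]; exact continuous_apply i
  have hfc : Continuous f := by
    rw [show f = fun x => V.φ {0} x / V.φ {0} (upd s 0 x) from funext hf]
    exact (hcont _).div ((hcont _).comp hu) fun x => (hpos _ _).ne'
  obtain ⟨ω, h0, h3, h4⟩ := exists_odds_memory hfc hfp s α hα0 hα1 h1 h2
  refine ⟨ω, h0, h3, fun k => ?_⟩
  obtain ⟨N, -, hN⟩ := h4 k
  refine ⟨N, fun x y hxy a b => ?_⟩
  simp_rw [boxWeight, V.tot_φ_mul hpos hinv hf]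
  have := mul_le_mul_of_nonneg_left (hN x y hxy a b)
    (mul_pos (hpos (Finset.Ico 0 (N : ℤ)) (fillS s N x)) (hpos (Finset.Ico 0 (N : ℤ)) (fillS s N y))).le
  linarith

lemma sum_Icc_two_pow (F : ℤ → ℝ) (n : ℕ) :
    ∑ i ∈ Finset.Icc ((2 : ℤ) ^ n) (2 ^ (n + 1)), F i =
      ∑ i ∈ Finset.Icc (2 ^ n : ℕ) (2 ^ (n + 1)), F (i : ℕ) := by
  refine (Finset.sum_bij (fun (i : ℕ) _ => (i : ℤ)) (fun i hi => ?_) (fun i _ j _ h => by omega)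
    (fun j hj => ?_) fun _ _ => rfl).symm
  · rw [Finset.mem_Icc] at hi ⊢
    exact_mod_cast hi
  · rw [Finset.mem_Icc] at hj
    have : 0 ≤ j := (by positivity : (0 : ℤ) ≤ 2 ^ n).trans hj.1
    lift j to ℕ using this
    exact ⟨j, Finset.mem_Icc.2 (by exact_mod_cast hj), rfl⟩

/-- **Theorem 1.1.**  A positive, continuous, `T`-invariant specification whose
single-site ratio function `f(x) = φ_{{0}}(x)/φ_{{0}}(s_0 x)` satisfies the two
variation conditions has a unique Gibbs state, which is shift-invariant and
Bernoulli. -/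
theorem unique_bernoulli_gibbs_of_ratio
    {S : Type} [Fintype S] [Nonempty S] [DecidableEq S]
    [TopologicalSpace S] [DiscreteTopology S]
    [MeasurableSpace S] [MeasurableSingletonClass S]
    (V : Specification S) (hpos : V.Positive) (hcont : V.IsCont)
    (hinv : V.TInvariant) (s : S) (f : Conf S → ℝ)
    (hf : ∀ x, f x = V.φ {0} x / V.φ {0} (upd s 0 x))
    (α : ℝ) (hα0 : 0 < α) (hα1 : α ≤ 1)
    (h1 : (fun n : ℕ => ∏ i ∈ Finset.range (n + 1), rSup (Set.Iic (i : ℤ)) f)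
        =O[atTop] fun n : ℕ => (n : ℝ) ^ ((1 : ℝ) - α))
    (h2 : Tendsto
        (fun n : ℕ => ∑ i ∈ Finset.Icc (2 ^ n) (2 ^ (n + 1)),
          Real.log (rSup (Set.Ici (-(i : ℤ))) f) ^ (2 * α))
        atTop (nhds 0)) :
    ∃ μ : Measure (Conf S), IsGibbs V μ ∧ (∀ ν : Measure (Conf S), IsGibbs V ν → ν = μ) ∧
      μ.map (shift 1) = μ ∧ IsBernoulliSystem μ := by
  simp_rw [sum_Icc_two_pow fun i => Real.log (rSup (Set.Ici (-i)) f) ^ (2 * α)] at h2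
  obtain ⟨ω, h0, h3, h4⟩ := exists_oddsMemory hpos hcont hinv s f hf α hα0 hα1 h1 h2
  obtain ⟨k, hs, hκ⟩ := exists_stateKernel hpos hcont hinv h0 h3 h4
  obtain ⟨μ, hμ⟩ := exists_isGibbs V hcont
  have := hμ.1
  have hT : μ.map (shift 1) = μ := gibbs_unique hpos hs hκ (hμ.map_shift hcont hinv 1) hμ
  let R : KRep μ := ⟨GState V, k, (⟨μ, hμ⟩, 0, Classical.arbitrary _), law_eq_wl hpos hs hκ hμ _⟩
  exact ⟨μ, hμ, fun ν hν => gibbs_unique hpos hs hκ hν hμ, hT,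
    KRep.isBernoulliSystem R (Stat.of_one hT)⟩
end GibbsFormal
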